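/- Pathwise uniqueness holds for the perturbed Tanaka equation Υ(t) = y + ∫₀ᵗ sgn(Υ(s)) dM(s) + N(t), 0 ≤ t < ∞: if Υ and Υ' are two continuous semimartingales on the same filtered probability space, both satisfying this equation with the same initial value y ∈ ℝ and the same driving processes M(·), N(·), then Υ(t) = Υ'(t) for all t ≥ 0 almost surely. -/

import Mathlib

open MeasureTheory ProbabilityTheory Filter Set

noncomputable section

namespace SDEPaper

/-- The signum convention of the paper: `psgn y = 1` for `y > 0`, `= -1` for `y ≤ 0`. -/
def psgn (y : ℝ) : ℝ := if 0 < y then 1 else -1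

variable {Ω : Type*} [m : MeasurableSpace Ω]

/-- The σ-algebra generated by the process `Ξ` on the time interval `[0, t]`. -/
def natSA {E : Type*} [MeasurableSpace E] (Ξ : ℝ → Ω → E) (t : ℝ) : MeasurableSpace Ω :=
  ⨆ s ∈ Icc (0 : ℝ) t, MeasurableSpace.comap (Ξ s) inferInstance

/-- The `μ`-augmentation of a σ-algebra. -/
def augSA (μ : Measure Ω) (m' : MeasurableSpace Ω) : MeasurableSpace Ω :=
  m' ⊔ MeasurableSpace.generateFrom {A : Set Ω | μ A = 0}

/-- `𝔉^Ξ(t)`: the `μ`-augmented σ-algebra generated by the process `Ξ` up to time `t`. -/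
def natFilt {E : Type*} [MeasurableSpace E] (μ : Measure Ω) (Ξ : ℝ → Ω → E) (t : ℝ) :
    MeasurableSpace Ω := augSA μ (natSA Ξ t)

/-- Dyadic left-point Riemann sum of `H` against `X` on `[0,t]`. -/
def rsum (H X : ℝ → Ω → ℝ) (t : ℝ) (n : ℕ) (ω : Ω) : ℝ :=
  ∑ i ∈ Finset.range (2 ^ n),
    H (t * i / 2 ^ n) ω * (X (t * (i + 1) / 2 ^ n) ω - X (t * i / 2 ^ n) ω)

/-- `I = ∫₀^· H dX`: dyadic Riemann sums converge in probability, and `I 0 = 0` a.s. -/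
def IsSI (μ : Measure Ω) (H X I : ℝ → Ω → ℝ) : Prop :=
  (∀ᵐ ω ∂μ, I 0 ω = 0) ∧
  ∀ t : ℝ, 0 ≤ t → TendstoInMeasure μ (fun n => rsum H X t n) atTop (I t)

/-- `I = ∫₀^· H₁ dX₁ + ∫₀^· H₂ dX₂` in the sense of convergence in probability
of dyadic Riemann sums. -/
def IsSI2 (μ : Measure Ω) (H₁ X₁ H₂ X₂ I : ℝ → Ω → ℝ) : Prop :=
  (∀ᵐ ω ∂μ, I 0 ω = 0) ∧
  ∀ t : ℝ, 0 ≤ t →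
    TendstoInMeasure μ (fun n ω => rsum H₁ X₁ t n ω + rsum H₂ X₂ t n ω) atTop (I t)

/-- Dyadic sums of products of increments. -/
def qsum (X Y : ℝ → Ω → ℝ) (t : ℝ) (n : ℕ) (ω : Ω) : ℝ :=
  ∑ i ∈ Finset.range (2 ^ n),
    (X (t * (i + 1) / 2 ^ n) ω - X (t * i / 2 ^ n) ω) *
      (Y (t * (i + 1) / 2 ^ n) ω - Y (t * i / 2 ^ n) ω)

/-- `C = ⟨X,Y⟩`: the quadratic covariation, as a limit in probability of dyadic sums. -/
def IsQV (μ : Measure Ω) (X Y C : ℝ → Ω → ℝ) : Prop :=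
  ∀ t : ℝ, 0 ≤ t → TendstoInMeasure μ (fun n => qsum X Y t n) atTop (C t)

/-- `W` is a standard one-dimensional Brownian motion with respect to the family of
σ-algebras `F` (a filtration contained in the ambient σ-algebra). -/
structure IsBM (μ : Measure Ω) (F : ℝ → MeasurableSpace Ω) (W : ℝ → Ω → ℝ) : Prop where
  le : ∀ t : ℝ, F t ≤ m
  mono : Monotone F
  adapted : ∀ t : ℝ, 0 ≤ t → MeasurableSpace.comap (W t) inferInstance ≤ F t
  init : ∀ᵐ ω ∂μ, W 0 ω = 0
  cont : ∀ᵐ ω ∂μ, Continuous fun t => W t ω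
  law : ∀ s t : ℝ, 0 ≤ s → s ≤ t →
    μ.map (fun ω => W t ω - W s ω) = gaussianReal 0 ((t - s).toNNReal)
  indep : ∀ s t : ℝ, 0 ≤ s → s ≤ t →
    Indep (MeasurableSpace.comap (fun ω => W t ω - W s ω) inferInstance) (F s) μ

/-- `(B₁, B₂)` is a planar Brownian motion: two independent standard Brownian motions
with respect to the common filtration `F`. -/
def IsPlanarBM (μ : Measure Ω) (F : ℝ → MeasurableSpace Ω) (B₁ B₂ : ℝ → Ω → ℝ) : Prop :=
  IsBM μ F B₁ ∧ IsBM μ F B₂ ∧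
    IndepFun (fun ω => (fun t => B₁ t ω)) (fun ω => (fun t => B₂ t ω)) μ

/-- `L` is the (right) local time at the origin of the process `Y`:
`L t = lim_{ε ↓ 0} (4ε)⁻¹ ∫₀ᵗ 1{|Y(s)| < ε} ds`. -/
def IsLocalTime (μ : Measure Ω) (Y L : ℝ → Ω → ℝ) : Prop :=
  ∀ᵐ ω ∂μ, ∀ t : ℝ, 0 ≤ t →
    Tendsto (fun ε : ℝ =>
        (4 * ε)⁻¹ * ∫ s in (0:ℝ)..t, (if |Y s ω| < ε then (1:ℝ) else 0))
      (nhdsWithin 0 (Ioi 0)) (nhds (L t ω))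

/-- A continuous local martingale with respect to the filtration `F`. -/
def IsContLocMart (μ : Measure Ω) (F : Filtration ℝ m) (M : ℝ → Ω → ℝ) : Prop :=
  (∀ᵐ ω ∂μ, Continuous fun t => M t ω) ∧ StronglyAdapted F M ∧
    ∃ τ : ℕ → Ω → ℝ, (∀ n, IsStoppingTime F (fun ω => (τ n ω : WithTop ℝ))) ∧
      (∀ᵐ ω ∂μ, Tendsto (fun n => τ n ω) atTop atTop) ∧
      ∀ n, Martingale (fun t ω => M (min t (τ n ω)) ω) F μ

/-- Orthogonality: the cross-variation `⟨M,N⟩` vanishes identically. -/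
def Orthogonal (μ : Measure Ω) (M N : ℝ → Ω → ℝ) : Prop :=
  IsQV μ M N fun _ _ => 0

/-- Domination: `⟨M⟩(t) = ∫₀ᵗ q(s) d⟨N⟩(s)` for a progressively measurable
process `q` with values in `[0,c]`. -/
def Dominated (μ : Measure Ω) (F : Filtration ℝ m) (M N : ℝ → Ω → ℝ) (c : ℝ) : Prop :=
  ∃ QM QN q : ℝ → Ω → ℝ, IsQV μ M M QM ∧ IsQV μ N N QN ∧
    ProgMeasurable F q ∧ (∀ t ω, q t ω ∈ Icc (0:ℝ) c) ∧
    ∀ᵐ ω ∂μ, ∃ ν : Measure ℝ,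
      (∀ a b : ℝ, 0 ≤ a → a ≤ b → ν (Ioc a b) = ENNReal.ofReal (QN b ω - QN a ω)) ∧
      ∀ t : ℝ, 0 ≤ t → QM t ω = ∫ s in Ioc (0:ℝ) t, q s ω ∂ν

/-- The law of the two-dimensional process `(X₁, X₂)` on path space. -/
def pathLaw (μ : Measure Ω) (X₁ X₂ : ℝ → Ω → ℝ) : Measure (ℝ → ℝ × ℝ) :=
  μ.map fun ω => (fun t => (X₁ t ω, X₂ t ω))
/-- `(X₁, X₂)` solves the system (1.1)-(1.2) driven by `(B₁, B₂)`. -/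
def Solves11 (μ : Measure Ω) (F : ℝ → MeasurableSpace Ω) (g h ρ σ x₁ x₂ : ℝ)
    (B₁ B₂ X₁ X₂ : ℝ → Ω → ℝ) : Prop :=
  (∀ t : ℝ, 0 ≤ t →
    MeasurableSpace.comap (fun ω => (X₁ t ω, X₂ t ω)) inferInstance ≤ F t) ∧
  (∀ᵐ ω ∂μ, Continuous (fun t => X₁ t ω) ∧ Continuous (fun t => X₂ t ω)) ∧
  ∃ I₁ I₂ : ℝ → Ω → ℝ,
    IsSI μ (fun s ω => if X₁ s ω ≤ X₂ s ω then σ else ρ) B₁ I₁ ∧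
    IsSI μ (fun s ω => if X₁ s ω ≤ X₂ s ω then ρ else σ) B₂ I₂ ∧
    ∀ᵐ ω ∂μ, ∀ t : ℝ, 0 ≤ t →
      X₁ t ω = x₁ + (∫ s in (0:ℝ)..t, (if X₁ s ω ≤ X₂ s ω then g else -h)) + I₁ t ω ∧
      X₂ t ω = x₂ + (∫ s in (0:ℝ)..t, (if X₁ s ω ≤ X₂ s ω then -h else g)) + I₂ t ω

/-- `(X₁, X₂)` solves the system (4.7)-(4.8), driven by the single Brownian motion `W`. -/
def Solves47 (μ : Measure Ω) (F : ℝ → MeasurableSpace Ω) (g h x₁ x₂ : ℝ)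
    (W X₁ X₂ : ℝ → Ω → ℝ) : Prop :=
  (∀ t : ℝ, 0 ≤ t →
    MeasurableSpace.comap (fun ω => (X₁ t ω, X₂ t ω)) inferInstance ≤ F t) ∧
  (∀ᵐ ω ∂μ, Continuous (fun t => X₁ t ω) ∧ Continuous (fun t => X₂ t ω)) ∧
  ∃ I₁ I₂ : ℝ → Ω → ℝ,
    IsSI μ (fun s ω => if X₁ s ω ≤ X₂ s ω then (0:ℝ) else 1) W I₁ ∧
    IsSI μ (fun s ω => if X₁ s ω ≤ X₂ s ω then (-1:ℝ) else 0) W I₂ ∧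
    ∀ᵐ ω ∂μ, ∀ t : ℝ, 0 ≤ t →
      X₁ t ω = x₁ + (∫ s in (0:ℝ)..t, (if X₁ s ω ≤ X₂ s ω then g else -h)) + I₁ t ω ∧
      X₂ t ω = x₂ + (∫ s in (0:ℝ)..t, (if X₁ s ω ≤ X₂ s ω then -h else g)) + I₂ t ω

/-- `(X₁, X₂)` solves the system (4.9)-(4.10), driven by the single Brownian motion `V`. -/
def Solves49 (μ : Measure Ω) (F : ℝ → MeasurableSpace Ω) (g h x₁ x₂ : ℝ)
    (V X₁ X₂ : ℝ → Ω → ℝ) : Prop :=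
  (∀ t : ℝ, 0 ≤ t →
    MeasurableSpace.comap (fun ω => (X₁ t ω, X₂ t ω)) inferInstance ≤ F t) ∧
  (∀ᵐ ω ∂μ, Continuous (fun t => X₁ t ω) ∧ Continuous (fun t => X₂ t ω)) ∧
  ∃ I₁ I₂ : ℝ → Ω → ℝ,
    IsSI μ (fun s ω => if X₁ s ω ≤ X₂ s ω then (0:ℝ) else 1) V I₁ ∧
    IsSI μ (fun s ω => if X₁ s ω ≤ X₂ s ω then (1:ℝ) else 0) V I₂ ∧
    ∀ᵐ ω ∂μ, ∀ t : ℝ, 0 ≤ t →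
      X₁ t ω = x₁ + (∫ s in (0:ℝ)..t, (if X₁ s ω ≤ X₂ s ω then g else -h)) + I₁ t ω ∧
      X₂ t ω = x₂ + (∫ s in (0:ℝ)..t, (if X₁ s ω ≤ X₂ s ω then -h else g)) + I₂ t ω

/-- `(X₁, X₂)` solves the system (2.12)-(2.13), driven by the planar BM `(W₁, W₂)`. -/
def Solves212 (μ : Measure Ω) (F : ℝ → MeasurableSpace Ω) (g h ρ σ x₁ x₂ : ℝ)
    (W₁ W₂ X₁ X₂ : ℝ → Ω → ℝ) : Prop :=
  (∀ t : ℝ, 0 ≤ t →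
    MeasurableSpace.comap (fun ω => (X₁ t ω, X₂ t ω)) inferInstance ≤ F t) ∧
  (∀ᵐ ω ∂μ, Continuous (fun t => X₁ t ω) ∧ Continuous (fun t => X₂ t ω)) ∧
  ∃ I₁ I₂ : ℝ → Ω → ℝ,
    IsSI2 μ (fun s ω => if X₁ s ω ≤ X₂ s ω then 0 else ρ) W₁
            (fun s ω => if X₁ s ω ≤ X₂ s ω then σ else 0) W₂ I₁ ∧
    IsSI2 μ (fun s ω => if X₁ s ω ≤ X₂ s ω then -ρ else 0) W₁
            (fun s ω => if X₁ s ω ≤ X₂ s ω then 0 else -σ) W₂ I₂ ∧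
    ∀ᵐ ω ∂μ, ∀ t : ℝ, 0 ≤ t →
      X₁ t ω = x₁ + (∫ s in (0:ℝ)..t, (if X₁ s ω ≤ X₂ s ω then g else -h)) + I₁ t ω ∧
      X₂ t ω = x₂ + (∫ s in (0:ℝ)..t, (if X₁ s ω ≤ X₂ s ω then -h else g)) + I₂ t ω

/-- `(X₁, X₂)` solves the system (2.14)-(2.15), driven by the planar BM `(V₁, V₂)`. -/
def Solves214 (μ : Measure Ω) (F : ℝ → MeasurableSpace Ω) (g h ρ σ x₁ x₂ : ℝ)
    (V₁ V₂ X₁ X₂ : ℝ → Ω → ℝ) : Prop :=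
  (∀ t : ℝ, 0 ≤ t →
    MeasurableSpace.comap (fun ω => (X₁ t ω, X₂ t ω)) inferInstance ≤ F t) ∧
  (∀ᵐ ω ∂μ, Continuous (fun t => X₁ t ω) ∧ Continuous (fun t => X₂ t ω)) ∧
  ∃ I₁ I₂ : ℝ → Ω → ℝ,
    IsSI2 μ (fun s ω => if X₁ s ω ≤ X₂ s ω then 0 else ρ) V₁
            (fun s ω => if X₁ s ω ≤ X₂ s ω then σ else 0) V₂ I₁ ∧
    IsSI2 μ (fun s ω => if X₁ s ω ≤ X₂ s ω then ρ else 0) V₁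
            (fun s ω => if X₁ s ω ≤ X₂ s ω then 0 else σ) V₂ I₂ ∧
    ∀ᵐ ω ∂μ, ∀ t : ℝ, 0 ≤ t →
      X₁ t ω = x₁ + (∫ s in (0:ℝ)..t, (if X₁ s ω ≤ X₂ s ω then g else -h)) + I₁ t ω ∧
      X₂ t ω = x₂ + (∫ s in (0:ℝ)..t, (if X₁ s ω ≤ X₂ s ω then -h else g)) + I₂ t ω

/-- `(X₁, X₂)` solves the system `dX = Σ(X) dU + G(X) dt` of (eq:xSigma), where
`Σ(x) = Σ₊ 1{x₁ > x₂} + Σ₋ 1{x₁ ≤ x₂}`. -/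
def SolvesGen (μ : Measure Ω) (F : ℝ → MeasurableSpace Ω) (g h : ℝ)
    (Sp Sm : Matrix (Fin 2) (Fin 2) ℝ) (x₁ x₂ : ℝ)
    (U₁ U₂ X₁ X₂ : ℝ → Ω → ℝ) : Prop :=
  (∀ t : ℝ, 0 ≤ t →
    MeasurableSpace.comap (fun ω => (X₁ t ω, X₂ t ω)) inferInstance ≤ F t) ∧
  (∀ᵐ ω ∂μ, Continuous (fun t => X₁ t ω) ∧ Continuous (fun t => X₂ t ω)) ∧
  ∃ I₁ I₂ : ℝ → Ω → ℝ,
    IsSI2 μ (fun s ω => if X₁ s ω ≤ X₂ s ω then Sm 0 0 else Sp 0 0) U₁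
            (fun s ω => if X₁ s ω ≤ X₂ s ω then Sm 0 1 else Sp 0 1) U₂ I₁ ∧
    IsSI2 μ (fun s ω => if X₁ s ω ≤ X₂ s ω then Sm 1 0 else Sp 1 0) U₁
            (fun s ω => if X₁ s ω ≤ X₂ s ω then Sm 1 1 else Sp 1 1) U₂ I₂ ∧
    ∀ᵐ ω ∂μ, ∀ t : ℝ, 0 ≤ t →
      X₁ t ω = x₁ + (∫ s in (0:ℝ)..t, (if X₁ s ω ≤ X₂ s ω then g else -h)) + I₁ t ω ∧
      X₂ t ω = x₂ + (∫ s in (0:ℝ)..t, (if X₁ s ω ≤ X₂ s ω then -h else g)) + I₂ t ω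


/-- `Υ` solves the perturbed Tanaka equation
`Υ(t) = y + ∫₀ᵗ sgn(Υ(s)) dM(s) + N(t)` on a given filtered probability space. -/
def SolvesPerturbedTanaka (μ : Measure Ω) (F : ℝ → MeasurableSpace Ω)
    (M N : ℝ → Ω → ℝ) (y : ℝ) (Y : ℝ → Ω → ℝ) : Prop :=
  (∀ t : ℝ, 0 ≤ t → MeasurableSpace.comap (Y t) inferInstance ≤ F t) ∧
  (∀ᵐ ω ∂μ, Continuous fun t => Y t ω) ∧
  ∃ I : ℝ → Ω → ℝ, IsSI μ (fun s ω => psgn (Y s ω)) M I ∧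
    ∀ᵐ ω ∂μ, ∀ t : ℝ, 0 ≤ t → Y t ω = y + I t ω + N t ω

set_option linter.unusedSectionVars false
set_option linter.unusedVariables false
set_option linter.unusedSimpArgs false
set_option linter.style.multiGoal false

/-! ### Bounded measurable functions -/

/-- Bounded and measurable with respect to `g`. -/
def Bd (g : MeasurableSpace Ω) (f : Ω → ℝ) : Prop := Measurable[g] f ∧ ∃ B : ℝ, ∀ ω, |f ω| ≤ B

lemma Bd.const (g : MeasurableSpace Ω) (a : ℝ) : Bd g (fun _ => a) :=
  ⟨measurable_const, |a|, fun _ => le_rfl⟩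

lemma Bd.mk' {g : MeasurableSpace Ω} {f : Ω → ℝ} (hf : Measurable[g] f) (B : ℝ)
    (h : ∀ ω, |f ω| ≤ B) : Bd g f := ⟨hf, B, h⟩

lemma Bd.meas {g : MeasurableSpace Ω} {f : Ω → ℝ} (h : Bd g f) : Measurable[g] f := h.1

lemma Bd.mono {g g' : MeasurableSpace Ω} {f : Ω → ℝ} (h : Bd g f) (hg : g ≤ g') : Bd g' f :=
  ⟨h.1.mono hg le_rfl, h.2⟩

lemma Bd.add {g : MeasurableSpace Ω} {f f' : Ω → ℝ} (h : Bd g f) (h' : Bd g f') :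
    Bd g (fun ω => f ω + f' ω) := by
  obtain ⟨hm, B, hB⟩ := h
  obtain ⟨hm', B', hB'⟩ := h'
  exact ⟨hm.add hm', B + B', fun ω => (abs_add_le _ _).trans (add_le_add (hB ω) (hB' ω))⟩

lemma Bd.neg {g : MeasurableSpace Ω} {f : Ω → ℝ} (h : Bd g f) :
    Bd g (fun ω => - f ω) := by
  obtain ⟨hm, B, hB⟩ := h
  exact ⟨hm.neg, B, fun ω => by rw [abs_neg]; exact hB ω⟩

lemma Bd.sub {g : MeasurableSpace Ω} {f f' : Ω → ℝ} (h : Bd g f) (h' : Bd g f') :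
    Bd g (fun ω => f ω - f' ω) := by
  simpa [sub_eq_add_neg] using h.add h'.neg

lemma Bd.mul {g : MeasurableSpace Ω} {f f' : Ω → ℝ} (h : Bd g f) (h' : Bd g f') :
    Bd g (fun ω => f ω * f' ω) := by
  obtain ⟨hm, B, hB⟩ := h
  obtain ⟨hm', B', hB'⟩ := h'
  refine ⟨hm.mul hm', B * B', fun ω => ?_⟩
  rw [abs_mul]
  exact mul_le_mul (hB ω) (hB' ω) (abs_nonneg _) ((abs_nonneg _).trans (hB ω))

lemma Bd.pow {g : MeasurableSpace Ω} {f : Ω → ℝ} (h : Bd g f) (n : ℕ) :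
    Bd g (fun ω => f ω ^ n) := by
  induction n with
  | zero => simpa using Bd.const g 1
  | succ n ih => simpa [pow_succ] using ih.mul h

lemma Bd.abs {g : MeasurableSpace Ω} {f : Ω → ℝ} (h : Bd g f) :
    Bd g (fun ω => |f ω|) := by
  obtain ⟨hm, B, hB⟩ := h
  exact ⟨measurable_norm.comp hm, B, fun ω => by rw [abs_abs]; exact hB ω⟩

lemma Bd.sum {ι : Type*} {g : MeasurableSpace Ω} (s : Finset ι) {f : ι → Ω → ℝ}
    (h : ∀ i ∈ s, Bd g (f i)) : Bd g (fun ω => ∑ i ∈ s, f i ω) := by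
  classical
  induction s using Finset.induction_on with
  | empty => simpa using Bd.const g 0
  | insert a s ha ih =>
    simp only [Finset.sum_insert ha]
    exact (h a (by simp)).add (ih fun i hi => h i (by simp [hi]))

lemma Bd.comp {g : MeasurableSpace Ω} {f : Ω → ℝ} (h : Bd g f) {φ : ℝ → ℝ} (hφ : Continuous φ) :
    Bd g (fun ω => φ (f ω)) := by
  obtain ⟨hm, B, hB⟩ := h
  obtain ⟨C, hC⟩ := (isCompact_Icc (a := -B) (b := B)).exists_bound_of_continuousOn hφ.continuousOn
  exact ⟨hφ.measurable.comp hm, C, fun ω => hC _ (abs_le.1 (hB ω))⟩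

lemma Bd.ite {g : MeasurableSpace Ω} {f f' : Ω → ℝ} {p : Ω → Prop} [DecidablePred p]
    (hp : MeasurableSet[g] {ω | p ω}) (h : Bd g f) (h' : Bd g f') :
    Bd g (fun ω => if p ω then f ω else f' ω) := by
  obtain ⟨hm, B, hB⟩ := h
  obtain ⟨hm', B', hB'⟩ := h'
  refine ⟨Measurable.ite hp hm hm', max B B', fun ω => ?_⟩
  beta_reduce
  split_ifs
  · exact (hB ω).trans (le_max_left _ _)
  · exact (hB' ω).trans (le_max_right _ _)

lemma Bd.ind {g : MeasurableSpace Ω} {p : Ω → Prop} [DecidablePred p]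
    (hp : MeasurableSet[g] {ω | p ω}) : Bd g (fun ω => if p ω then (1:ℝ) else 0) :=
  Bd.ite hp (Bd.const g 1) (Bd.const g 0)

lemma Bd.int {μ : Measure Ω} [IsFiniteMeasure μ] {g : MeasurableSpace Ω} {f : Ω → ℝ}
    (h : Bd g f) (hg : g ≤ m) : Integrable f μ := by
  obtain ⟨hm, B, hB⟩ := h
  exact Integrable.of_bound (hm.mono hg le_rfl).aestronglyMeasurable B
    (Eventually.of_forall hB)

lemma Bd.i {μ : Measure Ω} [IsFiniteMeasure μ] {f : Ω → ℝ} (h : Bd m f) : Integrable f μ :=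
  h.int le_rfl

/-- monotonicity of expectation for bounded functions -/
lemma Bd.le {μ : Measure Ω} [IsFiniteMeasure μ] {f f' : Ω → ℝ} (h : Bd m f) (hfm : Bd m f')
    (hle : ∀ ω, f ω ≤ f' ω) : ∫ ω, f ω ∂μ ≤ ∫ ω, f' ω ∂μ :=
  integral_mono h.i hfm.i hle

/-- probability bound -/
lemma Bd.markov {μ : Measure Ω} [IsProbabilityMeasure μ] {f : Ω → ℝ} (h : Bd m f)
    (h0 : ∀ ω, 0 ≤ f ω) {A : Set Ω} (hA : MeasurableSet A) {a : ℝ} (ha : 0 < a)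
    (hle : ∀ ω ∈ A, a ≤ f ω) : μ.real A ≤ (∫ ω, f ω ∂μ) / a := by
  rw [le_div_iff₀ ha]
  have : ∫ ω, A.indicator (fun _ => a) ω ∂μ ≤ ∫ ω, f ω ∂μ := by
    apply integral_mono _ h.i
    · intro ω
      by_cases hω : ω ∈ A
      · simpa [hω] using hle ω hω
      · simpa [hω] using h0 ω
    · exact (integrable_const a).indicator hA
  rwa [integral_indicator_const _ hA, smul_eq_mul] at this

/-! ### Discrete bounded martingales -/

/-- A discrete-time martingale with bounded values (bounds may depend on time). -/
structure DM (μ : Measure Ω) (g : ℕ → MeasurableSpace Ω) (x : ℕ → Ω → ℝ) : Prop where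
  mono : Monotone g
  le : ∀ k, g k ≤ m
  bd : ∀ k, Bd (g k) (x k)
  orth : ∀ k Z, Bd (g k) Z → ∫ ω, Z ω * (x (k + 1) ω - x k ω) ∂μ = 0

/-- martingale transform -/
def tr (h x : ℕ → Ω → ℝ) (n : ℕ) (ω : Ω) : ℝ :=
  ∑ k ∈ Finset.range n, h k ω * (x (k + 1) ω - x k ω)

lemma tr_succ (h x : ℕ → Ω → ℝ) (n : ℕ) (ω : Ω) :
    tr h x (n + 1) ω = tr h x n ω + h n ω * (x (n + 1) ω - x n ω) := by
  simp [tr, Finset.sum_range_succ]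

lemma tr_zero (h x : ℕ → Ω → ℝ) (ω : Ω) : tr h x 0 ω = 0 := by simp [tr]

variable {μ : Measure Ω} [IsProbabilityMeasure μ] {g : ℕ → MeasurableSpace Ω} {x : ℕ → Ω → ℝ}

lemma DM.bdm (hx : DM μ g x) (k : ℕ) : Bd m (x k) := (hx.bd k).mono (hx.le k)

lemma DM.bd' (hx : DM μ g x) {k j : ℕ} (h : k ≤ j) : Bd (g j) (x k) := (hx.bd k).mono (hx.mono h)

lemma DM.trbd (hx : DM μ g x) {h : ℕ → Ω → ℝ} (hh : ∀ k, Bd (g k) (h k)) (n : ℕ) :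
    Bd (g n) (tr h x n) := by
  apply Bd.sum
  intro k hk
  rw [Finset.mem_range] at hk
  exact ((hh k).mono (hx.mono hk.le)).mul ((hx.bd' hk).sub (hx.bd' hk.le))

lemma DM.tr (hx : DM μ g x) {h : ℕ → Ω → ℝ} (hh : ∀ k, Bd (g k) (h k)) :
    DM μ g (tr h x) where
  mono := hx.mono
  le := hx.le
  bd := hx.trbd hh
  orth k Z hZ := by
    have := hx.orth k _ (hZ.mul (hh k))
    rw [← this]
    congr 1; ext ω; rw [tr_succ]; ring

lemma DM.orth' (hx : DM μ g x) (k n : ℕ) (Z : Ω → ℝ) (hZ : Bd (g k) Z) :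
    ∫ ω, Z ω * (x (k + n) ω - x k ω) ∂μ = 0 := by
  induction n with
  | zero => simp
  | succ n ih =>
    have h1 := hx.orth (k + n) Z (hZ.mono (hx.mono (by omega)))
    have hZ' : Bd m Z := hZ.mono (hx.le k)
    have : ∀ ω, Z ω * (x (k + (n + 1)) ω - x k ω) =
        Z ω * (x (k + n) ω - x k ω) + Z ω * (x (k + n + 1) ω - x (k + n) ω) := by
      intro ω; rw [← add_assoc]; ring
    simp_rw [this]
    rw [integral_add, ih, h1, add_zero]
    · exact (hZ'.mul ((hx.bdm _).sub (hx.bdm _))).i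
    · exact (hZ'.mul ((hx.bdm _).sub (hx.bdm _))).i

lemma DM.sqZ (hx : DM μ g x) {Z : Ω → ℝ} (hZ : Bd (g 0) Z) (n : ℕ) :
    ∫ ω, Z ω * (x n ω - x 0 ω) ^ 2 ∂μ =
      ∑ k ∈ Finset.range n, ∫ ω, Z ω * (x (k + 1) ω - x k ω) ^ 2 ∂μ := by
  have hZ' : Bd m Z := hZ.mono (hx.le 0)
  induction n with
  | zero => simp
  | succ n ih =>
    rw [Finset.sum_range_succ, ← ih]
    have h1 := hx.orth n (fun ω => 2 * (Z ω * (x n ω - x 0 ω)))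
      ((Bd.const _ 2).mul ((hZ.mono (hx.mono (by omega))).mul
        ((hx.bd n).sub (hx.bd' (by omega)))))
    have : ∀ ω, Z ω * (x (n + 1) ω - x 0 ω) ^ 2 =
        (Z ω * (x n ω - x 0 ω) ^ 2 + Z ω * (x (n + 1) ω - x n ω) ^ 2) +
        2 * (Z ω * (x n ω - x 0 ω)) * (x (n + 1) ω - x n ω) := by intro ω; ring
    simp_rw [this]
    rw [integral_add, h1, add_zero, integral_add]
    · exact (hZ'.mul (((hx.bdm _).sub (hx.bdm _)).pow 2)).i
    · exact (hZ'.mul (((hx.bdm _).sub (hx.bdm _)).pow 2)).i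
    · exact ((hZ'.mul (((hx.bdm _).sub (hx.bdm _)).pow 2)).add
        (hZ'.mul (((hx.bdm _).sub (hx.bdm _)).pow 2))).i
    · exact (((Bd.const _ 2).mul (hZ'.mul ((hx.bdm _).sub (hx.bdm _)))).mul
        ((hx.bdm _).sub (hx.bdm _))).i

lemma DM.sq (hx : DM μ g x) (n : ℕ) :
    ∫ ω, (x n ω - x 0 ω) ^ 2 ∂μ =
      ∑ k ∈ Finset.range n, ∫ ω, (x (k + 1) ω - x k ω) ^ 2 ∂μ := by
  simpa using hx.sqZ (Bd.const _ 1) n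

/-- Ito isometry for transforms. -/
lemma DM.iso (hx : DM μ g x) {h : ℕ → Ω → ℝ} (hh : ∀ k, Bd (g k) (h k)) (n : ℕ) :
    ∫ ω, (SDEPaper.tr h x n ω) ^ 2 ∂μ =
      ∑ k ∈ Finset.range n, ∫ ω, (h k ω) ^ 2 * (x (k + 1) ω - x k ω) ^ 2 ∂μ := by
  have := (hx.tr hh).sq n
  simp only [tr_succ, tr_zero, sub_zero, add_sub_cancel_left] at this
  rw [this]
  refine Finset.sum_congr rfl fun k _ => ?_
  congr 1; ext ω; ring

lemma DM.dbd (hx : DM μ g x) (k : ℕ) : Bd m (fun ω => x (k + 1) ω - x k ω) :=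
  (hx.bdm _).sub (hx.bdm _)

lemma DM.iso_le (hx : DM μ g x) {h : ℕ → Ω → ℝ} (hh : ∀ k, Bd (g k) (h k)) (n : ℕ) {C : ℝ}
    (hC : ∀ k < n, ∀ ω, |h k ω| ≤ C) :
    ∫ ω, (SDEPaper.tr h x n ω) ^ 2 ∂μ ≤ C ^ 2 * ∫ ω, (x n ω - x 0 ω) ^ 2 ∂μ := by
  rw [hx.iso hh, hx.sq, Finset.mul_sum]
  refine Finset.sum_le_sum fun k hk => ?_
  rw [← integral_const_mul]
  apply Bd.le
  · exact (((hh k).mono (hx.le k)).pow 2).mul ((hx.dbd k).pow 2)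
  · exact (Bd.const _ _).mul ((hx.dbd k).pow 2)
  · intro ω
    refine mul_le_mul_of_nonneg_right ?_ (sq_nonneg _)
    rw [← sq_abs]
    exact pow_le_pow_left₀ (abs_nonneg _) (hC k (Finset.mem_range.1 hk) ω) 2

lemma DM.Qbd (hx : DM μ g x) (n : ℕ) :
    Bd (g n) (fun ω => ∑ k ∈ Finset.range n, (x (k + 1) ω - x k ω) ^ 2) := by
  apply Bd.sum
  intro k hk
  rw [Finset.mem_range] at hk
  exact ((hx.bd' hk).sub (hx.bd' hk.le)).pow 2

lemma sum_sq_eq (x : ℕ → Ω → ℝ) (n : ℕ) (ω : Ω) :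
    ∑ k ∈ Finset.range n, (x (k + 1) ω - x k ω) ^ 2 =
      (x n ω - x 0 ω) ^ 2 - 2 * tr (fun k ω => x k ω - x 0 ω) x n ω := by
  induction n with
  | zero => simp [tr]
  | succ n ih => rw [Finset.sum_range_succ, ih, tr_succ]; ring

lemma DM.Qsq (hx : DM μ g x) {K : ℝ} (hK : ∀ k ω, |x k ω| ≤ K) (n : ℕ) :
    ∫ ω, (∑ k ∈ Finset.range n, (x (k + 1) ω - x k ω) ^ 2) ^ 2 ∂μ ≤ 160 * K ^ 4 := by
  have hd : ∀ j k ω, (x j ω - x k ω) ^ 2 ≤ 4 * K ^ 2 := by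
    intro j k ω
    have h1 := abs_le.1 (hK j ω)
    have h2 := abs_le.1 (hK k ω)
    nlinarith
  have hhb : ∀ k, Bd (g k) (fun ω => x k ω - x 0 ω) := fun k =>
    (hx.bd k).sub (hx.bd' (by omega))
  have htr : Bd m (SDEPaper.tr (fun k ω => x k ω - x 0 ω) x n) := (hx.trbd hhb n).mono (hx.le n)
  have h1 : ∫ ω, (SDEPaper.tr (fun k ω => x k ω - x 0 ω) x n ω) ^ 2 ∂μ ≤ 16 * K ^ 4 := by
    refine (hx.iso_le hhb n (C := 2 * K) ?_).trans ?_
    · intro k _ ω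
      have h1 := abs_le.1 (hK k ω)
      have h2 := abs_le.1 (hK 0 ω)
      rw [abs_le]; constructor <;> linarith
    · have : ∫ ω, (x n ω - x 0 ω) ^ 2 ∂μ ≤ 4 * K ^ 2 := by
        have := Bd.le (μ := μ) (((hx.bdm n).sub (hx.bdm 0)).pow 2) (Bd.const _ (4 * K ^ 2))
          (fun ω => hd n 0 ω)
        simpa using this
      calc (2 * K) ^ 2 * _ ≤ (2 * K) ^ 2 * (4 * K ^ 2) := by gcongr
        _ = _ := by ring
  have h2 : ∫ ω, (∑ k ∈ Finset.range n, (x (k + 1) ω - x k ω) ^ 2) ^ 2 ∂μ ≤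
      ∫ ω, (32 * K ^ 4 + 8 * (SDEPaper.tr (fun k ω => x k ω - x 0 ω) x n ω) ^ 2) ∂μ := by
    apply Bd.le
    · exact (((hx.Qbd n).mono (hx.le n)).pow 2)
    · exact (Bd.const _ _).add ((Bd.const _ _).mul (htr.pow 2))
    · intro ω
      rw [sum_sq_eq]
      set T := SDEPaper.tr (fun k ω => x k ω - x 0 ω) x n ω
      have h3 := hd n 0 ω
      have h4 : ((x n ω - x 0 ω) ^ 2) ^ 2 ≤ (4 * K ^ 2) ^ 2 :=
        pow_le_pow_left₀ (sq_nonneg _) h3 2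
      nlinarith [sq_nonneg ((x n ω - x 0 ω) ^ 2 + 2 * T)]
  rw [integral_add (integrable_const _) (((Bd.const _ _).mul (htr.pow 2)).i),
    integral_const_mul (8:ℝ)] at h2
  simp only [integral_const, probReal_univ, one_smul] at h2
  linarith

/-- Fourth-moment inequality for transforms with coefficients bounded by one. -/
lemma DM.bdg4 (hx : DM μ g x) {h : ℕ → Ω → ℝ} (hh : ∀ k, Bd (g k) (h k))
    (h1 : ∀ k ω, |h k ω| ≤ 1) (n : ℕ) :
    ∫ ω, (SDEPaper.tr h x n ω) ^ 4 ∂μ ≤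
      326 * ∫ ω, (∑ k ∈ Finset.range n, (x (k + 1) ω - x k ω) ^ 2) ^ 2 ∂μ := by
  set S := SDEPaper.tr h x with hS
  set Q : ℕ → Ω → ℝ := fun n ω => ∑ k ∈ Finset.range n, (x (k + 1) ω - x k ω) ^ 2 with hQ
  have bS : ∀ n, Bd (g n) (S n) := hx.trbd hh
  have bQ : ∀ n, Bd (g n) (Q n) := hx.Qbd
  have bSm : ∀ n, Bd m (S n) := fun n => (bS n).mono (hx.le n)
  have bQm : ∀ n, Bd m (Q n) := fun n => (bQ n).mono (hx.le n)
  have bP : ∀ n, Bd m (fun ω => S n ω ^ 4 - 16 * (S n ω ^ 2 * Q n ω) - 35 * Q n ω ^ 2) := fun n =>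
    (((bSm n).pow 4).sub ((Bd.const _ _).mul (((bSm n).pow 2).mul (bQm n)))).sub
      ((Bd.const _ _).mul ((bQm n).pow 2))
  have key : ∀ n, ∫ ω, (S n ω ^ 4 - 16 * (S n ω ^ 2 * Q n ω) - 35 * Q n ω ^ 2) ∂μ ≤ 0 := by
    intro n
    induction n with
    | zero => simp [hS, hQ, SDEPaper.tr]
    | succ n ih =>
      have bZ : Bd (g n) (fun ω => (4 * S n ω ^ 3 - 32 * (S n ω * Q n ω)) * h n ω) :=
        (((Bd.const _ _).mul ((bS n).pow 3)).sub
          ((Bd.const _ _).mul ((bS n).mul (bQ n)))).mul (hh n)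
      have ho := hx.orth n _ bZ
      have : ∫ ω, (S (n+1) ω ^ 4 - 16 * (S (n+1) ω ^ 2 * Q (n+1) ω) - 35 * Q (n+1) ω ^ 2) ∂μ ≤
          ∫ ω, ((S n ω ^ 4 - 16 * (S n ω ^ 2 * Q n ω) - 35 * Q n ω ^ 2) +
            (4 * S n ω ^ 3 - 32 * (S n ω * Q n ω)) * h n ω * (x (n + 1) ω - x n ω)) ∂μ := by
        apply Bd.le (bP _) ((bP n).add ((bZ.mono (hx.le n)).mul (hx.dbd n)))
        intro ω
        have e1 : S (n + 1) ω = S n ω + h n ω * (x (n + 1) ω - x n ω) := tr_succ _ _ _ _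
        have e2 : Q (n + 1) ω = Q n ω + (x (n + 1) ω - x n ω) ^ 2 := Finset.sum_range_succ _ _
        have q0 : 0 ≤ Q n ω := Finset.sum_nonneg fun k _ => sq_nonneg _
        rw [e1, e2]
        set d := x (n + 1) ω - x n ω
        have he : (h n ω * d) ^ 2 ≤ d ^ 2 := by
          have := (sq_le_one_iff_abs_le_one (h n ω)).2 (h1 n ω)
          nlinarith [sq_nonneg d]
        rw [mul_assoc _ (h n ω) d]
        set e := h n ω * d
        set s := S n ω
        set q := Q n ω
        have f1 : 6 * s ^ 2 * e ^ 2 + 4 * s * e ^ 3 + e ^ 4 ≤ 8 * s ^ 2 * d ^ 2 + 3 * (d ^ 2) ^ 2 := by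
          have a1 : s ^ 2 * e ^ 2 ≤ s ^ 2 * d ^ 2 := by gcongr
          have a2 : (e ^ 2) ^ 2 ≤ (d ^ 2) ^ 2 := pow_le_pow_left₀ (sq_nonneg _) he 2
          nlinarith [sq_nonneg (e * (s - e))]
        have f2 : s ^ 2 / 2 - d ^ 2 ≤ (s + e) ^ 2 := by nlinarith [sq_nonneg (s + 2 * e)]
        have f3 : (s ^ 2 / 2 - d ^ 2) * d ^ 2 ≤ (s + e) ^ 2 * d ^ 2 := by gcongr
        have f4 : 0 ≤ e ^ 2 * q := by positivity
        have f5 : 0 ≤ q * d ^ 2 := by positivity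
        have f6 : 0 ≤ (d ^ 2) ^ 2 := by positivity
        nlinarith
      rw [integral_add (bP n).i ((bZ.mono (hx.le n)).mul (hx.dbd n)).i, ho, add_zero] at this
      exact this.trans ih
  have kn := key n
  have : ∫ ω, (S n ω ^ 4 - 326 * Q n ω ^ 2) ∂μ ≤
      ∫ ω, 2 * (S n ω ^ 4 - 16 * (S n ω ^ 2 * Q n ω) - 35 * Q n ω ^ 2) ∂μ := by
    apply Bd.le (((bSm n).pow 4).sub ((Bd.const _ _).mul ((bQm n).pow 2)))
      ((Bd.const _ _).mul (bP n))
    intro ω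
    nlinarith [sq_nonneg (S n ω ^ 2 - 16 * Q n ω)]
  rw [integral_const_mul, integral_sub ((bSm n).pow 4).i ((Bd.const _ _).mul ((bQm n).pow 2)).i,
    integral_const_mul] at this
  linarith

/-- Kolmogorov's maximal inequality. -/
lemma DM.max_ineq (hx : DM μ g x) (n : ℕ) {ε : ℝ} (hε : 0 < ε) :
    μ.real {ω | ∃ k ≤ n, ε < |x k ω - x 0 ω|} ≤ (∫ ω, (x n ω - x 0 ω) ^ 2 ∂μ) / ε ^ 2 := by
  classical
  set h : ℕ → Ω → ℝ := fun k ω => if ∀ i ≤ k, |x i ω - x 0 ω| ≤ ε then 1 else 0 with hh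
  have mA : ∀ k, MeasurableSet[g k] {ω | ∀ i ≤ k, |x i ω - x 0 ω| ≤ ε} := by
    intro k
    have : {ω | ∀ i ≤ k, |x i ω - x 0 ω| ≤ ε} = ⋂ i ∈ Finset.range (k+1), {ω | |x i ω - x 0 ω| ≤ ε} := by
      ext ω; simp [Nat.lt_succ_iff]
    rw [this]
    refine Finset.measurableSet_biInter _ fun i hi => ?_
    have hb : Bd (g k) (fun ω => |x i ω - x 0 ω|) :=
      ((hx.bd' (by simpa [Nat.lt_succ_iff] using hi)).sub (hx.bd' (by omega))).abs
    exact @measurableSet_le _ _ _ _ _ (g k) _ _ _ _ _ hb.meas measurable_const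
  have hb : ∀ k, Bd (g k) (h k) := fun k => Bd.ind (mA k)
  have h01 : ∀ k ω, |h k ω| ≤ 1 := by
    intro k ω; simp only [hh]; split_ifs <;> simp
  have stay : ∀ ω k, (∀ i < k, h i ω = 1) → SDEPaper.tr h x k ω = x k ω - x 0 ω := by
    intro ω k hk
    induction k with
    | zero => simp [tr_zero]
    | succ k ih => rw [tr_succ, ih fun i hi => hk i (by omega), hk k (by omega)]; ring
  have frozen : ∀ ω k j, k ≤ j → h k ω = 0 → SDEPaper.tr h x j ω = SDEPaper.tr h x k ω := by
    intro ω k j hkj h0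
    induction j, hkj using Nat.le_induction with
    | base => rfl
    | succ j hj ih =>
      have : h j ω = 0 := by
        simp only [hh] at h0 ⊢
        rw [if_neg]
        intro hc
        rw [if_pos fun i hi => hc i (hi.trans hj)] at h0
        exact one_ne_zero h0
      rw [tr_succ, ih, this]; ring
  have key : ∀ ω ∈ {ω | ∃ k ≤ n, ε < |x k ω - x 0 ω|}, ε ^ 2 ≤ SDEPaper.tr h x n ω ^ 2 := by
    rintro ω hω
    obtain ⟨⟨hk, hlt⟩, hmin⟩ : (Nat.find hω ≤ n ∧ ε < |x (Nat.find hω) ω - x 0 ω|) ∧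
        ∀ i < Nat.find hω, ¬ (i ≤ n ∧ ε < |x i ω - x 0 ω|) :=
      ⟨Nat.find_spec hω, fun i hi => Nat.find_min hω hi⟩
    set k := Nat.find hω
    have e0 : h k ω = 0 := by
      simp only [hh]; rw [if_neg]; intro hc; exact absurd (hc k le_rfl) (not_le.2 hlt)
    have e1 : ∀ i < k, h i ω = 1 := by
      intro i hi; simp only [hh]; rw [if_pos]
      intro j hj
      have := hmin j (by omega)
      push Not at this
      exact this (by omega)
    rw [frozen ω k n hk e0, stay ω k e1, ← sq_abs (x k ω - x 0 ω)]
    exact pow_le_pow_left₀ hε.le hlt.le 2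
  have mE : MeasurableSet {ω | ∃ k ≤ n, ε < |x k ω - x 0 ω|} := by
    have : {ω | ∃ k ≤ n, ε < |x k ω - x 0 ω|} = {ω | ∀ i ≤ n, |x i ω - x 0 ω| ≤ ε}ᶜ := by
      ext ω; simp
    rw [this]; exact (hx.le n _ (mA n)).compl
  refine (Bd.markov (((hx.trbd hb n).mono (hx.le n)).pow 2) (fun ω => sq_nonneg _) mE
    (pow_pos hε 2) key).trans ?_
  refine div_le_div_of_nonneg_right ?_ (by positivity)
  simpa using hx.iso_le hb n (C := 1) (fun k _ ω => h01 k ω)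

/-! ### Elementary Taylor estimates for `√(u² + v² + e²)` -/

lemma norm_taylor {r P d : ℝ} (hr : 0 ≤ r) (h : r ^ 2 = 1 + 2 * P + d ^ 2) (hP : |P| ≤ d)
    (hrd : |r - 1| ≤ d) : |r - (1 + P + (d ^ 2 - P ^ 2) / 2)| ≤ 3 * d ^ 3 := by
  have hd : 0 ≤ d := (abs_nonneg _).trans hP
  rcases le_total d 1 with h1 | h1
  · have e : r - (1 + P + (d ^ 2 - P ^ 2) / 2) =
        (r - 1) ^ 3 * (r + 3) / 8 - P * d ^ 2 / 2 - d ^ 4 / 8 := by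
      have hP' : P = (r ^ 2 - 1 - d ^ 2) / 2 := by linarith
      rw [hP']; ring
    rw [e]
    have b1 : |(r - 1) ^ 3 * (r + 3) / 8| ≤ d ^ 3 * 5 / 8 := by
      rw [abs_div, abs_mul, abs_pow, abs_of_nonneg (by linarith : 0 ≤ r + 3),
        abs_of_pos (by norm_num : (0:ℝ) < 8)]
      have : r ≤ 2 := by linarith [(abs_le.1 hrd).2]
      gcongr
      linarith
    have b2 : |P * d ^ 2 / 2| ≤ d ^ 3 / 2 := by
      rw [abs_div, abs_mul, abs_of_nonneg (sq_nonneg d), abs_of_pos (by norm_num : (0:ℝ) < 2)]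
      have : |P| * d ^ 2 ≤ d * d ^ 2 := by gcongr
      linarith [this, (by ring : d * d ^ 2 = d ^ 3)]
    have b3 : d ^ 4 ≤ d ^ 3 := by
      have : 0 ≤ d ^ 3 := by positivity
      nlinarith
    have b4 : 0 ≤ d ^ 4 := by positivity
    rw [abs_le] at b1 b2 ⊢
    constructor <;> nlinarith
  · have h3 : d ≤ d ^ 3 := by nlinarith [sq_nonneg d]
    have h2 : d ^ 2 ≤ d ^ 3 := by nlinarith [sq_nonneg d]
    have hP2 : P ^ 2 ≤ d ^ 2 := sq_le_sq' (by linarith [(abs_le.1 hP).1]) (abs_le.1 hP).2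
    rw [abs_le] at hrd hP ⊢
    constructor <;> nlinarith [sq_nonneg P]

/-- the function `√(u² + v² + e²)` -/
def fq (e u v : ℝ) : ℝ := Real.sqrt (u ^ 2 + v ^ 2 + e ^ 2)

lemma fq_sq (e u v : ℝ) : fq e u v ^ 2 = u ^ 2 + v ^ 2 + e ^ 2 := Real.sq_sqrt (by positivity)

lemma fq_pos {e : ℝ} (he : 0 < e) (u v : ℝ) : 0 < fq e u v := Real.sqrt_pos.2 (by positivity)

lemma fq_ge {e : ℝ} (he : 0 < e) (u v : ℝ) : e ≤ fq e u v :=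
  Real.le_sqrt_of_sq_le (by nlinarith [sq_nonneg u, sq_nonneg v])

lemma fq_cont (e : ℝ) : Continuous (fun p : ℝ × ℝ => fq e p.1 p.2) := by
  unfold fq; fun_prop

lemma fq_lip {e : ℝ} (he : 0 < e) (u v x w : ℝ) :
    |fq e (u + x) (v + w) - fq e u v| ≤ Real.sqrt (x ^ 2 + w ^ 2) := by
  have h1 := fq_sq e u v
  have h2 := fq_sq e (u + x) (v + w)
  have p1 := fq_pos he u v
  have p2 := fq_pos he (u + x) (v + w)
  have hs : Real.sqrt (x ^ 2 + w ^ 2) ^ 2 = x ^ 2 + w ^ 2 := Real.sq_sqrt (by positivity)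
  apply abs_le_of_sq_le_sq _ (Real.sqrt_nonneg _)
  rw [hs]
  have key : u * (u + x) + v * (v + w) + e ^ 2 ≤ fq e u v * fq e (u + x) (v + w) := by
    apply le_of_sq_le_sq _ (by positivity)
    rw [mul_pow, h1, h2]
    nlinarith [sq_nonneg (u * (v + w) - v * (u + x)), sq_nonneg (u * e - e * (u + x)),
      sq_nonneg (v * e - e * (v + w))]
  nlinarith

lemma fq_taylor {e : ℝ} (he : 0 < e) (u v x w : ℝ) :
    |fq e (u + x) (v + w) - (fq e u v + (u * x + v * w) / fq e u v +
      ((v ^ 2 + e ^ 2) * x ^ 2 + (u ^ 2 + e ^ 2) * w ^ 2 - 2 * (u * v) * (x * w)) /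
        (2 * fq e u v ^ 3))| ≤ 3 * Real.sqrt (x ^ 2 + w ^ 2) ^ 3 / e ^ 2 := by
  have p1 := fq_pos he u v
  have hge := fq_ge he u v
  have p2 := fq_pos he (u + x) (v + w)
  have hl := fq_lip he u v x w
  have h1 := fq_sq e u v
  have h2 := fq_sq e (u + x) (v + w)
  have hs : Real.sqrt (x ^ 2 + w ^ 2) ^ 2 = x ^ 2 + w ^ 2 := Real.sq_sqrt (by positivity)
  have hs0 := Real.sqrt_nonneg (x ^ 2 + w ^ 2)
  set q := fq e u v
  set r := fq e (u + x) (v + w)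
  set δ := Real.sqrt (x ^ 2 + w ^ 2)
  have hP : |u * x + v * w| ≤ q * δ := by
    apply abs_le_of_sq_le_sq _ (by positivity)
    rw [mul_pow, h1, hs]
    nlinarith [sq_nonneg (u * w - v * x), sq_nonneg (e * x), sq_nonneg (e * w)]
  have := norm_taylor (r := r / q) (P := (u * x + v * w) / q ^ 2) (d := δ / q) (by positivity)
    (by
      have : r ^ 2 = q ^ 2 + 2 * (u * x + v * w) + δ ^ 2 := by rw [h2, h1, hs]; ring
      field_simp; linarith)
    (by
      rw [abs_div, abs_of_pos (by positivity : 0 < q ^ 2), div_le_div_iff₀ (by positivity) p1]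
      nlinarith)
    (by
      rw [← div_self p1.ne', ← sub_div, abs_div, abs_of_pos p1]
      gcongr)
  have e1 : r - (q + (u * x + v * w) / q +
      ((v ^ 2 + e ^ 2) * x ^ 2 + (u ^ 2 + e ^ 2) * w ^ 2 - 2 * (u * v) * (x * w)) /
        (2 * q ^ 3)) = q * (r / q - (1 + (u * x + v * w) / q ^ 2 +
          ((δ / q) ^ 2 - ((u * x + v * w) / q ^ 2) ^ 2) / 2)) := by
    have : (v ^ 2 + e ^ 2) * x ^ 2 + (u ^ 2 + e ^ 2) * w ^ 2 - 2 * (u * v) * (x * w) =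
        q ^ 2 * δ ^ 2 - (u * x + v * w) ^ 2 := by rw [h1, hs]; ring
    rw [this]
    field_simp
  rw [e1, abs_mul, abs_of_pos p1]
  calc q * _ ≤ q * (3 * (δ / q) ^ 3) := by gcongr
    _ = 3 * δ ^ 3 / q ^ 2 := by field_simp
    _ ≤ 3 * δ ^ 3 / e ^ 2 := by gcongr

/-- lower Taylor bound used for the two-dimensional function -/
lemma fq_lower {e : ℝ} (he : 0 < e) (u v x w : ℝ) :
    fq e u v + (u / fq e u v * x + v / fq e u v * w) +
      (v ^ 2 + e ^ 2) / (2 * fq e u v ^ 3) * x ^ 2 - (u * v) / fq e u v ^ 3 * (x * w)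
      - 3 * Real.sqrt (x ^ 2 + w ^ 2) ^ 3 / e ^ 2 ≤ fq e (u + x) (v + w) := by
  have p1 := fq_pos he u v
  have h := (abs_le.1 (fq_taylor he u v x w)).1
  have h2 : ((v ^ 2 + e ^ 2) * x ^ 2 + (u ^ 2 + e ^ 2) * w ^ 2 - 2 * (u * v) * (x * w)) /
        (2 * fq e u v ^ 3) = (v ^ 2 + e ^ 2) / (2 * fq e u v ^ 3) * x ^ 2
          + (u ^ 2 + e ^ 2) * w ^ 2 / (2 * fq e u v ^ 3) - (u * v) / fq e u v ^ 3 * (x * w) := by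
    field_simp
  have h3 : 0 ≤ (u ^ 2 + e ^ 2) * w ^ 2 / (2 * fq e u v ^ 3) := by positivity
  have h4 : (u * x + v * w) / fq e u v = u / fq e u v * x + v / fq e u v * w := by ring
  rw [h2, h4] at h
  linarith

/-- one-dimensional upper bound -/
lemma fq_upper1 {e : ℝ} (he : 0 < e) (v w : ℝ) :
    fq e 0 (v + w) ≤ fq e 0 v + v / fq e 0 v * w + e ^ 2 / (2 * fq e 0 v ^ 3) * w ^ 2
      + 3 * |w| ^ 3 / e ^ 2 := by
  have p1 := fq_pos he 0 v
  have h := (abs_le.1 (fq_taylor he 0 v 0 w)).2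
  simp only [add_zero, ne_eq, OfNat.ofNat_ne_zero, not_false_eq_true, zero_pow, mul_zero, zero_mul,
    zero_add, sub_zero, Real.sqrt_sq_eq_abs] at h
  have h4 : v * w / fq e 0 v = v / fq e 0 v * w := by ring
  have h5 : e ^ 2 * w ^ 2 / (2 * fq e 0 v ^ 3) = e ^ 2 / (2 * fq e 0 v ^ 3) * w ^ 2 := by ring
  rw [h4, h5] at h
  linarith

/-- The Yamada-Watanabe type function. -/
def psi (n : ℕ) (v : ℝ) : ℝ := ∑ i ∈ Finset.range (n + 1), (fq ((1 / 2) ^ i) 0 v - (1 / 2) ^ i)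

def psi1 (n : ℕ) (v : ℝ) : ℝ := ∑ i ∈ Finset.range (n + 1), v / fq ((1 / 2) ^ i) 0 v

def psi2 (n : ℕ) (v : ℝ) : ℝ :=
  ∑ i ∈ Finset.range (n + 1), ((1 / 2) ^ i) ^ 2 / (fq ((1 / 2) ^ i) 0 v ^ 3)

lemma half_pos' (i : ℕ) : (0:ℝ) < (1 / 2) ^ i := by positivity

lemma psi_upper (n : ℕ) (v w : ℝ) :
    psi n (v + w) ≤ psi n v + psi1 n v * w + psi2 n v / 2 * w ^ 2
      + (∑ i ∈ Finset.range (n + 1), 3 / ((1 / 2 : ℝ) ^ i) ^ 2) * |w| ^ 3 := by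
  unfold psi psi1 psi2
  rw [Finset.sum_mul, Finset.sum_div, Finset.sum_mul, Finset.sum_mul, ← Finset.sum_add_distrib,
    ← Finset.sum_add_distrib, ← Finset.sum_add_distrib]
  refine Finset.sum_le_sum fun i _ => ?_
  have := fq_upper1 (half_pos' i) v w
  have e : ((1 / 2 : ℝ) ^ i) ^ 2 / (2 * fq ((1 / 2) ^ i) 0 v ^ 3) * w ^ 2 =
    ((1 / 2) ^ i) ^ 2 / (fq ((1 / 2) ^ i) 0 v ^ 3) / 2 * w ^ 2 := by
    rw [mul_comm 2, div_div]
  rw [e] at this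
  have e' : 3 / ((1 / 2 : ℝ) ^ i) ^ 2 * |w| ^ 3 = 3 * |w| ^ 3 / ((1 / 2 : ℝ) ^ i) ^ 2 := by ring
  rw [e']
  linarith

lemma psi2_le (n : ℕ) (v : ℝ) : psi2 n v ≤ 2 / fq ((1 / 2) ^ n) 0 v := by
  induction n with
  | zero =>
    simp only [psi2, zero_add, Finset.range_one, Finset.sum_singleton, pow_zero, one_pow]
    have h := fq_ge one_pos 0 v
    rw [div_le_div_iff₀ (by positivity) (by positivity)]
    have : fq 1 0 v ≤ fq 1 0 v ^ 3 := by nlinarith [sq_nonneg (fq 1 0 v)]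
    linarith
  | succ n ih =>
    have e : psi2 (n + 1) v = psi2 n v + ((1 / 2) ^ (n + 1)) ^ 2 / (fq ((1 / 2) ^ (n + 1)) 0 v ^ 3) := by
      unfold psi2; rw [Finset.sum_range_succ]
    rw [e]
    have pa := fq_pos (half_pos' (n + 1)) 0 v
    have pb := fq_pos (half_pos' n) 0 v
    have ha := fq_sq ((1 / 2) ^ (n + 1)) 0 v
    have hb := fq_sq ((1 / 2) ^ n) 0 v
    set a := fq ((1 / 2) ^ (n + 1)) 0 v
    set b := fq ((1 / 2) ^ n) 0 v
    have h2 : ((1 / 2 : ℝ) ^ (n + 1)) = (1 / 2) ^ n / 2 := by rw [pow_succ]; ring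
    rw [h2] at ha ⊢
    have pe := half_pos' n
    set ε : ℝ := (1 / 2) ^ n
    have hba : b ≤ 2 * a := by
      apply le_of_sq_le_sq _ (by positivity)
      nlinarith [sq_nonneg v]
    have hab : a ≤ b := by
      apply le_of_sq_le_sq _ pb.le
      nlinarith [sq_nonneg v]
    have h3 : (ε / 2) ^ 2 = (b - a) * (a + b) / 3 := by nlinarith
    have : (ε / 2) ^ 2 / a ^ 3 ≤ 2 / a - 2 / b := by
      rw [h3, div_sub_div _ _ pa.ne' pb.ne', div_le_div_iff₀ (by positivity) (by positivity)]
      have h5 : (a + b) * b ≤ 6 * a ^ 2 := by nlinarith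
      have h6 : 0 ≤ (b - a) * a := mul_nonneg (by linarith) pa.le
      nlinarith [mul_le_mul_of_nonneg_left h5 h6]
    linarith

lemma psi2_nonneg (n : ℕ) (v : ℝ) : 0 ≤ psi2 n v :=
  Finset.sum_nonneg fun i _ => by
    have := fq_pos (half_pos' i) 0 v
    positivity

lemma psi_nonneg (n : ℕ) (v : ℝ) : 0 ≤ psi n v :=
  Finset.sum_nonneg fun i _ => by
    have := fq_ge (half_pos' i) 0 v
    linarith

lemma psi_zero (n : ℕ) : psi n 0 = 0 := by
  apply Finset.sum_eq_zero
  intro i _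
  simp [fq, Real.sqrt_sq (half_pos' i).le]

lemma psi_ge (n : ℕ) {a v : ℝ} (h : a ≤ |v|) : (n + 1) * a - 2 ≤ psi n v := by
  have h1 : ∀ i ∈ Finset.range (n + 1), a - (1 / 2 : ℝ) ^ i ≤ fq ((1 / 2) ^ i) 0 v - (1 / 2) ^ i := by
    intro i _
    have : |v| ≤ fq ((1 / 2) ^ i) 0 v := by
      apply Real.le_sqrt_of_sq_le
      rw [sq_abs]
      nlinarith [sq_nonneg (((1:ℝ) / 2) ^ i)]
    linarith
  have h2 := Finset.sum_le_sum h1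
  rw [Finset.sum_sub_distrib] at h2
  simp only [Finset.sum_const, Finset.card_range, nsmul_eq_mul, Nat.cast_add, Nat.cast_one] at h2
  have h3 : ∑ i ∈ Finset.range (n + 1), (1 / 2 : ℝ) ^ i ≤ 2 := by
    rw [geom_sum_eq (by norm_num)]
    have := half_pos' (n + 1)
    rw [div_le_iff_of_neg (by norm_num)]
    linarith
  unfold psi
  linarith

lemma fuu_ge {e : ℝ} (he : 0 < e) {u v : ℝ} (h : |u| ≤ |v| + 2 * e) :
    1 / (27 * fq e 0 v) ≤ (v ^ 2 + e ^ 2) / fq e u v ^ 3 := by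
  have p1 := fq_pos he u v
  have p0 := fq_pos he 0 v
  have h1 := fq_sq e u v
  have h0 := fq_sq e 0 v
  set q := fq e u v
  set a := fq e 0 v
  have hqa : q ≤ 3 * a := by
    apply le_of_sq_le_sq _ (by positivity)
    have : u ^ 2 ≤ (|v| + 2 * e) ^ 2 := by
      rw [← sq_abs u]; exact pow_le_pow_left₀ (abs_nonneg _) h 2
    nlinarith [sq_abs v, sq_nonneg (|v| - e), abs_nonneg v]
  have : v ^ 2 + e ^ 2 = a ^ 2 := by rw [h0]; ring
  rw [this, div_le_div_iff₀ (by positivity) (by positivity)]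
  have : q ^ 3 ≤ (3 * a) ^ 3 := pow_le_pow_left₀ p1.le hqa 3
  nlinarith

lemma ind_le_g2 {e x : ℝ} (he : 0 < e) (h : |x| ≤ e) : 1 ≤ 3 * e * (e ^ 2 / fq e x 0 ^ 3) := by
  have p1 := fq_pos he x 0
  have h1 := fq_sq e x 0
  have hx : x ^ 2 ≤ e ^ 2 := sq_le_sq' (by linarith [(abs_le.1 h).1]) (abs_le.1 h).2
  set q := fq e x 0
  have hq2 : q ^ 2 ≤ 2 * e ^ 2 := by nlinarith
  have hq3 : q ^ 3 ≤ 3 * e ^ 3 := by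
    apply le_of_sq_le_sq _ (by positivity)
    calc (q ^ 3) ^ 2 = (q ^ 2) ^ 3 := by ring
      _ ≤ (2 * e ^ 2) ^ 3 := pow_le_pow_left₀ (sq_nonneg _) hq2 3
      _ ≤ (3 * e ^ 3) ^ 2 := by nlinarith [pow_pos he 6]
  rw [← mul_div_assoc, le_div_iff₀ (by positivity)]
  linarith

/-! ### Dyadic grids and continuous bounded martingales -/

/-- transforms with coefficients dominated by a random variable -/
lemma DM.iso_W (hx : DM μ g x) {h : ℕ → Ω → ℝ} (hh : ∀ k, Bd (g k) (h k)) {n : ℕ} {w : Ω → ℝ}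
    (hw : Bd m w) (hhw : ∀ k < n, ∀ ω, |h k ω| ≤ w ω) {K : ℝ} (hK : ∀ k ω, |x k ω| ≤ K)
    {c : ℝ} (hc : 0 < c) :
    ∫ ω, (SDEPaper.tr h x n ω) ^ 2 ∂μ ≤ c * (160 * K ^ 4) + (∫ ω, w ω ^ 4 ∂μ) / (4 * c) := by
  rw [hx.iso hh, ← integral_finsetSum]
  swap
  · intro k _
    exact ((((hh k).mono (hx.le k)).pow 2).mul ((hx.dbd k).pow 2)).i
  have hQ : Bd m (fun ω => ∑ k ∈ Finset.range n, (x (k + 1) ω - x k ω) ^ 2) :=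
    (hx.Qbd n).mono (hx.le n)
  have : ∫ ω, ∑ k ∈ Finset.range n, h k ω ^ 2 * (x (k + 1) ω - x k ω) ^ 2 ∂μ ≤
      ∫ ω, (c * (∑ k ∈ Finset.range n, (x (k + 1) ω - x k ω) ^ 2) ^ 2
        + (1 / (4 * c)) * w ω ^ 4) ∂μ := by
    apply Bd.le
    · exact Bd.sum _ fun k _ => (((hh k).mono (hx.le k)).pow 2).mul ((hx.dbd k).pow 2)
    · exact ((Bd.const _ _).mul (hQ.pow 2)).add ((Bd.const _ _).mul (hw.pow 4))
    · intro ω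
      have h1 : ∑ k ∈ Finset.range n, h k ω ^ 2 * (x (k + 1) ω - x k ω) ^ 2 ≤
          w ω ^ 2 * ∑ k ∈ Finset.range n, (x (k + 1) ω - x k ω) ^ 2 := by
        rw [Finset.mul_sum]
        refine Finset.sum_le_sum fun k hk => ?_
        refine mul_le_mul_of_nonneg_right ?_ (sq_nonneg _)
        rw [← sq_abs (h k ω)]
        exact pow_le_pow_left₀ (abs_nonneg _) (hhw k (Finset.mem_range.1 hk) ω) 2
      refine h1.trans ?_
      set q := ∑ k ∈ Finset.range n, (x (k + 1) ω - x k ω) ^ 2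
      have : c * q ^ 2 + 1 / (4 * c) * w ω ^ 4 - w ω ^ 2 * q = c * (q - w ω ^ 2 / (2 * c)) ^ 2 := by
        field_simp; ring
      have h2 : 0 ≤ c * (q - w ω ^ 2 / (2 * c)) ^ 2 := by positivity
      linarith
  refine this.trans ?_
  rw [integral_add ((Bd.const _ _).mul (hQ.pow 2)).i ((Bd.const _ _).mul (hw.pow 4)).i,
    integral_const_mul, integral_const_mul]
  have := hx.Qsq hK n
  have h3 : c * ∫ ω, (∑ k ∈ Finset.range n, (x (k + 1) ω - x k ω) ^ 2) ^ 2 ∂μ ≤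
    c * (160 * K ^ 4) := mul_le_mul_of_nonneg_left this hc.le
  have h4 : 1 / (4 * c) * ∫ ω, w ω ^ 4 ∂μ = (∫ ω, w ω ^ 4 ∂μ) / (4 * c) := by ring
  linarith

lemma sum_range_mul' {M : Type*} [AddCommMonoid M] (f : ℕ → M) (a b : ℕ) :
    ∑ k ∈ Finset.range (a * b), f k =
      ∑ j ∈ Finset.range a, ∑ i ∈ Finset.range b, f (j * b + i) := by
  induction a with
  | zero => simp
  | succ a ih => rw [Nat.succ_mul, Finset.sum_range_add, ih, Finset.sum_range_succ]

/-- dyadic grid point -/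
def gd (L k : ℕ) : ℝ := (k : ℝ) / 2 ^ L

lemma gd_nonneg (L k : ℕ) : 0 ≤ gd L k := by unfold gd; positivity

lemma gd_mono (L : ℕ) : Monotone (gd L) := by
  intro a b h
  unfold gd
  gcongr

lemma gd_zero (L : ℕ) : gd L 0 = 0 := by simp [gd]

lemma gd_one (L : ℕ) : gd L (2 ^ L) = 1 := by simp [gd]

lemma gd_le_one {L k : ℕ} (h : k ≤ 2 ^ L) : gd L k ≤ 1 := by
  rw [← gd_one L]; exact gd_mono L h

lemma gd_ref (p l j : ℕ) : gd (p + l) (j * 2 ^ l) = gd p j := by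
  unfold gd
  push_cast
  rw [pow_add]
  field_simp

lemma gd_ref' (p l j : ℕ) : gd (p + l) (2 ^ l * j) = gd p j := by
  rw [mul_comm, gd_ref]

lemma gd_add (L k i : ℕ) : gd L (k + i) = gd L k + (i : ℝ) / 2 ^ L := by
  unfold gd; push_cast; ring

/-- increment over a grid interval -/
def dd (X : ℝ → Ω → ℝ) (L k : ℕ) (ω : Ω) : ℝ := X (gd L (k + 1)) ω - X (gd L k) ω

/-- bounded continuous martingales -/
structure Mart (μ : Measure Ω) (G : ℝ → MeasurableSpace Ω) (X : ℝ → Ω → ℝ) (K : ℝ) : Prop where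
  mono : Monotone G
  le : ∀ t, G t ≤ m
  adp : ∀ t, 0 ≤ t → Measurable[G t] (X t)
  bdd : ∀ t ω, |X t ω| ≤ K
  cont : ∀ ω, Continuous fun t => X t ω
  zero : ∀ ω, X 0 ω = 0
  orth : ∀ s t, 0 ≤ s → s ≤ t → ∀ Z, Bd (G s) Z → ∫ ω, Z ω * (X t ω - X s ω) ∂μ = 0

variable {G : ℝ → MeasurableSpace Ω} {X : ℝ → Ω → ℝ} {K : ℝ}

lemma Mart.bd (h : Mart μ G X K) {t : ℝ} (ht : 0 ≤ t) : Bd (G t) (X t) := ⟨h.adp t ht, K, h.bdd t⟩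

lemma Mart.bdm (h : Mart μ G X K) {t : ℝ} (ht : 0 ≤ t) : Bd m (X t) := (h.bd ht).mono (h.le t)

lemma Mart.K0 (h : Mart μ G X K) : 0 ≤ K := by
  have : Nonempty Ω := MeasureTheory.nonempty_of_isProbabilityMeasure μ
  exact (abs_nonneg _).trans (h.bdd 0 this.some)

lemma Mart.dm (h : Mart μ G X K) {v : ℕ → ℝ} (hv : Monotone v) (h0 : 0 ≤ v 0) :
    DM μ (fun k => G (v k)) (fun k => X (v k)) where
  mono := h.mono.comp hv
  le k := h.le _
  bd k := h.bd (h0.trans (hv (Nat.zero_le k)))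
  orth k Z hZ := h.orth _ _ (h0.trans (hv (Nat.zero_le k))) (hv (Nat.le_succ k)) Z hZ

lemma Mart.dmg (h : Mart μ G X K) (L a : ℕ) :
    DM μ (fun k => G (gd L (a + k))) (fun k => X (gd L (a + k))) :=
  h.dm (fun i j hij => gd_mono L (by omega)) (gd_nonneg _ _)

lemma Mart.dmg0 (h : Mart μ G X K) (L : ℕ) :
    DM μ (fun k => G (gd L k)) (fun k => X (gd L k)) :=
  h.dm (gd_mono L) (gd_nonneg _ _)

lemma Mart.dbd (h : Mart μ G X K) (L k : ℕ) : Bd m (dd X L k) :=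
  (h.bdm (gd_nonneg _ _)).sub (h.bdm (gd_nonneg _ _))

/-- modulus of continuity on dyadics -/
def Wm (X : ℝ → Ω → ℝ) (p : ℕ) (ω : Ω) : ℝ :=
  ⨆ z : ℕ × ℕ × ℕ, if gd z.1 z.2.1 ≤ 1 ∧ gd z.1 z.2.2 ≤ 1 ∧
    |gd z.1 z.2.1 - gd z.1 z.2.2| ≤ (1 / 2) ^ p then |X (gd z.1 z.2.1) ω - X (gd z.1 z.2.2) ω| else 0

lemma Wm_bdd (hb : ∀ t ω, |X t ω| ≤ K) (p : ℕ) (ω : Ω) (z : ℕ × ℕ × ℕ) :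
    (if gd z.1 z.2.1 ≤ 1 ∧ gd z.1 z.2.2 ≤ 1 ∧
    |gd z.1 z.2.1 - gd z.1 z.2.2| ≤ (1 / 2) ^ p then |X (gd z.1 z.2.1) ω - X (gd z.1 z.2.2) ω|
      else 0) ≤ 2 * K := by
  have h1 := hb (gd z.1 z.2.1) ω
  have h2 := hb (gd z.1 z.2.2) ω
  split_ifs
  · refine (abs_sub _ _).trans ?_
    linarith
  · linarith [abs_nonneg (X (gd z.1 z.2.1) ω)]

lemma le_Wm (hb : ∀ t ω, |X t ω| ≤ K) {p L k k' : ℕ} (hk : k ≤ 2 ^ L) (hk' : k' ≤ 2 ^ L)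
    (h : |gd L k - gd L k'| ≤ (1 / 2) ^ p) (ω : Ω) :
    |X (gd L k) ω - X (gd L k') ω| ≤ Wm X p ω := by
  have := le_ciSup (f := fun z : ℕ × ℕ × ℕ => if gd z.1 z.2.1 ≤ 1 ∧ gd z.1 z.2.2 ≤ 1 ∧
    |gd z.1 z.2.1 - gd z.1 z.2.2| ≤ (1 / 2) ^ p then |X (gd z.1 z.2.1) ω - X (gd z.1 z.2.2) ω|
      else 0) ⟨2 * K, by rintro _ ⟨z, rfl⟩; exact Wm_bdd hb p ω z⟩ (L, k, k')
  simp only [gd_le_one hk, gd_le_one hk', h, and_self, if_true] at this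
  exact this

lemma Wm_nonneg (X : ℝ → Ω → ℝ) (p : ℕ) (ω : Ω) : 0 ≤ Wm X p ω := by
  apply Real.iSup_nonneg
  intro z
  split_ifs <;> simp

lemma Wm_le (hb : ∀ t ω, |X t ω| ≤ K) (p : ℕ) (ω : Ω) : Wm X p ω ≤ 2 * K :=
  ciSup_le fun z => Wm_bdd hb p ω z

lemma Wm_bd (hm : ∀ t, 0 ≤ t → Measurable (X t)) (hb : ∀ t ω, |X t ω| ≤ K) (p : ℕ) :
    Bd m (Wm X p) := by
  refine ⟨?_, 2 * K, fun ω => ?_⟩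
  · refine Measurable.iSup fun z => ?_
    split_ifs
    · exact measurable_norm.comp ((hm _ (gd_nonneg _ _)).sub (hm _ (gd_nonneg _ _)))
    · exact measurable_const
  · rw [abs_of_nonneg (Wm_nonneg X p ω)]; exact Wm_le hb p ω

lemma Wm_tendsto {ω : Ω} (hc : Continuous fun t => X t ω) :
    Tendsto (fun p => Wm X p ω) atTop (nhds 0) := by
  rw [Metric.tendsto_atTop]
  intro ε hε
  have huc : UniformContinuousOn (fun t => X t ω) (Icc 0 1) :=
    isCompact_Icc.uniformContinuousOn_of_continuous hc.continuousOn
  rw [Metric.uniformContinuousOn_iff] at huc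
  obtain ⟨δ, hδ, h⟩ := huc (ε / 2) (by positivity)
  obtain ⟨p0, hp0⟩ := exists_pow_lt_of_lt_one hδ (by norm_num : (1 / 2 : ℝ) < 1)
  refine ⟨p0, fun p hp => ?_⟩
  rw [Real.dist_eq, sub_zero, abs_of_nonneg (Wm_nonneg X p ω)]
  refine lt_of_le_of_lt (b := ε / 2) (ciSup_le fun z => ?_) (by linarith)
  split_ifs with hz
  · refine (h _ ⟨gd_nonneg _ _, hz.1⟩ _ ⟨gd_nonneg _ _, hz.2.1⟩ ?_).le
    rw [Real.dist_eq]
    refine hz.2.2.trans_lt (lt_of_le_of_lt ?_ hp0)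
    exact pow_le_pow_of_le_one (by norm_num) (by norm_num) hp
  · positivity

lemma Wm_int_tendsto (μ : Measure Ω) [IsProbabilityMeasure μ]
    (hm : ∀ t, 0 ≤ t → Measurable (X t)) (hb : ∀ t ω, |X t ω| ≤ K)
    (hc : ∀ ω, Continuous fun t => X t ω) (r : ℕ) (hr : r ≠ 0) :
    Tendsto (fun p => ∫ ω, Wm X p ω ^ r ∂μ) atTop (nhds 0) := by
  have : (0:ℝ) = ∫ ω : Ω, (0:ℝ) ∂μ := by simp
  rw [this]
  refine tendsto_integral_of_dominated_convergence (fun _ => (2 * K) ^ r) ?_ (integrable_const _)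
    ?_ ?_
  · intro p; exact ((Wm_bd hm hb p).pow r).meas.aestronglyMeasurable
  · intro p
    refine Eventually.of_forall fun ω => ?_
    rw [Real.norm_eq_abs, abs_of_nonneg (pow_nonneg (Wm_nonneg X p ω) r)]
    exact pow_le_pow_left₀ (Wm_nonneg X p ω) (Wm_le hb p ω) r
  · refine Eventually.of_forall fun ω => ?_
    have := (Wm_tendsto (hc ω)).pow r
    simpa [hr] using this

lemma Mart.mm (h : Mart μ G X K) : ∀ t, 0 ≤ t → Measurable (X t) :=
  fun t ht => (h.adp t ht).mono (h.le t) le_rfl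

/-- For each `θ` the quantity from `iso_W` is eventually small. -/
lemma small_of_W {a : ℕ → ℝ} (ha : Tendsto a atTop (nhds 0)) (B : ℝ) (hB : 0 ≤ B) {θ : ℝ}
    (hθ : 0 < θ) : ∃ c > 0, ∀ᶠ p in atTop, c * B + a p / (4 * c) ≤ θ := by
  refine ⟨θ / (2 * (B + 1)), by positivity, ?_⟩
  set c := θ / (2 * (B + 1)) with hc
  have hc0 : 0 < c := by positivity
  have h1 : c * B ≤ θ / 2 := by
    rw [hc, div_mul_eq_mul_div, div_le_div_iff₀ (by positivity) (by positivity)]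
    nlinarith
  have : ∀ᶠ p in atTop, a p < θ / 2 * (4 * c) :=
    ha.eventually_lt_const (by positivity)
  filter_upwards [this] with p hp
  have : a p / (4 * c) ≤ θ / 2 := by
    rw [div_le_iff₀ (by positivity)]; exact hp.le
  linarith

/-- quadratic variation over a coarse block -/
def qb (X X' : ℝ → Ω → ℝ) (p l j : ℕ) (ω : Ω) : ℝ :=
  ∑ i ∈ Finset.range (2 ^ l), dd X (p + l) (j * 2 ^ l + i) ω * dd X' (p + l) (j * 2 ^ l + i) ω

lemma qb_nonneg (X : ℝ → Ω → ℝ) (p l j : ℕ) (ω : Ω) : 0 ≤ qb X X p l j ω :=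
  Finset.sum_nonneg fun i _ => mul_self_nonneg _

lemma Mart.qbbd {X' : ℝ → Ω → ℝ} {K' : ℝ} (h : Mart μ G X K) (h' : Mart μ G X' K') (p l j : ℕ) :
    Bd m (qb X X' p l j) :=
  Bd.sum _ fun i _ => (h.dbd _ _).mul (h'.dbd _ _)

lemma blk_dist {p l j i : ℕ} (hi : i ≤ 2 ^ l) :
    |gd (p + l) (j * 2 ^ l + i) - gd (p + l) (j * 2 ^ l)| ≤ (1 / 2) ^ p := by
  rw [gd_add, add_sub_cancel_left, abs_of_nonneg (by positivity)]
  rw [pow_add, one_div, inv_pow, div_le_iff₀ (by positivity)]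
  have : (i : ℝ) ≤ 2 ^ l := by exact_mod_cast hi
  field_simp
  exact this

lemma blk_le {p l j i : ℕ} (hj : j < 2 ^ p) (hi : i ≤ 2 ^ l) : j * 2 ^ l + i ≤ 2 ^ (p + l) := by
  rw [pow_add]
  calc j * 2 ^ l + i ≤ j * 2 ^ l + 2 ^ l := by omega
    _ = (j + 1) * 2 ^ l := by ring
    _ ≤ _ := Nat.mul_le_mul_right _ hj

lemma qb_eq (X : ℝ → Ω → ℝ) (p l j : ℕ) (ω : Ω) :
    qb X X p l j ω = ∑ k ∈ Finset.range (2 ^ l),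
      ((fun k => X (gd (p + l) (j * 2 ^ l + k))) (k + 1) ω -
        (fun k => X (gd (p + l) (j * 2 ^ l + k))) k ω) ^ 2 := by
  unfold qb dd
  refine Finset.sum_congr rfl fun i _ => ?_
  simp only [add_assoc]
  ring

lemma sumQ_blk (X : ℝ → Ω → ℝ) (p l : ℕ) (ω : Ω) :
    ∑ j ∈ Finset.range (2 ^ p), qb X X p l j ω =
      ∑ k ∈ Finset.range (2 ^ (p + l)), (dd X (p + l) k ω) ^ 2 := by
  rw [pow_add, sum_range_mul']
  refine Finset.sum_congr rfl fun j _ => ?_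
  unfold qb
  refine Finset.sum_congr rfl fun i _ => ?_
  ring

lemma Mart.Qsq (h : Mart μ G X K) (L n : ℕ) :
    ∫ ω, (∑ k ∈ Finset.range n, (dd X L k ω) ^ 2) ^ 2 ∂μ ≤ 160 * K ^ 4 :=
  (h.dmg0 L).Qsq (fun k ω => h.bdd _ ω) n

lemma Mart.Qbd (h : Mart μ G X K) (L n : ℕ) :
    Bd m (fun ω => ∑ k ∈ Finset.range n, (dd X L k ω) ^ 2) :=
  Bd.sum _ fun k _ => (h.dbd L k).pow 2

/-- `∫ W² Q` estimate -/
lemma W2Q_le (h : Mart μ G X K) (L n p : ℕ) {c : ℝ} (hc : 0 < c) :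
    ∫ ω, Wm X p ω ^ 2 * (∑ k ∈ Finset.range n, (dd X L k ω) ^ 2) ∂μ ≤
      c * (160 * K ^ 4) + (∫ ω, Wm X p ω ^ 4 ∂μ) / (4 * c) := by
  have hw := Wm_bd h.mm h.bdd p
  have hQ := h.Qbd L n
  have h1 : ∫ ω, Wm X p ω ^ 2 * (∑ k ∈ Finset.range n, (dd X L k ω) ^ 2) ∂μ ≤
      ∫ ω, (c * (∑ k ∈ Finset.range n, (dd X L k ω) ^ 2) ^ 2 + 1 / (4 * c) * Wm X p ω ^ 4) ∂μ := by
    apply Bd.le ((hw.pow 2).mul hQ)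
      (((Bd.const _ _).mul (hQ.pow 2)).add ((Bd.const _ _).mul (hw.pow 4)))
    intro ω
    set q := ∑ k ∈ Finset.range n, (dd X L k ω) ^ 2
    set w := Wm X p ω
    have : c * q ^ 2 + 1 / (4 * c) * w ^ 4 - w ^ 2 * q = c * (q - w ^ 2 / (2 * c)) ^ 2 := by
      field_simp; ring
    have h2 : 0 ≤ c * (q - w ^ 2 / (2 * c)) ^ 2 := by positivity
    linarith
  refine h1.trans ?_
  rw [integral_add ((Bd.const _ _).mul (hQ.pow 2)).i ((Bd.const _ _).mul (hw.pow 4)).i,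
    integral_const_mul, integral_const_mul]
  have h3 := mul_le_mul_of_nonneg_left (h.Qsq L n) hc.le
  have h4 : 1 / (4 * c) * ∫ ω, Wm X p ω ^ 4 ∂μ = (∫ ω, Wm X p ω ^ 4 ∂μ) / (4 * c) := by ring
  linarith

lemma SmallQ4 (h : Mart μ G X K) {θ : ℝ} (hθ : 0 < θ) :
    ∃ p0, ∀ p ≥ p0, ∀ l, ∑ j ∈ Finset.range (2 ^ p), ∫ ω, (qb X X p l j ω) ^ 2 ∂μ ≤ θ := by
  have hWt := Wm_int_tendsto μ h.mm h.bdd h.cont 4 (by norm_num)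
  have hK := h.K0
  obtain ⟨c, hc, hev⟩ := small_of_W hWt (160 * K ^ 4) (by positivity) (θ := θ / 10) (by positivity)
  obtain ⟨p0, hp0⟩ := eventually_atTop.1 hev
  refine ⟨p0, fun p hp l => ?_⟩
  have hs := hp0 p hp
  have hw := Wm_bd h.mm h.bdd p
  -- pointwise and isometry bound for each block
  have hblk : ∀ j ∈ Finset.range (2 ^ p), ∫ ω, (qb X X p l j ω) ^ 2 ∂μ ≤
      2 * ∫ ω, Wm X p ω ^ 2 * (dd X p j ω) ^ 2 ∂μ + 8 * ∫ ω, Wm X p ω ^ 2 * qb X X p l j ω ∂μ := by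
    intro j hj
    rw [Finset.mem_range] at hj
    have hD := h.dmg (p + l) (j * 2 ^ l)
    set x : ℕ → Ω → ℝ := fun k => X (gd (p + l) (j * 2 ^ l + k)) with hx
    set hh : ℕ → Ω → ℝ := fun k ω => x k ω - x 0 ω with hhd
    have hhb : ∀ k, Bd (G (gd (p + l) (j * 2 ^ l + k))) (hh k) := fun k =>
      (hD.bd k).sub (hD.bd' (Nat.zero_le k))
    have hW : ∀ k ≤ 2 ^ l, ∀ ω, |x k ω - x 0 ω| ≤ Wm X p ω := by
      intro k hk ω
      exact le_Wm h.bdd (blk_le hj hk) (by simpa using blk_le hj (Nat.zero_le (2 ^ l)))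
        (by simpa using blk_dist (p := p) (j := j) hk) ω
    have e : ∀ ω, qb X X p l j ω = (x (2 ^ l) ω - x 0 ω) ^ 2 - 2 * tr hh x (2 ^ l) ω := by
      intro ω; rw [qb_eq]; exact sum_sq_eq x (2 ^ l) ω
    have eΔ : ∀ ω, x (2 ^ l) ω - x 0 ω = dd X p j ω := by
      intro ω
      simp only [hx, dd, add_zero, gd_ref]
      rw [← gd_ref p l (j + 1), Nat.succ_mul]
    have htr : Bd m (tr hh x (2 ^ l)) := (hD.trbd hhb _).mono (hD.le _)
    have hd2 := (h.dbd p j).pow 2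
    have i1 : ∫ ω, (tr hh x (2 ^ l) ω) ^ 2 ∂μ ≤ ∫ ω, Wm X p ω ^ 2 * qb X X p l j ω ∂μ := by
      rw [hD.iso hhb, ← integral_finsetSum]
      · apply Bd.le
        · exact Bd.sum _ fun k _ => (((hhb k).mono (hD.le k)).pow 2).mul ((hD.dbd k).pow 2)
        · exact (hw.pow 2).mul (h.qbbd h p l j)
        · intro ω
          rw [qb_eq, Finset.mul_sum]
          refine Finset.sum_le_sum fun k hk => ?_
          refine mul_le_mul_of_nonneg_right ?_ (sq_nonneg _)
          rw [← sq_abs (hh k ω)]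
          exact pow_le_pow_left₀ (abs_nonneg _) (hW k (Finset.mem_range.1 hk).le ω) 2
      · intro k _
        exact ((((hhb k).mono (hD.le k)).pow 2).mul ((hD.dbd k).pow 2)).i
    have i2 : ∫ ω, (qb X X p l j ω) ^ 2 ∂μ ≤
        ∫ ω, (2 * (Wm X p ω ^ 2 * (dd X p j ω) ^ 2) + 8 * (tr hh x (2 ^ l) ω) ^ 2) ∂μ := by
      apply Bd.le ((h.qbbd h p l j).pow 2)
      · exact ((Bd.const _ _).mul ((hw.pow 2).mul hd2)).add ((Bd.const _ _).mul (htr.pow 2))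
      · intro ω
        have h1 := hW (2 ^ l) le_rfl ω
        rw [e ω, eΔ ω]
        rw [eΔ ω] at h1
        have h2 : (dd X p j ω) ^ 2 ≤ Wm X p ω ^ 2 := by
          rw [← sq_abs (dd X p j ω)]; exact pow_le_pow_left₀ (abs_nonneg _) h1 2
        nlinarith [sq_nonneg (dd X p j ω ^ 2 + 2 * tr hh x (2 ^ l) ω), sq_nonneg (dd X p j ω)]
    rw [integral_add ((Bd.const _ _).mul ((hw.pow 2).mul hd2)).i ((Bd.const _ _).mul (htr.pow 2)).i,
      integral_const_mul, integral_const_mul] at i2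
    linarith
  refine (Finset.sum_le_sum hblk).trans ?_
  rw [Finset.sum_add_distrib, ← Finset.mul_sum, ← Finset.mul_sum, ← integral_finsetSum,
    ← integral_finsetSum]
  · simp_rw [← Finset.mul_sum, sumQ_blk]
    have h1 := W2Q_le h p (2 ^ p) p hc
    have h2 := W2Q_le h (p + l) (2 ^ (p + l)) p hc
    linarith
  · intro j _; exact ((hw.pow 2).mul (h.qbbd h p l j)).i
  · intro j _; exact ((hw.pow 2).mul ((h.dbd p j).pow 2)).i

/-! ### Riemann sums on finer grids -/

lemma rsum_pt (p j n i : ℕ) : gd p j * (i : ℝ) / 2 ^ n = gd (p + n) (i * j) := by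
  unfold gd; push_cast; rw [pow_add]; field_simp

lemma rsum_pt1 (p j n i : ℕ) : gd p j * ((i : ℝ) + 1) / 2 ^ n = gd (p + n) (i * j + j) := by
  have := rsum_pt p j n (i + 1)
  push_cast at this
  rw [this]; congr 1; ring

lemma rsum_embed (H X : ℝ → Ω → ℝ) (p j n : ℕ) (ω : Ω) :
    rsum H X (gd p j) n ω =
      ∑ k ∈ Finset.range (2 ^ n * j), H (gd (p + n) (k / j * j)) ω * dd X (p + n) k ω := by
  rw [sum_range_mul']
  unfold rsum
  refine Finset.sum_congr rfl fun i _ => ?_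
  rw [rsum_pt, rsum_pt1]
  have : ∀ r ∈ Finset.range j, H (gd (p + n) ((i * j + r) / j * j)) ω * dd X (p + n) (i * j + r) ω =
      H (gd (p + n) (i * j)) ω * ((fun r => X (gd (p + n) (i * j + r)) ω) (r + 1) -
        (fun r => X (gd (p + n) (i * j + r)) ω) r) := by
    intro r hr
    rw [Finset.mem_range] at hr
    have : (i * j + r) / j = i := by
      rw [mul_comm, Nat.mul_add_div (by omega), Nat.div_eq_of_lt hr, add_zero]
    rw [this]; rfl
  rw [Finset.sum_congr rfl this, ← Finset.mul_sum,
    Finset.sum_range_sub (fun r => X (gd (p + n) (i * j + r)) ω) j]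
  simp

lemma mesh_dist {p j n k : ℕ} (hj : j ≤ 2 ^ p) (hj0 : 0 < j) :
    |gd (p + n) (k / j * j) - gd (p + n) k| ≤ (1 / 2) ^ n := by
  have h1 : gd (p + n) k = gd (p + n) (k / j * j) + ((k % j : ℕ) : ℝ) / 2 ^ (p + n) := by
    rw [← gd_add]; congr 1; exact (Nat.div_add_mod' k j).symm
  rw [h1, sub_add_cancel_left, abs_neg, abs_of_nonneg (by positivity)]
  rw [pow_add, one_div, inv_pow, div_le_iff₀ (by positivity)]
  have : ((k % j : ℕ) : ℝ) ≤ 2 ^ p := by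
    exact_mod_cast (Nat.mod_lt k hj0).le.trans hj
  field_simp
  exact this

/-- left-point sums on the full grid -/
def gs (H X : ℝ → Ω → ℝ) (L n : ℕ) (ω : Ω) : ℝ :=
  ∑ k ∈ Finset.range n, H (gd L k) ω * dd X L k ω

/-- covariation sums on the full grid -/
def Fs (X X' : ℝ → Ω → ℝ) (L n : ℕ) (ω : Ω) : ℝ :=
  ∑ k ∈ Finset.range n, dd X L k ω * dd X' L k ω

lemma rsum_bd {H : ℝ → Ω → ℝ} {K' : ℝ} (hH : Mart μ G H K') (hX : Mart μ G X K)
    {t : ℝ} (ht : 0 ≤ t) (n : ℕ) : Bd m (rsum H X t n) :=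
  Bd.sum _ fun i _ => (hH.bdm (by positivity)).mul
    ((hX.bdm (by positivity)).sub (hX.bdm (by positivity)))

lemma qsum_bd {H : ℝ → Ω → ℝ} {K' : ℝ} (hH : Mart μ G H K') (hX : Mart μ G X K)
    {t : ℝ} (ht : 0 ≤ t) (n : ℕ) : Bd m (qsum H X t n) :=
  Bd.sum _ fun i _ => ((hH.bdm (by positivity)).sub (hH.bdm (by positivity))).mul
    ((hX.bdm (by positivity)).sub (hX.bdm (by positivity)))

lemma gs_bd {H : ℝ → Ω → ℝ} {K' : ℝ} (hH : Mart μ G H K') (hX : Mart μ G X K)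
    (L n : ℕ) : Bd m (gs H X L n) :=
  Bd.sum _ fun i _ => (hH.bdm (gd_nonneg _ _)).mul (hX.dbd _ _)

lemma Fs_bd {H : ℝ → Ω → ℝ} {K' : ℝ} (hH : Mart μ G H K') (hX : Mart μ G X K)
    (L n : ℕ) : Bd m (Fs H X L n) :=
  Bd.sum _ fun i _ => (hH.dbd _ _).mul (hX.dbd _ _)

lemma mesh {H : ℝ → Ω → ℝ} {K' : ℝ} (hH : Mart μ G H K') (hX : Mart μ G X K) {p j : ℕ}
    (hj : j ≤ 2 ^ p) :
    Tendsto (fun n => ∫ ω, (rsum H X (gd p j) n ω - gs H X (p + n) (2 ^ n * j) ω) ^ 2 ∂μ)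
      atTop (nhds 0) := by
  have hWt := Wm_int_tendsto μ hH.mm hH.bdd hH.cont 4 (by norm_num)
  have hK := hX.K0
  rw [Metric.tendsto_atTop]
  intro ε hε
  obtain ⟨c, hc, hev⟩ := small_of_W hWt (160 * K ^ 4) (by positivity) (θ := ε / 2) (by positivity)
  obtain ⟨n0, hn0⟩ := eventually_atTop.1 hev
  refine ⟨n0, fun n hn => ?_⟩
  have h0 : 0 ≤ ∫ ω, (rsum H X (gd p j) n ω - gs H X (p + n) (2 ^ n * j) ω) ^ 2 ∂μ :=
    integral_nonneg fun ω => sq_nonneg _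
  rw [Real.dist_eq, sub_zero, abs_of_nonneg h0]
  refine lt_of_le_of_lt ?_ (half_lt_self hε)
  refine le_trans ?_ (hn0 n hn)
  set h : ℕ → Ω → ℝ := fun k ω => H (gd (p + n) (k / j * j)) ω - H (gd (p + n) k) ω with hh
  have hD := hX.dmg0 (p + n)
  have hb : ∀ k, Bd (G (gd (p + n) k)) (h k) := by
    intro k
    exact ((hH.bd (gd_nonneg _ _)).mono (hH.mono (gd_mono _ (Nat.div_mul_le_self k j)))).sub
      (hH.bd (gd_nonneg _ _))
  have e : ∀ ω, rsum H X (gd p j) n ω - gs H X (p + n) (2 ^ n * j) ω =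
      tr h (fun k => X (gd (p + n) k)) (2 ^ n * j) ω := by
    intro ω
    rw [rsum_embed, gs, ← Finset.sum_sub_distrib]
    unfold tr
    refine Finset.sum_congr rfl fun k _ => ?_
    simp only [hh, dd]; ring
  simp_rw [e]
  refine hD.iso_W hb (Wm_bd hH.mm hH.bdd n) ?_ (fun k ω => hX.bdd _ ω) hc
  intro k hk ω
  have hj0 : 0 < j := by
    rcases Nat.eq_zero_or_pos j with h | h
    · simp [h] at hk
    · exact h
  have hk' : k ≤ 2 ^ (p + n) := by
    rw [pow_add, mul_comm]
    exact hk.le.trans (Nat.mul_le_mul_left _ hj)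
  exact le_Wm hH.bdd ((Nat.div_mul_le_self k j).trans hk') hk' (mesh_dist hj hj0) ω

lemma sum_by_parts (a b : ℕ → ℝ) (n : ℕ) :
    ∑ k ∈ Finset.range n, (a (k + 1) - a k) * (b (k + 1) - b k) =
      a n * b n - a 0 * b 0 - ∑ k ∈ Finset.range n, a k * (b (k + 1) - b k)
        - ∑ k ∈ Finset.range n, b k * (a (k + 1) - a k) := by
  induction n with
  | zero => simp
  | succ n ih => simp only [Finset.sum_range_succ, ih]; ring

lemma qsum_eq (X X' : ℝ → Ω → ℝ) (t : ℝ) (n : ℕ) (ω : Ω) :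
    qsum X X' t n ω = X t ω * X' t ω - X 0 ω * X' 0 ω - rsum X X' t n ω - rsum X' X t n ω := by
  have := sum_by_parts (fun i => X (t * (i : ℝ) / 2 ^ n) ω) (fun i => X' (t * (i : ℝ) / 2 ^ n) ω)
    (2 ^ n)
  push_cast at this
  have e1 : t * (2:ℝ) ^ n / 2 ^ n = t := by field_simp
  have e0 : t * 0 / (2:ℝ) ^ n = 0 := by simp
  rw [e1, e0] at this
  unfold qsum rsum
  exact this

lemma Fs_eq (X X' : ℝ → Ω → ℝ) (L n : ℕ) (ω : Ω) :
    Fs X X' L n ω = X (gd L n) ω * X' (gd L n) ω - X 0 ω * X' 0 ω - gs X X' L n ω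
      - gs X' X L n ω := by
  have := sum_by_parts (fun i => X (gd L i) ω) (fun i => X' (gd L i) ω) n
  rw [gd_zero] at this
  unfold Fs gs
  exact this

lemma sq_add_tendsto {f f' : ℕ → Ω → ℝ} (hf : ∀ n, Bd m (f n)) (hf' : ∀ n, Bd m (f' n))
    (h : Tendsto (fun n => ∫ ω, f n ω ^ 2 ∂μ) atTop (nhds 0))
    (h' : Tendsto (fun n => ∫ ω, f' n ω ^ 2 ∂μ) atTop (nhds 0)) :
    Tendsto (fun n => ∫ ω, (f n ω + f' n ω) ^ 2 ∂μ) atTop (nhds 0) := by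
  have := (h.const_mul 2).add (h'.const_mul 2)
  simp only [mul_zero, add_zero] at this
  refine squeeze_zero (fun n => integral_nonneg fun ω => sq_nonneg _) (fun n => ?_) this
  rw [← integral_const_mul, ← integral_const_mul,
    ← integral_add ((Bd.const _ _).mul ((hf n).pow 2)).i ((Bd.const _ _).mul ((hf' n).pow 2)).i]
  refine Bd.le (((hf n).add (hf' n)).pow 2)
    (((Bd.const _ _).mul ((hf n).pow 2)).add ((Bd.const _ _).mul ((hf' n).pow 2))) fun ω => ?_
  nlinarith [sq_nonneg (f n ω - f' n ω)]

lemma qmesh {H : ℝ → Ω → ℝ} {K' : ℝ} (hH : Mart μ G H K') (hX : Mart μ G X K) {p j : ℕ}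
    (hj : j ≤ 2 ^ p) :
    Tendsto (fun n => ∫ ω, (qsum H X (gd p j) n ω - Fs H X (p + n) (2 ^ n * j) ω) ^ 2 ∂μ)
      atTop (nhds 0) := by
  have := sq_add_tendsto (μ := μ)
    (fun n => (rsum_bd hH hX (gd_nonneg p j) n).sub (gs_bd hH hX (p + n) (2 ^ n * j)))
    (fun n => (rsum_bd hX hH (gd_nonneg p j) n).sub (gs_bd hX hH (p + n) (2 ^ n * j)))
    (mesh hH hX hj) (mesh hX hH hj)
  refine this.congr fun n => ?_
  congr 1; ext ω
  rw [qsum_eq, Fs_eq, gd_ref']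
  ring

lemma Fs_qb (X X' : ℝ → Ω → ℝ) (p l j : ℕ) (ω : Ω) :
    qb X X' p l j ω = Fs X X' (p + l) (2 ^ l * (j + 1)) ω - Fs X X' (p + l) (2 ^ l * j) ω := by
  unfold Fs qb
  rw [mul_add, mul_one, Finset.sum_range_add, add_sub_cancel_left, mul_comm j]

lemma qb_mesh {H : ℝ → Ω → ℝ} {K' : ℝ} (hH : Mart μ G H K') (hX : Mart μ G X K) {p j : ℕ}
    (hj : j < 2 ^ p) :
    Tendsto (fun n => ∫ ω, (qsum H X (gd p (j + 1)) n ω - qsum H X (gd p j) n ω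
      - qb H X p n j ω) ^ 2 ∂μ) atTop (nhds 0) := by
  have h2 := qmesh hH hX (j := j) (p := p) hj.le
  have h2' : Tendsto (fun n => ∫ ω, (-(qsum H X (gd p j) n ω - Fs H X (p + n) (2 ^ n * j) ω)) ^ 2 ∂μ)
      atTop (nhds 0) := by simpa only [neg_sq] using h2
  have := sq_add_tendsto (μ := μ)
    (fun n => (qsum_bd hH hX (gd_nonneg p (j + 1)) n).sub (Fs_bd hH hX (p + n) (2 ^ n * (j + 1))))
    (fun n => ((qsum_bd hH hX (gd_nonneg p j) n).sub (Fs_bd hH hX (p + n) (2 ^ n * j))).neg)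
    (qmesh hH hX hj) h2'
  refine this.congr fun n => ?_
  congr 1; ext ω
  rw [Fs_qb]
  ring

lemma prob_tendsto {f : ℕ → Ω → ℝ} (hf : ∀ n, Bd m (f n))
    (h : Tendsto (fun n => ∫ ω, f n ω ^ 2 ∂μ) atTop (nhds 0)) {ε : ℝ} (hε : 0 < ε) :
    Tendsto (fun n => μ.real {ω | ε < |f n ω|}) atTop (nhds 0) := by
  have := h.div_const (ε ^ 2)
  rw [zero_div] at this
  refine squeeze_zero (fun n => measureReal_nonneg) (fun n => ?_) this
  refine Bd.markov ((hf n).pow 2) (fun ω => sq_nonneg _)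
    (measurableSet_lt measurable_const (hf n).abs.meas) (by positivity) fun ω hω => ?_
  rw [← sq_abs (f n ω)]
  exact pow_le_pow_left₀ hε.le (le_of_lt hω) 2

/-! ### The core setting -/

/-- Stopped, bounded driving martingales. -/
structure Core (μ : Measure Ω) (G : ℝ → MeasurableSpace Ω) (M N : ℝ → Ω → ℝ) (ρ : Ω → ℝ)
    (K c : ℝ) : Prop where
  hM : Mart μ G M K
  hN : Mart μ G N K
  c0 : 0 ≤ c
  mρ : Measurable ρ
  stopM : ∀ s t ω, 0 ≤ s → ρ ω ≤ s → s ≤ t → M t ω = M s ω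
  stopN : ∀ s t ω, 0 ≤ s → ρ ω ≤ s → s ≤ t → N t ω = N s ω
  dom0 : ∀ s t, 0 ≤ s → s ≤ t → ∀ ε > 0, Tendsto (fun n => μ.real {ω | t ≤ ρ ω ∧
    ε < (qsum M M t n ω - qsum M M s n ω) - c * max 0 (qsum N N t n ω - qsum N N s n ω)})
      atTop (nhds 0)
  orth0 : ∀ t, 0 ≤ t → ∀ ε > 0, Tendsto (fun n => μ.real {ω | t ≤ ρ ω ∧
    ε < |qsum M N t n ω|}) atTop (nhds 0)

variable {M N : ℝ → Ω → ℝ} {ρ : Ω → ℝ} {c : ℝ}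

lemma Core.ddM0 (C : Core μ G M N ρ K c) {L k : ℕ} {ω : Ω} (h : ρ ω ≤ gd L k) : dd M L k ω = 0 := by
  unfold dd
  rw [C.stopM _ _ ω (gd_nonneg L k) h (gd_mono L (Nat.le_succ k)), sub_self]

lemma Core.ddN0 (C : Core μ G M N ρ K c) {L k : ℕ} {ω : Ω} (h : ρ ω ≤ gd L k) : dd N L k ω = 0 := by
  unfold dd
  rw [C.stopN _ _ ω (gd_nonneg L k) h (gd_mono L (Nat.le_succ k)), sub_self]

lemma Core.blk0 {p l j i : ℕ} {ω : Ω} (h : ρ ω ≤ gd p j) : ρ ω ≤ gd (p + l) (j * 2 ^ l + i) := by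
  refine h.trans ?_
  rw [← gd_ref p l j]
  exact gd_mono _ (by omega)

lemma one_block {p : ℕ} (r : ℝ) :
    ∑ j ∈ Finset.range (2 ^ p), (if gd p j < r ∧ r < gd p (j + 1) then (1:ℝ) else 0) ≤ 1 := by
  rw [← Finset.sum_filter]
  simp only [Finset.sum_const, nsmul_eq_mul, mul_one]
  have : (Finset.filter (fun j => gd p j < r ∧ r < gd p (j + 1)) (Finset.range (2 ^ p))).card ≤ 1 := by
    rw [Finset.card_le_one]
    intro a ha b hb
    simp only [Finset.mem_filter] at ha hb
    by_contra hne
    rcases Nat.lt_or_gt_of_ne hne with h | h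
    · have := gd_mono p (show a + 1 ≤ b from h)
      linarith [ha.2.2, hb.2.1]
    · have := gd_mono p (show b + 1 ≤ a from h)
      linarith [hb.2.2, ha.2.1]
  exact_mod_cast this

lemma Core.Bcore (C : Core μ G M N ρ K c) {A : ℕ → ℕ → ℕ → Ω → ℝ}
    (hbd : ∀ p l j, Bd m (A p l j))
    (hA : ∀ p l j ω, A p l j ω ≤ qb M M p l j ω + qb N N p l j ω)
    (hA0 : ∀ p l j ω, ρ ω ≤ gd p j → A p l j ω ≤ 0)
    (hp : ∀ p j, j < 2 ^ p → ∀ ε > 0,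
      Tendsto (fun l => μ.real {ω | gd p (j + 1) ≤ ρ ω ∧ ε < A p l j ω}) atTop (nhds 0))
    {θ : ℝ} (hθ : 0 < θ) :
    ∃ p0, ∀ p ≥ p0, ∀ᶠ l in atTop, ∑ j ∈ Finset.range (2 ^ p), ∫ ω, A p l j ω ∂μ ≤ θ := by
  classical
  -- parameters
  set δ : ℝ := min 1 (θ / 8) with hδ
  have hδ0 : 0 < δ := by positivity
  obtain ⟨p1, hp1⟩ := SmallQ4 C.hM (θ := δ ^ 2 / 8) (by positivity)
  obtain ⟨p2, hp2⟩ := SmallQ4 C.hN (θ := δ ^ 2 / 8) (by positivity)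
  refine ⟨max p1 p2, fun p hpp => ?_⟩
  set R : ℕ → ℕ → Ω → ℝ := fun l j ω => qb M M p l j ω + qb N N p l j ω with hR
  have hRb : ∀ l j, Bd m (R l j) := fun l j => (C.hM.qbbd C.hM p l j).add (C.hN.qbbd C.hN p l j)
  have hR2 : ∀ l, ∑ j ∈ Finset.range (2 ^ p), ∫ ω, R l j ω ^ 2 ∂μ ≤ δ ^ 2 / 2 := by
    intro l
    have h1 := hp1 p (le_of_max_le_left hpp) l
    have h2 := hp2 p (le_of_max_le_right hpp) l
    have : ∀ j ∈ Finset.range (2 ^ p), ∫ ω, R l j ω ^ 2 ∂μ ≤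
        2 * ∫ ω, qb M M p l j ω ^ 2 ∂μ + 2 * ∫ ω, qb N N p l j ω ^ 2 ∂μ := by
      intro j _
      have b1 := (C.hM.qbbd C.hM p l j).pow 2
      have b2 := (C.hN.qbbd C.hN p l j).pow 2
      rw [← integral_const_mul, ← integral_const_mul,
        ← integral_add ((Bd.const _ _).mul b1).i ((Bd.const _ _).mul b2).i]
      refine Bd.le ((hRb l j).pow 2) (((Bd.const _ _).mul b1).add ((Bd.const _ _).mul b2)) fun ω => ?_
      simp only [hR]
      nlinarith [sq_nonneg (qb M M p l j ω - qb N N p l j ω)]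
    refine (Finset.sum_le_sum this).trans ?_
    rw [Finset.sum_add_distrib, ← Finset.mul_sum, ← Finset.mul_sum]
    linarith
  set ε : ℝ := δ / 2 ^ p with hε
  have hε0 : 0 < ε := by positivity
  have hbad : ∀ᶠ l in atTop, ∀ j ∈ Finset.range (2 ^ p),
      μ.real {ω | gd p (j + 1) ≤ ρ ω ∧ ε < A p l j ω} < ε := by
    rw [Filter.eventually_all_finset]
    intro j hj
    exact (hp p j (Finset.mem_range.1 hj) ε hε0).eventually_lt_const hε0
  filter_upwards [hbad] with l hl
  -- pointwise decomposition
  have hmB : ∀ j, MeasurableSet {ω | gd p (j + 1) ≤ ρ ω ∧ ε < A p l j ω} := fun j =>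
    (measurableSet_le measurable_const C.mρ).inter
      (measurableSet_lt measurable_const (hbd p l j).meas)
  have hmS : ∀ j, MeasurableSet {ω | gd p j < ρ ω ∧ ρ ω < gd p (j + 1)} := fun j =>
    (measurableSet_lt measurable_const C.mρ).inter (measurableSet_lt C.mρ measurable_const)
  set b1 : ℕ → Ω → ℝ := fun j ω => if gd p (j + 1) ≤ ρ ω ∧ ε < A p l j ω then 1 else 0
  set b2 : ℕ → Ω → ℝ := fun j ω => if gd p j < ρ ω ∧ ρ ω < gd p (j + 1) then 1 else 0
  have hb1 : ∀ j, Bd m (b1 j) := fun j => Bd.ind (hmB j)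
  have hb2 : ∀ j, Bd m (b2 j) := fun j => Bd.ind (hmS j)
  have hpt : ∀ j ω, A p l j ω ≤ ε + b1 j ω + δ * b2 j ω + (1 / δ) * R l j ω ^ 2 := by
    intro j ω
    have hAR : A p l j ω ≤ R l j ω := hA p l j ω
    have hsq : R l j ω ≤ δ + (1 / δ) * R l j ω ^ 2 := by
      have : δ + (1 / δ) * R l j ω ^ 2 - R l j ω =
        (1 / δ) * ((R l j ω - δ / 2) ^ 2 + 3 / 4 * δ ^ 2) := by field_simp; ring
      have h2 : 0 ≤ (1 / δ) * ((R l j ω - δ / 2) ^ 2 + 3 / 4 * δ ^ 2) := by positivity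
      linarith
    have hR0 : 0 ≤ (1 / δ) * R l j ω ^ 2 := by positivity
    have hδ1 : δ ≤ 1 := min_le_left _ _
    have hb1' : 0 ≤ b1 j ω := by simp only [b1]; split_ifs <;> norm_num
    have hb2' : 0 ≤ δ * b2 j ω := by
      apply mul_nonneg hδ0.le
      simp only [b2]; split_ifs <;> norm_num
    rcases le_or_gt (ρ ω) (gd p j) with h1 | h1
    · have := hA0 p l j ω h1
      linarith
    · rcases lt_or_ge (ρ ω) (gd p (j + 1)) with h2 | h2
      · have : b2 j ω = 1 := by simp only [b2]; rw [if_pos ⟨h1, h2⟩]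
        rw [this] at hb2' ⊢
        linarith
      · by_cases h3 : ε < A p l j ω
        · have : b1 j ω = 1 := by simp only [b1]; rw [if_pos ⟨h2, h3⟩]
          rw [this]
          linarith
        · linarith [not_lt.1 h3]
  have h_int_le : ∀ j ∈ Finset.range (2 ^ p), ∫ ω, A p l j ω ∂μ ≤
      ε + μ.real {ω | gd p (j + 1) ≤ ρ ω ∧ ε < A p l j ω} + δ * ∫ ω, b2 j ω ∂μ +
        (1 / δ) * ∫ ω, R l j ω ^ 2 ∂μ := by
    intro j _
    have e1 : μ.real {ω | gd p (j + 1) ≤ ρ ω ∧ ε < A p l j ω} = ∫ ω, b1 j ω ∂μ := by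
      rw [← integral_indicator_one (hmB j)]
      congr 1; ext ω
      simp only [b1, Set.indicator_apply, Set.mem_ofPred_eq, Pi.one_apply]
    have k3 := ((Bd.const m (1 / δ)).mul ((hRb l j).pow 2))
    have k2 := ((Bd.const m δ).mul (hb2 j))
    have k1 := (Bd.const m ε).add (hb1 j)
    have := Bd.le (μ := μ) (hbd p l j) ((k1.add k2).add k3) (fun ω => hpt j ω)
    rw [integral_add (k1.add k2).i k3.i, integral_add k1.i k2.i,
      integral_add (integrable_const _) (hb1 j).i, integral_const_mul, integral_const_mul] at this
    rw [e1]
    simpa using this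
  refine (Finset.sum_le_sum h_int_le).trans ?_
  rw [Finset.sum_add_distrib, Finset.sum_add_distrib, Finset.sum_add_distrib,
    ← Finset.mul_sum, ← Finset.mul_sum]
  have s1 : ∑ j ∈ Finset.range (2 ^ p), ε = δ := by
    simp only [Finset.sum_const, Finset.card_range, nsmul_eq_mul, hε]
    push_cast; field_simp
  have s2 : ∑ j ∈ Finset.range (2 ^ p), μ.real {ω | gd p (j + 1) ≤ ρ ω ∧ ε < A p l j ω} ≤ δ := by
    rw [← s1]
    exact Finset.sum_le_sum fun j hj => (hl j hj).le
  have s3 : ∑ j ∈ Finset.range (2 ^ p), ∫ ω, b2 j ω ∂μ ≤ 1 := by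
    rw [← integral_finsetSum _ fun j _ => (hb2 j).i]
    have := Bd.le (μ := μ) (Bd.sum (Finset.range (2 ^ p)) fun j _ => hb2 j) (Bd.const m 1)
      (fun ω => one_block (p := p) (ρ ω))
    simpa using this
  have s4 := hR2 l
  have s5 : 1 / δ * ∑ j ∈ Finset.range (2 ^ p), ∫ ω, R l j ω ^ 2 ∂μ ≤ δ := by
    calc 1 / δ * _ ≤ 1 / δ * (δ ^ 2 / 2) := by gcongr
      _ ≤ δ := by field_simp; linarith
  have s6 : δ * ∑ j ∈ Finset.range (2 ^ p), ∫ ω, b2 j ω ∂μ ≤ δ * 1 := by gcongr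
  have s7 : δ ≤ θ / 8 := min_le_right _ _
  linarith

lemma Mart.add {X' : ℝ → Ω → ℝ} {K' : ℝ} (h : Mart μ G X K) (h' : Mart μ G X' K') :
    Mart μ G (fun t ω => X t ω + X' t ω) (K + K') where
  mono := h.mono
  le := h.le
  adp t ht := (h.adp t ht).add (h'.adp t ht)
  bdd t ω := (abs_add_le _ _).trans (add_le_add (h.bdd t ω) (h'.bdd t ω))
  cont ω := (h.cont ω).add (h'.cont ω)
  zero ω := by simp [h.zero ω, h'.zero ω]
  orth s t hs hst Z hZ := by
    have hZm := hZ.mono (h.le s)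
    have e : ∀ ω, Z ω * (X t ω + X' t ω - (X s ω + X' s ω)) =
      Z ω * (X t ω - X s ω) + Z ω * (X' t ω - X' s ω) := fun ω => by ring
    simp_rw [e]
    rw [integral_add (hZm.mul ((h.bdm (hs.trans hst)).sub (h.bdm hs))).i
      (hZm.mul ((h'.bdm (hs.trans hst)).sub (h'.bdm hs))).i, h.orth s t hs hst Z hZ,
      h'.orth s t hs hst Z hZ, add_zero]

lemma gd_blk (p e k : ℕ) : gd (p + e) (k * 2 ^ e + 2 ^ e) = gd p (k + 1) := by
  rw [← gd_ref p e (k + 1)]; congr 1; ring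

lemma sq_blk (h : Mart μ G X K) {p k : ℕ} {Z : Ω → ℝ} (hZ : Bd (G (gd p k)) Z) (e l : ℕ) :
    ∫ ω, Z ω * (dd X p k ω) ^ 2 ∂μ =
      ∑ j ∈ Finset.range (2 ^ e), ∫ ω, Z ω * qb X X (p + e) l (k * 2 ^ e + j) ω ∂μ := by
  have hZm := hZ.mono (h.le _)
  have e0 : gd (p + e + l) (k * 2 ^ (e + l)) = gd p k := by
    rw [add_assoc]; exact gd_ref p (e + l) k
  have e1 : gd (p + e + l) (k * 2 ^ (e + l) + 2 ^ (e + l)) = gd p (k + 1) := by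
    rw [add_assoc]; exact gd_blk p (e + l) k
  have hd := h.dmg (p + e + l) (k * 2 ^ (e + l))
  have hZ' : Bd (G (gd (p + e + l) (k * 2 ^ (e + l) + 0))) Z := by
    rw [add_zero, e0]; exact hZ
  have := hd.sqZ hZ' (2 ^ (e + l))
  simp only [add_zero, e0, e1] at this
  rw [show (∫ ω, Z ω * (dd X p k ω) ^ 2 ∂μ) =
    ∫ ω, Z ω * (X (gd p (k + 1)) ω - X (gd p k) ω) ^ 2 ∂μ from rfl, this, pow_add,
    sum_range_mul']
  refine Finset.sum_congr rfl fun j _ => ?_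
  rw [← integral_finsetSum]
  · refine integral_congr_ae (Eventually.of_forall fun ω => ?_)
    simp only [qb, Finset.mul_sum]
    refine Finset.sum_congr rfl fun i _ => ?_
    have : k * (2 ^ e * 2 ^ l) + (j * 2 ^ l + i) = (k * 2 ^ e + j) * 2 ^ l + i := by ring
    have h2 : k * (2 ^ e * 2 ^ l) + (j * 2 ^ l + i + 1) = (k * 2 ^ e + j) * 2 ^ l + i + 1 := by ring
    simp only [dd, this, h2]; ring
  · intro i _
    have := (h.dbd (p + e + l) (k * (2 ^ e * 2 ^ l) + (j * 2 ^ l + i))).pow 2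
    exact (hZm.mul this).i

lemma cross_blk {X' : ℝ → Ω → ℝ} {K' : ℝ} (h : Mart μ G X K) (h' : Mart μ G X' K')
    {p k : ℕ} {Z : Ω → ℝ} (hZ : Bd (G (gd p k)) Z) (e l : ℕ) :
    ∫ ω, Z ω * (dd X p k ω * dd X' p k ω) ∂μ =
      ∑ j ∈ Finset.range (2 ^ e), ∫ ω, Z ω * qb X X' (p + e) l (k * 2 ^ e + j) ω ∂μ := by
  have hZm := hZ.mono (h.le _)
  have a1 := sq_blk h hZ e l
  have a2 := sq_blk h' hZ e l
  have a3 := sq_blk (h.add h') hZ e l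
  have b1 := (hZm.mul ((h.dbd p k).pow 2))
  have b2 := (hZm.mul ((h'.dbd p k).pow 2))
  have b3 := (hZm.mul ((h.dbd p k).mul (h'.dbd p k)))
  have c1 : ∫ ω, Z ω * (dd (fun t ω => X t ω + X' t ω) p k ω) ^ 2 ∂μ =
      ∫ ω, Z ω * (dd X p k ω) ^ 2 ∂μ + ∫ ω, Z ω * (dd X' p k ω) ^ 2 ∂μ +
        2 * ∫ ω, Z ω * (dd X p k ω * dd X' p k ω) ∂μ := by
    rw [← integral_const_mul, ← integral_add b1.i b2.i,
      ← integral_add (b1.add b2).i ((Bd.const m 2).mul b3).i]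
    refine integral_congr_ae (Eventually.of_forall fun ω => ?_)
    simp only [dd]; ring
  have c2 : ∀ j, ∫ ω, Z ω * qb (fun t ω => X t ω + X' t ω) (fun t ω => X t ω + X' t ω)
      (p + e) l (k * 2 ^ e + j) ω ∂μ =
      ∫ ω, Z ω * qb X X (p + e) l (k * 2 ^ e + j) ω ∂μ +
      ∫ ω, Z ω * qb X' X' (p + e) l (k * 2 ^ e + j) ω ∂μ +
        2 * ∫ ω, Z ω * qb X X' (p + e) l (k * 2 ^ e + j) ω ∂μ := by
    intro j
    have d1 := hZm.mul (h.qbbd h (p + e) l (k * 2 ^ e + j))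
    have d2 := hZm.mul (h'.qbbd h' (p + e) l (k * 2 ^ e + j))
    have d3 := hZm.mul (h.qbbd h' (p + e) l (k * 2 ^ e + j))
    rw [← integral_const_mul, ← integral_add d1.i d2.i,
      ← integral_add (d1.add d2).i ((Bd.const m 2).mul d3).i]
    refine integral_congr_ae (Eventually.of_forall fun ω => ?_)
    simp only [qb, Finset.mul_sum, ← Finset.sum_add_distrib]
    refine Finset.sum_congr rfl fun i _ => ?_
    simp only [dd]; ring
  rw [c1] at a3
  simp_rw [c2, Finset.sum_add_distrib, ← Finset.mul_sum] at a3
  linarith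

lemma sub_blk {f : ℕ → ℝ} (h0 : ∀ j, 0 ≤ f j) {p e k : ℕ} (hk : k < 2 ^ p) :
    ∑ j ∈ Finset.range (2 ^ e), f (k * 2 ^ e + j) ≤ ∑ j ∈ Finset.range (2 ^ (p + e)), f j := by
  rw [pow_add, sum_range_mul']
  exact Finset.single_le_sum (f := fun j => ∑ i ∈ Finset.range (2 ^ e), f (j * 2 ^ e + i))
    (fun j _ => Finset.sum_nonneg fun i _ => h0 _) (Finset.mem_range.2 hk)

lemma Core.qb0 (C : Core μ G M N ρ K c) {p l j : ℕ} {ω : Ω} (h : ρ ω ≤ gd p j) :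
    qb M M p l j ω = 0 ∧ qb N N p l j ω = 0 ∧ qb M N p l j ω = 0 := by
  refine ⟨?_, ?_, ?_⟩ <;>
  · refine Finset.sum_eq_zero fun i _ => ?_
    simp [C.ddM0 (Core.blk0 (i := i) (l := l) h), C.ddN0 (Core.blk0 (i := i) (l := l) h)]

lemma Core.of_Bcore (C : Core μ G M N ρ K c) {A : ℕ → ℕ → ℕ → Ω → ℝ}
    (hbd : ∀ p l j, Bd m (A p l j)) (h0 : ∀ p l j ω, 0 ≤ A p l j ω)
    (hA : ∀ p l j ω, A p l j ω ≤ qb M M p l j ω + qb N N p l j ω)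
    (hA0 : ∀ p l j ω, ρ ω ≤ gd p j → A p l j ω ≤ 0)
    (hp : ∀ p j, j < 2 ^ p → ∀ ε > 0,
      Tendsto (fun l => μ.real {ω | gd p (j + 1) ≤ ρ ω ∧ ε < A p l j ω}) atTop (nhds 0))
    {p k : ℕ} (hk : k < 2 ^ p) {I : ℝ} {B : ℝ} (hB : 0 ≤ B)
    (hI : ∀ e l, I ≤ ∑ j ∈ Finset.range (2 ^ e), B * ∫ ω, A (p + e) l (k * 2 ^ e + j) ω ∂μ) :
    I ≤ 0 := by
  refine le_of_forall_pos_le_add fun θ hθ => ?_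
  rw [zero_add]
  obtain ⟨p0, hp0⟩ := C.Bcore hbd hA hA0 hp (θ := θ / (B + 1)) (by positivity)
  obtain ⟨l, hl⟩ := (hp0 (p + p0) (by omega)).exists
  refine (hI p0 l).trans ?_
  rw [← Finset.mul_sum]
  have := sub_blk (f := fun j => ∫ ω, A (p + p0) l j ω ∂μ)
    (fun j => integral_nonneg (h0 _ _ _)) (e := p0) hk
  calc _ ≤ B * (θ / (B + 1)) := mul_le_mul_of_nonneg_left (this.trans hl) hB
    _ ≤ θ := by
      rw [mul_div_assoc', div_le_iff₀ (by positivity)]; nlinarith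

lemma real_tendsto_of_le {s : ℕ → Set Ω} {a : ℕ → ℝ} (h : ∀ n, μ.real (s n) ≤ a n)
    (ha : Tendsto a atTop (nhds 0)) : Tendsto (fun n => μ.real (s n)) atTop (nhds 0) :=
  squeeze_zero (fun _ => measureReal_nonneg) h ha

lemma real_union3 {s a b d : Set Ω} (h : s ⊆ a ∪ (b ∪ d)) :
    μ.real s ≤ μ.real a + (μ.real b + μ.real d) :=
  (measureReal_mono h).trans ((measureReal_union_le _ _).trans
    (add_le_add le_rfl (measureReal_union_le _ _)))

lemma Core.dom (C : Core μ G M N ρ K c) {p k : ℕ} (hk : k < 2 ^ p) {Z : Ω → ℝ}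
    (hZ : Bd (G (gd p k)) Z) (hZ0 : ∀ ω, 0 ≤ Z ω) :
    ∫ ω, Z ω * (dd M p k ω) ^ 2 ∂μ ≤ c * ∫ ω, Z ω * (dd N p k ω) ^ 2 ∂μ := by
  have hZm := hZ.mono (C.hM.le _)
  obtain ⟨-, B, hB⟩ := hZm
  have hc := C.c0
  have hB0 : 0 ≤ B := by
    obtain ⟨ω⟩ := nonempty_of_isProbabilityMeasure μ
    exact (abs_nonneg _).trans (hB ω)
  set A : ℕ → ℕ → ℕ → Ω → ℝ := fun p l j ω => max (qb M M p l j ω - c * qb N N p l j ω) 0 with hA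
  have hqd : ∀ p l j, Bd m (fun ω => qb M M p l j ω - c * qb N N p l j ω) := fun p l j =>
    (C.hM.qbbd C.hM p l j).sub ((Bd.const m c).mul (C.hN.qbbd C.hN p l j))
  have hbd : ∀ p l j, Bd m (A p l j) := fun p l j =>
    (hqd p l j).comp (φ := fun x => max x 0) (by fun_prop)
  rw [← sub_nonpos]
  refine C.of_Bcore hbd (fun _ _ _ _ => le_max_right _ _) ?_ ?_ ?_ hk hB0 ?_
  · intro p l j ω
    have h1 := qb_nonneg M p l j ω
    have h2 := qb_nonneg N p l j ω
    refine max_le ?_ (by linarith)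
    nlinarith [mul_nonneg hc h2]
  · intro p l j ω h
    obtain ⟨h1, h2, -⟩ := C.qb0 (l := l) h
    simp [hA, h1, h2]
  · intro p j hj ε hε
    have t1 := C.dom0 (gd p j) (gd p (j + 1)) (gd_nonneg _ _) (gd_mono p (Nat.le_succ j)) (ε / 3)
      (by positivity)
    have hδ : 0 < ε / (3 * (1 + c)) := by positivity
    have t2 := prob_tendsto (fun n => ((qsum_bd C.hM C.hM (gd_nonneg p (j + 1)) n).sub
      (qsum_bd C.hM C.hM (gd_nonneg p j) n)).sub (C.hM.qbbd C.hM p n j))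
      (qb_mesh C.hM C.hM hj) hδ
    have t3 := prob_tendsto (fun n => ((qsum_bd C.hN C.hN (gd_nonneg p (j + 1)) n).sub
      (qsum_bd C.hN C.hN (gd_nonneg p j) n)).sub (C.hN.qbbd C.hN p n j))
      (qb_mesh C.hN C.hN hj) hδ
    have t := t1.add (t2.add t3)
    simp only [add_zero] at t
    refine real_tendsto_of_le (fun n => real_union3 ?_) t
    rintro ω ⟨h1, h2⟩
    by_contra hcon
    simp only [Set.mem_union, Set.mem_ofPred_eq, not_or, not_and, not_lt] at hcon
    obtain ⟨u1, u2, u3⟩ := hcon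
    have u1 := u1 h1
    rw [abs_le] at u2 u3
    have hq := qb_nonneg N p n j ω
    have hε1 : (1 + c) * (ε / (3 * (1 + c))) = ε / 3 := by field_simp
    set δ := ε / (3 * (1 + c))
    rcases lt_max_iff.1 h2 with h2 | h2
    · have hm : max 0 (qsum N N (gd p (j + 1)) n ω - qsum N N (gd p j) n ω) ≤
          qb N N p n j ω + δ := max_le (by linarith) (by linarith)
      have := mul_le_mul_of_nonneg_left hm hc
      nlinarith
    · linarith
  · intro e l
    rw [sq_blk C.hM hZ e l, sq_blk C.hN hZ e l, Finset.mul_sum, ← Finset.sum_sub_distrib]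
    have hZm := hZ.mono (C.hM.le _)
    refine Finset.sum_le_sum fun j _ => ?_
    have d1 := hZm.mul (C.hM.qbbd C.hM (p + e) l (k * 2 ^ e + j))
    have d2 := hZm.mul (C.hN.qbbd C.hN (p + e) l (k * 2 ^ e + j))
    rw [← integral_const_mul, ← integral_const_mul,
      ← integral_sub d1.i ((Bd.const m c).mul d2).i]
    refine Bd.le (d1.sub ((Bd.const m c).mul d2)) ((Bd.const m B).mul (hbd _ _ _)) fun ω => ?_
    have e1 : Z ω * qb M M (p + e) l (k * 2 ^ e + j) ω -
        c * (Z ω * qb N N (p + e) l (k * 2 ^ e + j) ω) =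
      Z ω * (qb M M (p + e) l (k * 2 ^ e + j) ω - c * qb N N (p + e) l (k * 2 ^ e + j) ω) := by
      ring
    rw [e1]
    exact (mul_le_mul_of_nonneg_left (le_max_left _ _) (hZ0 ω)).trans
        (mul_le_mul_of_nonneg_right ((le_abs_self _).trans (hB ω)) (le_max_right _ _))

lemma Core.orthle (C : Core μ G M N ρ K c) {p k : ℕ} (hk : k < 2 ^ p) {Z : Ω → ℝ}
    (hZ : Bd (G (gd p k)) Z) :
    ∫ ω, Z ω * (dd M p k ω * dd N p k ω) ∂μ ≤ 0 := by
  have hZm := hZ.mono (C.hM.le _)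
  obtain ⟨-, B, hB⟩ := hZm
  have hB0 : 0 ≤ B := by
    obtain ⟨ω⟩ := nonempty_of_isProbabilityMeasure μ
    exact (abs_nonneg _).trans (hB ω)
  have hbd : ∀ p l j, Bd m (fun ω => |qb M N p l j ω|) := fun p l j =>
    (C.hM.qbbd C.hN p l j).abs
  refine C.of_Bcore (A := fun p l j ω => |qb M N p l j ω|) hbd
    (fun _ _ _ _ => abs_nonneg _) ?_ ?_ ?_ hk hB0 ?_
  · intro p l j ω
    refine (Finset.abs_sum_le_sum_abs _ _).trans ?_
    rw [qb, qb, ← Finset.sum_add_distrib]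
    refine Finset.sum_le_sum fun i _ => ?_
    rw [abs_le]
    constructor <;> nlinarith [sq_nonneg (dd M (p + l) (j * 2 ^ l + i) ω +
      dd N (p + l) (j * 2 ^ l + i) ω), sq_nonneg (dd M (p + l) (j * 2 ^ l + i) ω -
      dd N (p + l) (j * 2 ^ l + i) ω), sq_nonneg (dd M (p + l) (j * 2 ^ l + i) ω),
      sq_nonneg (dd N (p + l) (j * 2 ^ l + i) ω)]
  · intro p l j ω h
    obtain ⟨-, -, h2⟩ := C.qb0 (l := l) h
    simp [h2]
  · intro p j hj ε hε
    have hε3 : 0 < ε / 3 := by positivity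
    have t1 := C.orth0 (gd p j) (gd_nonneg _ _) (ε / 3) hε3
    have t2 := C.orth0 (gd p (j + 1)) (gd_nonneg _ _) (ε / 3) hε3
    have t3 := prob_tendsto (fun n => ((qsum_bd C.hM C.hN (gd_nonneg p (j + 1)) n).sub
      (qsum_bd C.hM C.hN (gd_nonneg p j) n)).sub (C.hM.qbbd C.hN p n j))
      (qb_mesh C.hM C.hN hj) hε3
    have t := t1.add (t2.add t3)
    simp only [add_zero] at t
    refine real_tendsto_of_le (fun n => real_union3 ?_) t
    rintro ω ⟨h1, h2⟩
    by_contra hcon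
    simp only [Set.mem_union, Set.mem_ofPred_eq, not_or, not_and, not_lt] at hcon
    obtain ⟨u1, u2, u3⟩ := hcon
    have u1 := u1 ((gd_mono p (Nat.le_succ j)).trans h1)
    have u2 := u2 h1
    rw [abs_le] at u1 u2 u3
    rcases lt_abs.1 h2 with h2 | h2 <;> linarith
  · intro e l
    rw [cross_blk C.hM C.hN hZ e l]
    have hZm := hZ.mono (C.hM.le _)
    refine Finset.sum_le_sum fun j _ => ?_
    have d1 := hZm.mul (C.hM.qbbd C.hN (p + e) l (k * 2 ^ e + j))
    rw [← integral_const_mul]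
    refine Bd.le d1 ((Bd.const m B).mul (hbd _ _ _)) fun ω => ?_
    refine (le_abs_self _).trans ?_
    rw [abs_mul]
    exact mul_le_mul_of_nonneg_right (hB ω) (abs_nonneg _)

lemma Core.orth (C : Core μ G M N ρ K c) {p k : ℕ} (hk : k < 2 ^ p) {Z : Ω → ℝ}
    (hZ : Bd (G (gd p k)) Z) :
    ∫ ω, Z ω * (dd M p k ω * dd N p k ω) ∂μ = 0 := by
  refine le_antisymm (C.orthle hk hZ) ?_
  have := C.orthle hk hZ.neg
  simp only [neg_mul, integral_neg] at this
  linarith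

/-- average of `f` on `[s-δ, s]` -/
def Ph (f : ℝ → ℝ) (s δ : ℝ) : ℝ := (1 / δ) * ∫ v in (s - δ)..s, f v

section eq
variable {f : ℝ → ℝ}

lemma bint (hf : Measurable f) (h1 : ∀ v, |f v| ≤ 1) (a b : ℝ) :
    IntervalIntegrable f volume a b := by
  refine (intervalIntegrable_const (c := (1:ℝ))).mono_fun hf.aestronglyMeasurable ?_
  exact Eventually.of_forall fun v => by simpa using h1 v

lemma bint_le (h1 : ∀ v, |f v| ≤ 1) (a b : ℝ) : |∫ v in a..b, f v| ≤ |b - a| := by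
  have := intervalIntegral.norm_integral_le_of_norm_le_const (a := a) (b := b) (f := f) (C := 1)
    (fun v _ => by simpa using h1 v)
  simpa using this

lemma Ph_le (h1 : ∀ v, |f v| ≤ 1) (s : ℝ) {δ : ℝ} (hδ : 0 < δ) : |Ph f s δ| ≤ 1 := by
  rw [Ph, abs_mul, abs_of_pos (by positivity : 0 < 1 / δ)]
  have := bint_le h1 (s - δ) s
  rw [show s - (s - δ) = δ by ring, abs_of_pos hδ] at this
  rw [one_div, inv_mul_le_iff₀ hδ]; simpa using this

lemma Ph_lip (hf : Measurable f) (h1 : ∀ v, |f v| ≤ 1) (s : ℝ) {δ δ' : ℝ} (hδ : 0 < δ)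
    (hd : δ ≤ δ') : |Ph f s δ' - Ph f s δ| ≤ 2 * (δ' - δ) / δ' := by
  have hδ' : 0 < δ' := hδ.trans_le hd
  have e : Ph f s δ' - Ph f s δ =
      ((∫ v in (s - δ')..(s - δ), f v) - (δ' - δ) * Ph f s δ) / δ' := by
    have := intervalIntegral.integral_add_adjacent_intervals (bint hf h1 (s - δ') (s - δ))
      (bint hf h1 (s - δ) s)
    rw [Ph, Ph, ← this]; field_simp; ring
  rw [e, abs_div, abs_of_pos hδ']
  refine div_le_div_of_nonneg_right ?_ hδ'.le
  have h2 := bint_le h1 (s - δ') (s - δ)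
  rw [show s - δ - (s - δ') = δ' - δ by ring, abs_of_nonneg (by linarith : 0 ≤ δ' - δ)] at h2
  have h3 : |(δ' - δ) * Ph f s δ| ≤ δ' - δ := by
    rw [abs_mul, abs_of_nonneg (by linarith : 0 ≤ δ' - δ)]
    exact mul_le_of_le_one_right (by linarith) (Ph_le h1 s hδ)
  exact (abs_sub _ _).trans (by linarith)

/-- the left grid point below `u` for the grid of mesh `r / 2^n` -/
def lg (n : ℕ) (u r : ℝ) : ℝ := r / 2 ^ n * (⌊u * 2 ^ n / r⌋₊ : ℝ)

lemma lg_meas (n : ℕ) (u : ℝ) : Measurable (lg n u) := by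
  unfold lg; fun_prop

lemma EQ_piece (hf : Measurable f) (h1 : ∀ v, |f v| ≤ 1) {s : ℝ} (hs : 0 < s) (n i : ℕ)
    (hi : 1 ≤ i) : ∫ r in (s * 2 ^ n / ((i : ℝ) + 1))..(s * 2 ^ n / i), f (lg n s r) =
      (s * 2 ^ n / i - s * 2 ^ n / ((i : ℝ) + 1)) * Ph f s (s / ((i : ℝ) + 1)) := by
  have hi0 : (0:ℝ) < i := by exact_mod_cast hi
  have h2 : (0:ℝ) < 2 ^ n := by positivity
  have hle : s * 2 ^ n / ((i : ℝ) + 1) ≤ s * 2 ^ n / i := by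
    apply div_le_div_of_nonneg_left (by positivity) hi0 (by linarith)
  have e1 : ∫ r in (s * 2 ^ n / ((i : ℝ) + 1))..(s * 2 ^ n / i), f (lg n s r) =
      ∫ r in (s * 2 ^ n / ((i : ℝ) + 1))..(s * 2 ^ n / i), f (r * (i / 2 ^ n)) := by
    refine intervalIntegral.integral_congr_ae (Eventually.of_forall fun r hr => ?_)
    rw [uIoc_of_le hle] at hr
    obtain ⟨ha, hb⟩ := hr
    have hr0 : 0 < r := lt_of_le_of_lt (by positivity) ha
    have hfl : ⌊s * 2 ^ n / r⌋₊ = i := by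
      rw [Nat.floor_eq_iff (by positivity)]
      constructor
      · rw [le_div_iff₀ hr0]; rw [le_div_iff₀ hi0] at hb; linarith
      · rw [div_lt_iff₀ hr0]; rw [div_lt_iff₀ (by positivity)] at ha; linarith
    rw [lg, hfl]; congr 1; ring
  rw [e1, intervalIntegral.integral_comp_mul_right _ (by positivity : (i:ℝ) / 2 ^ n ≠ 0), Ph]
  have e2 : s * 2 ^ n / ((i : ℝ) + 1) * (i / 2 ^ n) = s - s / ((i:ℝ) + 1) := by
    field_simp; ring
  have e3 : s * 2 ^ n / (i : ℝ) * (i / 2 ^ n) = s := by field_simp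
  rw [e2, e3, smul_eq_mul]
  field_simp; ring

lemma EQ_chain (hf : Measurable f) (h1 : ∀ v, |f v| ≤ 1) {s : ℝ} (hs : 0 < s) (n : ℕ) {m1 m2 : ℕ}
    (hm1 : 1 ≤ m1) (hm : m1 ≤ m2) {D P : ℝ}
    (hD : ∀ i, m1 ≤ i → i < m2 → |Ph f s (s / ((i : ℝ) + 1)) - P| ≤ D) :
    |(∫ r in (s * 2 ^ n / (m2 : ℝ))..(s * 2 ^ n / m1), f (lg n s r)) -
      (s * 2 ^ n / m1 - s * 2 ^ n / m2) * P| ≤ D * (s * 2 ^ n / m1 - s * 2 ^ n / m2) := by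
  induction m2, hm using Nat.le_induction with
  | base => simp
  | succ i hi ih =>
    have ih := ih fun q hq hq' => hD q hq (by omega)
    have hd := hD i hi (by omega)
    have hi0 : (0:ℝ) < i := by exact_mod_cast (hm1.trans hi)
    have hle : s * 2 ^ n / ((i : ℝ) + 1) ≤ s * 2 ^ n / i := by
      apply div_le_div_of_nonneg_left (by positivity) hi0 (by linarith)
    have hb := fun a b => bint (f := fun r => f (lg n s r)) (hf.comp (lg_meas n s))
      (fun v => h1 _) a b
    push_cast
    rw [← intervalIntegral.integral_add_adjacent_intervals (hb _ (s * 2 ^ n / i)) (hb _ _),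
      EQ_piece hf h1 hs n i (hm1.trans hi)]
    set a := s * 2 ^ n / (i : ℝ)
    set b := s * 2 ^ n / ((i : ℝ) + 1)
    have : |(a - b) * (Ph f s (s / ((i : ℝ) + 1)) - P)| ≤ (a - b) * D := by
      rw [abs_mul, abs_of_nonneg (by linarith)]
      exact mul_le_mul_of_nonneg_left hd (by linarith)
    rw [abs_le] at *
    constructor <;> nlinarith

set_option maxHeartbeats 800000 in
lemma EQ (hf : Measurable f) (h1 : ∀ v, |f v| ≤ 1) {s κ t η : ℝ} (hκ : 0 < κ) (hs : κ ≤ s)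
    (ht : 0 < t) (ht1 : t ≤ 1) (hη : 0 < η) (hη1 : η ≤ 1) (n : ℕ) :
    |1 / (η * t) * (∫ r in t..(t * (1 + η)), f (lg n s r)) - Ph f s (t / 2 ^ n)| ≤
      2 * η + 64 / (κ * 2 ^ n * η * t) := by
  have h2 : (0:ℝ) < 2 ^ n := by positivity
  have hs0 : 0 < s := hκ.trans_le hs
  set T := t * (1 + η) with hT
  have htT : T - t = η * t := by rw [hT]; ring
  have hηt : 0 < η * t := by positivity
  have hT0 : 0 < T := by positivity
  have hT2 : T ≤ 2 := by nlinarith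
  have hb := fun a b => bint (f := fun r => f (lg n s r)) (hf.comp (lg_meas n s))
      (fun v => h1 _) a b
  have hl := fun a b => bint_le (f := fun r => f (lg n s r)) (fun v => h1 _) a b
  set P := Ph f s (t / 2 ^ n) with hP
  have hP1 : |P| ≤ 1 := Ph_le h1 s (by positivity)
  by_cases hbig : κ * 2 ^ n * η * t ≤ 32
  · have h3 : 2 ≤ 64 / (κ * 2 ^ n * η * t) := by rw [le_div_iff₀ (by positivity)]; linarith
    have h4 : |1 / (η * t) * (∫ r in t..T, f (lg n s r))| ≤ 1 := by
      rw [abs_mul, abs_of_pos (by positivity), one_div, inv_mul_le_iff₀ hηt]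
      have := hl t T
      rw [htT, abs_of_pos hηt] at this; linarith
    exact (abs_sub _ _).trans (by linarith)
  push Not at hbig
  set C := s * 2 ^ n with hC
  have hC0 : 0 < C := by positivity
  have hCκ : κ * 2 ^ n ≤ C := mul_le_mul_of_nonneg_right hs h2.le
  have hCb : 32 < C * (η * t) := by nlinarith
  have hC32 : 32 < C := by
    have : η * t ≤ 1 := by nlinarith
    nlinarith
  set i0 := ⌊C / T⌋₊ with hi0
  set i1 := ⌊C / t⌋₊ with hi1
  have f0 : (i0:ℝ) ≤ C / T := Nat.floor_le (by positivity)
  have f0' : C / T < i0 + 1 := Nat.lt_floor_add_one _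
  have f1 : (i1:ℝ) ≤ C / t := Nat.floor_le (by positivity)
  have f1' : C / t < i1 + 1 := Nat.lt_floor_add_one _
  have hgap : 1 < C / t - C / T := by
    rw [div_sub_div _ _ ht.ne' hT0.ne', lt_div_iff₀ (by positivity)]
    have : C * T - t * C = C * (η * t) := by rw [hT]; ring
    nlinarith
  have hlt : (i0:ℝ) < i1 := by linarith
  have hlt' : i0 + 1 ≤ i1 := by exact_mod_cast hlt
  have hCT : 16 ≤ C / T := by rw [le_div_iff₀ hT0]; nlinarith
  have hi0p : (15:ℝ) < i0 := by linarith
  have hi1p : (15:ℝ) < i1 := by linarith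
  have hch := EQ_chain hf h1 hs0 n (m1 := i0 + 1) (m2 := i1) (by omega) hlt' (D := 2 * η) (P := P) ?_
  · push_cast at hch
    rw [← hC] at hch
    have b1 : t ≤ C / i1 := by
      rw [le_div_iff₀ (by linarith)]; rw [le_div_iff₀ ht] at f1; linarith
    have b1' : C / i1 ≤ t + 8 / C := by
      rw [div_le_iff₀ (by linarith)]
      have : C / 2 ≤ i1 := by
        have : C / 1 ≤ C / t := div_le_div_of_nonneg_left hC0.le ht ht1
        linarith
      rw [div_lt_iff₀ ht] at f1'
      have h5 : 8 / C * (C / 2) ≤ 8 / C * i1 := mul_le_mul_of_nonneg_left this (by positivity)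
      have h6 : 8 / C * (C / 2) = 4 := by field_simp; norm_num
      nlinarith
    have b0 : C / (i0 + 1) ≤ T := by
      rw [div_le_iff₀ (by linarith)]; rw [div_lt_iff₀ hT0] at f0'; linarith
    have b0' : T - 8 / C ≤ C / (i0 + 1) := by
      rw [le_div_iff₀ (by linarith)]
      rw [le_div_iff₀ hT0] at f0
      have : C / 2 ≤ i0 + 1 := by
        have : C / 2 ≤ C / T := div_le_div_of_nonneg_left hC0.le hT0 hT2
        linarith
      have h5 : 8 / C * (C / 2) ≤ 8 / C * (i0 + 1) :=
        mul_le_mul_of_nonneg_left this (by positivity)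
      have h6 : 8 / C * (C / 2) = 4 := by field_simp; norm_num
      nlinarith
    have b10 : C / i1 ≤ C / (i0 + 1) :=
      div_le_div_of_nonneg_left hC0.le (by linarith) (by exact_mod_cast hlt')
    set b := C / (i0 + 1 : ℝ)
    set a := C / (i1 : ℝ)
    have s1 := hl t a
    have s2 := hl b T
    rw [abs_of_nonneg (by linarith : 0 ≤ a - t)] at s1
    rw [abs_of_nonneg (by linarith : 0 ≤ T - b)] at s2
    have e : 1 / (η * t) * (∫ r in t..T, f (lg n s r)) - P =
      ((∫ r in t..a, f (lg n s r)) + ((∫ r in a..b, f (lg n s r)) - (b - a) * P) +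
       (∫ r in b..T, f (lg n s r)) - ((a - t) + (T - b)) * P) / (η * t) := by
      rw [← intervalIntegral.integral_add_adjacent_intervals (hb t b) (hb b T),
        ← intervalIntegral.integral_add_adjacent_intervals (hb t a) (hb a b), ← htT]
      have : T - t ≠ 0 := by rw [htT]; exact hηt.ne'
      field_simp; ring
    rw [e, abs_div, abs_of_pos hηt, div_le_iff₀ hηt]
    have s3 : |((a - t) + (T - b)) * P| ≤ (a - t) + (T - b) := by
      rw [abs_mul, abs_of_nonneg (by linarith)]
      exact mul_le_of_le_one_right (by linarith) hP1
    have e5 : 64 / (κ * 2 ^ n * η * t) * (η * t) = 64 / (κ * 2 ^ n) := by field_simp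
    have e6 : 64 / C ≤ 64 / (κ * 2 ^ n) := div_le_div_of_nonneg_left (by norm_num)
      (by positivity) hCκ
    have e7 : 64 / C = 8 * (8 / C) := by ring
    have e8 : 2 * η * (b - a) ≤ 2 * η * (η * t) :=
      mul_le_mul_of_nonneg_left (by linarith) (by positivity)
    have e9 : 0 < 8 / C := by positivity
    have e10 : (2 * η + 64 / (κ * 2 ^ n * η * t)) * (η * t) = 2 * η * (η * t) +
      64 / (κ * 2 ^ n) := by rw [add_mul, e5]
    rw [e10]
    rw [abs_le] at *
    constructor <;> linarith
  · intro i hi hi'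
    have hi0 : (i0:ℝ) + 1 ≤ i := by exact_mod_cast hi
    have hi1 : (i:ℝ) + 1 ≤ i1 := by exact_mod_cast hi'
    have g1 : t / 2 ^ n ≤ s / ((i:ℝ) + 1) := by
      rw [div_le_div_iff₀ h2 (by linarith)]
      rw [le_div_iff₀ ht] at f1
      have := mul_le_mul_of_nonneg_right hi1 ht.le
      linarith
    have g2 : s / ((i:ℝ) + 1) ≤ t * (1 + η) / 2 ^ n := by
      rw [div_le_div_iff₀ (by linarith) h2]
      rw [div_lt_iff₀ hT0] at f0'
      have := mul_le_mul_of_nonneg_right (by linarith : (i0:ℝ) + 1 ≤ i + 1) hT0.le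
      linarith
    refine (Ph_lip hf h1 s (by positivity) g1).trans ?_
    have hδ : 0 < s / ((i:ℝ) + 1) := div_pos hs0 (by linarith)
    rw [div_le_iff₀ hδ]
    have e1 : t * (1 + η) / 2 ^ n = t / 2 ^ n + η * (t / 2 ^ n) := by ring
    have e2 := mul_le_mul_of_nonneg_left g1 hη.le
    linarith

end eq

/-- average over `[t, t(1+η)]` -/
def av (t η : ℝ) (D : ℝ → ℝ) : ℝ := 1 / (η * t) * ∫ r in t..(t * (1 + η)), D r

section av
variable {t η : ℝ}

lemma av_le (ht : 0 < t) (hη : 0 < η) {D : ℝ → ℝ} {B : ℝ}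
    (h : ∀ r, t ≤ r → r ≤ t * (1 + η) → |D r| ≤ B) : |av t η D| ≤ B := by
  have hηt : 0 < η * t := by positivity
  have hle : t ≤ t * (1 + η) := by nlinarith
  have := intervalIntegral.norm_integral_le_of_norm_le_const (a := t) (b := t * (1 + η)) (f := D)
    (C := B) (fun r hr => by
      rw [uIoc_of_le hle] at hr
      simpa using h r hr.1.le hr.2)
  rw [show t * (1 + η) - t = η * t by ring, abs_of_pos hηt] at this
  rw [av, abs_mul, abs_of_pos (by positivity), one_div, inv_mul_le_iff₀ hηt]
  simpa [mul_comm] using this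

lemma av_const (ht : 0 < t) (hη : 0 < η) (a : ℝ) : av t η (fun _ => a) = a := by
  rw [av, intervalIntegral.integral_const, smul_eq_mul, show t * (1 + η) - t = η * t by ring]
  field_simp

lemma bdd_ii {D : ℝ → ℝ} (hD : Measurable D) {B : ℝ} (hB : ∀ r, |D r| ≤ B) (a b : ℝ) :
    IntervalIntegrable D volume a b := by
  refine (intervalIntegrable_const (c := B)).mono_fun hD.aestronglyMeasurable ?_
  refine Eventually.of_forall fun v => ?_
  have := hB v
  simp only [Real.norm_eq_abs]
  exact this.trans (le_abs_self _)

lemma av_add {D D' : ℝ → ℝ} (hD : IntervalIntegrable D volume t (t * (1 + η)))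
    (hD' : IntervalIntegrable D' volume t (t * (1 + η))) :
    av t η (fun r => D r + D' r) = av t η D + av t η D' := by
  rw [av, av, av, intervalIntegral.integral_add hD hD', mul_add]

lemma av_sub {D D' : ℝ → ℝ} (hD : IntervalIntegrable D volume t (t * (1 + η)))
    (hD' : IntervalIntegrable D' volume t (t * (1 + η))) :
    av t η (fun r => D r - D' r) = av t η D - av t η D' := by
  rw [av, av, av, intervalIntegral.integral_sub hD hD', mul_sub]

lemma av_mono (ht : 0 < t) (hη : 0 < η) {D D' : ℝ → ℝ}
    (hD : IntervalIntegrable D volume t (t * (1 + η)))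
    (hD' : IntervalIntegrable D' volume t (t * (1 + η)))
    (h : ∀ r, t ≤ r → r ≤ t * (1 + η) → D r ≤ D' r) : av t η D ≤ av t η D' := by
  rw [av, av]
  refine mul_le_mul_of_nonneg_left ?_ (by positivity)
  exact intervalIntegral.integral_mono_on (by nlinarith) hD hD' fun r hr => h r hr.1 hr.2

end av

lemma ii_meas {Ω : Type*} [MeasurableSpace Ω] {D : ℝ → Ω → ℝ}
    (hD : Measurable (Function.uncurry D)) (a b : ℝ) :
    Measurable (fun ω => ∫ r in a..b, D r ω) := by
  unfold intervalIntegral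
  exact ((StronglyMeasurable.integral_prod_left hD.stronglyMeasurable).sub
    (StronglyMeasurable.integral_prod_left hD.stronglyMeasurable)).measurable

lemma av_meas {Ω : Type*} [MeasurableSpace Ω] {D : ℝ → Ω → ℝ}
    (hD : Measurable (Function.uncurry D)) (t η : ℝ) :
    Measurable (fun ω => av t η fun r => D r ω) := by
  unfold av
  exact (ii_meas hD _ _).const_mul _

lemma int_abs_meas {D : ℝ → Ω → ℝ} (hD : Measurable (Function.uncurry D)) :
    Measurable (fun r => ∫ ω, |D r ω| ∂μ) := by
  have h2 : Measurable (Function.uncurry fun r ω => |D r ω|) := by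
    have := hD.abs
    exact this
  exact (StronglyMeasurable.integral_prod_right h2.stronglyMeasurable).measurable

lemma int_abs_le {D : ℝ → Ω → ℝ} {B : ℝ} (hB : ∀ r ω, |D r ω| ≤ B) (r : ℝ) :
    |∫ ω, |D r ω| ∂μ| ≤ B := by
  have := norm_integral_le_of_norm_le_const (μ := μ) (f := fun ω => |D r ω|) (C := B)
    (Eventually.of_forall fun ω => by simpa using hB r ω)
  simpa using this

lemma av_fub {t η : ℝ} (ht : 0 < t) (hη : 0 < η) {D : ℝ → Ω → ℝ}
    (hD : Measurable (Function.uncurry D)) {B : ℝ} (hB : ∀ r ω, |D r ω| ≤ B) :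
    ∫ ω, |av t η fun r => D r ω| ∂μ ≤ av t η (fun r => ∫ ω, |D r ω| ∂μ) := by
  have hηt : 0 < η * t := by positivity
  have hle : t ≤ t * (1 + η) := by nlinarith
  have hDa : Measurable (Function.uncurry fun r ω => |D r ω|) := by
    have := hD.abs
    exact this
  have hsec : ∀ ω, Measurable fun r => D r ω := fun ω => hD.comp (by fun_prop :
    Measurable fun r : ℝ => (r, ω))
  have key : ∀ ω, |av t η fun r => D r ω| ≤ av t η fun r => |D r ω| := by
    intro ω
    rw [av, av, abs_mul, abs_of_pos (by positivity : 0 < 1 / (η * t))]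
    exact mul_le_mul_of_nonneg_left (intervalIntegral.abs_integral_le_integral_abs hle)
      (by positivity)
  have b1 : Bd m (fun ω => |av t η fun r => D r ω|) :=
    Bd.mk' (av_meas hD t η).abs B fun ω => by
      rw [abs_abs]; exact av_le ht hη fun r _ _ => hB r ω
  have b2 : Bd m (fun ω => av t η fun r => |D r ω|) :=
    Bd.mk' (av_meas hDa t η) B fun ω => av_le ht hη fun r _ _ => by
      rw [abs_abs]; exact hB r ω
  refine (Bd.le b1 b2 key).trans (le_of_eq ?_)
  simp only [av]
  rw [integral_const_mul, intervalIntegral_integral_swap]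
  have : IsFiniteMeasure ((volume : Measure ℝ).restrict (uIoc t (t * (1 + η)))) := ⟨by
    rw [uIoc_of_le hle]; simp⟩
  refine Integrable.of_bound (C := B) hDa.aestronglyMeasurable ?_
  refine Eventually.of_forall fun z => ?_
  simpa [Function.uncurry] using hB z.1 z.2

lemma av_small {t η : ℝ} (ht : 0 < t) (hη : 0 < η) {D : ℝ → Ω → ℝ}
    (hD : Measurable (Function.uncurry D)) {B : ℝ} (hB : ∀ r ω, |D r ω| ≤ B) {e : ℝ}
    (h : ∀ r, t ≤ r → r ≤ t * (1 + η) → ∫ ω, |D r ω| ∂μ ≤ e) :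
    ∫ ω, |av t η fun r => D r ω| ∂μ ≤ e := by
  refine (av_fub ht hη hD hB).trans ((le_abs_self _).trans (av_le ht hη fun r h1 h2 => ?_))
  rw [abs_of_nonneg (integral_nonneg fun ω => abs_nonneg _)]
  exact h r h1 h2

lemma L1_of_L2 {f : Ω → ℝ} (hf : Bd m f) {a : ℝ} (ha : 0 < a) :
    ∫ ω, |f ω| ∂μ ≤ a + (∫ ω, f ω ^ 2 ∂μ) / a := by
  have b := (Bd.const m (1 / a)).mul (hf.pow 2)
  have := Bd.le (μ := μ) hf.abs ((Bd.const m a).add b) fun ω => by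
    have h1 : 0 ≤ (1 / a) * ((|f ω| - a / 2) ^ 2 + 3 / 4 * a ^ 2) := by positivity
    have h2 : (1 / a) * ((|f ω| - a / 2) ^ 2 + 3 / 4 * a ^ 2) =
      a + 1 / a * f ω ^ 2 - |f ω| := by
      rw [← sq_abs (f ω)]; field_simp; ring
    linarith
  rw [integral_add (integrable_const _) b.i, integral_const_mul] at this
  simp only [integral_const, probReal_univ, one_smul] at this
  rw [div_eq_mul_one_div, mul_comm _ (1 / a)]; exact this

lemma tail_sum (b : ℕ → ℝ) (q n : ℕ) :
    ∑ k ∈ Finset.range n, (if q ≤ k then (1:ℝ) else 0) * (b (k + 1) - b k) =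
      b n - b (min q n) := by
  induction n with
  | zero => simp
  | succ n ih =>
    rw [Finset.sum_range_succ, ih]
    split_ifs with h
    · rw [min_eq_left h, min_eq_left (by omega)]; ring
    · rw [min_eq_right (by omega), min_eq_right (by omega)]; ring

lemma regroup (x : ℝ → ℝ) (g : ℕ → ℝ) {r : ℝ} (hr : 0 < r) (n L q : ℕ) (hq : gd L q ≤ r) :
    ∑ k ∈ Finset.range q, g ⌊gd L k * 2 ^ n / r⌋₊ * (x (gd L (k + 1)) - x (gd L k)) =
      ∑ i ∈ Finset.range (2 ^ n), g i *
        (x (gd L (min ⌈(r * ((i:ℝ) + 1) / 2 ^ n) * 2 ^ L⌉₊ q)) -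
          x (gd L (min ⌈(r * (i:ℝ) / 2 ^ n) * 2 ^ L⌉₊ q))) := by
  have h2 : (0:ℝ) < 2 ^ n := by positivity
  have hL : (0:ℝ) < 2 ^ L := by positivity
  have hge : ∀ (k i : ℕ), ⌈(r * (i:ℝ) / 2 ^ n) * 2 ^ L⌉₊ ≤ k ↔ i ≤ ⌊gd L k * 2 ^ n / r⌋₊ := by
    intro k i
    rw [Nat.ceil_le, Nat.le_floor_iff (by have := gd_nonneg L k; positivity), gd,
      le_div_iff₀ hr, div_mul_eq_mul_div, div_mul_eq_mul_div, div_le_iff₀ h2, le_div_iff₀ hL]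
    constructor <;> intro h <;> linarith
  have step : ∀ k ∈ Finset.range q,
      g ⌊gd L k * 2 ^ n / r⌋₊ * (x (gd L (k + 1)) - x (gd L k)) =
      ∑ i ∈ Finset.range (2 ^ n), g i *
        ((if ⌈(r * (i:ℝ) / 2 ^ n) * 2 ^ L⌉₊ ≤ k then (1:ℝ) else 0) *
            (x (gd L (k + 1)) - x (gd L k)) -
         (if ⌈(r * ((i:ℝ) + 1) / 2 ^ n) * 2 ^ L⌉₊ ≤ k then (1:ℝ) else 0) *
            (x (gd L (k + 1)) - x (gd L k))) := by
    intro k hk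
    rw [Finset.mem_range] at hk
    have hlt : ⌊gd L k * 2 ^ n / r⌋₊ < 2 ^ n := by
      rw [Nat.floor_lt (by have := gd_nonneg L k; positivity), div_lt_iff₀ hr]
      have : gd L k < r := lt_of_lt_of_le (by
        unfold gd; exact div_lt_div_of_pos_right (by exact_mod_cast hk) hL) hq
      push_cast; nlinarith
    rw [Finset.sum_eq_single ⌊gd L k * 2 ^ n / r⌋₊]
    · have h1 := (hge k ⌊gd L k * 2 ^ n / r⌋₊).2 le_rfl
      have h3 : ¬ ⌈(r * ((⌊gd L k * 2 ^ n / r⌋₊:ℝ) + 1) / 2 ^ n) * 2 ^ L⌉₊ ≤ k := by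
        have := hge k (⌊gd L k * 2 ^ n / r⌋₊ + 1)
        push_cast at this
        rw [this]; omega
      rw [if_pos h1, if_neg h3]; ring
    · intro i _ hi
      have h1 := hge k i
      have h3 := hge k (i + 1)
      push_cast at h3
      simp only [h1, h3]
      rcases lt_or_gt_of_ne hi with h | h
      · rw [if_pos (by omega), if_pos (by omega)]; ring
      · rw [if_neg (by omega), if_neg (by omega)]; ring
    · intro h
      exact absurd (Finset.mem_range.2 hlt) h
  rw [Finset.sum_congr rfl step, Finset.sum_comm]
  refine Finset.sum_congr rfl fun i _ => ?_
  rw [← Finset.mul_sum, Finset.sum_sub_distrib,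
    tail_sum (fun k => x (gd L k)), tail_sum (fun k => x (gd L k))]
  ring

lemma regroup_err (x : ℝ → ℝ) (g : ℕ → ℝ) (hg : ∀ i, |g i| ≤ 1) {r : ℝ} (hr : 0 < r) (n L q : ℕ)
    (hq : gd L q ≤ r) {w : ℝ}
    (hw : ∀ a b, 0 ≤ a → a ≤ gd L q → 0 ≤ b → b ≤ gd L q → |a - b| ≤ 1 / 2 ^ L → |x a - x b| ≤ w) :
    |(∑ k ∈ Finset.range q, g ⌊gd L k * 2 ^ n / r⌋₊ * (x (gd L (k + 1)) - x (gd L k))) -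
      ∑ i ∈ Finset.range (2 ^ n), g i * (x (min (r * ((i:ℝ) + 1) / 2 ^ n) (gd L q)) -
        x (min (r * (i:ℝ) / 2 ^ n) (gd L q)))| ≤ 2 ^ n * (2 * w) := by
  rw [regroup x g hr n L q hq, ← Finset.sum_sub_distrib]
  refine (Finset.abs_sum_le_sum_abs _ _).trans ?_
  have hL : (0:ℝ) < 2 ^ L := by positivity
  have key : ∀ a : ℝ, 0 ≤ a → |x (gd L (min ⌈a * 2 ^ L⌉₊ q)) - x (min a (gd L q))| ≤ w := by
    intro a ha
    have e : gd L (min ⌈a * 2 ^ L⌉₊ q) = min (gd L ⌈a * 2 ^ L⌉₊) (gd L q) :=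
      (gd_mono L).map_min
    apply hw _ _ (gd_nonneg _ _) (gd_mono L (min_le_right _ _)) (le_min ha (gd_nonneg _ _))
      (min_le_right _ _)
    rw [e]
    refine (abs_min_sub_min_le_max _ _ _ _).trans ?_
    rw [sub_self, abs_zero]
    refine max_le ?_ (by positivity)
    have h1 := Nat.le_ceil (a * 2 ^ L)
    have h2 := Nat.ceil_lt_add_one (by positivity : 0 ≤ a * 2 ^ L)
    have h3 : a ≤ gd L ⌈a * 2 ^ L⌉₊ := by rw [gd, le_div_iff₀ hL]; exact h1
    have h4 : gd L ⌈a * 2 ^ L⌉₊ ≤ a + 1 / 2 ^ L := by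
      rw [gd, div_le_iff₀ hL, add_mul, one_div, inv_mul_cancel₀ hL.ne']; exact h2.le
    rw [abs_le]; constructor <;> linarith
  have : ∀ i ∈ Finset.range (2 ^ n), |g i *
        (x (gd L (min ⌈(r * ((i:ℝ) + 1) / 2 ^ n) * 2 ^ L⌉₊ q)) -
          x (gd L (min ⌈(r * (i:ℝ) / 2 ^ n) * 2 ^ L⌉₊ q))) -
          g i * (x (min (r * ((i:ℝ) + 1) / 2 ^ n) (gd L q)) -
        x (min (r * (i:ℝ) / 2 ^ n) (gd L q)))| ≤ 2 * w := by
    intro i _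
    have k1 := key (r * ((i:ℝ) + 1) / 2 ^ n) (by positivity)
    have k2 := key (r * (i:ℝ) / 2 ^ n) (by positivity)
    rw [← mul_sub, abs_mul]
    refine (mul_le_of_le_one_left (abs_nonneg _) (hg i)).trans ?_
    rw [abs_le] at *
    constructor <;> linarith
  refine (Finset.sum_le_sum this).trans ?_
  simp

lemma psgn_meas : Measurable psgn := by
  unfold psgn
  exact Measurable.ite measurableSet_Ioi measurable_const measurable_const

lemma abs_psgn (v : ℝ) : |psgn v| = 1 := by
  unfold psgn; split_ifs <;> simp

/-- Bounded solution of the (stopped) equation. -/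
structure Sol (μ : Measure Ω) (G : ℝ → MeasurableSpace Ω) (M N : ℝ → Ω → ℝ) (ρ : Ω → ℝ)
    (K y : ℝ) (Y : ℝ → Ω → ℝ) : Prop where
  adp : ∀ t, 0 ≤ t → Measurable[G t] (Y t)
  bdd : ∀ t ω, |Y t ω| ≤ K
  cont : ∀ ω, Continuous fun t => Y t ω
  conv : ∀ t, 0 ≤ t → ∀ ε > 0, Tendsto (fun n => μ.real {ω | t ≤ ρ ω ∧
    ε < |rsum (fun s ω => psgn (Y s ω)) M t n ω - (Y t ω - y - N t ω)|}) atTop (nhds 0)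

/-- the sign path extended to negative times -/
def fY (Y : ℝ → Ω → ℝ) (ω : Ω) (v : ℝ) : ℝ := psgn (Y (max v 0) ω)

lemma fY_le (Y : ℝ → Ω → ℝ) (ω : Ω) (v : ℝ) : |fY Y ω v| ≤ 1 := (abs_psgn _).le

lemma fY_meas {Y : ℝ → Ω → ℝ} {ω : Ω} (h : Continuous fun t => Y t ω) : Measurable (fY Y ω) :=
  psgn_meas.comp ((h.comp (continuous_id.max continuous_const)).measurable)

lemma jmc {Ω : Type*} [MeasurableSpace Ω] {X : ℝ → Ω → ℝ}
    (hX : ∀ v, 0 ≤ v → Measurable (X v)) (hc : ∀ ω, Continuous fun t => X t ω) {φ : ℝ → ℝ}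
    (hφ : Measurable φ) (h0 : ∀ r, 0 ≤ φ r) : Measurable (Function.uncurry fun r ω => X (φ r) ω) := by
  have h1 : Measurable (Function.uncurry fun v ω => X (max v 0) ω) :=
    measurable_uncurry_of_continuous_of_measurable
      (fun ω => (hc ω).comp (continuous_id.max continuous_const))
      (fun v => hX _ (le_max_right _ _))
  have h2 : Measurable fun z : ℝ × Ω => (φ z.1, z.2) := by fun_prop
  have := h1.comp h2
  convert this using 1
  ext z
  simp [Function.uncurry, max_eq_left (h0 z.1)]

lemma jmc' {Ω : Type*} [MeasurableSpace Ω] {X : ℝ → Ω → ℝ} {u : ℝ} (hu0 : 0 ≤ u)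
    (hX : ∀ v, 0 ≤ v → v ≤ u → Measurable (X v)) (hc : ∀ ω, Continuous fun t => X t ω) {φ : ℝ → ℝ}
    (hφ : Measurable φ) (h0 : ∀ r, 0 ≤ φ r) (hu : ∀ r, φ r ≤ u) :
    Measurable (Function.uncurry fun r ω => X (φ r) ω) := by
  have := jmc (X := fun v ω => X (min v u) ω)
    (fun v hv => hX _ (le_min hv hu0) (min_le_right _ _))
    (fun ω => (hc ω).comp (continuous_id.min continuous_const)) hφ h0
  simpa [min_eq_left (hu _)] using this

section sol
variable {Y : ℝ → Ω → ℝ} {y : ℝ}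

lemma Sol.adp' (S : Sol μ G M N ρ K y Y) (hG : Monotone G) {u v : ℝ} (hv : 0 ≤ v) (h : v ≤ u) :
    Measurable[G u] (Y v) := (S.adp v hv).mono (hG h) le_rfl

lemma Sol.Phi_bd (S : Sol μ G M N ρ K y Y) (hG : Monotone G) {s δ : ℝ} (hs : 0 ≤ s) (hδ : 0 < δ) :
    Bd (G s) (fun ω => Ph (fY Y ω) s δ) := by
  refine Bd.mk' ?_ 1 fun ω => Ph_le (fY_le Y ω) s hδ
  have e : (fun ω => Ph (fY Y ω) s δ) =
      fun ω => (1 / δ) * ∫ v in (s - δ)..s, psgn (Y (min (max v 0) s) ω) := by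
    ext ω
    unfold Ph
    congr 1
    refine intervalIntegral.integral_congr fun v hv => ?_
    rw [uIcc_of_le (by linarith)] at hv
    simp only [fY]
    rw [min_eq_left (max_le hv.2 hs)]
  rw [e]
  have h1 := @jmc' Ω (G s) Y s hs (fun v hv h => S.adp' hG hv h) S.cont
    (fun v => min (max v 0) s) (by fun_prop) (fun v => le_min (le_max_right _ _) hs)
    (fun v => min_le_right _ _)
  have h2 := @ii_meas Ω (G s) (fun v ω => psgn (Y (min (max v 0) s) ω))
    (psgn_meas.comp h1) (s - δ) s
  exact h2.const_mul _

lemma lg_nonneg {n : ℕ} {u r : ℝ} (hr : 0 ≤ r) : 0 ≤ lg n u r := by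
  unfold lg; positivity

lemma lg_le {n : ℕ} {u r : ℝ} (hr : 0 < r) (hu : 0 ≤ u) : lg n u r ≤ u := by
  unfold lg
  have h := Nat.floor_le (by positivity : 0 ≤ u * 2 ^ n / r)
  calc r / 2 ^ n * (⌊u * 2 ^ n / r⌋₊ : ℝ) ≤ r / 2 ^ n * (u * 2 ^ n / r) :=
        mul_le_mul_of_nonneg_left h (by positivity)
    _ = u := by field_simp

/-- averaged kernel -/
def KK (Y : ℝ → Ω → ℝ) (t η : ℝ) (n : ℕ) (u : ℝ) (ω : Ω) : ℝ :=
  av t η fun r => fY Y ω (lg n u r)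

lemma av_congr {t η : ℝ} (ht : 0 < t) (hη : 0 < η) {D D' : ℝ → ℝ}
    (h : ∀ r, t ≤ r → r ≤ t * (1 + η) → D r = D' r) : av t η D = av t η D' := by
  unfold av
  congr 1
  refine intervalIntegral.integral_congr fun r hr => ?_
  rw [uIcc_of_le (by nlinarith)] at hr
  exact h r hr.1 hr.2

lemma Sol.KK_bd (S : Sol μ G M N ρ K y Y) (hG : Monotone G) {t η u : ℝ} (ht : 0 < t) (hη : 0 < η)
    (hu : 0 ≤ u) (n : ℕ) : Bd (G u) (KK Y t η n u) := by
  refine Bd.mk' ?_ 1 fun ω => av_le ht hη fun r _ _ => fY_le Y ω _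
  have e : KK Y t η n u =
      fun ω => av t η fun r => psgn (Y (min (max (lg n u r) 0) u) ω) := by
    ext ω
    refine av_congr ht hη fun r h1 h2 => ?_
    simp only [fY]
    rw [min_eq_left (max_le (lg_le (by linarith) hu) hu)]
  rw [e]
  have hl := lg_meas n u
  have h1 := @jmc' Ω (G u) Y u hu (fun v hv h => S.adp' hG hv h) S.cont
    (fun r => min (max (lg n u r) 0) u) (by fun_prop) (fun v => le_min (le_max_right _ _) hu)
    (fun v => min_le_right _ _)
  exact @av_meas Ω (G u) (fun r ω => psgn (Y (min (max (lg n u r) 0) u) ω)) (psgn_meas.comp h1) t η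

lemma Mart.stopped (h : Mart μ G X K) {t : ℝ} (ht : 0 ≤ t) :
    Mart μ G (fun s ω => X (min s t) ω) K where
  mono := h.mono
  le := h.le
  adp s hs := (h.adp _ (le_min hs ht)).mono (h.mono (min_le_left _ _)) le_rfl
  bdd s ω := h.bdd _ ω
  cont ω := (h.cont ω).comp (continuous_id.min continuous_const)
  zero ω := by rw [min_eq_left ht]; exact h.zero ω
  orth s s' hs hss Z hZ := by
    rcases le_total t s with h1 | h1
    · simp [min_eq_right h1, min_eq_right (h1.trans hss)]
    · rw [min_eq_left h1]
      exact h.orth s (min s' t) hs (le_min hss h1) Z hZ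

lemma Mart.neg (h : Mart μ G X K) : Mart μ G (fun s ω => - X s ω) K where
  mono := h.mono
  le := h.le
  adp s hs := (h.adp s hs).neg
  bdd s ω := by rw [abs_neg]; exact h.bdd _ ω
  cont ω := (h.cont ω).neg
  zero ω := by simp [h.zero ω]
  orth s s' hs hss Z hZ := by
    have := h.orth s s' hs hss Z hZ
    have e : ∀ ω, Z ω * (-X s' ω - -X s ω) = -(Z ω * (X s' ω - X s ω)) := fun ω => by ring
    simp_rw [e, integral_neg, this, neg_zero]

lemma rsum_iso (h : Mart μ G X K) {H : ℝ → Ω → ℝ} (hH : ∀ s, 0 ≤ s → Measurable[G s] (H s))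
    (h1 : ∀ s ω, |H s ω| ≤ 1) {r : ℝ} (hr : 0 ≤ r) (n : ℕ) :
    ∫ ω, (rsum H X r n ω) ^ 2 ∂μ ≤ ∫ ω, (X r ω) ^ 2 ∂μ := by
  have hv : Monotone fun k : ℕ => r * k / 2 ^ n := by
    intro a b hab
    have : (a:ℝ) ≤ b := by exact_mod_cast hab
    exact div_le_div_of_nonneg_right (mul_le_mul_of_nonneg_left this hr) (by positivity)
  have hd := h.dm hv (by simp)
  have := hd.iso_le (h := fun k => H (r * k / 2 ^ n))
    (fun k => Bd.mk' (hH _ (by positivity)) 1 fun ω => h1 _ ω) (2 ^ n) (C := 1)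
    (fun k _ ω => h1 _ ω)
  have e0 : r * ((2 ^ n : ℕ) : ℝ) / 2 ^ n = r := by push_cast; field_simp
  have e1 : r * ((0 : ℕ) : ℝ) / 2 ^ n = 0 := by simp
  simp only [e0, e1, h.zero, sub_zero, one_pow, one_mul] at this
  have e2 : ∀ ω, SDEPaper.tr (fun k : ℕ => H (r * k / 2 ^ n)) (fun k : ℕ => X (r * k / 2 ^ n))
      (2 ^ n) ω = rsum H X r n ω := by
    intro ω
    simp only [SDEPaper.tr, rsum, Nat.cast_add, Nat.cast_one]
  simp_rw [e2] at this
  exact this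

lemma rsum_bd' (h : Mart μ G X K) {H : ℝ → Ω → ℝ} (hH : ∀ s, 0 ≤ s → Measurable[G s] (H s))
    (h1 : ∀ s ω, |H s ω| ≤ 1) {r : ℝ} (hr : 0 ≤ r) (n : ℕ) : Bd m (rsum H X r n) := by
  refine Bd.sum _ fun i _ => ?_
  refine (Bd.mk' ((hH _ (by positivity)).mono (h.le _) le_rfl) 1 fun ω => h1 _ ω).mul
    ((h.bdm (by positivity)).sub (h.bdm (by positivity)))

lemma rsum_abs (hX : ∀ t ω, |X t ω| ≤ K) {H : ℝ → Ω → ℝ}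
    (h1 : ∀ s ω, |H s ω| ≤ 1) (r : ℝ) (n : ℕ) (ω : Ω) : |rsum H X r n ω| ≤ 2 ^ n * (2 * K) := by
  refine (Finset.abs_sum_le_sum_abs _ _).trans ?_
  have : ∀ i ∈ Finset.range (2 ^ n), |H (r * i / 2 ^ n) ω *
      (X (r * (i + 1) / 2 ^ n) ω - X (r * i / 2 ^ n) ω)| ≤ 2 * K := by
    intro i _
    rw [abs_mul]
    refine (mul_le_of_le_one_left (abs_nonneg _) (h1 _ ω)).trans ?_
    exact (abs_sub _ _).trans (by linarith [hX (r * (i + 1) / 2 ^ n) ω, hX (r * i / 2 ^ n) ω])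
  refine (Finset.sum_le_sum this).trans ?_
  simp

lemma rsum_jm (hX : ∀ v, 0 ≤ v → Measurable (X v)) (hc : ∀ ω, Continuous fun t => X t ω)
    (hY : ∀ v, 0 ≤ v → Measurable (Y v)) (hcY : ∀ ω, Continuous fun t => Y t ω) (n : ℕ) :
    Measurable (Function.uncurry fun r ω => rsum (fun s ω => psgn (Y s ω)) X (max r 0) n ω) := by
  unfold rsum
  have : (Function.uncurry fun r ω => ∑ i ∈ Finset.range (2 ^ n),
      psgn (Y (max r 0 * i / 2 ^ n) ω) * (X (max r 0 * (i + 1) / 2 ^ n) ω -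
        X (max r 0 * i / 2 ^ n) ω)) = fun z : ℝ × Ω => ∑ i ∈ Finset.range (2 ^ n),
      (psgn (Y (max z.1 0 * i / 2 ^ n) z.2) * (X (max z.1 0 * (i + 1) / 2 ^ n) z.2 -
        X (max z.1 0 * i / 2 ^ n) z.2)) := by
    ext z; rfl
  rw [this]
  refine Finset.measurable_sum _ fun i _ => ?_
  have a1 := jmc hY hcY (φ := fun r => max r 0 * i / 2 ^ n) (by fun_prop) (fun r => by positivity)
  have a2 := jmc hX hc (φ := fun r => max r 0 * i / 2 ^ n) (by fun_prop) (fun r => by positivity)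
  have a3 := jmc hX hc (φ := fun r => max r 0 * (i + 1) / 2 ^ n) (by fun_prop)
    (fun r => by positivity)
  exact (psgn_meas.comp a1).mul (a3.sub a2)

lemma cont_L2 (hX : ∀ v, 0 ≤ v → Measurable (X v)) (hb : ∀ t ω, |X t ω| ≤ K)
    (hc : ∀ ω, Continuous fun t => X t ω) {t : ℝ} (ht : 0 ≤ t) {e : ℝ} (he : 0 < e) :
    ∃ d > 0, ∀ r, t ≤ r → r ≤ t + d → ∫ ω, (X r ω - X t ω) ^ 2 ∂μ ≤ e := by
  have : Tendsto (fun r => ∫ ω, (X r ω - X t ω) ^ 2 ∂μ) (nhdsWithin t (Ici t))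
      (nhds (∫ ω, (0:ℝ) ∂μ)) := by
    refine tendsto_integral_filter_of_dominated_convergence (fun _ => (2 * K) ^ 2) ?_ ?_
      (integrable_const _) ?_
    · filter_upwards [self_mem_nhdsWithin] with r hr
      exact (((hX r (ht.trans hr)).sub (hX t ht)).pow_const 2).aestronglyMeasurable
    · refine Eventually.of_forall fun r => Eventually.of_forall fun ω => ?_
      rw [Real.norm_eq_abs, abs_pow]
      refine pow_le_pow_left₀ (abs_nonneg _) ?_ 2
      exact (abs_sub _ _).trans (by linarith [hb r ω, hb t ω])
    · refine Eventually.of_forall fun ω => ?_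
      have h : Tendsto (fun r => (X r ω - X t ω) ^ 2) (nhds t) (nhds ((X t ω - X t ω) ^ 2)) :=
        (((hc ω).sub (continuous_const (y := X t ω))).pow 2).tendsto t
      rw [sub_self, zero_pow two_ne_zero] at h
      exact h.mono_left nhdsWithin_le_nhds
  simp only [integral_zero] at this
  have h2 := (this.eventually (gt_mem_nhds he))
  rw [eventually_nhdsWithin_iff, Metric.eventually_nhds_iff] at h2
  obtain ⟨d, hd, h⟩ := h2
  refine ⟨d / 2, by positivity, fun r h1 h2 => (h ?_ h1).le⟩
  rw [Real.dist_eq, abs_of_nonneg (by linarith)]; linarith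

lemma L1_split {f : Ω → ℝ} (hf : Bd m f) {A : Set Ω} (hA : MeasurableSet A) {ε a : ℝ}
    (hε : 0 ≤ ε) (ha : 0 < a) :
    ∫ ω, A.indicator (fun _ => (1:ℝ)) ω * |f ω| ∂μ ≤
      ε + a * μ.real {ω | ω ∈ A ∧ ε < |f ω|} + (∫ ω, f ω ^ 2 ∂μ) / a := by
  classical
  have hmS : MeasurableSet {ω | ω ∈ A ∧ ε < |f ω|} :=
    hA.inter (measurableSet_lt measurable_const hf.meas.abs)
  have b1 : Bd m (A.indicator fun _ => (1:ℝ)) := by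
    have := Bd.ind (g := m) (p := fun ω => ω ∈ A) hA
    convert this using 1
    ext ω; simp [Set.indicator_apply]
  have b2 : Bd m ({ω | ω ∈ A ∧ ε < |f ω|}.indicator fun _ => (1:ℝ)) := by
    have := Bd.ind (g := m) (p := fun ω => ω ∈ A ∧ ε < |f ω|) hmS
    convert this using 1
    ext ω; simp [Set.indicator_apply]
  have b3 := (Bd.const m (1 / a)).mul (hf.pow 2)
  have b4 := (Bd.const m a).mul b2
  have := Bd.le (μ := μ) (b1.mul hf.abs) (((Bd.const m ε).add b4).add b3) fun ω => by
    have h2 : 0 ≤ 1 / a * f ω ^ 2 := by positivity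
    by_cases h : ω ∈ A
    · by_cases h3 : ε < |f ω|
      · rw [indicator_of_mem h, indicator_of_mem (show ω ∈ {ω | ω ∈ A ∧ ε < |f ω|} from ⟨h, h3⟩)]
        have h1 : 0 ≤ (1 / a) * ((|f ω| - a / 2) ^ 2 + 3 / 4 * a ^ 2) := by positivity
        have h2 : (1 / a) * ((|f ω| - a / 2) ^ 2 + 3 / 4 * a ^ 2) =
          a + 1 / a * f ω ^ 2 - |f ω| := by
          rw [← sq_abs (f ω)]; field_simp; ring
        linarith
      · rw [indicator_of_mem h, indicator_of_notMem (fun hh => h3 hh.2)]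
        linarith [not_lt.1 h3]
    · rw [indicator_of_notMem h, indicator_of_notMem (fun hh => h hh.1)]
      linarith
  rw [integral_add ((Bd.const m ε).add b4).i b3.i, integral_add (integrable_const _) b4.i,
    integral_const_mul, integral_const_mul] at this
  have e : ∫ ω, ({ω | ω ∈ A ∧ ε < |f ω|}.indicator fun _ => (1:ℝ)) ω ∂μ =
    μ.real {ω | ω ∈ A ∧ ε < |f ω|} := integral_indicator_one hmS
  rw [e] at this
  simp only [integral_const, probReal_univ, one_smul] at this
  rw [div_eq_mul_one_div (∫ ω, f ω ^ 2 ∂μ), mul_comm _ (1 / a)]; exact this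

lemma Sol.conv_L1 (C : Core μ G M N ρ K c) (S : Sol μ G M N ρ K y Y) {r : ℝ} (hr : 0 ≤ r) :
    (∀ n, ∫ ω, (rsum (fun s ω => psgn (Y s ω)) M r n ω - (Y r ω - y - N r ω)) ^ 2 ∂μ ≤
      2 * K ^ 2 + 2 * (2 * K + |y|) ^ 2) ∧
    Tendsto (fun n => ∫ ω, {ω | r ≤ ρ ω}.indicator (fun _ => (1:ℝ)) ω *
      |rsum (fun s ω => psgn (Y s ω)) M r n ω - (Y r ω - y - N r ω)| ∂μ) atTop (nhds 0) := by
  have hbY : Bd m (Y r) := Bd.mk' ((S.adp r hr).mono (C.hM.le _) le_rfl) K (S.bdd r)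
  have hH : ∀ s, 0 ≤ s → Measurable[G s] (fun ω => psgn (Y s ω)) := fun s hs =>
    psgn_meas.comp (S.adp s hs)
  have hbS := fun n => rsum_bd' C.hM hH (fun s ω => (abs_psgn _).le) hr n
  have hbZ := (hbY.sub (Bd.const m y)).sub (C.hN.bdm hr)
  have hL2 : ∀ n, ∫ ω, (rsum (fun s ω => psgn (Y s ω)) M r n ω - (Y r ω - y - N r ω)) ^ 2 ∂μ ≤
      2 * K ^ 2 + 2 * (2 * K + |y|) ^ 2 := by
    intro n
    have i1 := rsum_iso C.hM hH (fun s ω => (abs_psgn _).le) hr n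
    have i2 : ∫ ω, (M r ω) ^ 2 ∂μ ≤ K ^ 2 := by
      have := Bd.le (μ := μ) ((C.hM.bdm hr).pow 2) (Bd.const m (K ^ 2)) fun ω => by
        exact sq_le_sq' (by linarith [abs_le.1 (C.hM.bdd r ω)]) (abs_le.1 (C.hM.bdd r ω)).2
      simpa using this
    have b := (Bd.const m 2).mul ((hbS n).pow 2)
    have := Bd.le (μ := μ) (((hbS n).sub hbZ).pow 2) (b.add (Bd.const m (2 * (2 * K + |y|) ^ 2)))
      fun ω => by
        have h1 : |Y r ω - y - N r ω| ≤ 2 * K + |y| := by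
          have a1 := S.bdd r ω
          have a2 := C.hN.bdd r ω
          have a3 := abs_sub (Y r ω - y) (N r ω)
          have a4 := abs_sub (Y r ω) y
          linarith
        have h2 := sq_le_sq' (by linarith [abs_le.1 h1]) (abs_le.1 h1).2
        nlinarith [sq_nonneg (rsum (fun s ω => psgn (Y s ω)) M r n ω + (Y r ω - y - N r ω))]
    rw [integral_add b.i (integrable_const _), integral_const_mul] at this
    simp only [integral_const, probReal_univ, one_smul] at this
    linarith
  refine ⟨hL2, ?_⟩
  set B := 2 * K ^ 2 + 2 * (2 * K + |y|) ^ 2 with hB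
  have hB0 : 0 ≤ B := by positivity
  have hA : MeasurableSet {ω | r ≤ ρ ω} := measurableSet_le measurable_const C.mρ
  rw [Metric.tendsto_atTop]
  intro e he
  set a := 4 * (B + 1) / e with ha
  have ha0 : 0 < a := by positivity
  have hc := S.conv r hr (e / 4) (by positivity)
  have hc2 := hc.eventually (gt_mem_nhds (show (0:ℝ) < e / (4 * a) by positivity))
  obtain ⟨n0, hn0⟩ := eventually_atTop.1 hc2
  refine ⟨n0, fun n hn => ?_⟩
  have h0 : 0 ≤ ∫ ω, {ω | r ≤ ρ ω}.indicator (fun _ => (1:ℝ)) ω *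
      |rsum (fun s ω => psgn (Y s ω)) M r n ω - (Y r ω - y - N r ω)| ∂μ :=
    integral_nonneg fun ω => mul_nonneg (indicator_nonneg (fun _ _ => zero_le_one) _) (abs_nonneg _)
  rw [Real.dist_0_eq_abs, abs_of_nonneg h0]
  have h1 := L1_split (μ := μ) ((hbS n).sub hbZ) hA (ε := e / 4) (by positivity) ha0
  have h2 := hn0 n hn
  have h3 : a * (e / (4 * a)) = e / 4 := by field_simp
  have h4 : (∫ ω, (rsum (fun s ω => psgn (Y s ω)) M r n ω - (Y r ω - y - N r ω)) ^ 2 ∂μ) / a ≤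
      e / 4 := by
    refine (div_le_div_of_nonneg_right (hL2 n) ha0.le).trans ?_
    rw [ha, div_div_eq_mul_div, div_le_iff₀ (by positivity)]; nlinarith
  have h5 := mul_lt_mul_of_pos_left h2 ha0
  rw [h3] at h5
  have h6 : {ω | ω ∈ {ω | r ≤ ρ ω} ∧ e / 4 < |rsum (fun s ω => psgn (Y s ω)) M r n ω -
    (Y r ω - y - N r ω)|} = {ω | r ≤ ρ ω ∧ e / 4 < |rsum (fun s ω => psgn (Y s ω)) M r n ω -
    (Y r ω - y - N r ω)|} := rfl
  rw [h6] at h1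
  linarith

end sol

section star

variable {Y : ℝ → Ω → ℝ} {y : ℝ}

lemma rsum_sub (H X X' : ℝ → Ω → ℝ) (r : ℝ) (n : ℕ) (ω : Ω) :
    rsum H X r n ω - rsum H X' r n ω = rsum H (fun s ω => X s ω + - X' s ω) r n ω := by
  unfold rsum
  rw [← Finset.sum_sub_distrib]
  exact Finset.sum_congr rfl fun i _ => by ring

lemma starA (C : Core μ G M N ρ K c) (S : Sol μ G M N ρ K y Y) {t : ℝ} (ht : 0 < t) {δ : ℝ}
    (hδ : 0 < δ) : ∃ η0 > 0, ∀ η, 0 < η → η ≤ η0 → ∀ᶠ n in atTop,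
      ∫ ω, |{ω | t * (1 + η) ≤ ρ ω}.indicator (fun _ => (1:ℝ)) ω *
        (Y t ω - N t ω - y - av t η (fun r => rsum (fun s ω => psgn (Y s ω))
          (fun s ω => M (min s t) ω) (max r 0) n ω))| ∂μ ≤ δ := by
  have hYm : ∀ v, 0 ≤ v → Measurable (Y v) := fun v hv => (S.adp v hv).mono (C.hM.le _) le_rfl
  have hYb : ∀ v, 0 ≤ v → Bd m (Y v) := fun v hv => Bd.mk' (hYm v hv) K (S.bdd v)
  have hH : ∀ s, 0 ≤ s → Measurable[G s] (fun ω => psgn (Y s ω)) := fun s hs =>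
    psgn_meas.comp (S.adp s hs)
  have hH1 : ∀ s ω, |(fun ω => psgn (Y s ω)) ω| ≤ 1 := fun s ω => (abs_psgn _).le
  have hK := C.hM.K0
  set a := δ / 16 with ha
  have ha0 : 0 < a := by positivity
  obtain ⟨d1, hd1, h1⟩ := cont_L2 (μ := μ) hYm S.bdd S.cont ht.le (show 0 < a ^ 2 by positivity)
  obtain ⟨d2, hd2, h2⟩ := cont_L2 (μ := μ) C.hN.mm C.hN.bdd C.hN.cont ht.le
    (show 0 < a ^ 2 by positivity)
  obtain ⟨d3, hd3, h3⟩ := cont_L2 (μ := μ) C.hM.mm C.hM.bdd C.hM.cont ht.le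
    (show 0 < a ^ 2 by positivity)
  refine ⟨min d1 (min d2 d3) / t, by positivity, fun η hη hη0 => ?_⟩
  set T := t * (1 + η) with hT
  have hTd : T ≤ t + min d1 (min d2 d3) := by
    rw [le_div_iff₀ ht] at hη0
    rw [hT]; linarith
  have hm1 : min d1 (min d2 d3) ≤ d1 := min_le_left _ _
  have hm2 : min d1 (min d2 d3) ≤ d2 := (min_le_right _ _).trans (min_le_left _ _)
  have hm3 : min d1 (min d2 d3) ≤ d3 := (min_le_right _ _).trans (min_le_right _ _)
  have htT : t ≤ T := by rw [hT]; nlinarith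
  set J : Ω → ℝ := {ω | T ≤ ρ ω}.indicator (fun _ => (1:ℝ)) with hJ
  have hJm : Measurable J := measurable_const.indicator (measurableSet_le measurable_const C.mρ)
  have hJ0 : ∀ ω, 0 ≤ J ω := fun ω => indicator_nonneg (fun _ _ => zero_le_one) _
  have hJ1 : ∀ ω, J ω ≤ 1 := fun ω => indicator_le_self' (fun _ _ => zero_le_one) _ |>.trans le_rfl
  have hJb : Bd m J := Bd.mk' hJm 1 fun ω => by rw [abs_of_nonneg (hJ0 ω)]; exact hJ1 ω
  let P : ℕ → ℝ → Ω → ℝ := fun n r ω => rsum (fun s ω => psgn (Y s ω))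
          (fun s ω => M (min s t) ω) (max r 0) n ω
  let SS : ℕ → ℝ → Ω → ℝ := fun n r ω => rsum (fun s ω => psgn (Y s ω)) M (max r 0) n ω
  have hMt := C.hM.stopped ht.le
  have hPm : ∀ n, Measurable (Function.uncurry (P n)) := fun n => rsum_jm hMt.mm hMt.cont hYm S.cont n
  have hSm : ∀ n, Measurable (Function.uncurry (SS n)) := fun n =>
    rsum_jm C.hM.mm C.hM.cont hYm S.cont n
  have hPb : ∀ n r ω, |P n r ω| ≤ 2 ^ n * (2 * K) := fun n r ω => rsum_abs hMt.bdd hH1 _ n ω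
  have hSb : ∀ n r ω, |SS n r ω| ≤ 2 ^ n * (2 * K) := fun n r ω => rsum_abs C.hM.bdd hH1 _ n ω
  -- D2
  let D2 : ℕ → ℝ → Ω → ℝ := fun n r ω => J ω * (SS n r ω - (Y (max r 0) ω - y - N (max r 0) ω))
  have hmax : Measurable fun r : ℝ => max r 0 := measurable_id.max measurable_const
  have hmax0 : ∀ r : ℝ, 0 ≤ max r 0 := fun r => le_max_right _ _
  have hYj := jmc hYm S.cont hmax hmax0
  have hNj := jmc C.hN.mm C.hN.cont hmax hmax0
  have hJj : Measurable (Function.uncurry fun (_ : ℝ) ω => J ω) := hJm.comp measurable_snd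
  have hD2m : ∀ n, Measurable (Function.uncurry (D2 n)) := fun n =>
    hJj.mul ((hSm n).sub ((hYj.sub measurable_const).sub hNj))
  have hD2b : ∀ n r ω, |D2 n r ω| ≤ 2 ^ n * (2 * K) + (2 * K + |y|) := by
    intro n r ω
    have e1 := hSb n r ω
    have e2 := S.bdd (max r 0) ω
    have e3 := C.hN.bdd (max r 0) ω
    have e4 := abs_sub (SS n r ω) (Y (max r 0) ω - y - N (max r 0) ω)
    have e5 := abs_sub (Y (max r 0) ω - y) (N (max r 0) ω)
    have e6 := abs_sub (Y (max r 0) ω) y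
    have : |D2 n r ω| ≤ |SS n r ω - (Y (max r 0) ω - y - N (max r 0) ω)| := by
      simp only [D2]
      rw [abs_mul, abs_of_nonneg (hJ0 ω)]
      exact mul_le_of_le_one_left (abs_nonneg _) (hJ1 ω)
    linarith
  set B := 2 * K ^ 2 + 2 * (2 * K + |y|) ^ 2 with hB
  have hφb : ∀ n r, 0 ≤ r → ∫ ω, |D2 n r ω| ∂μ ≤ 1 + B := by
    intro n r hr
    have i1 := (S.conv_L1 C hr).1 n
    have b0 : Bd m (fun ω => SS n r ω - (Y (max r 0) ω - y - N (max r 0) ω)) := by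
      rw [max_eq_left hr]
      have := rsum_bd' C.hM hH hH1 (hmax0 r) n
      exact this.sub (((hYb r hr).sub (Bd.const m y)).sub (C.hN.bdm hr))
    have i2 := L1_of_L2 (μ := μ) b0 one_pos
    have i3 := Bd.le (μ := μ) (hJb.mul b0).abs b0.abs fun ω => by
      rw [abs_mul, abs_of_nonneg (hJ0 ω)]
      exact mul_le_of_le_one_left (abs_nonneg _) (hJ1 ω)
    refine i3.trans (i2.trans ?_)
    rw [div_one]
    simp only [SS, max_eq_left hr]
    linarith
  have hφt : ∀ r, 0 ≤ r → r ≤ T → Tendsto (fun n => ∫ ω, |D2 n r ω| ∂μ) atTop (nhds 0) := by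
    intro r hr hrT
    refine squeeze_zero (fun n => integral_nonneg fun _ => abs_nonneg _) (fun n => ?_)
      (S.conv_L1 C hr).2
    have b0 : Bd m (fun ω => rsum (fun s ω => psgn (Y s ω)) M r n ω - (Y r ω - y - N r ω)) :=
      (rsum_bd' C.hM hH hH1 hr n).sub (((hYb r hr).sub (Bd.const m y)).sub (C.hN.bdm hr))
    have bI : Bd m ({ω | r ≤ ρ ω}.indicator (fun _ => (1:ℝ))) :=
      Bd.mk' (measurable_const.indicator (measurableSet_le measurable_const C.mρ)) 1 fun ω => by
        simp only [Set.indicator_apply]; split_ifs <;> simp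
    simp only [D2, SS, max_eq_left hr]
    refine Bd.le (hJb.mul b0).abs (bI.mul b0.abs) fun ω => ?_
    rw [abs_mul, abs_of_nonneg (hJ0 ω)]
    refine mul_le_mul_of_nonneg_right ?_ (abs_nonneg _)
    simp only [hJ, Set.indicator_apply, Set.mem_ofPred_eq]
    split_ifs with q1 q2 q2
    · exact le_rfl
    · exact absurd (hrT.trans q1) q2
    · exact zero_le_one
    · exact le_rfl
  have hav : Tendsto (fun n => av t η fun r => ∫ ω, |D2 n r ω| ∂μ) atTop (nhds 0) := by
    have : Tendsto (fun n => ∫ r in t..T, ∫ ω, |D2 n r ω| ∂μ) atTop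
        (nhds (∫ r in t..T, (0:ℝ))) := by
      refine intervalIntegral.tendsto_integral_filter_of_dominated_convergence (fun _ => 1 + B)
        ?_ ?_ intervalIntegrable_const ?_
      · exact Eventually.of_forall fun n => (int_abs_meas (hD2m n)).aestronglyMeasurable
      · refine Eventually.of_forall fun n => Eventually.of_forall fun r hr => ?_
        rw [uIoc_of_le htT] at hr
        rw [Real.norm_eq_abs, abs_of_nonneg (integral_nonneg fun _ => abs_nonneg _)]
        exact hφb n r (ht.le.trans hr.1.le)
      · refine Eventually.of_forall fun r hr => ?_
        rw [uIoc_of_le htT] at hr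
        exact hφt r (ht.le.trans hr.1.le) hr.2
    have := this.const_mul (1 / (η * t))
    rw [intervalIntegral.integral_zero, mul_zero] at this
    exact this
  filter_upwards [hav.eventually (gt_mem_nhds (show 0 < δ / 2 by positivity))] with n hn
  -- main bound
  let D : ℝ → Ω → ℝ := fun r ω => J ω * (Y t ω - N t ω - y - P n r ω)
  have hDm : Measurable (Function.uncurry D) :=
    hJj.mul (((((hYm t ht.le).sub (C.hN.mm t ht.le)).sub measurable_const).comp measurable_snd).sub
      (hPm n))
  have hDb : ∀ r ω, |D r ω| ≤ 2 * K + |y| + 2 ^ n * (2 * K) := by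
    intro r ω
    have e1 := hPb n r ω
    have e2 := S.bdd t ω
    have e3 := C.hN.bdd t ω
    have e4 := abs_sub (Y t ω - N t ω - y) (P n r ω)
    have e5 := abs_sub (Y t ω - N t ω) y
    have e6 := abs_sub (Y t ω) (N t ω)
    have : |D r ω| ≤ |Y t ω - N t ω - y - P n r ω| := by
      simp only [D]
      rw [abs_mul, abs_of_nonneg (hJ0 ω)]
      exact mul_le_of_le_one_left (abs_nonneg _) (hJ1 ω)
    linarith
  have key : ∀ r, t ≤ r → r ≤ T → ∫ ω, |D r ω| ∂μ ≤ 3 * (2 * a) + ∫ ω, |D2 n r ω| ∂μ := by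
    intro r hr hrT
    have hr0 : 0 ≤ r := ht.le.trans hr
    have bY : Bd m (fun ω => Y r ω - Y t ω) := (hYb r hr0).sub (hYb t ht.le)
    have bN : Bd m (fun ω => N r ω - N t ω) := (C.hN.bdm hr0).sub (C.hN.bdm ht.le)
    have hMs := C.hM.add hMt.neg
    have bR := rsum_bd' hMs hH hH1 hr0 n
    have i1 := L1_of_L2 (μ := μ) bY ha0
    have i2 := L1_of_L2 (μ := μ) bN ha0
    have i3 := L1_of_L2 (μ := μ) bR ha0
    have j3 := rsum_iso hMs hH hH1 hr0 n
    simp only [min_eq_right hr] at j3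
    have j4 := h3 r hr (by linarith)
    have j1 := h1 r hr (by linarith)
    have j2 := h2 r hr (by linarith)
    simp only [sub_eq_add_neg (M r _)] at j4
    have dv : ∀ z, z ≤ a ^ 2 → z / a ≤ a := fun z hz => by
      rw [div_le_iff₀ ha0]; linarith [sq a]
    have k1 := dv _ j1
    have k2 := dv _ j2
    have k3 := dv _ (j3.trans j4)
    have bD2 : Bd m (D2 n r) := Bd.mk' ((hD2m n).comp measurable_prodMk_left) _ (hD2b n r)
    have bD : Bd m (D r) := Bd.mk' (hDm.comp measurable_prodMk_left) _ (hDb r)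
    have := Bd.le (μ := μ) bD.abs (((bY.abs.add bN.abs).add bR.abs).add bD2.abs) fun ω => by
      have e0 : D r ω = J ω * (-(Y r ω - Y t ω) + (N r ω - N t ω) +
          rsum (fun s ω => psgn (Y s ω)) (fun s ω => M s ω + - M (min s t) ω) r n ω) -
          D2 n r ω := by
        rw [← rsum_sub]
        simp only [D, D2, P, SS, max_eq_left hr0]
        ring
      rw [e0]
      refine (abs_sub _ _).trans ?_
      refine add_le_add ?_ le_rfl
      rw [abs_mul, abs_of_nonneg (hJ0 ω)]
      refine (mul_le_of_le_one_left (abs_nonneg _) (hJ1 ω)).trans ?_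
      refine (abs_add_le _ _).trans (add_le_add ?_ le_rfl)
      refine (abs_add_le _ _).trans (add_le_add ?_ le_rfl)
      rw [abs_neg]
    rw [integral_add ((bY.abs.add bN.abs).add bR.abs).i bD2.abs.i,
      integral_add (bY.abs.add bN.abs).i bR.abs.i, integral_add bY.abs.i bN.abs.i] at this
    linarith
  have f1 := av_fub (μ := μ) ht hη hDm hDb
  have ii1 : IntervalIntegrable (fun r => ∫ ω, |D2 n r ω| ∂μ) volume t T :=
    bdd_ii (int_abs_meas (hD2m n)) (int_abs_le (hD2b n)) _ _
  have f2 := av_mono ht hη (bdd_ii (int_abs_meas hDm) (int_abs_le (μ := μ) hDb) _ _)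
    ((intervalIntegrable_const (c := 3 * (2 * a))).add ii1) key
  have f3 := av_add (t := t) (η := η) (intervalIntegrable_const (c := 3 * (2 * a))) ii1
  rw [av_const ht hη] at f3
  have f4 : ∀ ω, J ω * (Y t ω - N t ω - y - av t η (fun r => P n r ω)) =
      av t η (fun r => D r ω) := by
    intro ω
    have hp : IntervalIntegrable (fun r => P n r ω) volume t (t * (1 + η)) :=
      bdd_ii ((hPm n).comp measurable_prodMk_right) (fun r => hPb n r ω) _ _
    have g1 := av_sub (t := t) (η := η) (intervalIntegrable_const (c := Y t ω - N t ω - y)) hp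
    rw [av_const ht hη] at g1
    rw [← g1]
    simp only [av, D]
    rw [intervalIntegral.integral_const_mul]; ring
  have f5 : ∀ ω, |J ω * (Y t ω - N t ω - y - av t η (fun r => P n r ω))| =
      |av t η (fun r => D r ω)| := fun ω => by rw [f4]
  refine (integral_congr_ae (Eventually.of_forall f5)).le.trans ?_
  refine f1.trans (f2.trans ?_)
  refine f3.le.trans ?_
  linarith

end star

section star

variable {Y : ℝ → Ω → ℝ} {y : ℝ}

lemma starB_path (S : Sol μ G M N ρ K y Y) {p j l n : ℕ} {η : ℝ} (ht : 0 < gd p j) (hη : 0 < η)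
    {ω : Ω} (hc : Continuous fun t => M t ω) {w : ℝ}
    (hw : ∀ a b, 0 ≤ a → a ≤ gd p j → 0 ≤ b → b ≤ gd p j → |a - b| ≤ 1 / 2 ^ (p + l) →
      |M a ω - M b ω| ≤ w) :
    |av (gd p j) η (fun r => rsum (fun s ω => psgn (Y s ω))
          (fun s ω => M (min s (gd p j)) ω) (max r 0) n ω) -
      ∑ k ∈ Finset.range (j * 2 ^ l), KK Y (gd p j) η n (gd (p + l) k) ω * dd M (p + l) k ω| ≤
      2 ^ n * (2 * w) := by
  set t := gd p j with ht'
  have hfm := fY_meas (S.cont ω)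
  have hii : ∀ k, IntervalIntegrable (fun r => fY Y ω (lg n (gd (p + l) k) r) * dd M (p + l) k ω)
      volume t (t * (1 + η)) := fun k =>
    (bdd_ii (hfm.comp (lg_meas n _)) (fun r => fY_le Y ω _) _ _).mul_const _
  have e1 : ∑ k ∈ Finset.range (j * 2 ^ l), KK Y t η n (gd (p + l) k) ω * dd M (p + l) k ω =
      av t η (fun r => ∑ k ∈ Finset.range (j * 2 ^ l), fY Y ω (lg n (gd (p + l) k) r) *
        dd M (p + l) k ω) := by
    unfold av
    rw [intervalIntegral.integral_finsetSum fun k _ => hii k, Finset.mul_sum]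
    refine Finset.sum_congr rfl fun k _ => ?_
    rw [intervalIntegral.integral_mul_const]
    unfold KK av
    ring
  have i2 : IntervalIntegrable (fun r => ∑ k ∈ Finset.range (j * 2 ^ l),
      fY Y ω (lg n (gd (p + l) k) r) * dd M (p + l) k ω) volume t (t * (1 + η)) := by
    have := IntervalIntegrable.sum (μ := volume) (a := t) (b := t * (1 + η))
      (Finset.range (j * 2 ^ l)) (f := fun k r => fY Y ω (lg n (gd (p + l) k) r) *
        dd M (p + l) k ω) fun k _ => hii k
    simpa [Finset.sum_fn] using this
  have i1 : IntervalIntegrable (fun r => rsum (fun s ω => psgn (Y s ω))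
          (fun s ω => M (min s t) ω) (max r 0) n ω) volume t (t * (1 + η)) := by
    have hcm : ∀ φ : ℝ → ℝ, Measurable φ → Measurable fun r => M (φ r) ω := fun φ h =>
      hc.measurable.comp h
    have hcY : ∀ φ : ℝ → ℝ, Measurable φ → Measurable fun r => psgn (Y (φ r) ω) := fun φ h =>
      psgn_meas.comp ((S.cont ω).measurable.comp h)
    unfold rsum
    refine (IntervalIntegrable.sum (μ := volume) (a := t) (b := t * (1 + η))
      (Finset.range (2 ^ n)) (f := fun i r => psgn (Y (max r 0 * i / 2 ^ n) ω) *
        (M (min (max r 0 * (i + 1) / 2 ^ n) t) ω - M (min (max r 0 * i / 2 ^ n) t) ω))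
        fun i _ => ?_).congr ?_
    · have h1 : Measurable fun r => psgn (Y (max r 0 * i / 2 ^ n) ω) := hcY _ (by fun_prop)
      have h2 : Continuous fun r => (M (min (max r 0 * (i + 1) / 2 ^ n) t) ω -
          M (min (max r 0 * i / 2 ^ n) t) ω) :=
        (hc.comp (by fun_prop : Continuous fun r : ℝ => min (max r 0 * (i + 1) / 2 ^ n) t)).sub
          (hc.comp (by fun_prop : Continuous fun r : ℝ => min (max r 0 * i / 2 ^ n) t))
      exact (bdd_ii h1 (fun r => (abs_psgn _).le) _ _).mul_continuousOn h2.continuousOn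
    · intro r _
      simp only [Finset.sum_apply]
  rw [e1, ← av_sub i1 i2]
  refine av_le ht hη fun r hr _ => ?_
  have hr0 : 0 < r := ht.trans_le hr
  have hq : gd (p + l) (j * 2 ^ l) = t := gd_ref p l j
  have := regroup_err (fun s => M s ω) (fun i => fY Y ω (r / 2 ^ n * i)) (fun i => fY_le Y ω _) hr0
    n (p + l) (j * 2 ^ l) (by rw [hq]; exact hr) (w := w) (by rw [hq]; exact hw)
  rw [hq, abs_sub_comm] at this
  convert this using 3
  · unfold rsum
    refine Finset.sum_congr rfl fun i _ => ?_
    rw [max_eq_left hr0.le]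
    congr 1
    unfold fY
    have : (0:ℝ) ≤ r / 2 ^ n * i := by positivity
    rw [max_eq_left this]; congr 2; ring
  · rfl

lemma starB (C : Core μ G M N ρ K c) (S : Sol μ G M N ρ K y Y) {p j : ℕ} (ht : 0 < gd p j) {η : ℝ}
    (hη : 0 < η) (n : ℕ) : Tendsto (fun l => ∫ ω, |av (gd p j) η (fun r =>
      rsum (fun s ω => psgn (Y s ω)) (fun s ω => M (min s (gd p j)) ω) (max r 0) n ω) -
      ∑ k ∈ Finset.range (j * 2 ^ l), KK Y (gd p j) η n (gd (p + l) k) ω * dd M (p + l) k ω| ∂μ)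
      atTop (nhds 0) := by
  have hYm : ∀ v, 0 ≤ v → Measurable (Y v) := fun v hv => (S.adp v hv).mono (C.hM.le _) le_rfl
  have hMt := C.hM.stopped ht.le
  have hK := C.hM.K0
  have : Tendsto (fun l => ∫ ω, |av (gd p j) η (fun r =>
      rsum (fun s ω => psgn (Y s ω)) (fun s ω => M (min s (gd p j)) ω) (max r 0) n ω) -
      ∑ k ∈ Finset.range (j * 2 ^ l), KK Y (gd p j) η n (gd (p + l) k) ω * dd M (p + l) k ω| ∂μ)
      atTop (nhds (∫ ω, (0:ℝ) ∂μ)) := by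
    refine tendsto_integral_of_dominated_convergence (fun _ => 2 ^ n * (2 * (2 * K))) ?_
      (integrable_const _) ?_ ?_
    · intro l
      have h1 := av_meas (rsum_jm hMt.mm hMt.cont hYm S.cont n) (gd p j) η
      have h2 := Bd.sum (g := m) (Finset.range (j * 2 ^ l))
        (f := fun k ω => KK Y (gd p j) η n (gd (p + l) k) ω * dd M (p + l) k ω) fun k _ =>
        ((S.KK_bd C.hM.mono ht hη (gd_nonneg _ k) n).mono (C.hM.le _)).mul (C.hM.dbd _ k)
      exact (h1.sub h2.meas).abs.aestronglyMeasurable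
    · intro l
      refine Eventually.of_forall fun ω => ?_
      rw [Real.norm_eq_abs, abs_abs]
      refine starB_path S ht hη (C.hM.cont ω) fun a b _ _ _ _ _ => ?_
      exact (abs_sub _ _).trans (by linarith [C.hM.bdd a ω, C.hM.bdd b ω])
    · refine Eventually.of_forall fun ω => ?_
      rw [Metric.tendsto_atTop]
      intro e he
      have hu := (isCompact_Icc (a := (0:ℝ)) (b := gd p j)).uniformContinuousOn_of_continuous
        (C.hM.cont ω).continuousOn
      rw [Metric.uniformContinuousOn_iff] at hu
      obtain ⟨d, hd, h⟩ := hu (e / (4 * 2 ^ n)) (by positivity)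
      obtain ⟨l0, hl0⟩ := exists_pow_lt_of_lt_one hd (show (1/2:ℝ) < 1 by norm_num)
      refine ⟨l0, fun l hl => ?_⟩
      rw [Real.dist_0_eq_abs, abs_abs]
      refine (starB_path S ht hη (C.hM.cont ω) (w := e / (4 * 2 ^ n))
        fun a b ha ha' hb hb' hab => ?_).trans_lt ?_
      · refine (h a ⟨ha, ha'⟩ b ⟨hb, hb'⟩ ?_).le
        rw [Real.dist_eq]
        refine hab.trans_lt (lt_of_le_of_lt ?_ hl0)
        rw [← one_div_pow]
        exact pow_le_pow_of_le_one (by norm_num) (by norm_num) (by omega)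
      · have : 2 ^ n * (2 * (e / (4 * 2 ^ n))) = e / 2 := by field_simp; ring
        rw [this]; linarith
  simpa using this

end star

section star

variable {Y : ℝ → Ω → ℝ} {y : ℝ}

lemma DM.iso_two (hx : DM μ g x) {h : ℕ → Ω → ℝ} (hh : ∀ k, Bd (g k) (h k)) (n s : ℕ) {A b : ℝ}
    (hA : ∀ k < n, ∀ ω, |h k ω| ≤ A) (hb : ∀ k < n, s ≤ k → ∀ ω, |h k ω| ≤ b) :
    ∫ ω, (SDEPaper.tr h x n ω) ^ 2 ∂μ ≤ A ^ 2 * ∫ ω, (x (min s n) ω - x 0 ω) ^ 2 ∂μ +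
      b ^ 2 * ∫ ω, (x n ω - x 0 ω) ^ 2 ∂μ := by
  rw [hx.iso hh, hx.sq, hx.sq]
  have e : ∑ k ∈ Finset.range (min s n), ∫ ω, (x (k + 1) ω - x k ω) ^ 2 ∂μ =
      ∑ k ∈ Finset.range n, if k < s then ∫ ω, (x (k + 1) ω - x k ω) ^ 2 ∂μ else 0 := by
    rw [← Finset.sum_filter]
    congr 1
    ext k; simp; omega
  rw [e, Finset.mul_sum, Finset.mul_sum, ← Finset.sum_add_distrib]
  refine Finset.sum_le_sum fun k hk => ?_
  have hk := Finset.mem_range.1 hk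
  have bd := (hx.dbd k).pow 2
  have bh := ((hh k).mono (hx.le k)).pow 2
  have h0 : 0 ≤ ∫ ω, (x (k + 1) ω - x k ω) ^ 2 ∂μ := integral_nonneg fun _ => sq_nonneg _
  have key : ∀ B : ℝ, (∀ ω, |h k ω| ≤ B) → ∫ ω, h k ω ^ 2 * (x (k + 1) ω - x k ω) ^ 2 ∂μ ≤
      B ^ 2 * ∫ ω, (x (k + 1) ω - x k ω) ^ 2 ∂μ := by
    intro B hB
    rw [← integral_const_mul]
    refine Bd.le (bh.mul bd) ((Bd.const m (B ^ 2)).mul bd) fun ω => ?_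
    refine mul_le_mul_of_nonneg_right ?_ (sq_nonneg _)
    exact sq_le_sq' (by linarith [abs_le.1 (hB ω)]) (abs_le.1 (hB ω)).2
  split_ifs with hs
  · have := key A (hA k hk)
    have : 0 ≤ b ^ 2 * ∫ ω, (x (k + 1) ω - x k ω) ^ 2 ∂μ := by positivity
    linarith
  · have := key b (hb k hk (not_lt.1 hs))
    linarith

lemma starC (C : Core μ G M N ρ K c) (S : Sol μ G M N ρ K y Y) {p j : ℕ} (ht : 0 < gd p j)
    (ht1 : gd p j ≤ 1) {δ : ℝ} (hδ : 0 < δ) : ∃ η0 > 0, ∀ η, 0 < η → η ≤ η0 → ∀ᶠ n in atTop,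
      ∀ᶠ l in atTop, ∫ ω, (∑ k ∈ Finset.range (j * 2 ^ l), (KK Y (gd p j) η n (gd (p + l) k) ω -
        Ph (fY Y ω) (gd (p + l) k) (gd p j / 2 ^ n)) * dd M (p + l) k ω) ^ 2 ∂μ ≤ δ := by
  obtain ⟨d, hd, hdM⟩ := cont_L2 (μ := μ) C.hM.mm C.hM.bdd C.hM.cont (le_refl (0:ℝ))
    (show 0 < δ / 8 by positivity)
  set t := gd p j with ht'
  refine ⟨min 1 (δ / (18 * (K ^ 2 + 1))), by positivity, fun η hη hη0 => ?_⟩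
  have hη1 : η ≤ 1 := hη0.trans (min_le_left _ _)
  have hη2 : η ≤ δ / (18 * (K ^ 2 + 1)) := hη0.trans (min_le_right _ _)
  set κ := d / 2 with hκ
  have hκ0 : 0 < κ := by positivity
  have hlim : Tendsto (fun n : ℕ => 64 / (κ * 2 ^ n * η * t)) atTop (nhds 0) := by
    have : (fun n : ℕ => 64 / (κ * 2 ^ n * η * t)) =
        fun n : ℕ => (64 / (κ * η * t)) * (1 / 2) ^ n := by
      ext n; rw [one_div_pow]; field_simp
    rw [this]
    simpa using (tendsto_pow_atTop_nhds_zero_of_lt_one (by norm_num : (0:ℝ) ≤ 1 / 2)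
      (by norm_num)).const_mul (64 / (κ * η * t))
  filter_upwards [hlim.eventually (gt_mem_nhds hη)] with n hn
  have hl : ∀ᶠ l : ℕ in atTop, (1/2:ℝ) ^ l < κ :=
    (tendsto_pow_atTop_nhds_zero_of_lt_one (by norm_num : (0:ℝ) ≤ 1 / 2)
      (by norm_num)).eventually (gt_mem_nhds hκ0)
  filter_upwards [hl] with l hl
  set L := p + l with hL
  have hL2 : (1:ℝ) / 2 ^ L < κ := by
    refine lt_of_le_of_lt ?_ hl
    rw [← one_div_pow]
    exact pow_le_pow_of_le_one (by norm_num) (by norm_num) (by omega)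
  let h : ℕ → Ω → ℝ := fun k ω => KK Y t η n (gd L k) ω - Ph (fY Y ω) (gd L k) (t / 2 ^ n)
  have hh : ∀ k, Bd (G (gd L k)) (h k) := fun k =>
    (S.KK_bd C.hM.mono ht hη (gd_nonneg _ k) n).sub
      (S.Phi_bd C.hM.mono (gd_nonneg _ k) (by positivity))
  have hA : ∀ k ω, |h k ω| ≤ 2 := fun k ω => by
    have h1 : |KK Y t η n (gd L k) ω| ≤ 1 := av_le ht hη fun r _ _ => fY_le Y ω _
    have h2 : |Ph (fY Y ω) (gd L k) (t / 2 ^ n)| ≤ 1 := Ph_le (fY_le Y ω) _ (by positivity)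
    exact (abs_sub _ _).trans (by linarith)
  have hb : ∀ k, ⌈κ * 2 ^ L⌉₊ ≤ k → ∀ ω, |h k ω| ≤ 3 * η := by
    intro k hk ω
    have hs : κ ≤ gd L k := by
      unfold gd
      rw [le_div_iff₀ (by positivity)]
      exact (Nat.le_ceil _).trans (by exact_mod_cast hk)
    have := EQ (fY_meas (S.cont ω)) (fY_le Y ω) hκ0 hs ht ht1 hη hη1 n
    exact this.trans (by linarith)
  have := (C.hM.dmg0 L).iso_two hh (j * 2 ^ l) ⌈κ * 2 ^ L⌉₊ (A := 2) (b := 3 * η)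
    (fun k _ => hA k) (fun k _ => hb k)
  simp only [gd_zero, C.hM.zero, sub_zero] at this
  have q1 := hdM (gd L (min ⌈κ * 2 ^ L⌉₊ (j * 2 ^ l))) (gd_nonneg _ _) (by
    refine (gd_mono L (min_le_left _ _)).trans ?_
    unfold gd
    rw [div_le_iff₀ (by positivity)]
    have := (Nat.ceil_lt_add_one (show 0 ≤ κ * 2 ^ L by positivity)).le
    have h3 : 1 ≤ κ * 2 ^ L := by
      rw [div_lt_iff₀ (by positivity)] at hL2; exact hL2.le
    refine this.trans ?_
    have : (0 + d) = κ + κ := by rw [hκ]; ring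
    rw [this]; linarith)
  simp only [C.hM.zero, sub_zero] at q1
  have q2 : ∫ ω, (M (gd L (j * 2 ^ l)) ω) ^ 2 ∂μ ≤ K ^ 2 := by
    have := Bd.le (μ := μ) ((C.hM.bdm (gd_nonneg L (j * 2 ^ l))).pow 2) (Bd.const m (K ^ 2))
      fun ω => sq_le_sq' (by linarith [abs_le.1 (C.hM.bdd (gd L (j * 2 ^ l)) ω)])
        (abs_le.1 (C.hM.bdd _ ω)).2
    simpa using this
  have q3 : (3 * η) ^ 2 * K ^ 2 ≤ δ / 2 := by
    rw [le_div_iff₀ (by positivity)] at hη2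
    have : η ^ 2 ≤ η := by nlinarith
    have := mul_le_mul_of_nonneg_right this (sq_nonneg K)
    nlinarith
  have q4 := mul_le_mul_of_nonneg_left q2 (sq_nonneg (3 * η))
  refine this.trans ?_
  linarith

lemma rho_gap (hρ : Measurable ρ) (t : ℝ) {θ : ℝ} (hθ : 0 < θ) :
    ∃ d > 0, μ.real {ω | t < ρ ω ∧ ρ ω < t + d} ≤ θ := by
  have h1 : Tendsto (fun k : ℕ => μ {ω | t < ρ ω ∧ ρ ω < t + 1 / ((k:ℝ) + 1)}) atTop
      (nhds (μ (⋂ k : ℕ, {ω | t < ρ ω ∧ ρ ω < t + 1 / ((k:ℝ) + 1)}))) := by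
    refine tendsto_measure_iInter_atTop (fun k => ?_) ?_ ⟨0, measure_ne_top _ _⟩
    · exact ((measurableSet_lt measurable_const hρ).inter
        (measurableSet_lt hρ measurable_const)).nullMeasurableSet
    · intro a b hab ω hω
      refine ⟨hω.1, hω.2.trans_le ?_⟩
      have : (a:ℝ) ≤ b := by exact_mod_cast hab
      have := one_div_le_one_div_of_le (by positivity : (0:ℝ) < a + 1) (by linarith : (a:ℝ) + 1 ≤ b + 1)
      linarith
  have h2 : (⋂ k : ℕ, {ω | t < ρ ω ∧ ρ ω < t + 1 / ((k:ℝ) + 1)}) = ∅ := by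
    rw [Set.eq_empty_iff_forall_notMem]
    intro ω hω
    rw [Set.mem_iInter] at hω
    obtain ⟨k, hk⟩ := exists_nat_one_div_lt (sub_pos.2 (hω 0).1)
    linarith [(hω k).2]
  rw [h2, measure_empty] at h1
  have h3 := (ENNReal.tendsto_toReal ENNReal.zero_ne_top).comp h1
  obtain ⟨k, hk⟩ := (h3.eventually (gt_mem_nhds (show (0:ENNReal).toReal < θ by simpa using hθ))).exists
  exact ⟨1 / ((k:ℝ) + 1), by positivity, hk.le⟩

lemma star (C : Core μ G M N ρ K c) (S : Sol μ G M N ρ K y Y) {p j : ℕ} (hj : 1 ≤ j)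
    (hj1 : j ≤ 2 ^ p) {ε θ : ℝ} (hε : 0 < ε) (hθ : 0 < θ) :
    ∀ᶠ n in atTop, ∀ᶠ l in atTop, μ.real {ω | gd p j < ρ ω ∧ ε < |Y (gd p j) ω - y - N (gd p j) ω -
      ∑ k ∈ Finset.range (j * 2 ^ l), Ph (fY Y ω) (gd (p + l) k) (gd p j / 2 ^ n) *
        dd M (p + l) k ω|} ≤ θ := by
  have ht : 0 < gd p j := by unfold gd; positivity
  have ht1 := gd_le_one hj1
  have hYm : ∀ v, 0 ≤ v → Measurable (Y v) := fun v hv => (S.adp v hv).mono (C.hM.le _) le_rfl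
  have hMt := C.hM.stopped ht.le
  obtain ⟨η1, hη1, hA⟩ := starA C S ht (show 0 < θ / 4 * (ε / 3) by positivity)
  obtain ⟨η2, hη2, hC⟩ := starC C S ht ht1 (show 0 < θ / 4 * (ε / 3) ^ 2 by positivity)
  obtain ⟨d, hd, hgap⟩ := rho_gap (μ := μ) C.mρ (gd p j) (show 0 < θ / 4 by positivity)
  set t := gd p j with ht'
  set η := min η1 (min η2 (d / t)) with hη
  have hη0 : 0 < η := by positivity
  have hTd : t * (1 + η) ≤ t + d := by
    have : η ≤ d / t := (min_le_right _ _).trans (min_le_right _ _)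
    rw [le_div_iff₀ ht] at this; linarith
  filter_upwards [hA η hη0 (min_le_left _ _),
    hC η hη0 ((min_le_right _ _).trans (min_le_left _ _))] with n hAn hCn
  have hB := (starB C S ht hη0 n).eventually (gt_mem_nhds (show 0 < θ / 4 * (ε / 3) by positivity))
  filter_upwards [hCn, hB] with l hCl hBl
  set L := p + l
  set A := fun ω => av t η (fun r =>
      rsum (fun s ω => psgn (Y s ω)) (fun s ω => M (min s t) ω) (max r 0) n ω) with hAdef
  set Q := fun ω => ∑ k ∈ Finset.range (j * 2 ^ l), KK Y t η n (gd L k) ω * dd M L k ω with hQ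
  set R := fun ω => ∑ k ∈ Finset.range (j * 2 ^ l), (KK Y t η n (gd L k) ω -
        Ph (fY Y ω) (gd L k) (t / 2 ^ n)) * dd M L k ω with hR
  set J : Ω → ℝ := {ω | t * (1 + η) ≤ ρ ω}.indicator (fun _ => (1:ℝ)) with hJ
  have bJ : Bd m J :=
      Bd.mk' (measurable_const.indicator (measurableSet_le measurable_const C.mρ)) 1 fun ω => by
        simp only [J, Set.indicator_apply]; split_ifs <;> simp
  have bA : Bd m A := Bd.mk' (av_meas (rsum_jm hMt.mm hMt.cont hYm S.cont n) t η) (2 ^ n * (2 * K))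
    fun ω => av_le ht hη0 fun r _ _ => rsum_abs hMt.bdd (fun s ω => (abs_psgn _).le) _ n ω
  have bK : ∀ k, Bd m (KK Y t η n (gd L k)) := fun k =>
    (S.KK_bd C.hM.mono ht hη0 (gd_nonneg _ k) n).mono (C.hM.le _)
  have bP : ∀ k, Bd m (fun ω => Ph (fY Y ω) (gd L k) (t / 2 ^ n)) := fun k =>
    (S.Phi_bd C.hM.mono (gd_nonneg _ k) (by positivity)).mono (C.hM.le _)
  have bQ : Bd m Q := Bd.sum _ fun k _ => (bK k).mul (C.hM.dbd L k)
  have bR : Bd m R := Bd.sum _ fun k _ => ((bK k).sub (bP k)).mul (C.hM.dbd L k)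
  have bY : Bd m (Y t) := Bd.mk' (hYm t ht.le) K (S.bdd t)
  have b1 := (bJ.mul (((bY.sub (C.hN.bdm ht.le)).sub (Bd.const m y)).sub bA)).abs
  have b2 := (bA.sub bQ).abs
  have b3 := bR.pow 2
  have m1 := Bd.markov (μ := μ) b1 (fun ω => abs_nonneg _)
    (A := {ω | ε / 3 ≤ |J ω * (Y t ω - N t ω - y - A ω)|}) (measurableSet_le measurable_const b1.meas)
    (show 0 < ε / 3 by positivity) (fun ω h => h)
  have m2 := Bd.markov (μ := μ) b2 (fun ω => abs_nonneg _)
    (A := {ω | ε / 3 ≤ |A ω - Q ω|}) (measurableSet_le measurable_const b2.meas)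
    (show 0 < ε / 3 by positivity) (fun ω h => h)
  have m3 := Bd.markov (μ := μ) b3 (fun ω => sq_nonneg _)
    (A := {ω | (ε / 3) ^ 2 ≤ R ω ^ 2}) (measurableSet_le measurable_const b3.meas)
    (show 0 < (ε / 3) ^ 2 by positivity) (fun ω h => h)
  have n1 : (∫ ω, |J ω * (Y t ω - N t ω - y - A ω)| ∂μ) / (ε / 3) ≤ θ / 4 := by
    rw [div_le_iff₀ (by positivity)]; exact hAn
  have n2 : (∫ ω, |A ω - Q ω| ∂μ) / (ε / 3) ≤ θ / 4 := by
    rw [div_le_iff₀ (by positivity)]; exact hBl.le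
  have n3 : (∫ ω, R ω ^ 2 ∂μ) / (ε / 3) ^ 2 ≤ θ / 4 := by
    rw [div_le_iff₀ (by positivity)]; exact hCl
  have sub : {ω | t < ρ ω ∧ ε < |Y t ω - y - N t ω -
      ∑ k ∈ Finset.range (j * 2 ^ l), Ph (fY Y ω) (gd L k) (t / 2 ^ n) * dd M L k ω|} ⊆
      ({ω | t < ρ ω ∧ ρ ω < t + d} ∪ {ω | ε / 3 ≤ |J ω * (Y t ω - N t ω - y - A ω)|}) ∪
      ({ω | ε / 3 ≤ |A ω - Q ω|} ∪ {ω | (ε / 3) ^ 2 ≤ R ω ^ 2}) := by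
    rintro ω ⟨h1, h2⟩
    by_contra hcon
    simp only [Set.mem_union, Set.mem_ofPred_eq, not_or, not_and, not_le, not_lt] at hcon
    obtain ⟨⟨c1, c2⟩, c3, c4⟩ := hcon
    have c5 : J ω = 1 := by
      rw [hJ]; exact indicator_of_mem (show ω ∈ {ω | t * (1 + η) ≤ ρ ω} from hTd.trans (c1 h1)) _
    rw [c5, one_mul] at c2
    have c6 : |R ω| < ε / 3 := abs_lt_of_sq_lt_sq c4 (by positivity)
    have e : Y t ω - y - N t ω -
      ∑ k ∈ Finset.range (j * 2 ^ l), Ph (fY Y ω) (gd L k) (t / 2 ^ n) * dd M L k ω =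
      (Y t ω - N t ω - y - A ω) + (A ω - Q ω) + R ω := by
      have : R ω = Q ω - ∑ k ∈ Finset.range (j * 2 ^ l), Ph (fY Y ω) (gd L k) (t / 2 ^ n) *
          dd M L k ω := by
        simp only [hR, hQ]
        rw [← Finset.sum_sub_distrib]
        exact Finset.sum_congr rfl fun k _ => by ring
      rw [this]; ring
    rw [e] at h2
    have := abs_add_le ((Y t ω - N t ω - y - A ω) + (A ω - Q ω)) (R ω)
    have := abs_add_le (Y t ω - N t ω - y - A ω) (A ω - Q ω)
    linarith
  refine (measureReal_mono sub).trans ((measureReal_union_le _ _).trans ?_)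
  have := measureReal_union_le (μ := μ) {ω | t < ρ ω ∧ ρ ω < t + d}
    {ω | ε / 3 ≤ |J ω * (Y t ω - N t ω - y - A ω)|}
  have := measureReal_union_le (μ := μ) {ω | ε / 3 ≤ |A ω - Q ω|} {ω | (ε / 3) ^ 2 ≤ R ω ^ 2}
  linarith

end star

section occ

lemma DM.cross {x' : ℕ → Ω → ℝ} (hx : DM μ g x) (hx' : DM μ g x') {h : ℕ → Ω → ℝ}
    (hh : ∀ k, Bd (g k) (h k)) (n : ℕ)
    (ho : ∀ k < n, ∀ Z, Bd (g k) Z → ∫ ω, Z ω * ((x (k + 1) ω - x k ω) * (x' (k + 1) ω - x' k ω)) ∂μ = 0)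
    {Z : Ω → ℝ} (hZ : Bd (g 0) Z) :
    ∫ ω, Z ω * (SDEPaper.tr h x n ω * (x' n ω - x' 0 ω)) ∂μ = 0 := by
  induction n with
  | zero => simp [tr_zero]
  | succ n ih =>
    have ih := ih fun k hk => ho k (by omega)
    have hZn : Bd (g n) Z := hZ.mono (hx.mono (Nat.zero_le n))
    have bx : Bd (g n) (fun ω => x' n ω - x' 0 ω) := (hx'.bd n).sub (hx'.bd' (Nat.zero_le n))
    have bT := hx.trbd hh n
    have z1 := hx.orth n _ ((hZn.mul bx).mul (hh n))
    have z2 := hx'.orth n _ (hZn.mul bT)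
    have z3 := ho n (by omega) _ (hZn.mul (hh n))
    have e : ∀ ω, Z ω * (SDEPaper.tr h x (n + 1) ω * (x' (n + 1) ω - x' 0 ω)) =
        ((Z ω * (SDEPaper.tr h x n ω * (x' n ω - x' 0 ω)) +
        Z ω * (x' n ω - x' 0 ω) * h n ω * (x (n + 1) ω - x n ω)) +
        Z ω * SDEPaper.tr h x n ω * (x' (n + 1) ω - x' n ω)) +
        Z ω * h n ω * ((x (n + 1) ω - x n ω) * (x' (n + 1) ω - x' n ω)) := by
      intro ω; rw [tr_succ]; ring
    rw [integral_congr_ae (Eventually.of_forall e)]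
    have l := hx.le n
    have dx := hx.dbd n
    have dx' := hx'.dbd n
    have b1 := (hZn.mul (bT.mul bx)).mono l
    have b2 := (((hZn.mul bx).mul (hh n)).mono l).mul dx
    have b3 := ((hZn.mul bT).mono l).mul dx'
    have b4 := ((hZn.mul (hh n)).mono l).mul (dx.mul dx')
    rw [integral_add ((b1.add b2).add b3).i b4.i, integral_add (b1.add b2).i b3.i,
      integral_add b1.i b2.i, ih, z1, z2, z3]
    simp

/-- block transform -/
def xi (M : ℝ → Ω → ℝ) (φ : ℕ → Ω → ℝ) (p l j : ℕ) (ω : Ω) : ℝ :=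
  ∑ i ∈ Finset.range (2 ^ l), φ (j * 2 ^ l + i) ω * dd M (p + l) (j * 2 ^ l + i) ω

variable {φ : ℕ → Ω → ℝ} {p l j : ℕ}

lemma xi_eq : xi M φ p l j = tr (fun i => φ (j * 2 ^ l + i))
    (fun i => M (gd (p + l) (j * 2 ^ l + i))) (2 ^ l) := rfl

lemma blk0e : gd (p + l) (j * 2 ^ l + 0) = gd p j := by
  rw [add_zero, gd_ref]

lemma blk1e : gd (p + l) (j * 2 ^ l + 2 ^ l) = gd p (j + 1) := by
  rw [gd_blk]

lemma xi_bd (h : Mart μ G M K) (hφ : ∀ k, Bd (G (gd (p + l) k)) (φ k)) :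
    Bd m (xi M φ p l j) := by
  rw [xi_eq]
  exact ((h.dmg (p + l) (j * 2 ^ l)).trbd (fun i => hφ (j * 2 ^ l + i)) (2 ^ l)).mono (h.le _)

lemma xi_orth (h : Mart μ G M K) (hφ : ∀ k, Bd (G (gd (p + l) k)) (φ k)) {Z : Ω → ℝ}
    (hZ : Bd (G (gd p j)) Z) : ∫ ω, Z ω * xi M φ p l j ω ∂μ = 0 := by
  have hd := (h.dmg (p + l) (j * 2 ^ l)).tr (fun i => hφ (j * 2 ^ l + i))
  have hZ' : Bd (G (gd (p + l) (j * 2 ^ l + 0))) Z := by rw [add_zero, gd_ref]; exact hZ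
  have := hd.orth' 0 (2 ^ l) Z hZ'
  simp only [zero_add, tr_zero, sub_zero] at this
  exact this

lemma xi_sq (h : Mart μ G M K) (hφ : ∀ k, Bd (G (gd (p + l) k)) (φ k))
    (h1 : ∀ k ω, |φ k ω| ≤ 1) : ∫ ω, xi M φ p l j ω ^ 2 ∂μ ≤ ∫ ω, dd M p j ω ^ 2 ∂μ := by
  have := (h.dmg (p + l) (j * 2 ^ l)).iso_le (fun i => hφ (j * 2 ^ l + i)) (2 ^ l) (C := 1)
    (fun k _ ω => h1 _ ω)
  rw [one_pow, one_mul, blk0e, blk1e] at this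
  exact this

lemma xi_four (h : Mart μ G M K) (hφ : ∀ k, Bd (G (gd (p + l) k)) (φ k))
    (h1 : ∀ k ω, |φ k ω| ≤ 1) : ∫ ω, xi M φ p l j ω ^ 4 ∂μ ≤ 326 * ∫ ω, qb M M p l j ω ^ 2 ∂μ := by
  have := (h.dmg (p + l) (j * 2 ^ l)).bdg4 (fun i => hφ (j * 2 ^ l + i))
    (fun k ω => h1 _ ω) (2 ^ l)
  simp only [qb_eq]
  exact this

lemma xi_one (M : ℝ → Ω → ℝ) : xi M (fun _ _ => (1:ℝ)) p l j = dd M p j := by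
  ext ω
  unfold xi dd
  simp only [one_mul]
  have := Finset.sum_range_sub (fun i => M (gd (p + l) (j * 2 ^ l + i)) ω) (2 ^ l)
  rw [blk0e, blk1e] at this
  exact this

lemma dd_four (h : Mart μ G M K) (p l j : ℕ) :
    ∫ ω, dd M p j ω ^ 4 ∂μ ≤ 326 * ∫ ω, qb M M p l j ω ^ 2 ∂μ := by
  have := xi_four (p := p) (l := l) (j := j) h (φ := fun _ _ => (1:ℝ)) (fun k => Bd.const _ 1)
    (fun _ _ => by simp)
  rwa [xi_one] at this

lemma xi_cross (C : Core μ G M N ρ K c) (hj : j < 2 ^ p)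
    (hφ : ∀ k, Bd (G (gd (p + l) k)) (φ k)) {Z : Ω → ℝ}
    (hZ : Bd (G (gd p j)) Z) : ∫ ω, Z ω * (xi M φ p l j ω * dd N p j ω) ∂μ = 0 := by
  have hZ' : Bd (G (gd (p + l) (j * 2 ^ l + 0))) Z := by rw [add_zero, gd_ref]; exact hZ
  have := (C.hM.dmg (p + l) (j * 2 ^ l)).cross (C.hN.dmg (p + l) (j * 2 ^ l))
    (fun i => hφ (j * 2 ^ l + i)) (2 ^ l) (fun k hk Z hZ => by
      have hlt : j * 2 ^ l + k < 2 ^ (p + l) := by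
        have := blk_le (p := p) (l := l) hj (Nat.succ_le_of_lt hk); omega
      exact C.orth hlt hZ) hZ'
  rw [blk0e, blk1e] at this
  exact this

lemma xi_dom (C : Core μ G M N ρ K c) (hj : j < 2 ^ p)
    (hφ : ∀ k, Bd (G (gd (p + l) k)) (φ k)) {Z : Ω → ℝ}
    (hZ : Bd (G (gd p j)) Z) (hZ0 : ∀ ω, 0 ≤ Z ω) :
    ∫ ω, Z ω * dd N p j ω ^ 2 ∂μ ≤ ∫ ω, Z ω * (dd N p j ω + xi M φ p l j ω) ^ 2 ∂μ := by
  have c0 := xi_cross C hj hφ hZ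
  have bZ := hZ.mono (C.hM.le _)
  have bN := C.hN.dbd p j
  have bx := xi_bd (j := j) C.hM hφ
  have e : ∀ ω, Z ω * (dd N p j ω + xi M φ p l j ω) ^ 2 =
      (Z ω * dd N p j ω ^ 2 + 2 * (Z ω * (xi M φ p l j ω * dd N p j ω))) +
        Z ω * xi M φ p l j ω ^ 2 := fun ω => by ring
  rw [integral_congr_ae (Eventually.of_forall e)]
  have b1 := bZ.mul (bN.pow 2)
  have b2 := (Bd.const m 2).mul (bZ.mul (bx.mul bN))
  have b3 := bZ.mul (bx.pow 2)
  rw [integral_add (b1.add b2).i b3.i, integral_add b1.i b2.i, integral_const_mul, c0]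
  have : 0 ≤ ∫ ω, Z ω * xi M φ p l j ω ^ 2 ∂μ :=
    integral_nonneg fun ω => mul_nonneg (hZ0 ω) (sq_nonneg _)
  linarith

lemma cube_le (x : ℝ) {la : ℝ} (hl : 0 < la) : |x| ^ 3 ≤ la * x ^ 2 + x ^ 4 / la := by
  have h : la * (la * x ^ 2 + x ^ 4 / la - |x| ^ 3) =
      x ^ 2 * ((la - |x| / 2) ^ 2 + 3 / 4 * x ^ 2) := by
    have e2 : x ^ 2 = |x| ^ 2 := (sq_abs x).symm
    have e4 : x ^ 4 = |x| ^ 4 := by rw [← abs_pow]; exact (abs_of_nonneg (by positivity)).symm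
    rw [e4, e2]; field_simp; ring
  have h2 : 0 ≤ la * (la * x ^ 2 + x ^ 4 / la - |x| ^ 3) := by rw [h]; positivity
  have := nonneg_of_mul_nonneg_right h2 hl
  linarith

/-- third moments -/
lemma xi_three (C : Core μ G M N ρ K c) (hφ : ∀ k, Bd (G (gd (p + l) k)) (φ k))
    (h1 : ∀ k ω, |φ k ω| ≤ 1) {la : ℝ} (hl : 0 < la) :
    ∫ ω, |dd N p j ω + xi M φ p l j ω| ^ 3 ∂μ ≤
      2 * la * ((∫ ω, dd N p j ω ^ 2 ∂μ) + ∫ ω, dd M p j ω ^ 2 ∂μ) +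
      2608 / la * ((∫ ω, qb N N p l j ω ^ 2 ∂μ) + ∫ ω, qb M M p l j ω ^ 2 ∂μ) := by
  have bN := C.hN.dbd p j
  have bx := xi_bd (j := j) C.hM hφ
  have s2 := xi_sq (j := j) C.hM hφ h1
  have s4 := xi_four (j := j) C.hM hφ h1
  have n4 := dd_four C.hN p l j
  have b1 := (Bd.const m (2 * la)).mul (bN.pow 2)
  have b2 := (Bd.const m (2 * la)).mul (bx.pow 2)
  have b3 := (Bd.const m (8 / la)).mul (bN.pow 4)
  have b4 := (Bd.const m (8 / la)).mul (bx.pow 4)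
  have := Bd.le (μ := μ) ((bN.add bx).abs.pow 3) (((b1.add b2).add b3).add b4) fun ω => by
    set a := dd N p j ω
    set b := xi M φ p l j ω
    refine (cube_le (a + b) hl).trans ?_
    have e1 : (a + b) ^ 2 ≤ 2 * a ^ 2 + 2 * b ^ 2 := by nlinarith [sq_nonneg (a - b)]
    have e2 : (a + b) ^ 4 ≤ 8 * a ^ 4 + 8 * b ^ 4 := by
      have : (a + b) ^ 4 ≤ (2 * a ^ 2 + 2 * b ^ 2) ^ 2 := by
        have := pow_le_pow_left₀ (sq_nonneg (a + b)) e1 2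
        calc (a + b) ^ 4 = ((a + b) ^ 2) ^ 2 := by ring
          _ ≤ _ := this
      nlinarith [sq_nonneg (a ^ 2 - b ^ 2)]
    have e3 := mul_le_mul_of_nonneg_left e1 hl.le
    have e4 := div_le_div_of_nonneg_right e2 hl.le
    have e5 : (8 * a ^ 4 + 8 * b ^ 4) / la = 8 / la * a ^ 4 + 8 / la * b ^ 4 := by ring
    rw [e5] at e4
    linarith
  rw [integral_add ((b1.add b2).add b3).i b4.i, integral_add (b1.add b2).i b3.i,
    integral_add b1.i b2.i, integral_const_mul, integral_const_mul, integral_const_mul,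
    integral_const_mul] at this
  have p1 : 0 ≤ 2 * la := by positivity
  have p2 : 0 ≤ 8 / la := by positivity
  have q1 := mul_le_mul_of_nonneg_left s2 p1
  have q2 := mul_le_mul_of_nonneg_left s4 p2
  have q3 := mul_le_mul_of_nonneg_left n4 p2
  have e : 2608 / la = 8 / la * 326 := by ring
  rw [e]
  linarith

lemma fq_le_abs {e : ℝ} (he : 0 < e) (u : ℝ) : fq e u 0 ≤ |u| + e := by
  refine Real.sqrt_le_iff.2 ⟨by positivity, ?_⟩
  have := abs_nonneg u
  have := mul_nonneg this he.le
  nlinarith [sq_abs u]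

open Classical in
lemma occ {e : ℝ} (he : 0 < e) {n : ℕ} {yy z D Δ d : ℕ → Ω → ℝ}
    (by' : ∀ j, Bd m (yy j)) (bz : ∀ j, Bd m (z j)) (bD : ∀ j, Bd m (D j)) (bΔ : ∀ j, Bd m (Δ j))
    (bd : ∀ j, Bd m (d j)) (h1 : ∀ j < n, ∀ ω, yy (j + 1) ω = z j ω + Δ j ω)
    (h2 : ∀ j < n, ∀ ω, z j ω = yy j ω + D j ω)
    (hΔ : ∀ j < n, ∫ ω, z j ω / fq e (z j ω) 0 * Δ j ω ∂μ = 0)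
    (hd : ∀ j < n, ∫ ω, e ^ 2 / fq e (z j ω) 0 ^ 3 * d j ω ^ 2 ∂μ ≤
      ∫ ω, e ^ 2 / fq e (z j ω) 0 ^ 3 * Δ j ω ^ 2 ∂μ) :
    ∑ j ∈ Finset.range n, ∫ ω, (if |z j ω| ≤ e then (1:ℝ) else 0) * d j ω ^ 2 ∂μ ≤
      6 * e * ((∫ ω, fq e (yy n ω) 0 ∂μ) + (∑ j ∈ Finset.range n, ∫ ω, |D j ω| ∂μ) +
        3 / e ^ 2 * ∑ j ∈ Finset.range n, ∫ ω, |Δ j ω| ^ 3 ∂μ) := by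
  have cf : Continuous fun u : ℝ => fq e u 0 :=
    (fq_cont e).comp (continuous_id.prodMk continuous_const)
  have hne : ∀ u, fq e u 0 ≠ 0 := fun u => (fq_pos he u 0).ne'
  have bf : ∀ f, Bd m f → Bd m (fun ω => fq e (f ω) 0) := fun f hf => hf.comp cf
  have bg1 : ∀ f, Bd m f → Bd m (fun ω => f ω / fq e (f ω) 0) := fun f hf =>
    hf.comp (φ := fun u => u / fq e u 0) (continuous_id.div cf hne)
  have bg2 : ∀ f, Bd m f → Bd m (fun ω => e ^ 2 / fq e (f ω) 0 ^ 3) := fun f hf =>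
    hf.comp (φ := fun u => e ^ 2 / fq e u 0 ^ 3)
      (continuous_const.div (cf.pow 3) fun u => pow_ne_zero 3 (hne u))
  have step : ∀ j < n, ∫ ω, (if |z j ω| ≤ e then (1:ℝ) else 0) * d j ω ^ 2 ∂μ ≤
      6 * e * ((∫ ω, fq e (yy (j + 1) ω) 0 ∂μ) - (∫ ω, fq e (yy j ω) 0 ∂μ) +
        (∫ ω, |D j ω| ∂μ) + 3 / e ^ 2 * ∫ ω, |Δ j ω| ^ 3 ∂μ) := by
    intro j hj
    have bi : Bd m (fun ω => if |z j ω| ≤ e then (1:ℝ) else 0) :=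
      Bd.ind (measurableSet_le (bz j).meas.abs measurable_const)
    have s1 := Bd.le (μ := μ) (bi.mul ((bd j).pow 2))
      ((Bd.const m (3 * e)).mul ((bg2 _ (bz j)).mul ((bd j).pow 2))) fun ω => by
        split_ifs with h
        · have := mul_le_mul_of_nonneg_right (ind_le_g2 he h) (sq_nonneg (d j ω))
          linarith
        · have := fq_pos he (z j ω) 0
          rw [zero_mul]; positivity
    rw [integral_const_mul] at s1
    have s2 := mul_le_mul_of_nonneg_left (hd j hj) (by positivity : 0 ≤ 3 * e)
    have b1 := bf _ (by' j)
    have b2 := (bD j).abs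
    have b3 := (bg1 _ (bz j)).mul (bΔ j)
    have b4 := (Bd.const m (1/2)).mul ((bg2 _ (bz j)).mul ((bΔ j).pow 2))
    have b5 := (Bd.const m (3 / e ^ 2)).mul ((bΔ j).abs.pow 3)
    have s3 := Bd.le (μ := μ) ((((b1.sub b2).add b3).add b4).sub b5) (bf _ (by' (j + 1)))
      fun ω => by
        have t1 := fq_lower he (z j ω) 0 (Δ j ω) 0
        have t2 := fq_lip he (yy j ω) 0 (D j ω) 0
        rw [← h2 j hj] at t2
        simp only [add_zero, zero_pow two_ne_zero, mul_zero, zero_mul, zero_div, sub_zero, zero_add,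
          Real.sqrt_sq_eq_abs] at t1 t2
        rw [h1 j hj]
        have t3 := (abs_le.1 t2).1
        have t4 : e ^ 2 / (2 * fq e (z j ω) 0 ^ 3) * Δ j ω ^ 2 =
          1 / 2 * (e ^ 2 / fq e (z j ω) 0 ^ 3 * Δ j ω ^ 2) := by
          have := (fq_pos he (z j ω) 0).ne'
          field_simp
        have t5 : 3 * |Δ j ω| ^ 3 / e ^ 2 = 3 / e ^ 2 * |Δ j ω| ^ 3 := by ring
        rw [t4, t5] at t1
        linarith
    rw [integral_sub (((b1.sub b2).add b3).add b4).i b5.i, integral_add ((b1.sub b2).add b3).i b4.i,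
      integral_add (b1.sub b2).i b3.i, integral_sub b1.i b2.i, hΔ j hj, integral_const_mul,
      integral_const_mul] at s3
    have s4 := mul_le_mul_of_nonneg_left s3 (by positivity : 0 ≤ 6 * e)
    linarith
  refine (Finset.sum_le_sum fun j hj => step j (Finset.mem_range.1 hj)).trans ?_
  rw [← Finset.mul_sum, Finset.sum_add_distrib, Finset.sum_add_distrib, ← Finset.mul_sum,
    Finset.sum_range_sub (fun j => ∫ ω, fq e (yy j ω) 0 ∂μ)]
  refine mul_le_mul_of_nonneg_left ?_ (by positivity)
  have : 0 ≤ ∫ ω, fq e (yy 0 ω) 0 ∂μ := integral_nonneg fun ω => (fq_pos he _ _).le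
  linarith

end occ

section occC
variable {Y : ℝ → Ω → ℝ} {y : ℝ}

/-- discretised smoothed stochastic integral -/
def PS (Y M : ℝ → Ω → ℝ) (p l : ℕ) (δ : ℝ) (j : ℕ) (ω : Ω) : ℝ :=
  ∑ k ∈ Finset.range (j * 2 ^ l), Ph (fY Y ω) (gd (p + l) k) δ * dd M (p + l) k ω

lemma PS_eq (p l : ℕ) (δ : ℝ) (j : ℕ) : PS Y M p l δ j =
    tr (fun k ω => Ph (fY Y ω) (gd (p + l) k) δ) (fun k => M (gd (p + l) k)) (j * 2 ^ l) := rfl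

lemma PS_bd (C : Core μ G M N ρ K c) (S : Sol μ G M N ρ K y Y) (p l : ℕ) {δ : ℝ} (hδ : 0 < δ)
    (j : ℕ) : Bd (G (gd p j)) (PS Y M p l δ j) := by
  rw [PS_eq]
  have := (C.hM.dmg0 (p + l)).trbd (fun k => S.Phi_bd C.hM.mono (gd_nonneg (p + l) k) hδ) (j * 2 ^ l)
  rwa [gd_ref] at this

lemma PS_bdm (C : Core μ G M N ρ K c) (S : Sol μ G M N ρ K y Y) (p l : ℕ) {δ : ℝ} (hδ : 0 < δ)
    (j : ℕ) : Bd m (PS Y M p l δ j) := (PS_bd C S p l hδ j).mono (C.hM.le _)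

lemma Mart.sqK (h : Mart μ G X K) {t : ℝ} (ht : 0 ≤ t) : ∫ ω, X t ω ^ 2 ∂μ ≤ K ^ 2 := by
  have := Bd.le (μ := μ) ((h.bdm ht).pow 2) (Bd.const m (K ^ 2)) fun ω =>
    sq_le_sq' (abs_le.1 (h.bdd t ω)).1 (abs_le.1 (h.bdd t ω)).2
  simpa only [integral_const, probReal_univ, one_smul] using this

lemma Mart.sum_sq (h : Mart μ G X K) (p n : ℕ) :
    ∑ j ∈ Finset.range n, ∫ ω, dd X p j ω ^ 2 ∂μ = ∫ ω, X (gd p n) ω ^ 2 ∂μ := by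
  have := (h.dmg0 p).sq n
  simp only [gd_zero, h.zero, sub_zero] at this
  exact this.symm

lemma PS_sq (C : Core μ G M N ρ K c) (S : Sol μ G M N ρ K y Y) (p l : ℕ) {δ : ℝ} (hδ : 0 < δ)
    (j : ℕ) : ∫ ω, PS Y M p l δ j ω ^ 2 ∂μ ≤ K ^ 2 := by
  rw [PS_eq]
  have := (C.hM.dmg0 (p + l)).iso_le (fun k => S.Phi_bd C.hM.mono (gd_nonneg (p + l) k) hδ)
    (j * 2 ^ l) (C := 1) fun k _ ω => Ph_le (fY_le Y ω) _ hδ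
  simp only [gd_zero, C.hM.zero, sub_zero, one_pow, one_mul] at this
  exact this.trans (C.hM.sqK (gd_nonneg _ _))

lemma PS_diff (C : Core μ G M N ρ K c) (S : Sol μ G M N ρ K y Y) (p l n : ℕ)
    {j : ℕ} (hj : 1 ≤ j) :
    ∫ ω, (PS Y M p l (gd p (j + 1) / 2 ^ n) j ω - PS Y M p l (gd p j / 2 ^ n) j ω) ^ 2 ∂μ ≤
      4 * K ^ 2 / (j + 1) ^ 2 := by
  have hj0 : (0:ℝ) < j := by exact_mod_cast hj
  have d0 : 0 < gd p j / 2 ^ n := by unfold gd; positivity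
  have d1 : 0 < gd p (j + 1) / 2 ^ n := by unfold gd; positivity
  have hd : gd p j / 2 ^ n ≤ gd p (j + 1) / 2 ^ n :=
    div_le_div_of_nonneg_right (gd_mono p (Nat.le_succ j)) (by positivity)
  have e : (fun ω => PS Y M p l (gd p (j + 1) / 2 ^ n) j ω - PS Y M p l (gd p j / 2 ^ n) j ω) =
      tr (fun k ω => Ph (fY Y ω) (gd (p + l) k) (gd p (j + 1) / 2 ^ n) -
        Ph (fY Y ω) (gd (p + l) k) (gd p j / 2 ^ n)) (fun k => M (gd (p + l) k)) (j * 2 ^ l) := by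
    ext ω
    simp only [PS, tr, dd, ← Finset.sum_sub_distrib, sub_mul]
  have := (C.hM.dmg0 (p + l)).iso_le (fun k =>
      (S.Phi_bd C.hM.mono (gd_nonneg (p + l) k) d1).sub (S.Phi_bd C.hM.mono (gd_nonneg (p + l) k) d0))
    (j * 2 ^ l) (C := 2 / (j + 1)) fun k _ ω => by
      refine (Ph_lip (fY_meas (S.cont ω)) (fY_le Y ω) (gd (p + l) k) d0 hd).trans (le_of_eq ?_)
      unfold gd
      push_cast
      field_simp
      ring
  rw [← e] at this
  simp only [gd_zero, C.hM.zero, sub_zero] at this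
  refine this.trans ((mul_le_mul_of_nonneg_left (C.hM.sqK (gd_nonneg _ _)) (by positivity)).trans
    (le_of_eq ?_))
  field_simp
  ring

lemma PS_succ (p l : ℕ) (δ : ℝ) (j : ℕ) (ω : Ω) : PS Y M p l δ (j + 1) ω = PS Y M p l δ j ω +
    xi M (fun k ω => Ph (fY Y ω) (gd (p + l) k) δ) p l j ω := by
  unfold PS xi
  rw [add_mul, one_mul, Finset.sum_range_add]

open Classical in
/-- occupation bound on the grid -/
lemma occ_grid (C : Core μ G M N ρ K c) (S : Sol μ G M N ρ K y Y) (p l n r : ℕ) {J : ℕ} (hJ : 1 ≤ J)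
    (hr : J + r ≤ 2 ^ p) {e : ℝ} (he : 0 < e) {la : ℝ} (hla : 0 < la) :
    ∑ j ∈ Finset.range r, ∫ ω, (if |y + N (gd p (J + j)) ω +
        PS Y M p l (gd p (J + j + 1) / 2 ^ n) (J + j) ω| ≤ e then (1:ℝ) else 0) *
          dd N p (J + j) ω ^ 2 ∂μ ≤
      6 * e * ((|y| + K + (1 + K ^ 2) + e) + r * ((1 + 4 * K ^ 2) / J) +
        3 / e ^ 2 * (4 * la * K ^ 2 + 2608 / la *
          ((∑ j ∈ Finset.range (2 ^ p), ∫ ω, qb N N p l j ω ^ 2 ∂μ) +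
            ∑ j ∈ Finset.range (2 ^ p), ∫ ω, qb M M p l j ω ^ 2 ∂μ))) := by
  have hJ0 : (0:ℝ) < J := by exact_mod_cast hJ
  have dpos : ∀ j, 0 < gd p (J + j) / 2 ^ n := fun j => by unfold gd; positivity
  have dpos' : ∀ j, 0 < gd p (J + j + 1) / 2 ^ n := fun j => by unfold gd; positivity
  have bN : ∀ j, Bd m (fun ω => y + N (gd p j) ω) := fun j =>
    (Bd.const m y).add (C.hN.bdm (gd_nonneg _ _))
  have bNG : ∀ j, Bd (G (gd p j)) (fun ω => y + N (gd p j) ω) := fun j =>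
    (Bd.const _ y).add (C.hN.bd (gd_nonneg _ _))
  have hφ : ∀ j k, Bd (G (gd (p + l) k))
      (fun ω => Ph (fY Y ω) (gd (p + l) k) (gd p (J + j + 1) / 2 ^ n)) := fun j k =>
    S.Phi_bd C.hM.mono (gd_nonneg _ _) (dpos' j)
  have hφ1 : ∀ j k ω, |Ph (fY Y ω) (gd (p + l) k) (gd p (J + j + 1) / 2 ^ n)| ≤ 1 := fun j k ω =>
    Ph_le (fY_le Y ω) _ (dpos' j)
  have bzG : ∀ j, Bd (G (gd p (J + j))) (fun ω => y + N (gd p (J + j)) ω +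
        PS Y M p l (gd p (J + j + 1) / 2 ^ n) (J + j) ω) := fun j =>
    (bNG _).add (PS_bd C S p l (dpos' j) _)
  have cf : Continuous fun u : ℝ => fq e u 0 :=
    (fq_cont e).comp (continuous_id.prodMk continuous_const)
  have hne : ∀ u, fq e u 0 ≠ 0 := fun u => (fq_pos he u 0).ne'
  have key := occ (μ := μ) he (n := r)
    (yy := fun j ω => y + N (gd p (J + j)) ω + PS Y M p l (gd p (J + j) / 2 ^ n) (J + j) ω)
    (z := fun j ω => y + N (gd p (J + j)) ω + PS Y M p l (gd p (J + j + 1) / 2 ^ n) (J + j) ω)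
    (D := fun j ω => PS Y M p l (gd p (J + j + 1) / 2 ^ n) (J + j) ω -
      PS Y M p l (gd p (J + j) / 2 ^ n) (J + j) ω)
    (Δ := fun j ω => dd N p (J + j) ω + xi M (fun k ω => Ph (fY Y ω) (gd (p + l) k)
      (gd p (J + j + 1) / 2 ^ n)) p l (J + j) ω)
    (d := fun j => dd N p (J + j))
    (fun j => (bN _).add (PS_bdm C S p l (dpos j) _))
    (fun j => (bzG j).mono (C.hM.le _))
    (fun j => (PS_bdm C S p l (dpos' j) _).sub (PS_bdm C S p l (dpos j) _))
    (fun j => (C.hN.dbd _ _).add (xi_bd C.hM (hφ j)))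
    (fun j => C.hN.dbd _ _)
    (fun j _ ω => by
      have := PS_succ (Y := Y) (M := M) p l (gd p (J + j + 1) / 2 ^ n) (J + j) ω
      rw [← add_assoc, this]
      unfold dd
      ring)
    (fun j _ ω => by ring)
    (fun j hj => by
      have bZ := (bzG j).comp (φ := fun u => u / fq e u 0) (continuous_id.div cf hne)
      have z1 := C.hN.orth _ _ (gd_nonneg p (J + j)) (gd_mono p (Nat.le_succ _)) _ bZ
      have z2 := xi_orth C.hM (hφ j) bZ
      have bm := bZ.mono (C.hM.le _)
      simp only [mul_add]
      rw [integral_add (bm.mul (C.hN.dbd _ _)).i (bm.mul (xi_bd C.hM (hφ j))).i, z2]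
      unfold dd
      rw [z1, add_zero])
    (fun j hj => by
      have bZ := (bzG j).comp (φ := fun u => e ^ 2 / fq e u 0 ^ 3)
        (continuous_const.div (cf.pow 3) fun u => pow_ne_zero 3 (hne u))
      exact xi_dom C (by omega) (hφ j) bZ fun ω => by
        have := fq_pos he (y + N (gd p (J + j)) ω +
          PS Y M p l (gd p (J + j + 1) / 2 ^ n) (J + j) ω) 0
        positivity)
  refine key.trans (mul_le_mul_of_nonneg_left ?_ (by positivity))
  refine add_le_add (add_le_add ?_ ?_) (mul_le_mul_of_nonneg_left ?_ (by positivity))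
  · have bP := PS_bdm C S p l (dpos r) (J + r)
    have t1 := L1_of_L2 (μ := μ) bP one_pos
    rw [div_one] at t1
    have t2 := PS_sq C S p l (dpos r) (J + r)
    have bf : Bd m (fun ω => fq e (y + N (gd p (J + r)) ω +
        PS Y M p l (gd p (J + r) / 2 ^ n) (J + r) ω) 0) := ((bN _).add bP).comp cf
    have t3 := Bd.le (μ := μ) bf ((Bd.const m (|y| + K + e)).add bP.abs) fun ω => by
      refine (fq_le_abs he _).trans ?_
      have u1 := abs_add_le (y + N (gd p (J + r)) ω) (PS Y M p l (gd p (J + r) / 2 ^ n) (J + r) ω)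
      have u2 := abs_add_le y (N (gd p (J + r)) ω)
      have u3 := C.hN.bdd (gd p (J + r)) ω
      linarith
    rw [integral_add (Bd.const m _).i bP.abs.i] at t3
    simp only [integral_const, probReal_univ, one_smul] at t3
    linarith
  · have : ∀ j ∈ Finset.range r, ∫ ω, |PS Y M p l (gd p (J + j + 1) / 2 ^ n) (J + j) ω -
      PS Y M p l (gd p (J + j) / 2 ^ n) (J + j) ω| ∂μ ≤ (1 + 4 * K ^ 2) / J := fun j _ => by
      have hp : (0:ℝ) < (J + j : ℕ) + 1 := by positivity
      have t := L1_of_L2 (μ := μ) ((PS_bdm C S p l (dpos' j) (J + j)).sub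
        (PS_bdm C S p l (dpos j) (J + j))) (a := 1 / ((J + j : ℕ) + 1)) (by positivity)
      have t2 := PS_diff C S p l n (j := J + j) (by omega)
      have t3 := div_le_div_of_nonneg_right t2
        (show (0:ℝ) ≤ 1 / ((J + j : ℕ) + 1) by positivity)
      have t4 : 4 * K ^ 2 / (((J + j : ℕ):ℝ) + 1) ^ 2 / (1 / ((J + j : ℕ) + 1)) =
        4 * K ^ 2 / ((J + j : ℕ) + 1) := by field_simp
      have t5 : (1 + 4 * K ^ 2) / (((J + j : ℕ):ℝ) + 1) ≤ (1 + 4 * K ^ 2) / J :=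
        div_le_div_of_nonneg_left (by positivity) hJ0 (by push_cast; linarith [Nat.cast_nonneg (α := ℝ) j])
      rw [t4] at t3
      refine t.trans ((add_le_add_right t3 _).trans ((le_of_eq ?_).trans t5))
      ring
    refine (Finset.sum_le_sum this).trans ?_
    simp
  · refine (Finset.sum_le_sum fun j _ => xi_three (j := J + j) C (hφ j) (hφ1 j) hla).trans ?_
    have sub : ∀ f : ℕ → ℝ, (∀ j, 0 ≤ f j) → ∑ j ∈ Finset.range r, f (J + j) ≤
        ∑ j ∈ Finset.range (2 ^ p), f j := fun f hf => by
      refine le_trans ?_ (Finset.sum_le_sum_of_subset_of_nonneg (s := Finset.range (J + r))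
        (Finset.range_subset_range.2 hr) fun j _ _ => hf j)
      rw [Finset.sum_range_add]
      have : 0 ≤ ∑ j ∈ Finset.range J, f j := Finset.sum_nonneg fun j _ => hf j
      linarith
    have a1 := sub (fun j => ∫ ω, dd N p j ω ^ 2 ∂μ) fun j => integral_nonneg fun ω => sq_nonneg _
    have a2 := sub (fun j => ∫ ω, dd M p j ω ^ 2 ∂μ) fun j => integral_nonneg fun ω => sq_nonneg _
    have a3 := sub (fun j => ∫ ω, qb N N p l j ω ^ 2 ∂μ) fun j => integral_nonneg fun ω => sq_nonneg _
    have a4 := sub (fun j => ∫ ω, qb M M p l j ω ^ 2 ∂μ) fun j => integral_nonneg fun ω => sq_nonneg _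
    rw [C.hN.sum_sq] at a1
    rw [C.hM.sum_sq] at a2
    have k1 := C.hN.sqK (gd_nonneg p (2 ^ p))
    have k2 := C.hM.sqK (gd_nonneg p (2 ^ p))
    rw [Finset.sum_add_distrib, ← Finset.mul_sum, ← Finset.mul_sum, Finset.sum_add_distrib,
      Finset.sum_add_distrib]
    have b1 := mul_le_mul_of_nonneg_left ((add_le_add a1 a2).trans (add_le_add k1 k2))
      (by positivity : 0 ≤ 2 * la)
    have b2 := mul_le_mul_of_nonneg_left (add_le_add a3 a4) (by positivity : 0 ≤ 2608 / la)
    linarith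

end occC

section occD
variable {Y : ℝ → Ω → ℝ} {y : ℝ}

lemma ind_int {A : Set Ω} (hA : MeasurableSet A) [DecidablePred (· ∈ A)] (a : ℝ) :
    ∫ ω, (if ω ∈ A then (1:ℝ) else 0) * a ∂μ = μ.real A * a := by
  rw [integral_mul_const]
  congr 1
  have : (fun ω => if ω ∈ A then (1:ℝ) else 0) = A.indicator 1 := by
    ext ω; simp [Set.indicator_apply]
  rw [this, integral_indicator_one hA]

open Classical in
/-- one grid, with the approximations -/
lemma occ_step (C : Core μ G M N ρ K c) (S : Sol μ G M N ρ K y Y) (p l n : ℕ) {j : ℕ} (hj : 1 ≤ j)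
    {ε θ : ℝ} (hε : 0 < ε)
    (hs : μ.real {ω | gd p j < ρ ω ∧ ε < |Y (gd p j) ω - y - N (gd p j) ω -
      PS Y M p l (gd p j / 2 ^ n) j ω|} ≤ θ) :
    ∫ ω, (if |Y (gd p j) ω| ≤ ε then (1:ℝ) else 0) * dd N p j ω ^ 2 ∂μ ≤
      (∫ ω, (if |y + N (gd p j) ω + PS Y M p l (gd p (j + 1) / 2 ^ n) j ω| ≤ 3 * ε then (1:ℝ) else 0) *
          dd N p j ω ^ 2 ∂μ) + θ * (4 * K ^ 2) + 4 * K ^ 2 / (j + 1) ^ 2 / ε ^ 2 * (4 * K ^ 2) := by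
  have hj0 : (0:ℝ) < j := by exact_mod_cast hj
  have d0 : 0 < gd p j / 2 ^ n := by unfold gd; positivity
  have d1 : 0 < gd p (j + 1) / 2 ^ n := by unfold gd; positivity
  have bY : Bd m (Y (gd p j)) :=
    ⟨(S.adp _ (gd_nonneg _ _)).mono (C.hM.le _) le_rfl, K, S.bdd _⟩
  have bN : Bd m (N (gd p j)) := C.hN.bdm (gd_nonneg _ _)
  have b0 := PS_bdm C S p l d0 j
  have b1 := PS_bdm C S p l d1 j
  have bD := b1.sub b0
  have bE := ((bY.sub (Bd.const m y)).sub bN).sub b0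
  have hA : MeasurableSet {ω | gd p j < ρ ω ∧ ε < |Y (gd p j) ω - y - N (gd p j) ω -
      PS Y M p l (gd p j / 2 ^ n) j ω|} :=
    (measurableSet_lt measurable_const C.mρ).inter (measurableSet_lt measurable_const bE.meas.abs)
  have hB : MeasurableSet {ω | ε < |PS Y M p l (gd p (j + 1) / 2 ^ n) j ω -
      PS Y M p l (gd p j / 2 ^ n) j ω|} := measurableSet_lt measurable_const bD.meas.abs
  have hPB := Bd.markov (μ := μ) (bD.pow 2) (fun ω => sq_nonneg _) hB (a := ε ^ 2) (by positivity)
    fun ω hω => by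
      rw [← sq_abs (PS Y M p l (gd p (j + 1) / 2 ^ n) j ω - PS Y M p l (gd p j / 2 ^ n) j ω)]
      exact pow_le_pow_left₀ hε.le (le_of_lt hω) 2
  have hPB := hPB.trans (div_le_div_of_nonneg_right (PS_diff C S p l n hj) (by positivity))
  set A := {ω | gd p j < ρ ω ∧ ε < |Y (gd p j) ω - y - N (gd p j) ω -
      PS Y M p l (gd p j / 2 ^ n) j ω|} with hAd
  set B := {ω | ε < |PS Y M p l (gd p (j + 1) / 2 ^ n) j ω -
      PS Y M p l (gd p j / 2 ^ n) j ω|} with hBd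
  have bdN := (C.hN.dbd p j).pow 2
  have i1 := (Bd.ind (p := fun ω => |Y (gd p j) ω| ≤ ε)
    (measurableSet_le bY.meas.abs measurable_const)).mul bdN
  have i2 := (Bd.ind (p := fun ω => |y + N (gd p j) ω + PS Y M p l (gd p (j + 1) / 2 ^ n) j ω| ≤ 3 * ε)
    (measurableSet_le (((Bd.const m y).add bN).add b1).meas.abs measurable_const)).mul bdN
  have i3 := (Bd.ind (p := fun ω => ω ∈ A) hA).mul (Bd.const m (4 * K ^ 2))
  have i4 := (Bd.ind (p := fun ω => ω ∈ B) hB).mul (Bd.const m (4 * K ^ 2))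
  have := Bd.le (μ := μ) i1 ((i2.add i3).add i4) fun ω => by
    have hdK : dd N p j ω ^ 2 ≤ 4 * K ^ 2 := by
      have u1 := abs_le.1 (C.hN.bdd (gd p j) ω)
      have u2 := abs_le.1 (C.hN.bdd (gd p (j + 1)) ω)
      have : dd N p j ω ^ 2 ≤ (2 * K) ^ 2 := by
        unfold dd; exact sq_le_sq' (by linarith) (by linarith)
      linarith
    have s0 := sq_nonneg (dd N p j ω)
    have n2 : 0 ≤ (if |y + N (gd p j) ω + PS Y M p l (gd p (j + 1) / 2 ^ n) j ω| ≤ 3 * ε then (1:ℝ) else 0) *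
          dd N p j ω ^ 2 := by split_ifs <;> simp [s0]
    have n3 : 0 ≤ (if ω ∈ A then (1:ℝ) else 0) * (4 * K ^ 2) := by
      split_ifs <;> simp <;> positivity
    have n4 : 0 ≤ (if ω ∈ B then (1:ℝ) else 0) * (4 * K ^ 2) := by
      split_ifs <;> simp <;> positivity
    by_cases hY : |Y (gd p j) ω| ≤ ε
    swap
    · rw [if_neg hY, zero_mul]; linarith
    rw [if_pos hY, one_mul]
    by_cases hρ : ρ ω ≤ gd p j
    · rw [C.ddN0 hρ, zero_pow two_ne_zero] at *; linarith
    push Not at hρ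
    by_cases h3 : ω ∈ A
    · rw [if_pos h3] at n3 ⊢; linarith
    by_cases h4 : ω ∈ B
    · rw [if_pos h4] at n4 ⊢; linarith
    have h3' : |Y (gd p j) ω - y - N (gd p j) ω - PS Y M p l (gd p j / 2 ^ n) j ω| ≤ ε := by
      by_contra hc; push Not at hc; exact h3 ⟨hρ, hc⟩
    have h4' : |PS Y M p l (gd p (j + 1) / 2 ^ n) j ω - PS Y M p l (gd p j / 2 ^ n) j ω| ≤ ε := by
      by_contra hc; push Not at hc; exact h4 hc
    have hz : |y + N (gd p j) ω + PS Y M p l (gd p (j + 1) / 2 ^ n) j ω| ≤ 3 * ε := by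
      rw [abs_le] at *
      constructor <;> linarith [hY.1, hY.2, h3'.1, h3'.2, h4'.1, h4'.2]
    rw [if_pos hz]
    linarith
  rw [integral_add (i2.add i3).i i4.i, integral_add i2.i i3.i, ind_int hA, ind_int hB] at this
  have k0 : 0 ≤ 4 * K ^ 2 := by positivity
  have q1 := mul_le_mul_of_nonneg_right hs k0
  have q2 := mul_le_mul_of_nonneg_right hPB k0
  linarith

open Classical in
/-- (C): occupation time near zero on fine grids -/
lemma occC (C : Core μ G M N ρ K c) (S : Sol μ G M N ρ K y Y) {θ : ℝ} (hθ : 0 < θ) :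
    ∃ ε > 0, ∃ p0, ∀ p ≥ p0, ∑ j ∈ Finset.range (2 ^ p),
      ∫ ω, (if |Y (gd p j) ω| ≤ ε then (1:ℝ) else 0) * dd N p j ω ^ 2 ∂μ ≤ θ := by
  have hK := C.hN.K0
  -- initial piece
  obtain ⟨d, hd, hd'⟩ := cont_L2 (μ := μ) C.hN.mm C.hN.bdd C.hN.cont le_rfl
    (show 0 < θ / 5 by positivity)
  obtain ⟨p1, hp1⟩ := exists_pow_lt_of_lt_one hd (by norm_num : (1/2 : ℝ) < 1)
  set A0 : ℝ := |y| + K + (1 + K ^ 2) + 1 + (1 + 4 * K ^ 2) * 2 ^ p1 with hA0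
  have A0pos : 0 < A0 := by positivity
  set e : ℝ := min 1 (θ / 5 / (6 * A0)) with he
  have epos : 0 < e := by rw [he]; positivity
  have e1 : e ≤ 1 := min_le_left _ _
  have eA : 6 * e * A0 ≤ θ / 5 := by
    have : e ≤ θ / 5 / (6 * A0) := min_le_right _ _
    rw [le_div_iff₀ (by positivity)] at this
    linarith
  set la : ℝ := θ / 10 * e / (18 * (4 * (K ^ 2 + 1))) with hla
  have lapos : 0 < la := by positivity
  set θ2 : ℝ := θ / 20 * e / (18 * (2608 / la)) with hθ2
  have θtwo_pos : 0 < θ2 := by positivity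
  obtain ⟨pN, hpN⟩ := SmallQ4 C.hN θtwo_pos
  obtain ⟨pM, hpM⟩ := SmallQ4 C.hM θtwo_pos
  set ε : ℝ := e / 3 with hε
  have εpos : 0 < ε := by positivity
  obtain ⟨p2, hp2⟩ := exists_pow_lt_of_lt_one
    (show 0 < θ / 5 / (4 * K ^ 2 * 4 ^ p1 / ε ^ 2 * (4 * K ^ 2) + 1) by positivity)
    (by norm_num : (1/2 : ℝ) < 1)
  refine ⟨ε, εpos, max (max p1 p2) (max pN pM), fun p hp => ?_⟩
  have g1 : p1 ≤ p := (le_max_left _ _).trans ((le_max_left _ _).trans hp)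
  have g2 : p2 ≤ p := (le_max_right _ _).trans ((le_max_left _ _).trans hp)
  have g3 : pN ≤ p := (le_max_left _ _).trans ((le_max_right _ _).trans hp)
  have g4 : pM ≤ p := (le_max_right _ _).trans ((le_max_right _ _).trans hp)
  set θ' : ℝ := θ / 5 / (4 * (K ^ 2 + 1) * 2 ^ p) with hθ'
  have θ'pos : 0 < θ' := by positivity
  have hev : ∀ᶠ n in atTop, ∀ᶠ l in atTop, ∀ j ∈ Finset.Icc 1 (2 ^ p),
      μ.real {ω | gd p j < ρ ω ∧ ε < |Y (gd p j) ω - y - N (gd p j) ω -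
      ∑ k ∈ Finset.range (j * 2 ^ l), Ph (fY Y ω) (gd (p + l) k) (gd p j / 2 ^ n) *
        dd M (p + l) k ω|} ≤ θ' := by
    have : ∀ᶠ n in atTop, ∀ j ∈ Finset.Icc 1 (2 ^ p), ∀ᶠ l in atTop,
      μ.real {ω | gd p j < ρ ω ∧ ε < |Y (gd p j) ω - y - N (gd p j) ω -
      ∑ k ∈ Finset.range (j * 2 ^ l), Ph (fY Y ω) (gd (p + l) k) (gd p j / 2 ^ n) *
        dd M (p + l) k ω|} ≤ θ' := by
      rw [Filter.eventually_all_finset]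
      intro j hj
      rw [Finset.mem_Icc] at hj
      exact star C S hj.1 hj.2 εpos θ'pos
    filter_upwards [this] with n hn
    rw [Filter.eventually_all_finset]
    exact hn
  obtain ⟨n, hn⟩ := hev.exists
  obtain ⟨l, hl⟩ := hn.exists
  clear hev hn
  set J : ℕ := 2 ^ (p - p1) with hJ
  have hJ1 : 1 ≤ J := Nat.one_le_two_pow
  have hJp : J ≤ 2 ^ p := Nat.pow_le_pow_right (by norm_num) (Nat.sub_le _ _)
  obtain ⟨r, hr⟩ := Nat.exists_eq_add_of_le hJp
  have hJR : (J : ℝ) * 2 ^ p1 = 2 ^ p := by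
    rw [hJ]; push_cast; rw [← pow_add]; congr 1; omega
  have hJ0 : (0:ℝ) < J := by positivity
  have hrR : (r : ℝ) ≤ 2 ^ p := by
    have : r ≤ 2 ^ p := by omega
    exact_mod_cast this
  rw [hr, Finset.sum_range_add]
  have first : ∑ j ∈ Finset.range J,
      ∫ ω, (if |Y (gd p j) ω| ≤ ε then (1:ℝ) else 0) * dd N p j ω ^ 2 ∂μ ≤ θ / 5 := by
    have : ∀ j ∈ Finset.range J, ∫ ω, (if |Y (gd p j) ω| ≤ ε then (1:ℝ) else 0) * dd N p j ω ^ 2 ∂μ ≤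
        ∫ ω, dd N p j ω ^ 2 ∂μ := fun j _ => by
      refine Bd.le ((Bd.ind (measurableSet_le ((S.adp _ (gd_nonneg _ _)).mono (C.hM.le _) le_rfl).abs
        measurable_const)).mul ((C.hN.dbd p j).pow 2)) ((C.hN.dbd p j).pow 2) fun ω => ?_
      have := sq_nonneg (dd N p j ω)
      split_ifs <;> linarith
    refine (Finset.sum_le_sum this).trans ?_
    rw [C.hN.sum_sq]
    have h2 := hd' (gd p J) (gd_nonneg _ _) (by
      have : gd p J = (1/2) ^ p1 := by
        unfold gd; rw [← hJR, one_div, inv_pow]; field_simp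
      rw [this]; linarith)
    simpa only [C.hN.zero, sub_zero] using h2
  have second : ∑ j ∈ Finset.range r, ∫ ω, (if |Y (gd p (J + j)) ω| ≤ ε then (1:ℝ) else 0) *
      dd N p (J + j) ω ^ 2 ∂μ ≤ 4 * (θ / 5) := by
    have : ∀ j ∈ Finset.range r, ∫ ω, (if |Y (gd p (J + j)) ω| ≤ ε then (1:ℝ) else 0) *
      dd N p (J + j) ω ^ 2 ∂μ ≤ (∫ ω, (if |y + N (gd p (J + j)) ω +
        PS Y M p l (gd p (J + j + 1) / 2 ^ n) (J + j) ω| ≤ e then (1:ℝ) else 0) *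
          dd N p (J + j) ω ^ 2 ∂μ) + θ' * (4 * K ^ 2) +
            4 * K ^ 2 / J ^ 2 / ε ^ 2 * (4 * K ^ 2) := fun j hj => by
      have hj := Finset.mem_range.1 hj
      have h1 := occ_step C S p l n (j := J + j) (by omega) εpos
        (hl (J + j) (Finset.mem_Icc.2 ⟨by omega, by omega⟩))
      have h3 : 3 * ε = e := by rw [hε]; ring
      rw [h3] at h1
      refine h1.trans (add_le_add le_rfl ?_)
      refine mul_le_mul_of_nonneg_right (div_le_div_of_nonneg_right
        (div_le_div_of_nonneg_left (by positivity) (by positivity) ?_) (by positivity)) (by positivity)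
      refine pow_le_pow_left₀ hJ0.le ?_ 2
      push_cast
      linarith [Nat.cast_nonneg (α := ℝ) j]
    refine (Finset.sum_le_sum this).trans ?_
    rw [Finset.sum_add_distrib, Finset.sum_add_distrib, Finset.sum_const, Finset.sum_const,
      Finset.card_range, nsmul_eq_mul, nsmul_eq_mul]
    have hg := occ_grid C S p l n r hJ1 (by omega) epos lapos
    have t1 : (r:ℝ) * (θ' * (4 * K ^ 2)) ≤ θ / 5 := by
      have : (2 ^ p : ℝ) * (θ' * (4 * (K ^ 2 + 1))) = θ / 5 := by rw [hθ']; field_simp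
      have h1 : θ' * (4 * K ^ 2) ≤ θ' * (4 * (K ^ 2 + 1)) :=
        mul_le_mul_of_nonneg_left (by linarith) θ'pos.le
      rw [← this]
      exact mul_le_mul hrR h1 (by positivity) (by positivity)
    have t2 : (r:ℝ) * (4 * K ^ 2 / J ^ 2 / ε ^ 2 * (4 * K ^ 2)) ≤ θ / 5 := by
      refine (mul_le_mul_of_nonneg_right hrR (by positivity)).trans ?_
      have hJe : (J:ℝ) = 2 ^ p / 2 ^ p1 := by rw [← hJR]; field_simp
      have e4 : (4:ℝ) ^ p1 = 2 ^ p1 * 2 ^ p1 := by rw [← mul_pow]; norm_num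
      have e5 : (2 ^ p : ℝ) * (4 * K ^ 2 / J ^ 2 / ε ^ 2 * (4 * K ^ 2)) =
          (1/2) ^ p * (4 * K ^ 2 * 4 ^ p1 / ε ^ 2 * (4 * K ^ 2)) := by
        rw [hJe, e4, one_div, inv_pow]; field_simp
      rw [e5]
      have h6 : (1/2 : ℝ) ^ p ≤ (1/2) ^ p2 := pow_le_pow_of_le_one (by norm_num) (by norm_num) g2
      have h7 := (le_div_iff₀ (by positivity)).1 (h6.trans hp2.le)
      have h8 : (0:ℝ) ≤ (1/2) ^ p := by positivity
      linarith
    have t3 : 6 * e * (3 / e ^ 2 * (4 * la * K ^ 2 + 2608 / la *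
          ((∑ j ∈ Finset.range (2 ^ p), ∫ ω, qb N N p l j ω ^ 2 ∂μ) +
            ∑ j ∈ Finset.range (2 ^ p), ∫ ω, qb M M p l j ω ^ 2 ∂μ))) ≤ θ / 5 := by
      have q := mul_le_mul_of_nonneg_left (add_le_add (hpN p g3 l) (hpM p g4 l))
        (by positivity : 0 ≤ 2608 / la)
      have q2 : 4 * la * K ^ 2 ≤ 4 * la * (K ^ 2 + 1) :=
        mul_le_mul_of_nonneg_left (by linarith) (by positivity)
      have q3 : 4 * la * (K ^ 2 + 1) = θ / 10 * e / 18 := by rw [hla]; field_simp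
      have q4 : 2608 / la * (θ2 + θ2) = θ / 10 * e / 18 := by rw [hθ2]; field_simp; norm_num
      have q5 := mul_le_mul_of_nonneg_left (add_le_add q2 q)
        (show 0 ≤ 6 * e * (3 / e ^ 2) by positivity)
      rw [q3, q4] at q5
      have q6 : 6 * e * (3 / e ^ 2) * (θ / 10 * e / 18 + θ / 10 * e / 18) = θ / 5 := by
        field_simp; norm_num
      rw [q6] at q5
      rwa [← mul_assoc]
    have t4 : 6 * e * ((|y| + K + (1 + K ^ 2) + e) + r * ((1 + 4 * K ^ 2) / J)) ≤ θ / 5 := by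
      refine le_trans (mul_le_mul_of_nonneg_left ?_ (by positivity)) eA
      have : (r:ℝ) * ((1 + 4 * K ^ 2) / J) ≤ (1 + 4 * K ^ 2) * 2 ^ p1 := by
        refine (mul_le_mul_of_nonneg_right hrR (by positivity)).trans (le_of_eq ?_)
        rw [← hJR]; field_simp
      rw [hA0]; linarith
    have t5 : ∀ a b : ℝ, 6 * e * (a + b) = 6 * e * a + 6 * e * b := fun a b => by ring
    rw [t5] at hg
    linarith
  linarith

end occD

section signs
variable {Y : ℝ → Ω → ℝ} {y : ℝ}

open Classical in
lemma indQ (h : Mart μ G X K) (L n : ℕ) {A : Set Ω} (hA : MeasurableSet A) {la : ℝ} (hla : 0 < la) :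
    ∑ k ∈ Finset.range n, ∫ ω, (if ω ∈ A then (1:ℝ) else 0) * dd X L k ω ^ 2 ∂μ ≤
      la * (160 * K ^ 4) + μ.real A / (4 * la) := by
  have bA : Bd m (fun ω => if ω ∈ A then (1:ℝ) else 0) := Bd.ind (p := fun ω => ω ∈ A) hA
  have bQ := h.Qbd L n
  rw [← integral_finsetSum _ fun k _ => (bA.mul ((h.dbd L k).pow 2)).i]
  simp only [← Finset.mul_sum]
  have b1 := (Bd.const m la).mul (bQ.pow 2)
  have b2 := bA.mul (Bd.const m (1 / (4 * la)))
  have := Bd.le (μ := μ) (bA.mul bQ) (b1.add b2) fun ω => by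
    set Q := ∑ k ∈ Finset.range n, dd X L k ω ^ 2
    split_ifs
    · have e : la * Q ^ 2 + 1 * (1 / (4 * la)) - 1 * Q = la * (Q - 1 / (2 * la)) ^ 2 := by
        field_simp; ring
      have : 0 ≤ la * (Q - 1 / (2 * la)) ^ 2 := by positivity
      linarith
    · have : 0 ≤ la * Q ^ 2 := by positivity
      linarith
  rw [integral_add b1.i b2.i, integral_const_mul, ind_int hA] at this
  refine this.trans ?_
  have q := mul_le_mul_of_nonneg_left (h.Qsq L n) hla.le
  rw [mul_one_div]
  linarith

lemma Sol.mm (C : Core μ G M N ρ K c) (S : Sol μ G M N ρ K y Y) : ∀ t, 0 ≤ t → Measurable (Y t) :=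
  fun t ht => (S.adp t ht).mono (C.hM.le t) le_rfl

lemma psgn_ne {a b : ℝ} (h : psgn a ≠ psgn b) : |b| ≤ |b - a| := by
  unfold psgn at h
  split_ifs at h with h1 h2 h2
  · exact absurd rfl h
  · push Not at h2
    rw [abs_of_nonpos h2, abs_of_nonpos (by linarith)]; linarith
  · push Not at h1
    rw [abs_of_pos h2, abs_of_nonneg (by linarith)]; linarith
  · exact absurd rfl h

open Classical in
/-- the sign rarely changes on a fine grid -/
lemma signC (C : Core μ G M N ρ K c) (S : Sol μ G M N ρ K y Y) {θ : ℝ} (hθ : 0 < θ) :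
    ∃ q0, ∀ q ≥ q0, ∀ L ≥ q, ∀ a : ℕ → ℕ, (∀ k, a k ≤ k) →
      (∀ k, |gd L (a k) - gd L k| ≤ (1 / 2) ^ q) → ∑ k ∈ Finset.range (2 ^ L),
      ∫ ω, (if psgn (Y (gd L (a k)) ω) ≠ psgn (Y (gd L k) ω) then (1:ℝ) else 0) *
        dd N L k ω ^ 2 ∂μ ≤ θ := by
  have hK := C.hN.K0
  obtain ⟨ε, hε, p0, hp0⟩ := occC C S (show 0 < θ / 2 by positivity)
  have hW : Tendsto (fun q => μ.real {ω | ε < Wm Y q ω}) atTop (nhds 0) := by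
    have h1 := (Wm_int_tendsto μ (Sol.mm C S) S.bdd S.cont 1 one_ne_zero).div_const ε
    rw [zero_div] at h1
    simp only [pow_one] at h1
    refine real_tendsto_of_le (fun q => ?_) h1
    exact Bd.markov (Wm_bd (Sol.mm C S) S.bdd q) (Wm_nonneg Y q)
      (measurableSet_lt measurable_const (Wm_bd (Sol.mm C S) S.bdd q).meas) hε fun ω h => le_of_lt h
  obtain ⟨la, hla, hev⟩ := small_of_W hW (160 * K ^ 4) (by positivity) (show 0 < θ / 2 by positivity)
  obtain ⟨q0, hq0⟩ := eventually_atTop.1 hev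
  refine ⟨max p0 q0, fun q hq L hL a ha had => ?_⟩
  have h1 := hp0 L (((le_max_left _ _).trans hq).trans hL)
  have hWm : MeasurableSet {ω | ε < Wm Y q ω} :=
    measurableSet_lt measurable_const (Wm_bd (Sol.mm C S) S.bdd q).meas
  have h2 := (indQ C.hN L (2 ^ L) hWm hla).trans (hq0 q ((le_max_right _ _).trans hq))
  have mY : ∀ k, Measurable (Y (gd L k)) := fun k => Sol.mm C S _ (gd_nonneg _ _)
  have : ∀ k ∈ Finset.range (2 ^ L),
      ∫ ω, (if psgn (Y (gd L (a k)) ω) ≠ psgn (Y (gd L k) ω) then (1:ℝ) else 0) *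
        dd N L k ω ^ 2 ∂μ ≤ (∫ ω, (if |Y (gd L k) ω| ≤ ε then (1:ℝ) else 0) * dd N L k ω ^ 2 ∂μ) +
      ∫ ω, (if ω ∈ {ω | ε < Wm Y q ω} then (1:ℝ) else 0) * dd N L k ω ^ 2 ∂μ := fun k hk => by
    have hk := Finset.mem_range.1 hk
    have bd := (C.hN.dbd L k).pow 2
    have b1 := (Bd.ind (p := fun ω => psgn (Y (gd L (a k)) ω) ≠ psgn (Y (gd L k) ω))
      (measurableSet_eq_fun (psgn_meas.comp (mY _)) (psgn_meas.comp (mY _))).compl).mul bd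
    have b2 := (Bd.ind (p := fun ω => |Y (gd L k) ω| ≤ ε)
      (measurableSet_le (mY k).abs measurable_const)).mul bd
    have b3 := (Bd.ind (p := fun ω => ω ∈ {ω | ε < Wm Y q ω}) hWm).mul bd
    rw [← integral_add b2.i b3.i]
    refine Bd.le b1 (b2.add b3) fun ω => ?_
    have s0 := sq_nonneg (dd N L k ω)
    rw [← add_mul]
    refine mul_le_mul_of_nonneg_right ?_ s0
    by_cases hne : psgn (Y (gd L (a k)) ω) ≠ psgn (Y (gd L k) ω)
    swap
    · rw [if_neg hne]; split_ifs <;> norm_num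
    by_cases hw : ω ∈ {ω | ε < Wm Y q ω}
    · rw [if_pos hw]; split_ifs <;> norm_num
    have hw' : Wm Y q ω ≤ ε := not_lt.1 hw
    have hle := le_Wm S.bdd (p := q) (L := L) (k := k) (k' := a k) hk.le ((ha k).trans hk.le)
      (by rw [abs_sub_comm]; exact had k) ω
    rw [if_pos ((psgn_ne hne).trans (hle.trans hw'))]
    split_ifs <;> norm_num
  refine (Finset.sum_le_sum this).trans ?_
  rw [Finset.sum_add_distrib]
  linarith

/-- discrete stochastic integral of the sign -/
def RR (Y M : ℝ → Ω → ℝ) (L j : ℕ) (ω : Ω) : ℝ :=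
  ∑ k ∈ Finset.range j, psgn (Y (gd L k) ω) * dd M L k ω

lemma Sol.psgn_bd (S : Sol μ G M N ρ K y Y) {t : ℝ} (ht : 0 ≤ t) :
    Bd (G t) (fun ω => psgn (Y t ω)) :=
  Bd.mk' (psgn_meas.comp (S.adp t ht)) 1 fun _ => (abs_psgn _).le

open Classical in
/-- closeness of the discretised integrals -/
lemma Rclose (C : Core μ G M N ρ K c) (S : Sol μ G M N ρ K y Y) {θ : ℝ} {L : ℕ}
    {a : ℕ → ℕ} (ha : ∀ k, a k ≤ k) (hs : ∑ k ∈ Finset.range (2 ^ L),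
      ∫ ω, (if psgn (Y (gd L (a k)) ω) ≠ psgn (Y (gd L k) ω) then (1:ℝ) else 0) *
        dd N L k ω ^ 2 ∂μ ≤ θ) {ε : ℝ} (hε : 0 < ε) :
    μ.real {ω | ∃ n ≤ 2 ^ L, ε < |(∑ k ∈ Finset.range n, psgn (Y (gd L (a k)) ω) * dd M L k ω) -
      RR Y M L n ω|} ≤ 4 * c * θ / ε ^ 2 := by
  set h : ℕ → Ω → ℝ := fun k ω => psgn (Y (gd L (a k)) ω) - psgn (Y (gd L k) ω) with hh
  have bh : ∀ k, Bd (G (gd L k)) (h k) := fun k =>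
    ((S.psgn_bd (gd_nonneg _ _)).mono (C.hM.mono (gd_mono L (ha k)))).sub (S.psgn_bd (gd_nonneg _ _))
  have hd := C.hM.dmg0 L
  have e : ∀ n ω, (∑ k ∈ Finset.range n, psgn (Y (gd L (a k)) ω) * dd M L k ω) -
      RR Y M L n ω = tr h (fun k => M (gd L k)) n ω := fun n ω => by
    unfold RR tr
    rw [← Finset.sum_sub_distrib]
    exact Finset.sum_congr rfl fun k _ => by rw [hh]; unfold dd; ring
  have hmax := (hd.tr bh).max_ineq (2 ^ L) hε
  simp only [tr_zero, sub_zero] at hmax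
  simp only [e]
  refine hmax.trans (div_le_div_of_nonneg_right ?_ (by positivity))
  rw [hd.iso bh]
  have mY : ∀ k, Measurable[G (gd L k)] (Y (gd L k)) := fun k => S.adp _ (gd_nonneg _ _)
  have mYa : ∀ k, Measurable[G (gd L k)] (Y (gd L (a k))) := fun k =>
    (mY (a k)).mono (C.hM.mono (gd_mono L (ha k))) le_rfl
  have bI : ∀ k, Bd (G (gd L k))
      (fun ω => if psgn (Y (gd L (a k)) ω) ≠ psgn (Y (gd L k) ω) then (1:ℝ) else 0) := fun k =>
    Bd.ind (p := fun ω => psgn (Y (gd L (a k)) ω) ≠ psgn (Y (gd L k) ω))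
      (@MeasurableSet.compl _ _ (G (gd L k)) (measurableSet_eq_fun
        (psgn_meas.comp (mYa k)) (psgn_meas.comp (mY k))))
  have st : ∀ k ∈ Finset.range (2 ^ L), ∫ ω, h k ω ^ 2 * (M (gd L (k + 1)) ω - M (gd L k) ω) ^ 2 ∂μ ≤
      4 * (c * ∫ ω, (if psgn (Y (gd L (a k)) ω) ≠ psgn (Y (gd L k) ω) then (1:ℝ) else 0) *
        dd N L k ω ^ 2 ∂μ) := fun k hk => by
    have d := C.dom (Finset.mem_range.1 hk) (bI k) fun ω => by split_ifs <;> norm_num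
    refine le_trans ?_ (mul_le_mul_of_nonneg_left d (by norm_num : (0:ℝ) ≤ 4))
    rw [← integral_const_mul]
    have bd := (C.hM.dbd L k).pow 2
    refine Bd.le ((((bh k).mono (C.hM.le _)).pow 2).mul bd)
      ((Bd.const m 4).mul (((bI k).mono (C.hM.le _)).mul bd)) fun ω => ?_
    have s0 := sq_nonneg (dd M L k ω)
    rw [← mul_assoc]
    refine mul_le_mul_of_nonneg_right ?_ s0
    have a1 := abs_le.1 (abs_psgn (Y (gd L (a k)) ω)).le
    have a2 := abs_le.1 (abs_psgn (Y (gd L k) ω)).le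
    rw [hh]
    split_ifs with hne
    · nlinarith [a1.1, a1.2, a2.1, a2.2]
    · push Not at hne
      simp [hne]
  refine (Finset.sum_le_sum st).trans ?_
  rw [← Finset.mul_sum, ← Finset.mul_sum]
  have := mul_le_mul_of_nonneg_left hs (mul_nonneg (by norm_num : (0:ℝ) ≤ 4) C.c0)
  linarith

lemma RR_coarse (p l j : ℕ) (ω : Ω) : (∑ k ∈ Finset.range (j * 2 ^ l),
    psgn (Y (gd (p + l) (k / 2 ^ l * 2 ^ l)) ω) * dd M (p + l) k ω) = RR Y M p j ω := by
  rw [sum_range_mul']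
  unfold RR
  refine Finset.sum_congr rfl fun i _ => ?_
  have : ∀ r ∈ Finset.range (2 ^ l), psgn (Y (gd (p + l) ((i * 2 ^ l + r) / 2 ^ l * 2 ^ l)) ω) *
      dd M (p + l) (i * 2 ^ l + r) ω = psgn (Y (gd p i) ω) * ((fun _ _ => (1:ℝ)) (i * 2 ^ l + r) ω *
        dd M (p + l) (i * 2 ^ l + r) ω) := fun r hr => by
    have hr := Finset.mem_range.1 hr
    have : (i * 2 ^ l + r) / 2 ^ l = i := by
      rw [mul_comm, Nat.mul_add_div (by positivity), Nat.div_eq_of_lt hr, add_zero]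
    rw [this, gd_ref, one_mul]
  rw [Finset.sum_congr rfl this, ← Finset.mul_sum]
  congr 1
  exact congrFun (xi_one (p := p) (l := l) (j := i) M) ω

/-- distance of a point to its rounded-down version -/
lemma gd_round {L k j q : ℕ} (hj : 0 < j) (h : j * 2 ^ q ≤ 2 ^ L) :
    |gd L (k / j * j) - gd L k| ≤ (1 / 2) ^ q := by
  have h1 : k / j * j ≤ k := Nat.div_mul_le_self k j
  rw [abs_sub_comm, abs_of_nonneg (sub_nonneg.2 (gd_mono L h1))]
  have h2 : k ≤ k / j * j + j := by
    have := Nat.mod_lt k hj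
    have h3 := Nat.div_add_mod' k j
    omega
  have h3 : (k : ℝ) ≤ (k / j * j : ℕ) + j := by exact_mod_cast h2
  have h4 : (j : ℝ) * 2 ^ q ≤ 2 ^ L := by exact_mod_cast h
  unfold gd
  rw [← sub_div, one_div, inv_pow, div_le_iff₀ (by positivity), inv_mul_eq_div,
    le_div_iff₀ (by positivity)]
  refine le_trans (mul_le_mul_of_nonneg_right ?_ (by positivity)) h4
  linarith

/-- the discretised equation is close to the solution -/
lemma good (C : Core μ G M N ρ K c) (S : Sol μ G M N ρ K y Y) {ε θ : ℝ} (hε : 0 < ε) (hθ : 0 < θ) :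
    ∃ p0, ∀ p ≥ p0, μ.real {ω | ∃ j ≤ 2 ^ p, gd p j < ρ ω ∧
      ε < |Y (gd p j) ω - (y + N (gd p j) ω + RR Y M p j ω)|} ≤ θ := by
  have hc := C.c0
  have small : ∀ θ1 > 0, 4 * c * (θ1 * (ε / 3) ^ 2 / (4 * (c + 1))) / (ε / 3) ^ 2 ≤ θ1 := by
    intro θ1 h1
    have : 4 * c * (θ1 * (ε / 3) ^ 2 / (4 * (c + 1))) / (ε / 3) ^ 2 = θ1 * (c / (c + 1)) := by
      field_simp
    rw [this]
    have : c / (c + 1) ≤ 1 := by rw [div_le_one (by linarith)]; linarith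
    nlinarith
  obtain ⟨q0, hq0⟩ := signC C S (show 0 < (θ / 3) * (ε / 3) ^ 2 / (4 * (c + 1)) by positivity)
  refine ⟨q0, fun p hp => ?_⟩
  have hpp : (0:ℝ) < 2 ^ p + 1 := by positivity
  set θ1 := θ / 3 / (2 ^ p + 1) with hθ1
  have θone_pos : 0 < θ1 := by positivity
  obtain ⟨q1, hq1⟩ := signC C S (show 0 < θ1 * (ε / 3) ^ 2 / (4 * (c + 1)) by positivity)
  -- choose n
  have hev : ∀ᶠ n in atTop, ∀ j ∈ Finset.range (2 ^ p + 1), μ.real {ω | gd p j ≤ ρ ω ∧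
      ε / 3 < |rsum (fun s ω => psgn (Y s ω)) M (gd p j) n ω -
        (Y (gd p j) ω - y - N (gd p j) ω)|} ≤ θ1 := by
    rw [Filter.eventually_all_finset]
    intro j _
    exact (S.conv (gd p j) (gd_nonneg _ _) (ε / 3) (by positivity)).eventually_le_const θone_pos
  obtain ⟨n, hn1, hn2⟩ := (hev.and (eventually_ge_atTop q1)).exists
  have E1 := Rclose C S (a := fun k => k / 2 ^ n * 2 ^ n) (fun k => Nat.div_mul_le_self k _)
    (hq0 p hp (p + n) (by omega) _ (fun k => Nat.div_mul_le_self k _)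
      (fun k => gd_round (by positivity) (by rw [pow_add, mul_comm])))
    (show 0 < ε / 3 by positivity)
  replace E1 := E1.trans (small _ (by positivity))
  have E2 : ∀ j ∈ Finset.range (2 ^ p + 1), μ.real {ω | ε / 3 <
      |rsum (fun s ω => psgn (Y s ω)) M (gd p j) n ω - RR Y M (p + n) (j * 2 ^ n) ω|} ≤ θ1 := by
    intro j hj
    have hj := Finset.mem_range.1 hj
    rcases Nat.eq_zero_or_pos j with rfl | hj0
    · have : {ω | ε / 3 < |rsum (fun s ω => psgn (Y s ω)) M (gd p 0) n ω -
          RR Y M (p + n) (0 * 2 ^ n) ω|} = ∅ := by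
        ext ω
        simp only [rsum_embed, RR, mul_zero, zero_mul, Finset.range_zero, Finset.sum_empty, sub_zero,
          abs_zero, Set.mem_ofPred_eq, Set.mem_empty_iff_false, iff_false, not_lt]
        positivity
      rw [this]; simpa using θone_pos.le
    have hjn : j * 2 ^ n ≤ 2 ^ (p + n) := by
      rw [pow_add]; exact Nat.mul_le_mul_right _ (by omega)
    have := Rclose C S (a := fun k => k / j * j) (fun k => Nat.div_mul_le_self k _)
      (hq1 n hn2 (p + n) (by omega) _ (fun k => Nat.div_mul_le_self k _)
        (fun k => gd_round hj0 hjn)) (show 0 < ε / 3 by positivity)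
    refine le_trans (measureReal_mono ?_) (this.trans (small _ θone_pos))
    intro ω hω
    refine ⟨j * 2 ^ n, hjn, ?_⟩
    have hω : ε / 3 < |rsum (fun s ω => psgn (Y s ω)) M (gd p j) n ω -
          RR Y M (p + n) (j * 2 ^ n) ω| := hω
    rw [rsum_embed, mul_comm (2 ^ n) j] at hω
    exact hω
  have hsub : {ω | ∃ j ≤ 2 ^ p, gd p j < ρ ω ∧
      ε < |Y (gd p j) ω - (y + N (gd p j) ω + RR Y M p j ω)|} ⊆
      (⋃ j ∈ Finset.range (2 ^ p + 1), {ω | gd p j ≤ ρ ω ∧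
      ε / 3 < |rsum (fun s ω => psgn (Y s ω)) M (gd p j) n ω -
        (Y (gd p j) ω - y - N (gd p j) ω)|}) ∪
      ((⋃ j ∈ Finset.range (2 ^ p + 1), {ω | ε / 3 <
      |rsum (fun s ω => psgn (Y s ω)) M (gd p j) n ω - RR Y M (p + n) (j * 2 ^ n) ω|}) ∪
      {ω | ∃ n' ≤ 2 ^ (p + n), ε / 3 < |(∑ k ∈ Finset.range n',
        psgn (Y (gd (p + n) (k / 2 ^ n * 2 ^ n)) ω) * dd M (p + n) k ω) -
          RR Y M (p + n) n' ω|}) := by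
    rintro ω ⟨j, hj, hρ, hlt⟩
    by_contra hcon
    simp only [Set.mem_union, Set.mem_iUnion, Finset.mem_range, Set.mem_ofPred_eq, not_or, not_exists,
      not_and, not_lt] at hcon
    obtain ⟨a1, a2, a3⟩ := hcon
    have b1 := a1 j (by omega) hρ.le
    have b2 := a2 j (by omega)
    have b3 := a3 (j * 2 ^ n) (by rw [pow_add]; exact Nat.mul_le_mul_right _ hj)
    rw [RR_coarse] at b3
    have : |Y (gd p j) ω - (y + N (gd p j) ω + RR Y M p j ω)| ≤ ε := by
      rw [abs_le] at *
      constructor <;> linarith [b1.1, b1.2, b2.1, b2.2, b3.1, b3.2]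
    linarith
  refine (real_union3 hsub).trans ?_
  have u : ∀ s : ℕ → Set Ω, (∀ j ∈ Finset.range (2 ^ p + 1), μ.real (s j) ≤ θ1) →
      μ.real (⋃ j ∈ Finset.range (2 ^ p + 1), s j) ≤ θ / 3 := fun s hs => by
    refine (measureReal_biUnion_finset_le _ _).trans ((Finset.sum_le_sum hs).trans (le_of_eq ?_))
    rw [Finset.sum_const, Finset.card_range, nsmul_eq_mul, hθ1]
    push_cast
    field_simp
  have v1 := u _ hn1
  have v2 := u _ E2
  linarith

end signs

section dstep
variable {Y Y' : ℝ → Ω → ℝ} {y : ℝ}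

lemma Bd.comp2 {g : MeasurableSpace Ω} {f f' : Ω → ℝ} (h : Bd g f) (h' : Bd g f') {φ : ℝ × ℝ → ℝ}
    (hφ : Continuous φ) : Bd g (fun ω => φ (f ω, f' ω)) := by
  obtain ⟨hm, B, hB⟩ := h
  obtain ⟨hm', B', hB'⟩ := h'
  obtain ⟨C, hC⟩ := ((isCompact_Icc (a := -B) (b := B)).prod
    (isCompact_Icc (a := -B') (b := B'))).exists_bound_of_continuousOn hφ.continuousOn
  exact ⟨hφ.measurable.comp (hm.prodMk hm'), C, fun ω =>
    hC _ ⟨abs_le.1 (hB ω), abs_le.1 (hB' ω)⟩⟩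

lemma psi_cont (n : ℕ) : Continuous (psi n) :=
  continuous_finsetSum _ fun i _ => by unfold fq; fun_prop

lemma psi1_cont (n : ℕ) : Continuous (psi1 n) :=
  continuous_finsetSum _ fun i _ => continuous_id.div (by unfold fq; fun_prop)
    fun v => (fq_pos (half_pos' i) 0 v).ne'

lemma psi2_cont (n : ℕ) : Continuous (psi2 n) :=
  continuous_finsetSum _ fun i _ => continuous_const.div (by unfold fq; fun_prop)
    fun v => pow_ne_zero 3 (fq_pos (half_pos' i) 0 v).ne'

lemma sqrt_le_abs (x w : ℝ) : Real.sqrt (x ^ 2 + w ^ 2) ≤ |x| + |w| := by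
  refine Real.sqrt_le_iff.2 ⟨by positivity, ?_⟩
  have := mul_nonneg (abs_nonneg x) (abs_nonneg w)
  nlinarith [sq_abs x, sq_abs w]

lemma fstep (C : Core μ G M N ρ K c) {p j : ℕ} (hj : j < 2 ^ p) {u v α β : Ω → ℝ}
    (hu : Bd (G (gd p j)) u) (hv : Bd (G (gd p j)) v) (hα : Bd (G (gd p j)) α)
    (hβ : Bd (G (gd p j)) β) (hα1 : ∀ ω, |α ω| ≤ 1) (hβ1 : ∀ ω, |β ω| ≤ 1)
    (hαβ : ∀ ω, α ω * β ω = 0) {e : ℝ} (he : 0 < e) :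
    (∫ ω, fq e (u ω) (v ω) ∂μ) + 1 / 2 * (∫ ω, (v ω ^ 2 + e ^ 2) / fq e (u ω) (v ω) ^ 3 *
      dd N p j ω ^ 2 ∂μ) - 3 / e ^ 2 * ∫ ω, (|dd N p j ω| + 2 * |dd M p j ω|) ^ 3 ∂μ ≤
    ∫ ω, fq e (u ω + (dd N p j ω + α ω * dd M p j ω)) (v ω + β ω * dd M p j ω) ∂μ := by
  have hle := C.hM.le (gd p j)
  have cf := fq_cont e
  have hne : ∀ z : ℝ × ℝ, fq e z.1 z.2 ≠ 0 := fun z => (fq_pos he _ _).ne'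
  have bN := C.hN.dbd p j
  have bM := C.hM.dbd p j
  -- coefficient functions
  have gu : Bd (G (gd p j)) (fun ω => u ω / fq e (u ω) (v ω)) :=
    hu.comp2 hv (φ := fun z => z.1 / fq e z.1 z.2) (continuous_fst.div cf hne)
  have gv : Bd (G (gd p j)) (fun ω => v ω / fq e (u ω) (v ω)) :=
    hu.comp2 hv (φ := fun z => z.2 / fq e z.1 z.2) (continuous_snd.div cf hne)
  have gz : Bd (G (gd p j)) (fun ω => (v ω ^ 2 + e ^ 2) / fq e (u ω) (v ω) ^ 3) :=
    hu.comp2 hv (φ := fun z => (z.2 ^ 2 + e ^ 2) / fq e z.1 z.2 ^ 3)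
      (((continuous_snd.pow 2).add continuous_const).div (cf.pow 3) fun z => pow_ne_zero 3 (hne z))
  have gc : Bd (G (gd p j)) (fun ω => u ω * v ω / fq e (u ω) (v ω) ^ 3) :=
    hu.comp2 hv (φ := fun z => z.1 * z.2 / fq e z.1 z.2 ^ 3)
      ((continuous_fst.mul continuous_snd).div (cf.pow 3) fun z => pow_ne_zero 3 (hne z))
  have o1 := C.hN.orth _ _ (gd_nonneg p j) (gd_mono p (Nat.le_succ j)) _ gu
  have o2 := C.hM.orth _ _ (gd_nonneg p j) (gd_mono p (Nat.le_succ j)) _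
    ((gu.mul hα).add (gv.mul hβ))
  have o3 := C.orth hj ((gz.mul hα).sub (gc.mul hβ))
  have b0 : Bd m (fun ω => fq e (u ω) (v ω)) := (hu.comp2 hv cf).mono hle
  have b1 := (gu.mono hle).mul bN
  have b2 := (((gu.mul hα).add (gv.mul hβ)).mono hle).mul bM
  have b3 := (((gz.mul hα).sub (gc.mul hβ)).mono hle).mul (bM.mul bN)
  have b4 := (Bd.const m (1/2)).mul ((gz.mono hle).mul (bN.pow 2))
  have b5 := (Bd.const m (3 / e ^ 2)).mul ((bN.abs.add ((Bd.const m 2).mul bM.abs)).pow 3)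
  have bend : Bd m (fun ω => fq e (u ω + (dd N p j ω + α ω * dd M p j ω)) (v ω + β ω * dd M p j ω)) :=
    ((hu.mono hle).add (bN.add ((hα.mono hle).mul bM))).comp2
      ((hv.mono hle).add ((hβ.mono hle).mul bM)) cf
  have main := Bd.le (μ := μ) (((((b0.add b1).add b2).add b3).add b4).sub b5) bend fun ω => by
    have t := fq_lower he (u ω) (v ω) (dd N p j ω + α ω * dd M p j ω) (β ω * dd M p j ω)
    have hab := hαβ ω
    have fp := fq_pos he (u ω) (v ω)
    set f := fq e (u ω) (v ω)
    set n := dd N p j ω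
    set k := dd M p j ω
    have s3 : Real.sqrt ((n + α ω * k) ^ 2 + (β ω * k) ^ 2) ^ 3 ≤ (|n| + 2 * |k|) ^ 3 := by
      refine pow_le_pow_left₀ (Real.sqrt_nonneg _) ((sqrt_le_abs _ _).trans ?_) 3
      have a1 := abs_add_le n (α ω * k)
      rw [abs_mul] at a1 ⊢
      have a2 := mul_le_mul_of_nonneg_right (hα1 ω) (abs_nonneg k)
      have a3 := mul_le_mul_of_nonneg_right (hβ1 ω) (abs_nonneg k)
      linarith
    have s4 : 3 * Real.sqrt ((n + α ω * k) ^ 2 + (β ω * k) ^ 2) ^ 3 / e ^ 2 ≤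
        3 / e ^ 2 * (|n| + 2 * |k|) ^ 3 := by
      rw [mul_div_right_comm]
      exact mul_le_mul_of_nonneg_left s3 (by positivity)
    have c1 : (v ω ^ 2 + e ^ 2) / (2 * f ^ 3) * (n + α ω * k) ^ 2 =
        1 / 2 * ((v ω ^ 2 + e ^ 2) / f ^ 3 * n ^ 2) + (v ω ^ 2 + e ^ 2) / f ^ 3 * α ω * (k * n) +
        1 / 2 * ((v ω ^ 2 + e ^ 2) / f ^ 3 * (α ω * k) ^ 2) := by
      field_simp; ring
    have c2 : 0 ≤ 1 / 2 * ((v ω ^ 2 + e ^ 2) / f ^ 3 * (α ω * k) ^ 2) := by positivity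
    have c3 : u ω * v ω / f ^ 3 * ((n + α ω * k) * (β ω * k)) =
        u ω * v ω / f ^ 3 * β ω * (k * n) := by
      have : (n + α ω * k) * (β ω * k) = β ω * (k * n) + (α ω * β ω) * k ^ 2 := by ring
      rw [this, hab]; ring
    rw [c1, c3] at t
    have c4 : u ω / f * (n + α ω * k) + v ω / f * (β ω * k) =
      u ω / f * n + (u ω / f * α ω + v ω / f * β ω) * k := by ring
    rw [c4] at t
    have c5 : ((v ω ^ 2 + e ^ 2) / f ^ 3 * α ω - u ω * v ω / f ^ 3 * β ω) * (k * n) =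
      (v ω ^ 2 + e ^ 2) / f ^ 3 * α ω * (k * n) - u ω * v ω / f ^ 3 * β ω * (k * n) := by ring
    rw [c5]
    linarith
  rw [integral_sub ((((b0.add b1).add b2).add b3).add b4).i b5.i,
    integral_add (((b0.add b1).add b2).add b3).i b4.i, integral_add ((b0.add b1).add b2).i b3.i,
    integral_add (b0.add b1).i b2.i, integral_add b0.i b1.i, integral_const_mul,
    integral_const_mul] at main
  have o1' : ∫ ω, u ω / fq e (u ω) (v ω) * dd N p j ω ∂μ = 0 := o1
  have o2' : ∫ ω, (u ω / fq e (u ω) (v ω) * α ω + v ω / fq e (u ω) (v ω) * β ω) * dd M p j ω ∂μ = 0 :=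
    o2
  rw [o1', o2', o3] at main
  linarith

open Classical in
lemma pstep (C : Core μ G M N ρ K c) {p j : ℕ} (hj : j < 2 ^ p) {u v β : Ω → ℝ}
    (hu : Bd (G (gd p j)) u) (hv : Bd (G (gd p j)) v)
    (hβ : Bd (G (gd p j)) β) (hβ1 : ∀ ω, |β ω| ≤ 1) (n : ℕ) {B : Set Ω} (hB : MeasurableSet B)
    (hgood : ∀ ω, ω ∉ B → β ω ≠ 0 → dd M p j ω ≠ 0 → |u ω| ≤ |v ω| + 2 * (1 / 2) ^ n) :
    ∫ ω, psi n (v ω + β ω * dd M p j ω) ∂μ ≤ (∫ ω, psi n (v ω) ∂μ) +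
      27 * (c * ∫ ω, (v ω ^ 2 + ((1 / 2) ^ n) ^ 2) / fq ((1 / 2) ^ n) (u ω) (v ω) ^ 3 *
        dd N p j ω ^ 2 ∂μ) +
      1 / (1 / 2) ^ n * (∫ ω, (if ω ∈ B then (1:ℝ) else 0) * dd M p j ω ^ 2 ∂μ) +
      (∑ i ∈ Finset.range (n + 1), 3 / ((1 / 2 : ℝ) ^ i) ^ 2) * ∫ ω, |dd M p j ω| ^ 3 ∂μ := by
  have hle := C.hM.le (gd p j)
  set e : ℝ := (1 / 2) ^ n with hedef
  have he : 0 < e := half_pos' n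
  have cf := fq_cont e
  have hne : ∀ z : ℝ × ℝ, fq e z.1 z.2 ≠ 0 := fun z => (fq_pos he _ _).ne'
  have bM := C.hM.dbd p j
  have gz : Bd (G (gd p j)) (fun ω => (v ω ^ 2 + e ^ 2) / fq e (u ω) (v ω) ^ 3) :=
    hu.comp2 hv (φ := fun z => (z.2 ^ 2 + e ^ 2) / fq e z.1 z.2 ^ 3)
      (((continuous_snd.pow 2).add continuous_const).div (cf.pow 3) fun z => pow_ne_zero 3 (hne z))
  have dm := C.dom hj gz fun ω => by
    have := fq_pos he (u ω) (v ω)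
    positivity
  have o1 : ∫ ω, psi1 n (v ω) * β ω * dd M p j ω ∂μ = 0 :=
    C.hM.orth _ _ (gd_nonneg p j) (gd_mono p (Nat.le_succ j)) _ ((hv.comp (psi1_cont n)).mul hβ)
  set Cn := ∑ i ∈ Finset.range (n + 1), 3 / ((1 / 2 : ℝ) ^ i) ^ 2 with hCn
  have Cn0 : 0 ≤ Cn := Finset.sum_nonneg fun i _ => by positivity
  have b0 := (hv.comp (psi_cont n)).mono hle
  have b1 := (((hv.comp (psi1_cont n)).mul hβ).mono hle).mul bM
  have b2 := (Bd.const m 27).mul ((gz.mono hle).mul (bM.pow 2))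
  have b3 := (Bd.const m (1 / e)).mul ((Bd.ind (p := fun ω => ω ∈ B) hB).mul (bM.pow 2))
  have b4 := (Bd.const m Cn).mul (bM.abs.pow 3)
  have bend := ((hv.mono hle).add ((hβ.mono hle).mul bM)).comp (psi_cont n)
  have main := Bd.le (μ := μ) bend ((((b0.add b1).add b2).add b3).add b4) fun ω => by
    have t := psi_upper n (v ω) (β ω * dd M p j ω)
    rw [← hCn] at t
    have p2 := psi2_le n (v ω)
    have p2n := psi2_nonneg n (v ω)
    have f0 := fq_pos he 0 (v ω)
    have f0e := fq_ge he 0 (v ω)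
    have f1 := fq_pos he (u ω) (v ω)
    rw [← hedef] at p2
    have hb := hβ1 ω
    set k := dd M p j ω with hk
    have t3 : Cn * |β ω * k| ^ 3 ≤ Cn * |k| ^ 3 := by
      refine mul_le_mul_of_nonneg_left (pow_le_pow_left₀ (abs_nonneg _) ?_ 3) Cn0
      rw [abs_mul]
      have := mul_le_mul_of_nonneg_right hb (abs_nonneg k)
      linarith
    have hb2 : β ω ^ 2 ≤ 1 := by rw [← sq_abs]; exact pow_le_one₀ (abs_nonneg _) hb
    have t2 : psi2 n (v ω) / 2 * (β ω * k) ^ 2 ≤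
        27 * ((v ω ^ 2 + e ^ 2) / fq e (u ω) (v ω) ^ 3 * k ^ 2) +
          1 / e * ((if ω ∈ B then (1:ℝ) else 0) * k ^ 2) := by
      have z0 : 0 ≤ 27 * ((v ω ^ 2 + e ^ 2) / fq e (u ω) (v ω) ^ 3 * k ^ 2) := by positivity
      by_cases hz : β ω * k = 0
      · rw [hz]
        have : 0 ≤ 1 / e * ((if ω ∈ B then (1:ℝ) else 0) * k ^ 2) := by
          split_ifs <;> positivity
        rw [zero_pow two_ne_zero, mul_zero]
        linarith
      have hz1 : β ω ≠ 0 := fun h => hz (by rw [h, zero_mul])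
      have hz2 : k ≠ 0 := fun h => hz (by rw [h, mul_zero])
      have q : (β ω * k) ^ 2 ≤ k ^ 2 := by
        rw [mul_pow]
        have := mul_le_mul_of_nonneg_right hb2 (sq_nonneg k)
        linarith
      have q2 : psi2 n (v ω) / 2 * (β ω * k) ^ 2 ≤ 1 / fq e 0 (v ω) * k ^ 2 := by
        refine mul_le_mul ?_ q (sq_nonneg _) (by positivity)
        have : 2 / fq e 0 (v ω) = 2 * (1 / fq e 0 (v ω)) := by ring
        linarith
      refine q2.trans ?_
      by_cases hω : ω ∈ B
      · rw [if_pos hω, one_mul]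
        have := mul_le_mul_of_nonneg_right (one_div_le_one_div_of_le he f0e) (sq_nonneg k)
        linarith
      · rw [if_neg hω, zero_mul, mul_zero, add_zero]
        have g := fuu_ge he (hgood ω hω hz1 hz2)
        have g2 : 1 / fq e 0 (v ω) = 27 * (1 / (27 * fq e 0 (v ω))) := by field_simp
        rw [g2, mul_assoc]
        exact mul_le_mul_of_nonneg_left (mul_le_mul_of_nonneg_right g (sq_nonneg k)) (by norm_num)
    have e1 : psi1 n (v ω) * (β ω * k) = psi1 n (v ω) * β ω * k := by ring
    rw [e1] at t
    linarith
  rw [integral_add (((b0.add b1).add b2).add b3).i b4.i, integral_add ((b0.add b1).add b2).i b3.i,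
    integral_add (b0.add b1).i b2.i, integral_add b0.i b1.i, o1, integral_const_mul,
    integral_const_mul, integral_const_mul] at main
  have := mul_le_mul_of_nonneg_left dm (by norm_num : (0:ℝ) ≤ 27)
  linarith

/-- third moments vanish on fine grids -/
lemma third (h : Mart μ G X K) {θ : ℝ} (hθ : 0 < θ) :
    ∃ p0, ∀ p ≥ p0, ∑ j ∈ Finset.range (2 ^ p), ∫ ω, |dd X p j ω| ^ 3 ∂μ ≤ θ := by
  set la := θ / 2 / (K ^ 2 + 1) with hla
  have lap : 0 < la := by positivity
  obtain ⟨p0, hp0⟩ := SmallQ4 h (show 0 < θ / 2 * la / 326 by positivity)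
  refine ⟨p0, fun p hp => ?_⟩
  have st : ∀ j ∈ Finset.range (2 ^ p), ∫ ω, |dd X p j ω| ^ 3 ∂μ ≤ la * (∫ ω, dd X p j ω ^ 2 ∂μ) +
      326 / la * ∫ ω, qb X X p 0 j ω ^ 2 ∂μ := fun j _ => by
    have b := h.dbd p j
    have b1 := (Bd.const m la).mul (b.pow 2)
    have b2 := (Bd.const m (1 / la)).mul (b.pow 4)
    have t := Bd.le (μ := μ) (b.abs.pow 3) (b1.add b2) fun ω => by
      have := cube_le (dd X p j ω) lap
      rw [one_div_mul_eq_div]; exact this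
    rw [integral_add b1.i b2.i, integral_const_mul, integral_const_mul] at t
    have t2 := mul_le_mul_of_nonneg_left (dd_four h p 0 j) (show 0 ≤ 1 / la by positivity)
    have e : 326 / la = 1 / la * 326 := by ring
    rw [e]
    linarith
  refine (Finset.sum_le_sum st).trans ?_
  rw [Finset.sum_add_distrib, ← Finset.mul_sum, ← Finset.mul_sum, h.sum_sq]
  have t1 := mul_le_mul_of_nonneg_left (h.sqK (gd_nonneg p (2 ^ p))) lap.le
  have t2 := mul_le_mul_of_nonneg_left (hp0 p hp 0) (show 0 ≤ 326 / la by positivity)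
  have e1 : la * (K ^ 2 + 1) = θ / 2 := by rw [hla]; field_simp
  have e2 : 326 / la * (θ / 2 * la / 326) = θ / 2 := by field_simp
  rw [e2] at t2
  linarith

lemma cube_sum (a b : ℝ) : (|a| + 2 * |b|) ^ 3 ≤ 4 * |a| ^ 3 + 32 * |b| ^ 3 := by
  have h1 := abs_nonneg a
  have h2 := abs_nonneg b
  have : 4 * |a| ^ 3 + 32 * |b| ^ 3 - (|a| + 2 * |b|) ^ 3 =
      3 * (|a| + 2 * |b|) * (|a| - 2 * |b|) ^ 2 := by ring
  have : 0 ≤ 3 * (|a| + 2 * |b|) * (|a| - 2 * |b|) ^ 2 := by positivity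
  linarith

end dstep

section dfin
variable {Y Y' : ℝ → Ω → ℝ} {y : ℝ}

/-- discretised solution -/
def YT (y : ℝ) (N M Y : ℝ → Ω → ℝ) (p j : ℕ) (ω : Ω) : ℝ := y + N (gd p j) ω + RR Y M p j ω

lemma YT_succ (p j : ℕ) (ω : Ω) : YT y N M Y p (j + 1) ω =
    YT y N M Y p j ω + (dd N p j ω + psgn (Y (gd p j) ω) * dd M p j ω) := by
  unfold YT RR dd
  rw [Finset.sum_range_succ]
  ring

lemma RR_bd (C : Core μ G M N ρ K c) (S : Sol μ G M N ρ K y Y) (p j : ℕ) :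
    Bd (G (gd p j)) (RR Y M p j) := by
  refine Bd.sum _ fun k hk => ?_
  have hk := Finset.mem_range.1 hk
  refine ((S.psgn_bd (gd_nonneg _ _)).mono (C.hM.mono (gd_mono p hk.le))).mul ?_
  exact ((C.hM.bd (gd_nonneg _ _)).mono (C.hM.mono (gd_mono p hk))).sub
    ((C.hM.bd (gd_nonneg _ _)).mono (C.hM.mono (gd_mono p hk.le)))

lemma YT_bd (C : Core μ G M N ρ K c) (S : Sol μ G M N ρ K y Y) (p j : ℕ) :
    Bd (G (gd p j)) (YT y N M Y p j) :=
  ((Bd.const _ y).add (C.hN.bd (gd_nonneg _ _))).add (RR_bd C S p j)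

lemma YT_int (C : Core μ G M N ρ K c) (S : Sol μ G M N ρ K y Y) (p j : ℕ) :
    ∫ ω, |YT y N M Y p j ω| ∂μ ≤ |y| + K + 1 + K ^ 2 := by
  have hle := C.hM.le (gd p j)
  have b := (RR_bd C S p j).mono hle
  have h1 : ∫ ω, RR Y M p j ω ^ 2 ∂μ ≤ K ^ 2 := by
    have := (C.hM.dmg0 p).iso_le (fun k => S.psgn_bd (gd_nonneg p k)) j (C := 1)
      fun k _ ω => (abs_psgn _).le
    simp only [gd_zero, C.hM.zero, sub_zero, one_pow, one_mul] at this
    exact this.trans (C.hM.sqK (gd_nonneg _ _))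
  have h2 := L1_of_L2 (μ := μ) b one_pos
  have h3 := Bd.le (μ := μ) ((YT_bd C S p j).mono hle).abs ((Bd.const m (|y| + K)).add b.abs)
    fun ω => by
      have := C.hN.bdd (gd p j) ω
      unfold YT
      have t1 := abs_add_le (y + N (gd p j) ω) (RR Y M p j ω)
      have t2 := abs_add_le y (N (gd p j) ω)
      linarith
  rw [integral_add (Bd.const m (|y| + K)).i b.abs.i] at h3
  simp only [integral_const, probReal_univ, one_smul] at h3
  rw [div_one] at h2
  linarith

lemma fq_le_add {e : ℝ} (he : 0 < e) (u v : ℝ) : fq e u v ≤ |u| + |v| + e := by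
  have h1 := abs_nonneg u
  have h2 := abs_nonneg v
  refine Real.sqrt_le_iff.2 ⟨by positivity, ?_⟩
  rw [← sq_abs u, ← sq_abs v]
  nlinarith [mul_nonneg h1 h2, mul_nonneg h1 he.le, mul_nonneg h2 he.le]

lemma half_sum_diff (a b : ℝ) : |(a + b) / 2| + |(a - b) / 2| ≤ |a| + |b| := by
  rcases abs_cases a with ⟨h1, _⟩ | ⟨h1, _⟩ <;> rcases abs_cases b with ⟨h2, _⟩ | ⟨h2, _⟩ <;>
    rcases abs_cases ((a + b) / 2) with ⟨h3, _⟩ | ⟨h3, _⟩ <;>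
    rcases abs_cases ((a - b) / 2) with ⟨h4, _⟩ | ⟨h4, _⟩ <;> linarith

lemma sgn_close {a b a' b' e : ℝ} (h : psgn a - psgn b ≠ 0) (h1 : |a - a'| ≤ e) (h2 : |b - b'| ≤ e) :
    |(a' + b') / 2| ≤ |(a' - b') / 2| + 2 * e := by
  have hs : |a + b| ≤ |a - b| := by
    unfold psgn at h
    by_cases ha : 0 < a <;> by_cases hb : 0 < b
    · simp [ha, hb] at h
    · push Not at hb
      rw [abs_of_nonneg (by linarith : 0 ≤ a - b), abs_le]
      constructor <;> linarith
    · push Not at ha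
      rw [abs_of_nonpos (by linarith : a - b ≤ 0), abs_le]
      constructor <;> linarith
    · simp [ha, hb] at h
  have k1 := abs_le.1 h1
  have k2 := abs_le.1 h2
  have u1 : |(a' + b') / 2| ≤ |(a + b) / 2| + e := by
    have := abs_sub_abs_le_abs_sub ((a' + b') / 2) ((a + b) / 2)
    have h3 : |(a' + b') / 2 - (a + b) / 2| ≤ e := by
      rw [abs_le]; constructor <;> linarith
    linarith
  have u2 : |(a - b) / 2| ≤ |(a' - b') / 2| + e := by
    have := abs_sub_abs_le_abs_sub ((a - b) / 2) ((a' - b') / 2)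
    have h3 : |(a - b) / 2 - (a' - b') / 2| ≤ e := by
      rw [abs_le]; constructor <;> linarith
    linarith
  have u3 : |(a + b) / 2| ≤ |(a - b) / 2| := by
    rw [abs_div, abs_div]
    exact div_le_div_of_nonneg_right hs (abs_nonneg _)
  linarith

lemma psgn_sq (a : ℝ) : psgn a * psgn a = 1 := by
  unfold psgn; split_ifs <;> norm_num

open Classical in
lemma dsum (C : Core μ G M N ρ K c) (S : Sol μ G M N ρ K y Y) (S' : Sol μ G M N ρ K y Y')
    (p n : ℕ) {B : Set Ω} (hB : MeasurableSet B)
    (hg : ∀ ω, ω ∉ B → ∀ j < 2 ^ p, gd p j < ρ ω →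
      |Y (gd p j) ω - YT y N M Y p j ω| ≤ (1 / 2) ^ n ∧
      |Y' (gd p j) ω - YT y N M Y' p j ω| ≤ (1 / 2) ^ n) (J : ℕ) (hJ : J ≤ 2 ^ p) :
    ∫ ω, psi n ((YT y N M Y p J ω - YT y N M Y' p J ω) / 2) ∂μ ≤
      54 * c * ((∫ ω, fq ((1 / 2) ^ n) ((YT y N M Y p J ω + YT y N M Y' p J ω) / 2)
        ((YT y N M Y p J ω - YT y N M Y' p J ω) / 2) ∂μ) + 3 / ((1 / 2) ^ n) ^ 2 *
          (4 * ∑ j ∈ Finset.range J, ∫ ω, |dd N p j ω| ^ 3 ∂μ +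
            32 * ∑ j ∈ Finset.range J, ∫ ω, |dd M p j ω| ^ 3 ∂μ)) +
      1 / (1 / 2) ^ n * (∑ j ∈ Finset.range J,
        ∫ ω, (if ω ∈ B then (1:ℝ) else 0) * dd M p j ω ^ 2 ∂μ) +
      (∑ i ∈ Finset.range (n + 1), 3 / ((1 / 2 : ℝ) ^ i) ^ 2) *
        ∑ j ∈ Finset.range J, ∫ ω, |dd M p j ω| ^ 3 ∂μ := by
  have he : (0:ℝ) < (1 / 2) ^ n := half_pos' n
  induction J with
  | zero =>
    have h0 : ∀ ω, YT y N M Y p 0 ω - YT y N M Y' p 0 ω = 0 := fun ω => by simp [YT, RR]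
    simp only [h0, zero_div, psi_zero, integral_zero, Finset.range_zero, Finset.sum_empty,
      mul_zero, add_zero]
    have : 0 ≤ ∫ ω, fq ((1 / 2) ^ n) ((YT y N M Y p 0 ω + YT y N M Y' p 0 ω) / 2) 0 ∂μ :=
      integral_nonneg fun ω => (fq_pos he _ _).le
    have := C.c0
    positivity
  | succ J ih =>
    have hJ' : J < 2 ^ p := hJ
    have ih := ih hJ'.le
    have hle := C.hM.le (gd p J)
    have b1 := YT_bd C S p J
    have b2 := YT_bd C S' p J
    have hu : Bd (G (gd p J)) (fun ω => (YT y N M Y p J ω + YT y N M Y' p J ω) / 2) :=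
      (b1.add b2).comp (φ := fun x => x / 2) (by fun_prop)
    have hv : Bd (G (gd p J)) (fun ω => (YT y N M Y p J ω - YT y N M Y' p J ω) / 2) :=
      (b1.sub b2).comp (φ := fun x => x / 2) (by fun_prop)
    have s1 := S.psgn_bd (gd_nonneg p J)
    have s2 := S'.psgn_bd (gd_nonneg p J)
    have hα : Bd (G (gd p J)) (fun ω => (psgn (Y (gd p J) ω) + psgn (Y' (gd p J) ω)) / 2) :=
      (s1.add s2).comp (φ := fun x => x / 2) (by fun_prop)
    have hβ : Bd (G (gd p J)) (fun ω => (psgn (Y (gd p J) ω) - psgn (Y' (gd p J) ω)) / 2) :=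
      (s1.sub s2).comp (φ := fun x => x / 2) (by fun_prop)
    have ha : ∀ a b : ℝ, |(psgn a + psgn b) / 2| ≤ 1 ∧ |(psgn a - psgn b) / 2| ≤ 1 := fun a b => by
      have h1 := abs_le.1 (abs_psgn a).le
      have h2 := abs_le.1 (abs_psgn b).le
      rw [abs_le, abs_le]
      refine ⟨⟨?_, ?_⟩, ?_, ?_⟩ <;> linarith
    have F := fstep C hJ' hu hv hα hβ (fun ω => (ha _ _).1) (fun ω => (ha _ _).2)
      (fun ω => by
        have t1 := psgn_sq (Y (gd p J) ω)
        have t2 := psgn_sq (Y' (gd p J) ω)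
        linear_combination t1 / 4 - t2 / 4) he
    have P := pstep C hJ' hu hv hβ (fun ω => (ha _ _).2) n hB (fun ω h1 h2 h3 => by
      have h4 : gd p J < ρ ω := by
        by_contra hh
        push Not at hh
        exact h3 (C.ddM0 hh)
      obtain ⟨g1, g2⟩ := hg ω h1 J hJ' h4
      exact sgn_close (fun h => h2 (by rw [h, zero_div])) g1 g2)
    have e1 : ∀ ω, (YT y N M Y p (J + 1) ω + YT y N M Y' p (J + 1) ω) / 2 =
        (YT y N M Y p J ω + YT y N M Y' p J ω) / 2 + (dd N p J ω +
          (psgn (Y (gd p J) ω) + psgn (Y' (gd p J) ω)) / 2 * dd M p J ω) := fun ω => by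
      rw [YT_succ, YT_succ]; ring
    have e2 : ∀ ω, (YT y N M Y p (J + 1) ω - YT y N M Y' p (J + 1) ω) / 2 =
        (YT y N M Y p J ω - YT y N M Y' p J ω) / 2 +
          (psgn (Y (gd p J) ω) - psgn (Y' (gd p J) ω)) / 2 * dd M p J ω := fun ω => by
      rw [YT_succ, YT_succ]; ring
    simp only [← e1, ← e2] at F P
    have bM := (C.hM.dbd p J).abs
    have bN := (C.hN.dbd p J).abs
    have bM3 := (Bd.const m 32).mul (bM.pow 3)
    have bN3 := (Bd.const m 4).mul (bN.pow 3)
    have cs := Bd.le (μ := μ) ((bN.add ((Bd.const m 2).mul bM)).pow 3) (bN3.add bM3)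
      fun ω => cube_sum _ _
    rw [integral_add bN3.i bM3.i, integral_const_mul, integral_const_mul] at cs
    have cs' := mul_le_mul_of_nonneg_left cs (show 0 ≤ 3 / (((1:ℝ) / 2) ^ n) ^ 2 by positivity)
    simp only [Finset.sum_range_succ _ J]
    generalize (∫ ω, fq ((1 / 2) ^ n) ((YT y N M Y p (J + 1) ω + YT y N M Y' p (J + 1) ω) / 2)
        ((YT y N M Y p (J + 1) ω - YT y N M Y' p (J + 1) ω) / 2) ∂μ) = F1 at *
    generalize (∫ ω, fq ((1 / 2) ^ n) ((YT y N M Y p J ω + YT y N M Y' p J ω) / 2)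
        ((YT y N M Y p J ω - YT y N M Y' p J ω) / 2) ∂μ) = F0 at *
    generalize (∫ ω, (((YT y N M Y p J ω - YT y N M Y' p J ω) / 2) ^ 2 + ((1 / 2) ^ n) ^ 2) /
      fq ((1 / 2) ^ n) ((YT y N M Y p J ω + YT y N M Y' p J ω) / 2)
        ((YT y N M Y p J ω - YT y N M Y' p J ω) / 2) ^ 3 * dd N p J ω ^ 2 ∂μ) = Q at *
    generalize (∫ ω, (|dd N p J ω| + 2 * |dd M p J ω|) ^ 3 ∂μ) = T at *
    generalize ∫ ω, |dd M p J ω| ^ 3 ∂μ = a at *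
    generalize ∫ ω, |dd N p J ω| ^ 3 ∂μ = b at *
    generalize (∑ i ∈ Finset.range (n + 1), 3 / ((1 / 2 : ℝ) ^ i) ^ 2) = D at *
    generalize (3:ℝ) / ((1 / 2) ^ n) ^ 2 = E at *
    generalize (∫ ω, (if ω ∈ B then (1:ℝ) else 0) * dd M p J ω ^ 2 ∂μ) = I at *
    have hc := C.c0
    have k : Q ≤ 2 * (F1 - F0 + E * (4 * b + 32 * a)) := by linarith
    have k2 := mul_le_mul_of_nonneg_left k hc
    clear cs cs' F k
    linarith

end dfin

section cfin
variable {Y Y' : ℝ → Ω → ℝ} {y : ℝ}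

lemma good_meas (C : Core μ G M N ρ K c) (S : Sol μ G M N ρ K y Y) (ε : ℝ) (p : ℕ) :
    MeasurableSet {ω | ∃ j ≤ 2 ^ p, gd p j < ρ ω ∧ ε < |Y (gd p j) ω - YT y N M Y p j ω|} := by
  have : {ω | ∃ j ≤ 2 ^ p, gd p j < ρ ω ∧ ε < |Y (gd p j) ω - YT y N M Y p j ω|} =
      ⋃ j : ℕ, ⋃ _ : j ≤ 2 ^ p, ({ω | gd p j < ρ ω} ∩ {ω | ε < |Y (gd p j) ω - YT y N M Y p j ω|}) := by
    ext ω
    simp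
    exact exists_congr fun i => and_left_comm
  rw [this]
  refine MeasurableSet.iUnion fun j => MeasurableSet.iUnion fun _ => ?_
  have h1 : Measurable (Y (gd p j)) := (S.adp _ (gd_nonneg p j)).mono (C.hM.le _) le_rfl
  have h2 := ((YT_bd C S p j).mono (C.hM.le _)).meas
  have h3 : Measurable (fun ω => |Y (gd p j) ω - YT y N M Y p j ω|) :=
    continuous_abs.measurable.comp (h1.sub h2)
  exact (measurableSet_lt measurable_const C.mρ).inter (measurableSet_lt measurable_const h3)

lemma core_prob (C : Core μ G M N ρ K c) (S : Sol μ G M N ρ K y Y) (S' : Sol μ G M N ρ K y Y')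
    {a θ : ℝ} (ha : 0 < a) (hθ : 0 < θ) :
    μ.real {ω | 1 < ρ ω ∧ 4 * a < |Y 1 ω - Y' 1 ω|} ≤ θ := by
  classical
  have hc := C.c0
  have hK := C.hM.K0
  set A : ℝ := 2 * (|y| + K + 1 + K ^ 2) + 1 with hA
  have A0 : 0 < A := by positivity
  obtain ⟨n, hn1, hn2⟩ : ∃ n : ℕ, ((1:ℝ) / 2) ^ n ≤ a ∧
      2 * (54 * c * A + 1) / θ ≤ (n + 1) * a - 2 := by
    obtain ⟨n1, h1⟩ := exists_pow_lt_of_lt_one ha (by norm_num : (1:ℝ) / 2 < 1)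
    obtain ⟨n2, h2⟩ := exists_nat_ge ((2 * (54 * c * A + 1) / θ + 2) / a)
    refine ⟨max n1 n2, ?_, ?_⟩
    · exact (pow_le_pow_of_le_one (by norm_num) (by norm_num) (le_max_left n1 n2)).trans h1.le
    · rw [div_le_iff₀ ha] at h2
      have : (n2 : ℝ) ≤ (max n1 n2 : ℕ) := by exact_mod_cast le_max_right n1 n2
      have := mul_le_mul_of_nonneg_right this ha.le
      linarith
  have he : (0:ℝ) < (1 / 2) ^ n := half_pos' n
  have he1 : ((1:ℝ) / 2) ^ n ≤ 1 := pow_le_one₀ (by norm_num) (by norm_num)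
  set E : ℝ := 3 / ((1 / 2) ^ n) ^ 2 with hE
  set D : ℝ := ∑ i ∈ Finset.range (n + 1), 3 / ((1 / 2 : ℝ) ^ i) ^ 2 with hD
  have E0 : 0 ≤ E := by positivity
  have D0 : 0 ≤ D := Finset.sum_nonneg fun i _ => by positivity
  set κ : ℝ := 1 / (2 * (54 * c * (E * 36) + D + 1)) with hκ
  have κ0 : 0 < κ := by positivity
  set la : ℝ := (1 / 2) ^ n / (4 * (160 * K ^ 4 + 1)) with hla
  have la0 : 0 < la := by positivity
  set η : ℝ := min (θ / 2) ((1 / 2) ^ n * la) with hη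
  have η0 : 0 < η := by positivity
  obtain ⟨p1, hp1⟩ := good C S he (half_pos η0)
  obtain ⟨p2, hp2⟩ := good C S' he (half_pos η0)
  obtain ⟨p3, hp3⟩ := third C.hM κ0
  obtain ⟨p4, hp4⟩ := third C.hN κ0
  set p := max (max p1 p2) (max p3 p4) with hp
  have q1 := hp1 p (by omega)
  have q2 := hp2 p (by omega)
  have q3 := hp3 p (by omega)
  have q4 := hp4 p (by omega)
  set B1 := {ω | ∃ j ≤ 2 ^ p, gd p j < ρ ω ∧ (1 / 2) ^ n < |Y (gd p j) ω - YT y N M Y p j ω|} with hB1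
  set B2 := {ω | ∃ j ≤ 2 ^ p, gd p j < ρ ω ∧ (1 / 2) ^ n < |Y' (gd p j) ω - YT y N M Y' p j ω|} with hB2
  have q1 : μ.real B1 ≤ η / 2 := q1
  have q2 : μ.real B2 ≤ η / 2 := q2
  have mB : MeasurableSet (B1 ∪ B2) := (good_meas C S _ p).union (good_meas C S' _ p)
  have hB : μ.real (B1 ∪ B2) ≤ η := by
    have := measureReal_union_le (μ := μ) B1 B2
    linarith
  have hg : ∀ ω, ω ∉ B1 ∪ B2 → ∀ j ≤ 2 ^ p, gd p j < ρ ω →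
      |Y (gd p j) ω - YT y N M Y p j ω| ≤ (1 / 2) ^ n ∧
      |Y' (gd p j) ω - YT y N M Y' p j ω| ≤ (1 / 2) ^ n := fun ω hω j hj hr => by
    constructor
    · by_contra hh
      exact hω (Or.inl ⟨j, hj, hr, not_le.1 hh⟩)
    · by_contra hh
      exact hω (Or.inr ⟨j, hj, hr, not_le.1 hh⟩)
  have main := dsum C S S' p n mB (fun ω h j hj => hg ω h j hj.le) (2 ^ p) le_rfl
  have iq := indQ C.hM p (2 ^ p) mB la0
  have b1 := (YT_bd C S p (2 ^ p)).mono (C.hM.le _)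
  have b2 := (YT_bd C S' p (2 ^ p)).mono (C.hM.le _)
  have hu : Bd m (fun ω => (YT y N M Y p (2 ^ p) ω + YT y N M Y' p (2 ^ p) ω) / 2) :=
    (b1.add b2).comp (φ := fun x => x / 2) (by fun_prop)
  have hv : Bd m (fun ω => (YT y N M Y p (2 ^ p) ω - YT y N M Y' p (2 ^ p) ω) / 2) :=
    (b1.sub b2).comp (φ := fun x => x / 2) (by fun_prop)
  have fb := Bd.le (μ := μ) (hu.comp2 hv (fq_cont ((1 / 2) ^ n)))
    ((b1.abs.add b2.abs).add (Bd.const m 1)) fun ω => by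
      have t1 := fq_le_add he ((YT y N M Y p (2 ^ p) ω + YT y N M Y' p (2 ^ p) ω) / 2)
        ((YT y N M Y p (2 ^ p) ω - YT y N M Y' p (2 ^ p) ω) / 2)
      have t2 := half_sum_diff (YT y N M Y p (2 ^ p) ω) (YT y N M Y' p (2 ^ p) ω)
      linarith
  rw [integral_add (b1.abs.add b2.abs).i (Bd.const m 1).i, integral_add b1.abs.i b2.abs.i] at fb
  simp only [integral_const, probReal_univ, one_smul] at fb
  have i1 := YT_int C S p (2 ^ p)
  have i2 := YT_int C S' p (2 ^ p)
  rw [← hD, ← hE] at main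
  have mk := Bd.markov (μ := μ) (hv.comp (psi_cont n)) (fun ω => psi_nonneg n _)
    (A := {ω | a ≤ |(YT y N M Y p (2 ^ p) ω - YT y N M Y' p (2 ^ p) ω) / 2|})
    (measurableSet_le measurable_const hv.abs.meas) (a := (n + 1) * a - 2)
    (lt_of_lt_of_le (by positivity) hn2) (fun ω hω => psi_ge n hω)
  have sub : {ω | 1 < ρ ω ∧ 4 * a < |Y 1 ω - Y' 1 ω|} ⊆ (B1 ∪ B2) ∪
      {ω | a ≤ |(YT y N M Y p (2 ^ p) ω - YT y N M Y' p (2 ^ p) ω) / 2|} := by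
    rintro ω ⟨h1, h2⟩
    by_cases hω : ω ∈ B1 ∪ B2
    · exact Or.inl hω
    right
    have := hg ω hω (2 ^ p) le_rfl (by rw [gd_one]; exact h1)
    rw [gd_one] at this
    obtain ⟨g1, g2⟩ := this
    show a ≤ _
    have k1 := abs_le.1 (g1.trans hn1)
    have k2 := abs_le.1 (g2.trans hn1)
    rcases lt_abs.1 h2 with h | h
    · exact le_abs.2 (Or.inl (by linarith))
    · exact le_abs.2 (Or.inr (by linarith))
  have fin := (measureReal_mono sub).trans (measureReal_union_le (μ := μ) _ _)
  -- numeric part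
  have r1 : 54 * c * (E * (4 * ∑ j ∈ Finset.range (2 ^ p), ∫ ω, |dd N p j ω| ^ 3 ∂μ +
      32 * ∑ j ∈ Finset.range (2 ^ p), ∫ ω, |dd M p j ω| ^ 3 ∂μ)) ≤ 54 * c * (E * 36) * κ := by
    have : 54 * c * (E * 36) * κ = 54 * c * (E * (36 * κ)) := by ring
    rw [this]
    refine mul_le_mul_of_nonneg_left (mul_le_mul_of_nonneg_left ?_ E0) (by positivity)
    linarith
  have r2 := mul_le_mul_of_nonneg_left q3 D0
  have r3 : 54 * c * (E * 36) * κ + D * κ ≤ 1 / 2 := by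
    have : (54 * c * (E * 36) + D + 1) * κ = 1 / 2 := by
      rw [hκ]; field_simp
    linarith
  have r4 : 1 / (1 / 2) ^ n * (∑ j ∈ Finset.range (2 ^ p),
        ∫ ω, (@ite ℝ (ω ∈ B1 ∪ B2) (Classical.propDecidable _) 1 0) * dd M p j ω ^ 2 ∂μ) ≤ 1 / 2 := by
    rw [one_div_mul_eq_div, div_le_iff₀ he]
    refine iq.trans ?_
    have s1 : la * (160 * K ^ 4 + 1) = (1 / 2) ^ n / 4 := by rw [hla]; field_simp
    have s2 : μ.real (B1 ∪ B2) / (4 * la) ≤ (1 / 2) ^ n / 4 := by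
      rw [div_le_iff₀ (by positivity)]
      have := hB.trans (min_le_right _ _)
      linarith
    linarith
  have r5 : ∫ ω, psi n ((YT y N M Y p (2 ^ p) ω - YT y N M Y' p (2 ^ p) ω) / 2) ∂μ ≤
      54 * c * A + 1 := by
    have : 54 * c * (∫ ω, fq ((1 / 2) ^ n) ((YT y N M Y p (2 ^ p) ω + YT y N M Y' p (2 ^ p) ω) / 2)
        ((YT y N M Y p (2 ^ p) ω - YT y N M Y' p (2 ^ p) ω) / 2) ∂μ) ≤ 54 * c * A :=
      mul_le_mul_of_nonneg_left (by linarith) (by positivity)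
    rw [mul_add (54 * c)] at main
    linarith
  have hpos : 0 < ((n:ℝ) + 1) * a - 2 := lt_of_lt_of_le (by positivity) hn2
  have r6 : (54 * c * A + 1) / ((n + 1) * a - 2) ≤ θ / 2 := by
    rw [div_le_iff₀ hθ] at hn2
    rw [div_le_iff₀ hpos]
    linarith
  have r7 := div_le_div_of_nonneg_right r5 hpos.le
  have r8 := hB.trans (min_le_left _ _)
  linarith

/-- The core uniqueness statement. -/
theorem core (C : Core μ G M N ρ K c) (S : Sol μ G M N ρ K y Y) (S' : Sol μ G M N ρ K y Y') :
    μ {ω | 1 < ρ ω ∧ Y 1 ω ≠ Y' 1 ω} = 0 := by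
  have h0 : ∀ k : ℕ, μ {ω | 1 < ρ ω ∧ 4 * (1 / ((k:ℝ) + 1)) < |Y 1 ω - Y' 1 ω|} = 0 := fun k => by
    rw [← measureReal_eq_zero_iff]
    refine le_antisymm (le_of_forall_pos_le_add fun θ hθ => ?_) measureReal_nonneg
    rw [zero_add]
    exact core_prob C S S' (by positivity) hθ
  refine measure_mono_null ?_ (measure_iUnion_null h0)
  rintro ω ⟨h1, h2⟩
  have : 0 < |Y 1 ω - Y' 1 ω| := abs_pos.2 (sub_ne_zero.2 h2)
  obtain ⟨k, hk⟩ := exists_nat_one_div_lt (show 0 < |Y 1 ω - Y' 1 ω| / 4 by positivity)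
  exact mem_iUnion.2 ⟨k, h1, by linarith⟩

end cfin

section os

/-- a continuous (integrable) martingale -/
structure CM (μ : Measure Ω) (G : ℝ → MeasurableSpace Ω) (V : ℝ → Ω → ℝ) : Prop where
  mono : Monotone G
  le : ∀ t, G t ≤ m
  adp : ∀ t, 0 ≤ t → Measurable[G t] (V t)
  cont : ∀ ω, Continuous fun t => V t ω
  int : ∀ t, 0 ≤ t → Integrable (V t) μ
  orth : ∀ s t, 0 ≤ s → s ≤ t → ∀ Z, Bd (G s) Z → ∫ ω, Z ω * (V t ω - V s ω) ∂μ = 0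

variable {V : ℝ → Ω → ℝ}

lemma Bd.mul_int {Z f : Ω → ℝ} (hZ : Bd m Z) (hf : Integrable f μ) :
    Integrable (fun ω => Z ω * f ω) μ := by
  obtain ⟨hm, B, hB⟩ := hZ
  exact hf.bdd_mul hm.aestronglyMeasurable (ae_of_all _ fun ω => by rw [Real.norm_eq_abs]; exact hB ω)

/-- index of the first grid point after `ρ` -/
def kap (s h : ℝ) (ρ : Ω → ℝ) (ω : Ω) : ℕ := ⌈(ρ ω - s) / h⌉₊

lemma kap_le {s h : ℝ} (hh : 0 < h) {k : ℕ} {ω : Ω} : kap s h ρ ω ≤ k ↔ ρ ω ≤ s + h * k := by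
  unfold kap
  rw [Nat.ceil_le, div_le_iff₀ hh]
  constructor <;> intro h <;> linarith

lemma os_sum (s : ℝ) {h : ℝ} (hh : 0 < h) (n : ℕ) (ω : Ω) :
    ∑ i ∈ Finset.range n, (if s + h * i < ρ ω then (1:ℝ) else 0) *
      (V (s + h * (i + 1 : ℕ)) ω - V (s + h * i) ω) =
    V (s + h * (min n (kap s h ρ ω) : ℕ)) ω - V s ω := by
  induction n with
  | zero => simp
  | succ n ih =>
    rw [Finset.sum_range_succ, ih]
    by_cases hk : kap s h ρ ω ≤ n
    · have := (kap_le hh).1 hk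
      rw [if_neg (not_lt.2 this), min_eq_right hk, min_eq_right (hk.trans n.le_succ)]
      ring
    · have h1 : ¬ ρ ω ≤ s + h * n := fun h => hk ((kap_le hh).2 h)
      rw [if_pos (not_le.1 h1), min_eq_left (by omega), min_eq_left (by omega)]
      ring

lemma os_zero (h : CM μ G V) (hρ : ∀ t, 0 ≤ t → MeasurableSet[G t] {ω | ρ ω ≤ t}) {s : ℝ}
    (hs : 0 ≤ s) {d : ℝ} (hd : 0 < d) {Z : Ω → ℝ} (hZ : Bd (G s) Z) (n : ℕ) :
    ∫ ω, Z ω * (V (s + d * (min n (kap s d ρ ω) : ℕ)) ω - V s ω) ∂μ = 0 := by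
  simp only [← os_sum s hd, Finset.mul_sum]
  have st : ∀ i : ℕ, 0 ≤ s + d * i := fun i => by positivity
  have bz : ∀ i : ℕ, Bd (G (s + d * i)) (fun ω => Z ω * (if s + d * i < ρ ω then (1:ℝ) else 0)) :=
    fun i => (hZ.mono (h.mono (by nlinarith [Nat.cast_nonneg (α := ℝ) i]))).mul (Bd.ind (by
      have := @MeasurableSet.compl _ _ (G (s + d * i)) (hρ _ (st i))
      convert this using 1
      ext ω; simp))
  have e : ∀ (i : ℕ) ω, Z ω * ((if s + d * i < ρ ω then (1:ℝ) else 0) *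
      (V (s + d * (i + 1 : ℕ)) ω - V (s + d * i) ω)) = (Z ω * (if s + d * i < ρ ω then (1:ℝ) else 0)) *
      (V (s + d * (i + 1 : ℕ)) ω - V (s + d * i) ω) := fun i ω => by ring
  simp only [e]
  rw [integral_finsetSum]
  · refine Finset.sum_eq_zero fun i _ => h.orth _ _ (st i) ?_ _ (bz i)
    push_cast
    nlinarith
  · exact fun i _ => ((bz i).mono (h.le _)).mul_int ((h.int _ (st _)).sub (h.int _ (st _)))

lemma abs_dist_clip {R x : ℝ} (hR : 0 ≤ R) : |x - max (-R) (min R x)| ≤ (if R < |x| then (1:ℝ) else 0) * |x| := by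
  split_ifs with h
  · rw [one_mul]
    rcases lt_abs.1 h with h | h
    · rw [min_eq_left h.le, max_eq_right (by linarith), abs_le, abs_of_pos (by linarith)]
      constructor <;> linarith
    · rw [min_eq_right (by linarith), max_eq_left (by linarith), abs_le, abs_of_neg (by linarith)]
      constructor <;> linarith
  · have := abs_le.1 (not_lt.1 h)
    rw [min_eq_right this.2, max_eq_right this.1]
    simp

open Classical in
lemma os_ui (h : CM μ G V) (hρ : ∀ t, 0 ≤ t → MeasurableSet[G t] {ω | ρ ω ≤ t}) {s : ℝ}
    (hs : 0 ≤ s) {d : ℝ} (hd : 0 < d) (n : ℕ) (R : ℝ) {A : Set Ω} (hA : MeasurableSet A)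
    (hAR : ∀ ω, ∀ k ≤ n, R < |V (s + d * k) ω| → ω ∈ A) :
    ∫ ω, (if R < |V (s + d * (min n (kap s d ρ ω) : ℕ)) ω| then (1:ℝ) else 0) *
      |V (s + d * (min n (kap s d ρ ω) : ℕ)) ω| ∂μ ≤
    ∫ ω, (if ω ∈ A then (1:ℝ) else 0) * |V (s + d * n) ω| ∂μ := by
  have st : ∀ i : ℕ, 0 ≤ s + d * i := fun i => by positivity
  set J : ℕ → Ω → ℝ := fun k ω => (if min n (kap s d ρ ω) = k then (1:ℝ) else 0) *
    (if R < |V (s + d * k) ω| then (1:ℝ) else 0) with hJ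
  have m1 : ∀ k : ℕ, MeasurableSet[G (s + d * k)] {ω | min n (kap s d ρ ω) ≤ k} := fun k => by
    by_cases hk : n ≤ k
    · have : {ω | min n (kap s d ρ ω) ≤ k} = univ := by
        ext ω; simp [hk]
      rw [this]; exact @MeasurableSet.univ _ (G (s + d * k))
    · have : {ω | min n (kap s d ρ ω) ≤ k} = {ω | ρ ω ≤ s + d * k} := by
        ext ω
        simp only [Set.mem_ofPred_eq, min_le_iff, hk, false_or]
        exact kap_le hd
      rw [this]; exact hρ _ (st k)
  have m2 : ∀ k : ℕ, MeasurableSet[G (s + d * k)] {ω | min n (kap s d ρ ω) = k} := fun k => by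
    rcases k with _ | k
    · have : {ω | min n (kap s d ρ ω) = 0} = {ω | min n (kap s d ρ ω) ≤ 0} := by
        ext ω; simp
      rw [this]; exact m1 0
    · have : {ω | min n (kap s d ρ ω) = k + 1} =
          {ω | min n (kap s d ρ ω) ≤ (k + 1 : ℕ)} \ {ω | min n (kap s d ρ ω) ≤ k} := by
        ext ω
        simp only [Set.mem_ofPred_eq, Set.mem_sdiff]
        omega
      rw [this]
      exact @MeasurableSet.diff _ (G (s + d * (k + 1 : ℕ))) _ _ (m1 (k + 1))
        (h.mono (by push_cast; nlinarith) _ (m1 k))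
  have mV : ∀ k : ℕ, MeasurableSet[G (s + d * k)] {ω | R < |V (s + d * k) ω|} := fun k => by
    have hv := h.adp _ (st k)
    have hv2 := @Measurable.comp _ _ _ (G (s + d * k)) _ _ _ _ continuous_abs.measurable hv
    exact hv2 measurableSet_Ioi
  have bJ : ∀ k : ℕ, Bd (G (s + d * k)) (J k) := fun k => (Bd.ind (m2 k)).mul (Bd.ind (mV k))
  have bS : ∀ k : ℕ, Bd (G (s + d * k)) (fun ω => psgn (V (s + d * k) ω)) := fun k =>
    Bd.mk' (psgn_meas.comp (h.adp _ (st k))) 1 fun _ => (abs_psgn _).le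
  have ps : ∀ x : ℝ, psgn x * x = |x| := fun x => by
    unfold psgn
    split_ifs with hx
    · rw [abs_of_pos hx, one_mul]
    · rw [abs_of_nonpos (not_lt.1 hx)]; ring
  have key : ∀ k ∈ Finset.range (n + 1), ∫ ω, J k ω * |V (s + d * k) ω| ∂μ ≤
      ∫ ω, J k ω * |V (s + d * n) ω| ∂μ := fun k hk => by
    have hk : k ≤ n := by have := Finset.mem_range.1 hk; omega
    have hkn : s + d * k ≤ s + d * n := by
      have : (k:ℝ) ≤ n := by exact_mod_cast hk
      nlinarith
    have o := h.orth _ _ (st k) hkn _ ((bJ k).mul (bS k))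
    have b := ((bJ k).mul (bS k)).mono (h.le _)
    have e : ∫ ω, J k ω * |V (s + d * k) ω| ∂μ =
        ∫ ω, J k ω * psgn (V (s + d * k) ω) * V (s + d * n) ω ∂μ := by
      have i1 := b.mul_int (h.int _ (st n))
      have i2 := b.mul_int (h.int _ (st k))
      have : ∀ ω, J k ω * |V (s + d * k) ω| =
          J k ω * psgn (V (s + d * k) ω) * V (s + d * k) ω := fun ω => by
        rw [mul_assoc (J k ω), ps]
      simp only [this]
      simp only [mul_sub] at o
      rw [integral_sub i1 i2] at o
      linarith
    rw [e]
    refine integral_mono (b.mul_int (h.int _ (st n)))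
      (((bJ k).mono (h.le _)).mul_int (h.int _ (st n)).abs) fun ω => ?_
    show J k ω * psgn (V (s + d * k) ω) * V (s + d * n) ω ≤ J k ω * |V (s + d * n) ω|
    rw [mul_assoc]
    refine mul_le_mul_of_nonneg_left ?_ ?_
    · refine (le_abs_self _).trans ?_
      rw [abs_mul, abs_psgn, one_mul]
    · simp only [hJ]; split_ifs <;> norm_num
  have sumJ : ∀ ω (f : ℕ → ℝ), ∑ k ∈ Finset.range (n + 1), J k ω * f k =
      (if R < |V (s + d * (min n (kap s d ρ ω) : ℕ)) ω| then (1:ℝ) else 0) *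
        f (min n (kap s d ρ ω)) := fun ω f => by
    rw [Finset.sum_eq_single (min n (kap s d ρ ω))]
    · simp only [hJ, if_true, one_mul]
    · intro k _ hk
      simp only [hJ, if_neg hk.symm, zero_mul]
    · intro hh
      exact absurd (Finset.mem_range.2 (by omega)) hh
  have t := Finset.sum_le_sum key
  rw [← integral_finsetSum, ← integral_finsetSum] at t
  · have e1 : ∀ ω, ∑ k ∈ Finset.range (n + 1), J k ω * |V (s + d * k) ω| = _ :=
      fun ω => sumJ ω (fun k => |V (s + d * k) ω|)
    have e2 : ∀ ω, ∑ k ∈ Finset.range (n + 1), J k ω * |V (s + d * n) ω| = _ :=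
      fun ω => sumJ ω (fun _ => |V (s + d * n) ω|)
    simp only [e1] at t
    refine t.trans ?_
    refine integral_mono (integrable_finsetSum _ fun k _ =>
      ((bJ k).mono (h.le _)).mul_int (h.int _ (st n)).abs)
      ((Bd.ind (p := fun ω => ω ∈ A) hA).mul_int (h.int _ (st n)).abs) fun ω => ?_
    show ∑ k ∈ Finset.range (n + 1), J k ω * |V (s + d * n) ω| ≤ _
    rw [e2]
    refine mul_le_mul_of_nonneg_right ?_ (abs_nonneg _)
    split_ifs with h1 h2 h2
    · norm_num
    · exact absurd (hAR ω _ (min_le_left _ _) h1) h2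
    · norm_num
    · norm_num
  · exact fun k _ => ((bJ k).mono (h.le _)).mul_int (h.int _ (st n)).abs
  · exact fun k _ => ((bJ k).mono (h.le _)).mul_int (h.int _ (st k)).abs

end os

section os2
variable {V : ℝ → Ω → ℝ}

lemma os_integrable (h : CM μ G V) (hρ : ∀ t, 0 ≤ t → MeasurableSet[G t] {ω | ρ ω ≤ t}) {s : ℝ}
    (hs : 0 ≤ s) {d : ℝ} (hd : 0 < d) (n : ℕ) :
    Integrable (fun ω => V (s + d * (min n (kap s d ρ ω) : ℕ)) ω) μ := by
  have st : ∀ i : ℕ, 0 ≤ s + d * i := fun i => by positivity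
  have e : ∀ ω, V (s + d * (min n (kap s d ρ ω) : ℕ)) ω = V s ω +
    ∑ i ∈ Finset.range n, (if s + d * i < ρ ω then (1:ℝ) else 0) *
      (V (s + d * (i + 1 : ℕ)) ω - V (s + d * i) ω) := fun ω => by rw [os_sum s hd]; ring
  simp only [e]
  refine (h.int s hs).add (integrable_finsetSum _ fun i _ => ?_)
  refine (Bd.ind ?_).mul_int ((h.int _ (st _)).sub (h.int _ (st _)))
  have := (h.le _ _ (hρ _ (st i))).compl
  convert this using 1
  ext ω; simp

lemma os_point {s t r : ℝ} (hst : s < t) (hr : s < r) (L : ℕ) (ω : Ω) :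
    |(s + (t - s) / 2 ^ L * (min (2 ^ L) (kap s ((t - s) / 2 ^ L) (fun _ => r) ω) : ℕ)) - min t r| ≤
      (t - s) / 2 ^ L := by
  have hd : 0 < (t - s) / 2 ^ L := div_pos (by linarith) (by positivity)
  set d := (t - s) / 2 ^ L with hdd
  set κ := kap s d (fun _ : Ω => r) ω with hκ
  have h1 : r ≤ s + d * κ := (kap_le (ρ := fun _ : Ω => r) (ω := ω) hd).1 le_rfl
  have h2 : d * κ < r - s + d := by
    have := Nat.ceil_lt_add_one (show 0 ≤ (r - s) / d from div_nonneg (by linarith) hd.le)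
    have h3 : (κ : ℝ) < (r - s) / d + 1 := this
    have h4 := mul_lt_mul_of_pos_left h3 hd
    have : d * ((r - s) / d + 1) = r - s + d := by field_simp
    linarith
  have h3 : d * 2 ^ L = t - s := by rw [hdd]; field_simp
  rcases le_total (2 ^ L) κ with hk | hk
  · rw [min_eq_left hk]
    have : (2:ℝ) ^ L ≤ κ := by exact_mod_cast hk
    have := mul_le_mul_of_nonneg_left this hd.le
    push_cast
    rw [h3, abs_le]
    constructor
    · have := min_le_left t r; linarith
    · have : t - d ≤ min t r := le_min (by linarith) (by linarith)
      linarith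
  · rw [min_eq_right hk]
    have : (κ : ℝ) ≤ 2 ^ L := by exact_mod_cast hk
    have := mul_le_mul_of_nonneg_left this hd.le
    rw [min_eq_right (by linarith : r ≤ t), abs_le]
    constructor <;> linarith

lemma os_lim {s t : ℝ} (hst : s < t) {ω : Ω} (hc : Continuous fun t => V t ω) (hr : s < ρ ω) :
    Tendsto (fun L : ℕ => V (s + (t - s) / 2 ^ L * (min (2 ^ L) (kap s ((t - s) / 2 ^ L) ρ ω) : ℕ)) ω)
      atTop (nhds (V (min t (ρ ω)) ω)) := by
  refine (hc.tendsto _).comp ?_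
  rw [tendsto_iff_dist_tendsto_zero]
  have h0 : Tendsto (fun L : ℕ => (t - s) / 2 ^ L) atTop (nhds 0) := by
    have := (tendsto_pow_atTop_nhds_zero_of_lt_one (r := (1:ℝ) / 2) (by norm_num) (by norm_num)).const_mul (t - s)
    rw [mul_zero] at this
    refine this.congr fun L => ?_
    rw [one_div, inv_pow]; rfl
  refine squeeze_zero (fun _ => dist_nonneg) (fun L => ?_) h0
  rw [Real.dist_eq]
  exact os_point (Ω := Ω) hst hr L ω

/-- optional stopping, with the stopped process bounded -/
lemma os_main (h : CM μ G V) (hρ : ∀ t, 0 ≤ t → MeasurableSet[G t] {ω | ρ ω ≤ t}) {s t : ℝ}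
    (hs : 0 ≤ s) (hst : s ≤ t) (hK : 0 ≤ K)
    (hb : ∀ ω, s < ρ ω → ∀ u, s ≤ u → u ≤ ρ ω → |V u ω| ≤ K) {Z : Ω → ℝ} (hZ : Bd (G s) Z) :
    ∫ ω, Z ω * ((if s < ρ ω then (1:ℝ) else 0) * (V (min t (ρ ω)) ω - V s ω)) ∂μ = 0 := by
  classical
  rcases hst.eq_or_lt with rfl | hst
  · refine integral_eq_zero_of_ae (ae_of_all _ fun ω => ?_)
    show Z ω * ((if s < ρ ω then (1:ℝ) else 0) * (V (min s (ρ ω)) ω - V s ω)) = (0:ℝ)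
    split_ifs with hh
    · rw [min_eq_left hh.le]; ring
    · ring
  set W : Ω → ℝ := fun ω => Z ω * (if s < ρ ω then (1:ℝ) else 0) with hW
  have bW : Bd (G s) W := hZ.mul (Bd.ind (by
      have := @MeasurableSet.compl _ _ (G s) (hρ _ hs)
      convert this using 1
      ext ω; simp))
  have bWm := bW.mono (h.le s)
  obtain ⟨B, hB⟩ := bW.2
  have hΩ : Nonempty Ω := nonempty_of_isProbabilityMeasure μ
  have B0 : 0 ≤ B := (abs_nonneg _).trans (hB hΩ.some)
  have W0 : ∀ ω, ¬ s < ρ ω → W ω = 0 := fun ω hω => by simp only [hW, if_neg hω, mul_zero]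
  set d : ℕ → ℝ := fun L => (t - s) / 2 ^ L with hd
  have d0 : ∀ L, 0 < d L := fun L => div_pos (by linarith) (by positivity)
  have dt : ∀ L : ℕ, s + d L * (2 ^ L : ℕ) = t := fun L => by
    simp only [hd]; push_cast; field_simp; ring
  set U : ℕ → Ω → ℝ := fun L ω => V (s + d L * (min (2 ^ L) (kap s (d L) ρ ω) : ℕ)) ω with hU
  have iU : ∀ L, Integrable (U L) μ := fun L => os_integrable h hρ hs (d0 L) (2 ^ L)
  have mU : ∀ L, ∫ ω, W ω * U L ω ∂μ = ∫ ω, W ω * V s ω ∂μ := fun L => by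
    have := os_zero h hρ hs (d0 L) bW (2 ^ L)
    simp only [mul_sub] at this
    rw [integral_sub (bWm.mul_int (iU L)) (bWm.mul_int (h.int s hs))] at this
    linarith
  set A : ℕ → Set Ω := fun j => ⋃ L : ℕ, ⋃ k : ℕ, ⋃ _ : k ≤ 2 ^ L, {ω | K + j < |V (s + d L * k) ω|} with hA
  have mA : ∀ j, MeasurableSet (A j) := fun j => by
    refine MeasurableSet.iUnion fun L => MeasurableSet.iUnion fun k => MeasurableSet.iUnion fun _ => ?_
    have d0 := (d0 L).le
    have hv : Measurable (V (s + d L * k)) := (h.adp _ (by positivity)).mono (h.le _) le_rfl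
    exact measurableSet_lt measurable_const (continuous_abs.measurable.comp hv)
  have lim : ∀ j : ℕ, |∫ ω, W ω * V (min t (ρ ω)) ω ∂μ - ∫ ω, W ω * V s ω ∂μ| ≤
      B * ∫ ω, (if ω ∈ A j then (1:ℝ) else 0) * |V t ω| ∂μ := fun j => by
    set R : ℝ := K + j with hR
    have R0 : 0 ≤ R := by positivity
    have cl : ∀ x : ℝ, |max (-R) (min R x)| ≤ R := fun x => by
      rw [abs_le]
      exact ⟨le_max_left _ _, max_le (by linarith) (min_le_left _ _)⟩
    have clc : Continuous fun x : ℝ => max (-R) (min R x) := by fun_prop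
    have t1 : Tendsto (fun L => ∫ ω, W ω * max (-R) (min R (U L ω)) ∂μ) atTop
        (nhds (∫ ω, W ω * V (min t (ρ ω)) ω ∂μ)) := by
      refine tendsto_integral_of_dominated_convergence (fun _ => B * R) (fun L => ?_)
        (integrable_const _) (fun L => ae_of_all _ fun ω => ?_) (ae_of_all _ fun ω => ?_)
      · exact bWm.meas.aestronglyMeasurable.mul
          (clc.comp_aestronglyMeasurable (iU L).aestronglyMeasurable)
      · rw [Real.norm_eq_abs, abs_mul]
        exact mul_le_mul (hB ω) (cl _) (abs_nonneg _) B0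
      · by_cases hω : s < ρ ω
        · have := (clc.tendsto _).comp (os_lim hst (h.cont ω) hω)
          have e : max (-R) (min R (V (min t (ρ ω)) ω)) = V (min t (ρ ω)) ω := by
            have := abs_le.1 (hb ω hω (min t (ρ ω)) (le_min hst.le hω.le) (min_le_right _ _))
            have hj : (0:ℝ) ≤ j := Nat.cast_nonneg j
            rw [min_eq_right (by linarith), max_eq_right (by linarith)]
          rw [e] at this
          exact this.const_mul _
        · simp only [W0 ω hω, zero_mul]
          exact tendsto_const_nhds
    refine le_of_tendsto ((t1.sub_const _).abs) (Eventually.of_forall fun L => ?_)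
    rw [← mU L]
    have i1 : Integrable (fun ω => W ω * max (-R) (min R (U L ω))) μ := bWm.mul_int (by
      refine Integrable.mono' (integrable_const R)
        (clc.comp_aestronglyMeasurable (iU L).aestronglyMeasurable) (ae_of_all _ fun ω => ?_)
      rw [Real.norm_eq_abs]; exact cl _)
    rw [← integral_sub i1 (bWm.mul_int (iU L))]
    have ui := os_ui h hρ hs (d0 L) (2 ^ L) R (mA j) (fun ω k hk hh => by
      exact mem_iUnion.2 ⟨L, mem_iUnion.2 ⟨k, mem_iUnion.2 ⟨hk, hh⟩⟩⟩)
    rw [dt L] at ui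
    refine abs_integral_le_integral_abs.trans (le_trans ?_ (mul_le_mul_of_nonneg_left ui B0))
    rw [← integral_const_mul]
    refine integral_mono_of_nonneg (ae_of_all _ fun ω => abs_nonneg _) ?_ (ae_of_all _ fun ω => ?_)
    · have : Integrable (fun ω => (if R < |U L ω| then (1:ℝ) else 0) * |U L ω|) μ := by
        refine (iU L).abs.mono' ?_ (ae_of_all _ fun ω => ?_)
        · have hm : Measurable fun x : ℝ => (if R < |x| then (1:ℝ) else 0) * |x| :=
            (Measurable.ite (measurableSet_lt measurable_const continuous_abs.measurable)
              measurable_const measurable_const).mul continuous_abs.measurable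
          exact (hm.comp_aemeasurable (iU L).aestronglyMeasurable.aemeasurable).aestronglyMeasurable
        · rw [Real.norm_eq_abs, abs_mul, abs_abs]
          refine mul_le_of_le_one_left (abs_nonneg _) ?_
          split_ifs <;> norm_num
      exact this.const_mul B
    · show |W ω * max (-R) (min R (U L ω)) - W ω * U L ω| ≤ B * _
      rw [← mul_sub, abs_mul, abs_sub_comm]
      exact mul_le_mul (hB ω) (abs_dist_clip R0) (abs_nonneg _) B0
  have t2 : Tendsto (fun j : ℕ => ∫ ω, (if ω ∈ A j then (1:ℝ) else 0) * |V t ω| ∂μ) atTop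
      (nhds (∫ _ω, (0:ℝ) ∂μ)) := by
    have it := (h.int t (hs.trans hst.le)).abs
    refine tendsto_integral_of_dominated_convergence (fun ω => |V t ω|) (fun j => ?_)
      it (fun j => ae_of_all _ fun ω => ?_) (ae_of_all _ fun ω => ?_)
    · exact ((Bd.ind (p := fun ω => ω ∈ A j) (mA j)).mul_int it).aestronglyMeasurable
    · rw [Real.norm_eq_abs, abs_mul, abs_abs]
      refine mul_le_of_le_one_left (abs_nonneg _) ?_
      split_ifs <;> norm_num
    · obtain ⟨b, hb⟩ := (isCompact_Icc (a := s) (b := t)).exists_bound_of_continuousOn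
        (h.cont ω).continuousOn
      obtain ⟨j0, hj0⟩ := exists_nat_ge b
      refine tendsto_const_nhds.congr' ?_
      filter_upwards [eventually_ge_atTop j0] with j hj
      have : ω ∉ A j := by
        intro hω
        obtain ⟨L, h1⟩ := mem_iUnion.1 hω
        obtain ⟨k, h2⟩ := mem_iUnion.1 h1
        obtain ⟨hk, h3⟩ := mem_iUnion.1 h2
        have h3 : K + j < |V (s + d L * k) ω| := h3
        have d0 := (d0 L).le
        have hk' : (k:ℝ) ≤ (2 ^ L : ℕ) := by exact_mod_cast hk
        have h4 := mul_le_mul_of_nonneg_left hk' d0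
        have := hb (s + d L * k) ⟨by nlinarith [Nat.cast_nonneg (α := ℝ) k], by linarith [dt L]⟩
        rw [Real.norm_eq_abs] at this
        have : (j0:ℝ) ≤ j := by exact_mod_cast hj
        linarith
      rw [if_neg this, zero_mul]
  rw [integral_zero] at t2
  have t3 := t2.const_mul B
  rw [mul_zero] at t3
  have z := ge_of_tendsto' t3 lim
  have z := abs_eq_zero.1 (le_antisymm z (abs_nonneg _))
  have e : ∀ ω, Z ω * ((if s < ρ ω then (1:ℝ) else 0) * (V (min t (ρ ω)) ω - V s ω)) =
      W ω * V (min t (ρ ω)) ω - W ω * V s ω := fun ω => by simp only [hW]; ring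
  simp only [e]
  rw [integral_sub _ (bWm.mul_int (h.int s hs)), z]
  refine Integrable.mono' (integrable_const (B * K)) ?_ (ae_of_all _ fun ω => ?_)
  · refine aestronglyMeasurable_of_tendsto_ae atTop (f := fun L ω => W ω * U L ω) (fun L =>
      bWm.meas.aestronglyMeasurable.mul (iU L).aestronglyMeasurable) (ae_of_all _ fun ω => ?_)
    by_cases hω : s < ρ ω
    · exact (os_lim hst (h.cont ω) hω).const_mul _
    · simp only [W0 ω hω, zero_mul]
      exact tendsto_const_nhds
  · rw [Real.norm_eq_abs, abs_mul]
    by_cases hω : s < ρ ω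
    · exact mul_le_mul (hB ω) (hb ω hω _ (le_min hst.le hω.le) (min_le_right _ _)) (abs_nonneg _) B0
    · rw [W0 ω hω, abs_zero, zero_mul]; positivity

end os2

section hitting
variable {H : ℝ → Ω → ℝ} {b : ℝ}

/-- first time `H ≥ K`, capped at `b` -/
def hit (H : ℝ → Ω → ℝ) (K b : ℝ) (ω : Ω) : ℝ := sInf ({u | 0 ≤ u ∧ K ≤ H u ω} ∪ {b})

lemma hit_bdd (hb : 0 ≤ b) (ω : Ω) : BddBelow ({u | 0 ≤ u ∧ K ≤ H u ω} ∪ {b}) := by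
  refine ⟨0, fun u hu => ?_⟩
  rcases hu with hu | hu
  · exact hu.1
  · rw [hu]; exact hb

lemma hit_lt (hb : 0 ≤ b) {ω : Ω} {u : ℝ} (hu : 0 ≤ u) (h : u < hit H K b ω) : H u ω < K := by
  by_contra hh
  exact absurd (csInf_le (hit_bdd hb ω) (Or.inl ⟨hu, not_lt.1 hh⟩)) (not_le.2 h)

lemma hit_mem (hH : ∀ ω, Continuous fun t => H t ω) (hb : 0 ≤ b) (ω : Ω) :
    hit H K b ω ∈ ({u | 0 ≤ u ∧ K ≤ H u ω} ∪ {b}) := by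
  refine IsClosed.csInf_mem ?_ ⟨b, Or.inr rfl⟩ (hit_bdd hb ω)
  refine IsClosed.union ?_ isClosed_singleton
  exact (isClosed_le continuous_const continuous_id).inter (isClosed_le continuous_const (hH ω))

lemma hit_nonneg (hH : ∀ ω, Continuous fun t => H t ω) (hb : 0 ≤ b) (ω : Ω) : 0 ≤ hit H K b ω := by
  rcases hit_mem (K := K) hH hb ω with h | h
  · exact h.1
  · rw [h]; exact hb

lemma hit_bound (hH : ∀ ω, Continuous fun t => H t ω) (hb : 0 ≤ b) {ω : Ω} (h0 : H 0 ω ≤ K) {u : ℝ}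
    (hu : 0 ≤ u) (h : u ≤ hit H K b ω) : H u ω ≤ K := by
  rcases h.lt_or_eq with h | h
  · exact (hit_lt hb hu h).le
  rcases hu.eq_or_lt with h1 | h1
  · rw [← h1]; exact h0
  have cl : IsClosed {v | H v ω ≤ K} := isClosed_le (hH ω) continuous_const
  have sub : Ico 0 u ⊆ {v | H v ω ≤ K} := fun v hv => (hit_lt hb hv.1 (by rw [← h]; exact hv.2)).le
  have := closure_minimal sub cl
  rw [closure_Ico h1.ne] at this
  exact this ⟨hu, le_rfl⟩

lemma hit_le_iff (hH : ∀ ω, Continuous fun t => H t ω) (hb : 0 ≤ b) {ω : Ω} {t : ℝ} (ht : 0 ≤ t) :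
    hit H K b ω ≤ t ↔ b ≤ t ∨ ∀ k : ℕ, ∃ q : ℚ, K - 1 / (k + 1) < H (t * max 0 (min 1 (q:ℝ))) ω := by
  constructor
  · intro h
    rcases hit_mem (K := K) hH hb ω with h1 | h1
    · right
      intro k
      have hp : (0:ℝ) < 1 / (k + 1) := by positivity
      set u := hit H K b ω with hu
      have op : IsOpen {x : ℝ | K - 1 / (k + 1) < H (t * max 0 (min 1 x)) ω} := by
        refine isOpen_lt continuous_const ((hH ω).comp ?_)
        fun_prop
      have ne : {x : ℝ | K - 1 / (k + 1) < H (t * max 0 (min 1 x)) ω}.Nonempty := by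
        rcases ht.eq_or_lt with h0 | h0
        · refine ⟨0, ?_⟩
          have : u = 0 := le_antisymm (by rw [h0]; exact h) h1.1
          have h2 := h1.2
          rw [this] at h2
          show K - 1 / (k + 1) < H (t * max 0 (min 1 0)) ω
          rw [← h0, zero_mul]
          linarith
        · refine ⟨u / t, ?_⟩
          show K - 1 / (k + 1) < H (t * max 0 (min 1 (u / t))) ω
          rw [min_eq_right ((div_le_one h0).2 h), max_eq_right (div_nonneg h1.1 ht),
            mul_div_cancel₀ _ h0.ne']
          have := h1.2
          linarith
      obtain ⟨q, hq⟩ := Rat.denseRange_cast.exists_mem_open op ne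
      exact ⟨q, hq⟩
    · left
      have h1 : hit H K b ω = b := h1
      rw [← h1]; exact h
  · rintro (h | h)
    · exact (csInf_le (hit_bdd hb ω) (Or.inr rfl)).trans h
    · obtain ⟨u, hu, hmax⟩ := (isCompact_Icc (a := (0:ℝ)) (b := t)).exists_isMaxOn ⟨0, le_rfl, ht⟩
        (hH ω).continuousOn
      have : K ≤ H u ω := by
        refine le_of_forall_pos_lt_add fun ε hε => ?_
        obtain ⟨k, hk⟩ := exists_nat_one_div_lt hε
        obtain ⟨q, hq⟩ := h k
        have hm : t * max 0 (min 1 (q:ℝ)) ∈ Icc 0 t := by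
          have h1 : (0:ℝ) ≤ max 0 (min 1 (q:ℝ)) := le_max_left _ _
          have h2 : max 0 (min 1 (q:ℝ)) ≤ 1 := max_le zero_le_one (min_le_left _ _)
          exact ⟨by positivity, by nlinarith⟩
        have := hmax hm
        have : H (t * max 0 (min 1 (q:ℝ))) ω ≤ H u ω := this
        linarith
      exact (csInf_le (hit_bdd hb ω) (Or.inl ⟨hu.1, this⟩)).trans hu.2

lemma hit_meas (hG : Monotone G) (hH : ∀ ω, Continuous fun t => H t ω)
    (hm : ∀ t, 0 ≤ t → Measurable[G t] (H t)) (hb : 0 ≤ b) {t : ℝ} (ht : 0 ≤ t) :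
    MeasurableSet[G t] {ω | hit H K b ω ≤ t} := by
  simp only [hit_le_iff hH hb ht]
  by_cases hbt : b ≤ t
  · simp only [hbt, true_or]
    exact @MeasurableSet.const _ (G t) True
  simp only [hbt, false_or]
  have : {ω | ∀ k : ℕ, ∃ q : ℚ, K - 1 / (k + 1) < H (t * max 0 (min 1 (q:ℝ))) ω} =
      ⋂ k : ℕ, ⋃ q : ℚ, {ω | K - 1 / (k + 1) < H (t * max 0 (min 1 (q:ℝ))) ω} := by
    ext ω; simp
  rw [this]
  refine @MeasurableSet.iInter _ _ (G t) _ _ fun k => @MeasurableSet.iUnion _ _ (G t) _ _ fun q => ?_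
  have h1 : (0:ℝ) ≤ max 0 (min 1 (q:ℝ)) := le_max_left _ _
  have h2 : max 0 (min 1 (q:ℝ)) ≤ 1 := max_le zero_le_one (min_le_left _ _)
  have := (hm (t * max 0 (min 1 (q:ℝ))) (by positivity)).mono (hG (by nlinarith : _ ≤ t)) le_rfl
  exact this measurableSet_Ioi

lemma hit_big (hH : ∀ ω, Continuous fun t => H t ω) (hb : 0 ≤ b) {ω : Ω}
    (h : ∀ u ∈ Icc 0 b, H u ω < K) : hit H K b ω = b := by
  rcases hit_mem (K := K) hH hb ω with h1 | h1
  · have : hit H K b ω ≤ b := csInf_le (hit_bdd hb ω) (Or.inr rfl)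
    exact absurd h1.2 (not_le.2 (h _ ⟨h1.1, this⟩))
  · exact h1

end hitting

section nice

/-- time-changed and stopped process -/
def st (T : ℝ) (ρ : Ω → ℝ) (X : ℝ → Ω → ℝ) (t : ℝ) (ω : Ω) : ℝ := X (min (T * max t 0) (ρ ω)) ω

lemma st_eq {T : ℝ} {ω : Ω} {u : ℝ} (hu : 0 ≤ u) (h : T * u ≤ ρ ω) : st T ρ X u ω = X (T * u) ω := by
  unfold st
  rw [max_eq_left hu, min_eq_left h]

lemma st_adp (hG : Monotone G) (hX : ∀ t, 0 ≤ t → Measurable[G t] (X t)) (hc : ∀ ω, Continuous fun t => X t ω)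
    (hρ : ∀ t, 0 ≤ t → MeasurableSet[G t] {ω | ρ ω ≤ t}) (h0 : ∀ ω, 0 ≤ ρ ω) {u : ℝ} (hu : 0 ≤ u) :
    Measurable[G u] (fun ω => X (min u (ρ ω)) ω) := by
  rcases hu.eq_or_lt with rfl | hu
  · simp only [min_eq_left (h0 _)]
    exact hX 0 le_rfl
  refine @measurable_of_tendsto_metrizable _ _ (G u) _ _ _ _ (fun (L : ℕ) ω =>
    X (0 + (u - 0) / 2 ^ L * (min (2 ^ L) (kap 0 ((u - 0) / 2 ^ L) ρ ω) : ℕ)) ω) _ (fun L => ?_) ?_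
  · have hd : 0 < (u - 0) / 2 ^ L := div_pos (by linarith) (by positivity)
    have e : ∀ ω, X (0 + (u - 0) / 2 ^ L * (min (2 ^ L) (kap 0 ((u - 0) / 2 ^ L) ρ ω) : ℕ)) ω = X 0 ω +
      ∑ i ∈ Finset.range (2 ^ L), (if 0 + (u - 0) / 2 ^ L * i < ρ ω then (1:ℝ) else 0) *
        (X (0 + (u - 0) / 2 ^ L * (i + 1 : ℕ)) ω - X (0 + (u - 0) / 2 ^ L * i) ω) := fun ω => by
      rw [os_sum 0 hd]; ring
    simp only [e]
    have hle : ∀ i : ℕ, i ≤ 2 ^ L → 0 + (u - 0) / 2 ^ L * (i:ℝ) ≤ u := fun i hi => by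
      have : (i:ℝ) ≤ 2 ^ L := by exact_mod_cast hi
      have := mul_le_mul_of_nonneg_left this hd.le
      have e : (u - 0) / 2 ^ L * 2 ^ L = u := by field_simp; ring
      linarith
    have hm : ∀ i : ℕ, i ≤ 2 ^ L → Measurable[G u] (X (0 + (u - 0) / 2 ^ L * (i:ℝ))) := fun i hi =>
      (hX _ (by positivity)).mono (hG (hle i hi)) le_rfl
    have h0u : Measurable[G u] (X 0) := (hX 0 le_rfl).mono (hG hu.le) le_rfl
    refine h0u.add ?_
    refine @Finset.measurable_fun_sum _ _ _ _ _ _ (G u) _ _ fun i hi => ?_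
    have hi := Finset.mem_range.1 hi
    refine Measurable.mul ?_ ((hm (i + 1) hi).sub (hm i hi.le))
    refine (Bd.ind (g := G u) ?_).meas
    have := hG (hle i hi.le) _ (@MeasurableSet.compl _ _ (G _) (hρ (0 + (u - 0) / 2 ^ L * (i:ℝ)) (by positivity)))
    convert this using 1
    ext ω; simp
  · rw [tendsto_pi_nhds]
    intro ω
    rcases (h0 ω).eq_or_lt with h | h
    · refine tendsto_const_nhds.congr fun L => ?_
      have : kap 0 ((u - 0) / 2 ^ L) ρ ω = 0 := by
        unfold kap; rw [← h]; simp
      rw [this, ← h, min_eq_right hu.le]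
      simp
    · exact os_lim hu (hc ω) h

structure Nice (μ : Measure Ω) (G : ℝ → MeasurableSpace Ω) (M N : ℝ → Ω → ℝ) (τ σ : Ω → ℝ)
    (c : ℝ) : Prop where
  mono : Monotone G
  le : ∀ t, G t ≤ m
  adpM : ∀ t, 0 ≤ t → Measurable[G t] (M t)
  adpN : ∀ t, 0 ≤ t → Measurable[G t] (N t)
  contM : ∀ ω, Continuous fun t => M t ω
  contN : ∀ ω, Continuous fun t => N t ω
  zeroM : ∀ ω, M 0 ω = 0
  zeroN : ∀ ω, N 0 ω = 0
  c0 : 0 ≤ c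
  hτ : ∀ t, 0 ≤ t → MeasurableSet[G t] {ω | τ ω ≤ t}
  hσ : ∀ t, 0 ≤ t → MeasurableSet[G t] {ω | σ ω ≤ t}
  cmM : CM μ G (fun t ω => M (min t (τ ω)) ω)
  cmN : CM μ G (fun t ω => N (min t (σ ω)) ω)
  dom : ∀ s t, 0 ≤ s → s ≤ t → ∀ ε > 0, Tendsto (fun n => μ.real {ω |
    ε < (qsum M M t n ω - qsum M M s n ω) - c * max 0 (qsum N N t n ω - qsum N N s n ω)})
      atTop (nhds 0)
  orth : ∀ t, 0 ≤ t → ∀ ε > 0, Tendsto (fun n => μ.real {ω | ε < |qsum M N t n ω|}) atTop (nhds 0)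

structure NSol (μ : Measure Ω) (G : ℝ → MeasurableSpace Ω) (M N : ℝ → Ω → ℝ)
    (y : ℝ) (Y : ℝ → Ω → ℝ) : Prop where
  adp : ∀ t, 0 ≤ t → Measurable[G t] (Y t)
  cont : ∀ ω, Continuous fun t => Y t ω
  start : ∀ ω, Y 0 ω = y
  conv : ∀ t, 0 ≤ t → ∀ ε > 0, Tendsto (fun n => μ.real {ω |
    ε < |rsum (fun s ω => psgn (Y s ω)) M t n ω - (Y t ω - y - N t ω)|}) atTop (nhds 0)

lemma grid_bd {T t s r : ℝ} (hT : 0 < T) (hs : 0 ≤ s) (hst : s ≤ t) (h : t ≤ r / T) {n i : ℕ} (hi : i ≤ 2 ^ n) :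
    0 ≤ s * i / 2 ^ n ∧ T * (s * i / 2 ^ n) ≤ r := by
  have h1 : (i:ℝ) / 2 ^ n ≤ 1 := by
    rw [div_le_one (by positivity)]; exact_mod_cast hi
  have h2 : s * i / 2 ^ n ≤ s := by
    rw [mul_div_assoc]; exact mul_le_of_le_one_right hs h1
  refine ⟨by positivity, ?_⟩
  rw [mul_comm, ← le_div_iff₀ hT]
  linarith

lemma st_grid {T t s : ℝ} {ω : Ω} (hT : 0 < T) (hs : 0 ≤ s) (hst : s ≤ t) (h : t ≤ ρ ω / T) {n i : ℕ} (hi : i ≤ 2 ^ n) :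
    st T ρ X (s * i / 2 ^ n) ω = X (T * s * i / 2 ^ n) ω := by
  obtain ⟨h1, h2⟩ := grid_bd hT hs hst h hi
  rw [st_eq h1 h2]
  congr 1; ring

lemma st_grid' {T t s : ℝ} {ω : Ω} (hT : 0 < T) (hs : 0 ≤ s) (hst : s ≤ t) (h : t ≤ ρ ω / T) {n i : ℕ} (hi : i < 2 ^ n) :
    st T ρ X (s * (i + 1) / 2 ^ n) ω = X (T * s * (i + 1) / 2 ^ n) ω := by
  have := st_grid (X := X) (i := i + 1) hT hs hst h hi
  push_cast at this
  exact this

lemma st_qsum {T t s : ℝ} {ω : Ω} (hT : 0 < T) (hs : 0 ≤ s) (hst : s ≤ t) (h : t ≤ ρ ω / T) (n : ℕ) :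
    qsum (st T ρ M) (st T ρ N) s n ω = qsum M N (T * s) n ω := by
  refine Finset.sum_congr rfl fun i hi => ?_
  have hi := Finset.mem_range.1 hi
  rw [st_grid hT hs hst h hi.le, st_grid hT hs hst h hi.le, st_grid' hT hs hst h hi, st_grid' hT hs hst h hi]

lemma st_rsum {T t s : ℝ} {ω : Ω} {Y : ℝ → Ω → ℝ} (hT : 0 < T) (hs : 0 ≤ s) (hst : s ≤ t) (h : t ≤ ρ ω / T) (n : ℕ) :
    rsum (fun s ω => psgn (st T ρ Y s ω)) (st T ρ M) s n ω = rsum (fun s ω => psgn (Y s ω)) M (T * s) n ω := by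
  refine Finset.sum_congr rfl fun i hi => ?_
  have hi := Finset.mem_range.1 hi
  beta_reduce
  rw [st_grid hT hs hst h hi.le, st_grid hT hs hst h hi.le, st_grid' hT hs hst h hi]

lemma st_cont {T : ℝ} (hc : ∀ ω, Continuous fun t => X t ω) (ω : Ω) : Continuous fun t => st T ρ X t ω :=
  (hc ω).comp (by fun_prop)

lemma st_mart {T : ℝ} {τ : Ω → ℝ} (hT : 0 < T) (hG : Monotone G) (hle : ∀ t, G t ≤ m)
    (hX : ∀ t, 0 ≤ t → Measurable[G t] (X t)) (hc : ∀ ω, Continuous fun t => X t ω) (hz : ∀ ω, X 0 ω = 0)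
    (hcm : CM μ G (fun t ω => X (min t (τ ω)) ω))
    (hρ : ∀ t, 0 ≤ t → MeasurableSet[G t] {ω | ρ ω ≤ t}) (h0 : ∀ ω, 0 ≤ ρ ω)
    (hτ : ∀ ω, 0 < ρ ω → ρ ω ≤ τ ω) (hK : 0 ≤ K) (hb : ∀ ω u, 0 ≤ u → u ≤ ρ ω → |X u ω| ≤ K) :
    Mart μ (fun t => G (T * t)) (st T ρ X) K where
  mono := fun a b h => hG (mul_le_mul_of_nonneg_left h hT.le)
  le := fun t => hle _
  adp := fun t ht => by
    unfold st
    simp only [max_eq_left ht]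
    exact st_adp hG hX hc hρ h0 (by positivity)
  bdd := fun t ω => hb ω _ (le_min (by positivity) (h0 ω)) (min_le_right _ _)
  cont := st_cont hc
  zero := fun ω => by
    unfold st
    rw [max_self, mul_zero, min_eq_left (h0 ω), hz]
  orth := fun s t hs hst Z hZ => by
    have hTs : 0 ≤ T * s := by positivity
    have hTst : T * s ≤ T * t := mul_le_mul_of_nonneg_left hst hT.le
    have hτ' : ∀ ω, T * s < ρ ω → ρ ω ≤ τ ω := fun ω h => hτ ω (hTs.trans_lt h)
    have := os_main hcm hρ hTs hTst hK (fun ω h u h1 h2 => by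
      rw [min_eq_left (h2.trans (hτ' ω h))]
      exact hb ω u (hTs.trans h1) h2) hZ
    rw [← this]
    congr 1; ext ω
    congr 1
    unfold st
    rw [max_eq_left hs, max_eq_left (hs.trans hst)]
    split_ifs with h
    · rw [one_mul, min_eq_left h.le, min_assoc, min_eq_left (hτ' ω h), min_eq_left (h.le.trans (hτ' ω h))]
    · have h := not_lt.1 h
      rw [min_eq_right h, min_eq_right (h.trans hTst)]
      ring

variable {τ σ : Ω → ℝ} {Y Y' : ℝ → Ω → ℝ} {y : ℝ}

/-- the localising time -/
def loc (M N Y Y' : ℝ → Ω → ℝ) (τ σ : Ω → ℝ) (K T : ℝ) (ω : Ω) : ℝ :=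
  max 0 (min (hit (fun t ω => max (max |M t ω| |N t ω|) (max |Y t ω| |Y' t ω|)) K (T + 1) ω) (min (τ ω) (σ ω)))

lemma st_sol {T : ℝ} (hT : 0 < T) (hG : Monotone G) (h : NSol μ G M N y Y)
    (hρ : ∀ t, 0 ≤ t → MeasurableSet[G t] {ω | ρ ω ≤ t}) (h0 : ∀ ω, 0 ≤ ρ ω)
    (hb : ∀ ω u, 0 ≤ u → u ≤ ρ ω → |Y u ω| ≤ K) :
    Sol μ (fun t => G (T * t)) (st T ρ M) (st T ρ N) (fun ω => ρ ω / T) K y (st T ρ Y) where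
  adp := fun t ht => by
    unfold st
    simp only [max_eq_left ht]
    exact st_adp hG h.adp h.cont hρ h0 (by positivity)
  bdd := fun t ω => hb ω _ (le_min (by positivity) (h0 ω)) (min_le_right _ _)
  cont := st_cont h.cont
  conv := fun t ht ε hε => by
    refine real_tendsto_of_le (fun n => ?_) (h.conv (T * t) (by positivity) ε hε)
    refine measureReal_mono fun ω hω => ?_
    obtain ⟨h1, h2⟩ := hω
    have h3 : T * t ≤ ρ ω := by
      have := (le_div_iff₀ hT).1 h1
      linarith
    rw [st_rsum hT ht le_rfl h1, st_eq ht h3, st_eq ht h3] at h2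
    exact h2

theorem nice_T (h : Nice μ G M N τ σ c) (hY : NSol μ G M N y Y) (hY' : NSol μ G M N y Y') {T : ℝ}
    (hT : 0 < T) (hK : |y| ≤ K) :
    μ {ω | T < loc M N Y Y' τ σ K T ω ∧ Y T ω ≠ Y' T ω} = 0 := by
  set H : ℝ → Ω → ℝ := fun t ω => max (max |M t ω| |N t ω|) (max |Y t ω| |Y' t ω|) with hH
  have Hc : ∀ ω, Continuous fun t => H t ω := fun ω =>
    ((h.contM ω).abs.max (h.contN ω).abs).max ((hY.cont ω).abs.max (hY'.cont ω).abs)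
  have ab : ∀ {X : ℝ → Ω → ℝ} {t : ℝ}, Measurable[G t] (X t) → Measurable[G t] (fun ω => |X t ω|) :=
    fun {X t} hx => @Measurable.comp _ _ _ (G t) _ _ _ _ continuous_abs.measurable hx
  have Hm : ∀ t, 0 ≤ t → Measurable[G t] (H t) := fun t ht =>
    Measurable.max (Measurable.max (ab (h.adpM t ht)) (ab (h.adpN t ht)))
      (Measurable.max (ab (hY.adp t ht)) (ab (hY'.adp t ht)))
  have K0 : 0 ≤ K := (abs_nonneg y).trans hK
  have H0 : ∀ ω, H 0 ω ≤ K := fun ω => by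
    simp only [hH, h.zeroM, h.zeroN, hY.start, hY'.start, abs_zero, max_self]
    exact max_le K0 hK
  have hb : (0:ℝ) ≤ T + 1 := by linarith
  set ρ := loc M N Y Y' τ σ K T with hρdef
  have ρe : ∀ ω, ρ ω = max 0 (min (hit H K (T + 1) ω) (min (τ ω) (σ ω))) := fun ω => rfl
  have ρ0 : ∀ ω, 0 ≤ ρ ω := fun ω => le_max_left _ _
  have ρp : ∀ ω, 0 < ρ ω → ρ ω = min (hit H K (T + 1) ω) (min (τ ω) (σ ω)) := fun ω hω => by
    rw [ρe] at hω ⊢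
    rcases lt_max_iff.1 hω with h | h
    · exact absurd h (lt_irrefl _)
    · exact max_eq_right h.le
  have ρm : ∀ t, 0 ≤ t → MeasurableSet[G t] {ω | ρ ω ≤ t} := fun t ht => by
    have e : {ω | ρ ω ≤ t} = {ω | hit H K (T + 1) ω ≤ t} ∪ ({ω | τ ω ≤ t} ∪ {ω | σ ω ≤ t}) := by
      ext ω
      simp only [Set.mem_ofPred_eq, Set.mem_union, ρe, max_le_iff, min_le_iff, ht, true_and]
    rw [e]
    exact @MeasurableSet.union _ (G t) _ _ (hit_meas h.mono Hc Hm hb ht)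
      (@MeasurableSet.union _ (G t) _ _ (h.hτ t ht) (h.hσ t ht))
  have ρh : ∀ ω u, 0 ≤ u → u ≤ ρ ω → H u ω ≤ K := fun ω u hu hur => by
    rcases (ρ0 ω).eq_or_lt with h1 | h1
    · rw [← h1] at hur
      rw [le_antisymm hur hu]; exact H0 ω
    · refine hit_bound Hc hb (H0 ω) hu (hur.trans ?_)
      rw [ρp ω h1]; exact min_le_left _ _
  have bM : ∀ ω u, 0 ≤ u → u ≤ ρ ω → |M u ω| ≤ K := fun ω u h1 h2 =>
    ((le_max_left _ _).trans (le_max_left _ _)).trans (ρh ω u h1 h2)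
  have bN : ∀ ω u, 0 ≤ u → u ≤ ρ ω → |N u ω| ≤ K := fun ω u h1 h2 =>
    ((le_max_right _ _).trans (le_max_left _ _)).trans (ρh ω u h1 h2)
  have bY : ∀ ω u, 0 ≤ u → u ≤ ρ ω → |Y u ω| ≤ K := fun ω u h1 h2 =>
    ((le_max_left _ _).trans (le_max_right _ _)).trans (ρh ω u h1 h2)
  have bY' : ∀ ω u, 0 ≤ u → u ≤ ρ ω → |Y' u ω| ≤ K := fun ω u h1 h2 =>
    ((le_max_right _ _).trans (le_max_right _ _)).trans (ρh ω u h1 h2)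
  have ρmeas : Measurable ρ := by
    refine measurable_of_Iic fun t => ?_
    rcases lt_or_ge t 0 with ht | ht
    · have : ρ ⁻¹' Iic t = ∅ := by
        ext ω
        simp only [Set.mem_preimage, Set.mem_Iic, Set.mem_empty_iff_false, iff_false, not_le]
        exact ht.trans_le (ρ0 ω)
      rw [this]; exact MeasurableSet.empty
    · exact h.le t _ (ρm t ht)
  have tm : ∀ {ω t}, t ≤ ρ ω / T → T * t ≤ ρ ω := fun {ω t} ht => by
    have := (le_div_iff₀ hT).1 ht
    linarith
  have stp : ∀ {X : ℝ → Ω → ℝ} s t ω, 0 ≤ s → ρ ω / T ≤ s → s ≤ t → st T ρ X t ω = st T ρ X s ω :=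
    fun {X} s t ω h1 h2 h3 => by
    have h4 := (div_le_iff₀ hT).1 h2
    have h5 : T * s ≤ T * t := mul_le_mul_of_nonneg_left h3 hT.le
    unfold st
    rw [max_eq_left h1, max_eq_left (h1.trans h3), min_eq_right (by linarith), min_eq_right (by linarith)]
  have C : Core μ (fun t => G (T * t)) (st T ρ M) (st T ρ N) (fun ω => ρ ω / T) K c := {
    hM := st_mart hT h.mono h.le h.adpM h.contM h.zeroM h.cmM ρm ρ0
      (fun ω hω => by rw [ρp ω hω]; exact (min_le_right _ _).trans (min_le_left _ _)) K0 bM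
    hN := st_mart hT h.mono h.le h.adpN h.contN h.zeroN h.cmN ρm ρ0
      (fun ω hω => by rw [ρp ω hω]; exact (min_le_right _ _).trans (min_le_right _ _)) K0 bN
    c0 := h.c0
    mρ := ρmeas.div_const T
    stopM := stp
    stopN := stp
    dom0 := fun s t hs hst ε hε => by
      refine real_tendsto_of_le (fun n => ?_) (h.dom (T * s) (T * t) (by positivity)
        (mul_le_mul_of_nonneg_left hst hT.le) ε hε)
      refine measureReal_mono fun ω hω => ?_
      obtain ⟨h1, h2⟩ := hω
      have ht := hs.trans hst
      rw [st_qsum hT ht le_rfl h1, st_qsum hT ht le_rfl h1, st_qsum hT hs hst h1, st_qsum hT hs hst h1] at h2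
      exact h2
    orth0 := fun t ht ε hε => by
      refine real_tendsto_of_le (fun n => ?_) (h.orth (T * t) (by positivity) ε hε)
      refine measureReal_mono fun ω hω => ?_
      obtain ⟨h1, h2⟩ := hω
      rw [st_qsum hT ht le_rfl h1] at h2
      exact h2 }
  have S := st_sol hT h.mono hY ρm ρ0 bY
  have S' := st_sol hT h.mono hY' ρm ρ0 bY'
  refine measure_mono_null (fun ω hω => ?_) (core C S S')
  obtain ⟨h1, h2⟩ := hω
  refine ⟨(one_lt_div hT).2 h1, ?_⟩
  rw [st_eq zero_le_one (by rw [mul_one]; exact h1.le), st_eq zero_le_one (by rw [mul_one]; exact h1.le), mul_one]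
  exact h2

/-- the localising times eventually exceed `T` -/
lemma loc_gt (hM : ∀ ω, Continuous fun t => M t ω) (hN : ∀ ω, Continuous fun t => N t ω)
    (hY : ∀ ω, Continuous fun t => Y t ω) (hY' : ∀ ω, Continuous fun t => Y' t ω) {T : ℝ} (hT : 0 < T) {ω : Ω}
    (hτ : T < τ ω) (hσ : T < σ ω) : ∃ K0 : ℕ, ∀ K : ℕ, K0 ≤ K → T < loc M N Y Y' τ σ K T ω := by
  set H : ℝ → Ω → ℝ := fun t ω => max (max |M t ω| |N t ω|) (max |Y t ω| |Y' t ω|) with hH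
  have Hc : ∀ ω, Continuous fun t => H t ω := fun ω =>
    ((hM ω).abs.max (hN ω).abs).max ((hY ω).abs.max (hY' ω).abs)
  obtain ⟨b, hb⟩ := (isCompact_Icc (a := (0:ℝ)) (b := T + 1)).exists_bound_of_continuousOn
        (Hc ω).continuousOn
  obtain ⟨j, hj⟩ := exists_nat_gt b
  refine ⟨j, fun K hK => ?_⟩
  have hK' : (j:ℝ) ≤ K := by exact_mod_cast hK
  have : hit H K (T + 1) ω = T + 1 := hit_big Hc (by linarith) fun u hu => by
    have := (le_abs_self _).trans (hb u hu)
    linarith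
  have e : loc M N Y Y' τ σ K T ω = max 0 (min (hit H K (T + 1) ω) (min (τ ω) (σ ω))) := rfl
  rw [e, this]
  exact lt_max_of_lt_right (lt_min (by linarith) (lt_min hτ hσ))

end nice

section reduction
variable {r : Ω → Ω} {F : Filtration ℝ m}

lemma real_le_ae {S U : Set Ω} (h : ∀ᵐ ω ∂μ, ω ∈ S → ω ∈ U) : μ.real S ≤ μ.real U :=
  ENNReal.toReal_mono (measure_ne_top _ _) (measure_mono_ae h)

lemma Bd.of_comap {g : MeasurableSpace Ω} {Z : Ω → ℝ} (hZ : Bd (MeasurableSpace.comap r g) Z) :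
    ∃ Z', Bd g Z' ∧ ∀ ω, Z ω = Z' (r ω) := by
  obtain ⟨hm, B, hB⟩ := hZ
  obtain ⟨f, hf, hfe⟩ := Measurable.exists_eq_measurable_comp hm
  rcases isEmpty_or_nonempty Ω with hΩ | hΩ
  · exact ⟨fun _ => 0, Bd.const g 0, fun ω => (hΩ.false ω).elim⟩
  have B0 : 0 ≤ B := (abs_nonneg _).trans (hB hΩ.some)
  have clc : Continuous fun x : ℝ => max (-B) (min B x) := by fun_prop
  refine ⟨fun ω => max (-B) (min B (f ω)), Bd.mk' (clc.measurable.comp hf) B fun ω => ?_, fun ω => ?_⟩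
  · rw [abs_le]
    exact ⟨le_max_left _ _, max_le (by linarith) (min_le_left _ _)⟩
  · have h1 : Z ω = f (r ω) := congrFun hfe ω
    have h2 := abs_le.1 (hB ω)
    beta_reduce
    rw [← h1, min_eq_right h2.2, max_eq_right h2.1]

lemma mart_orth {V : ℝ → Ω → ℝ} (hV : Martingale V F μ) {s t : ℝ} (hst : s ≤ t) {Z : Ω → ℝ}
    (hZ : Bd (F s) Z) : ∫ ω, Z ω * (V t ω - V s ω) ∂μ = 0 := by
  have hD : Integrable (V t - V s) μ := (hV.integrable t).sub (hV.integrable s)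
  have hZD : Integrable (Z * (V t - V s)) μ := (hZ.mono (F.le s)).mul_int hD
  have h1 := condExp_mul_of_stronglyMeasurable_left (m := F s) hZ.meas.stronglyMeasurable hZD hD
  have h2 : μ[V t - V s | F s] =ᵐ[μ] 0 := by
    filter_upwards [condExp_sub (hV.integrable t) (hV.integrable s) (F s), hV.condExp_ae_eq hst,
      hV.condExp_ae_eq (le_refl s)] with ω e1 e2 e3
    rw [e1, Pi.sub_apply, e2, e3, sub_self]; rfl
  have h3 : μ[Z * (V t - V s) | F s] =ᵐ[μ] 0 := by
    filter_upwards [h1, h2] with ω e1 e2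
    rw [e1, Pi.mul_apply, e2, Pi.zero_apply, mul_zero]
  have h4 := integral_condExp (μ := μ) (F.le s) (f := Z * (V t - V s))
  rw [integral_congr_ae h3] at h4
  simp only [Pi.zero_apply, integral_zero] at h4
  exact h4.symm

lemma comap_le (hr : Measurable r) (t : ℝ) : MeasurableSpace.comap r (F t) ≤ m :=
  (MeasurableSpace.comap_mono (F.le t)).trans hr.comap_le

lemma comap_CM {V : ℝ → Ω → ℝ} (hV : Martingale V F μ) (hr : Measurable r) (hre : ∀ᵐ ω ∂μ, r ω = ω)
    (hc : ∀ ω, Continuous fun t => V t (r ω)) :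
    CM μ (fun t => MeasurableSpace.comap r (F t)) (fun t ω => V t (r ω)) where
  mono := fun a b h => MeasurableSpace.comap_mono (F.mono h)
  le := comap_le hr
  adp := fun t _ => (hV.stronglyMeasurable t).measurable.comp (comap_measurable r)
  cont := hc
  int := fun t _ => (hV.integrable t).congr (by
    filter_upwards [hre] with ω h
    rw [h])
  orth := fun s t _ hst Z hZ => by
    obtain ⟨Z', hZ', e⟩ := hZ.of_comap
    rw [← mart_orth hV hst hZ']
    refine integral_congr_ae ?_
    filter_upwards [hre] with ω h
    rw [e, h]

lemma dom_le {QM QN q : ℝ → ℝ} (hc : 0 ≤ c) (hq : ∀ t, q t ∈ Icc (0:ℝ) c) {ν : Measure ℝ}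
    (h1 : ∀ a b : ℝ, 0 ≤ a → a ≤ b → ν (Ioc a b) = ENNReal.ofReal (QN b - QN a))
    (h2 : ∀ t : ℝ, 0 ≤ t → QM t = ∫ s in Ioc (0:ℝ) t, q s ∂ν) {s t : ℝ} (hs : 0 ≤ s) (hst : s ≤ t) :
    QM t - QM s ≤ c * max 0 (QN t - QN s) := by
  have p : 0 ≤ c * max 0 (QN t - QN s) := mul_nonneg hc (le_max_left _ _)
  rw [h2 t (hs.trans hst), h2 s hs]
  by_cases hi : IntegrableOn q (Ioc 0 t) ν
  · rw [← Ioc_union_Ioc_eq_Ioc hs hst, setIntegral_union (Ioc_disjoint_Ioc_of_le le_rfl) measurableSet_Ioc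
      (hi.mono_set (Ioc_subset_Ioc_right hst)) (hi.mono_set (Ioc_subset_Ioc_left hs))]
    have fin : ν (Ioc s t) < ⊤ := by rw [h1 s t hs hst]; exact ENNReal.ofReal_lt_top
    have := norm_setIntegral_le_of_norm_le_const (f := q) (C := c) fin fun x _ => by
      rw [Real.norm_eq_abs, abs_of_nonneg (hq x).1]; exact (hq x).2
    rw [measureReal_def, h1 s t hs hst, ENNReal.toReal_ofReal', max_comm] at this
    have := (le_abs_self _).trans this
    linarith
  · rw [integral_undef hi]
    have : 0 ≤ ∫ s in Ioc (0:ℝ) s, q s ∂ν := integral_nonneg fun x => (hq x).1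
    linarith

lemma tim_real {f : ℕ → Ω → ℝ} {g : Ω → ℝ} (h : TendstoInMeasure μ f atTop g) {ε : ℝ} (hε : 0 < ε) :
    Tendsto (fun n => μ.real {ω | ε ≤ |f n ω - g ω|}) atTop (nhds 0) :=
  tendstoInMeasure_iff_measureReal_norm.1 h ε hε

lemma dom_red (hc : 0 ≤ c) (hdom : Dominated μ F M N c) (hre : ∀ᵐ ω ∂μ, r ω = ω) (s t : ℝ) (hs : 0 ≤ s)
    (hst : s ≤ t) (ε : ℝ) (hε : ε > 0) : Tendsto (fun n => μ.real {ω |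
    ε < (qsum (fun t ω => M t (r ω)) (fun t ω => M t (r ω)) t n ω -
      qsum (fun t ω => M t (r ω)) (fun t ω => M t (r ω)) s n ω) -
      c * max 0 (qsum (fun t ω => N t (r ω)) (fun t ω => N t (r ω)) t n ω -
        qsum (fun t ω => N t (r ω)) (fun t ω => N t (r ω)) s n ω)}) atTop (nhds 0) := by
  obtain ⟨QM, QN, q, hM, hN, -, hq, hν⟩ := hdom
  have ht := hs.trans hst
  set δ := ε / (2 * (1 + c)) with hδ
  have δ0 : 0 < δ := by positivity
  have δe : 2 * δ + c * (2 * δ) = ε := by rw [hδ]; field_simp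
  have l := ((tim_real (hM t ht) δ0).add (tim_real (hM s hs) δ0)).add
    ((tim_real (hN t ht) δ0).add (tim_real (hN s hs) δ0))
  simp only [add_zero] at l
  refine real_tendsto_of_le (fun n => ?_) l
  refine le_trans (real_le_ae (U := ({ω | δ ≤ |qsum M M t n ω - QM t ω|} ∪ {ω | δ ≤ |qsum M M s n ω - QM s ω|}) ∪
    ({ω | δ ≤ |qsum N N t n ω - QN t ω|} ∪ {ω | δ ≤ |qsum N N s n ω - QN s ω|})) ?_) ?_
  · filter_upwards [hre, hν] with ω h1 h2 h3
    obtain ⟨ν, h4, h5⟩ := h2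
    have h6 := dom_le hc (fun t => hq t ω) h4 h5 hs hst
    have e : ∀ (X : ℝ → Ω → ℝ) u, qsum (fun t ω => X t (r ω)) (fun t ω => X t (r ω)) u n ω = qsum X X u n ω :=
      fun X u => by unfold qsum; simp only [h1]
    simp only [Set.mem_ofPred_eq, e] at h3
    by_contra hh
    simp only [Set.mem_union, Set.mem_ofPred_eq, not_or, not_le, abs_lt] at hh
    obtain ⟨⟨a1, a2⟩, a3, a4⟩ := hh
    have b1 : max 0 (QN t ω - QN s ω) ≤ max 0 (qsum N N t n ω - qsum N N s n ω) + 2 * δ := by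
      refine max_le ?_ ?_
      · have := le_max_left 0 (qsum N N t n ω - qsum N N s n ω); linarith
      · have := le_max_right 0 (qsum N N t n ω - qsum N N s n ω); linarith
    have b2 := mul_le_mul_of_nonneg_left b1 hc
    rw [mul_add] at b2
    linarith
  · exact (measureReal_union_le _ _).trans (add_le_add (measureReal_union_le _ _) (measureReal_union_le _ _))

lemma nsol_red {y : ℝ} {Y : ℝ → Ω → ℝ} (h : SolvesPerturbedTanaka μ (fun t => F t) M N y Y)
    (hre : ∀ᵐ ω ∂μ, r ω = ω) (hc : ∀ ω, Continuous fun t => Y t (r ω)) (h0 : ∀ ω, Y 0 (r ω) = y) :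
    NSol μ (fun t => MeasurableSpace.comap r (F t)) (fun t ω => M t (r ω)) (fun t ω => N t (r ω)) y
      (fun t ω => Y t (r ω)) where
  adp := fun t ht => by
    have : Measurable[F t] (Y t) := measurable_iff_comap_le.2 (h.1 t ht)
    exact this.comp (comap_measurable r)
  cont := hc
  start := h0
  conv := fun t ht ε hε => by
    obtain ⟨-, -, I, hI, hYI⟩ := h
    refine real_tendsto_of_le (fun n => ?_) (tim_real (hI.2 t ht) hε)
    refine real_le_ae ?_
    filter_upwards [hre, hYI] with ω h1 h2 h3
    have e : rsum (fun s ω => psgn (Y s (r ω))) (fun t ω => M t (r ω)) t n ω =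
        rsum (fun s ω => psgn (Y s ω)) M t n ω := by unfold rsum; simp only [h1]
    simp only [Set.mem_ofPred_eq, e, h1] at h3
    have e2 : Y t ω - y - N t ω = I t ω := by rw [h2 t ht]; ring
    rw [e2] at h3
    exact h3.le

lemma stop_red {τ : Ω → ℝ} (h : IsStoppingTime F (fun ω => (τ ω : WithTop ℝ))) (t : ℝ) :
    MeasurableSet[MeasurableSpace.comap r (F t)] {ω | τ (r ω) ≤ t} := by
  have h1 := h t
  have e : {ω | (τ ω : WithTop ℝ) ≤ (t : WithTop ℝ)} = {ω | τ ω ≤ t} := by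
    ext ω; simp
  have h1 : MeasurableSet[F t] {ω | τ ω ≤ t} := by rw [← e]; exact h1
  exact ⟨_, h1, rfl⟩

end reduction

section final

theorem uniq_aux (μ : Measure Ω) [IsProbabilityMeasure μ]
    (F : Filtration ℝ m) (M N : ℝ → Ω → ℝ) (c : ℝ) (hc : 0 ≤ c)
    (hM : IsContLocMart μ F M) (hN : IsContLocMart μ F N)
    (hM0 : ∀ᵐ ω ∂μ, M 0 ω = 0) (hN0 : ∀ᵐ ω ∂μ, N 0 ω = 0)
    (horth : Orthogonal μ M N) (hdom : Dominated μ F M N c)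
    (y : ℝ) (Y Y' : ℝ → Ω → ℝ)
    (hY : SolvesPerturbedTanaka μ (fun t => F t) M N y Y)
    (hY' : SolvesPerturbedTanaka μ (fun t => F t) M N y Y') :
    ∀ᵐ ω ∂μ, ∀ t : ℝ, 0 ≤ t → Y t ω = Y' t ω := by
  classical
  obtain ⟨cM, aM, τ, sτ, lτ, mτ⟩ := hM
  obtain ⟨cN, aN, σ, sσ, lσ, mσ⟩ := hN
  have ini : ∀ {Y : ℝ → Ω → ℝ}, SolvesPerturbedTanaka μ (fun t => F t) M N y Y → ∀ᵐ ω ∂μ, Y 0 ω = y := by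
    rintro Y ⟨-, -, I, hI, h⟩
    filter_upwards [hI.1, h, hN0] with ω h1 h2 h3
    rw [h2 0 le_rfl, h1, h3]; ring
  have hE : ∀ᵐ ω ∂μ, (Continuous fun t => M t ω) ∧ (Continuous fun t => N t ω) ∧ (Continuous fun t => Y t ω) ∧
      (Continuous fun t => Y' t ω) ∧ M 0 ω = 0 ∧ N 0 ω = 0 ∧ Y 0 ω = y ∧ Y' 0 ω = y := by
    filter_upwards [cM, cN, hY.2.1, hY'.2.1, hM0, hN0, ini hY, ini hY'] with ω h1 h2 h3 h4 h5 h6 h7 h8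
    exact ⟨h1, h2, h3, h4, h5, h6, h7, h8⟩
  set Ω0 : Set Ω := (toMeasurable μ {ω | ¬ ((Continuous fun t => M t ω) ∧ (Continuous fun t => N t ω) ∧
      (Continuous fun t => Y t ω) ∧ (Continuous fun t => Y' t ω) ∧ M 0 ω = 0 ∧ N 0 ω = 0 ∧ Y 0 ω = y ∧ Y' 0 ω = y)})ᶜ
    with hΩ0
  have mΩ0 : MeasurableSet Ω0 := (measurableSet_toMeasurable _ _).compl
  have aΩ0 : ∀ᵐ ω ∂μ, ω ∈ Ω0 := by
    rw [ae_iff]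
    have : {a | ¬ a ∈ Ω0} = Ω0ᶜ := rfl
    rw [this, hΩ0, compl_compl, measure_toMeasurable]
    exact ae_iff.1 hE
  have pΩ0 : ∀ ω ∈ Ω0, (Continuous fun t => M t ω) ∧ (Continuous fun t => N t ω) ∧ (Continuous fun t => Y t ω) ∧
      (Continuous fun t => Y' t ω) ∧ M 0 ω = 0 ∧ N 0 ω = 0 ∧ Y 0 ω = y ∧ Y' 0 ω = y := fun ω hω => by
    by_contra hh
    exact hω (subset_toMeasurable _ _ hh)
  obtain ⟨ω0, hω0⟩ := aΩ0.exists
  set r : Ω → Ω := fun ω => if ω ∈ Ω0 then ω else ω0 with hr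
  have rm : Measurable r := Measurable.ite mΩ0 measurable_id measurable_const
  have rΩ : ∀ ω, r ω ∈ Ω0 := fun ω => by
    simp only [hr]
    split_ifs with h
    · exact h
    · exact hω0
  have re : ∀ᵐ ω ∂μ, r ω = ω := by
    filter_upwards [aΩ0] with ω h
    simp only [hr, if_pos h]
  have P := fun ω => pΩ0 _ (rΩ ω)
  have nice : ∀ n, Nice μ (fun t => MeasurableSpace.comap r (F t)) (fun t ω => M t (r ω)) (fun t ω => N t (r ω))
      (fun ω => τ n (r ω)) (fun ω => σ n (r ω)) c := fun n => {
    mono := fun a b h => MeasurableSpace.comap_mono (F.mono h)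
    le := comap_le rm
    adpM := fun t _ => (aM t).measurable.comp (comap_measurable r)
    adpN := fun t _ => (aN t).measurable.comp (comap_measurable r)
    contM := fun ω => (P ω).1
    contN := fun ω => (P ω).2.1
    zeroM := fun ω => (P ω).2.2.2.2.1
    zeroN := fun ω => (P ω).2.2.2.2.2.1
    c0 := hc
    hτ := fun t _ => stop_red (sτ n) t
    hσ := fun t _ => stop_red (sσ n) t
    cmM := comap_CM (mτ n) rm re fun ω => (P ω).1.comp (by fun_prop)
    cmN := comap_CM (mσ n) rm re fun ω => (P ω).2.1.comp (by fun_prop)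
    dom := dom_red hc hdom re
    orth := fun t ht ε hε => by
      refine real_tendsto_of_le (fun n => ?_) (tim_real (horth t ht) hε)
      refine real_le_ae ?_
      filter_upwards [re] with ω h1 h3
      have e : qsum (fun t ω => M t (r ω)) (fun t ω => N t (r ω)) t n ω = qsum M N t n ω := by
        unfold qsum; simp only [h1]
      simp only [Set.mem_ofPred_eq, e] at h3
      simp only [Set.mem_ofPred_eq, sub_zero]
      exact h3.le }
  have sY := nsol_red hY re (fun ω => (P ω).2.2.1) (fun ω => (P ω).2.2.2.2.2.2.1)
  have sY' := nsol_red hY' re (fun ω => (P ω).2.2.2.1) (fun ω => (P ω).2.2.2.2.2.2.2)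
  have key : ∀ᵐ ω ∂μ, ∀ (q : ℚ) (n K : ℕ), (0:ℝ) < q → |y| ≤ K → ¬ ((q:ℝ) < loc (fun t ω => M t (r ω))
      (fun t ω => N t (r ω)) (fun t ω => Y t (r ω)) (fun t ω => Y' t (r ω)) (fun ω => τ n (r ω))
      (fun ω => σ n (r ω)) K q ω ∧ Y q (r ω) ≠ Y' q (r ω)) := by
    rw [ae_all_iff]; intro q
    rw [ae_all_iff]; intro n
    rw [ae_all_iff]; intro K
    by_cases hq : (0:ℝ) < q
    · by_cases hK : |y| ≤ K
      · have := nice_T (nice n) sY sY' hq hK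
        rw [measure_eq_zero_iff_ae_notMem] at this
        filter_upwards [this] with ω h _ _
        exact h
      · exact ae_of_all _ fun ω _ h => absurd h hK
    · exact ae_of_all _ fun ω h => absurd h hq
  filter_upwards [key, re, lτ, lσ] with ω k1 k2 k3 k4 t ht
  have Q : ∀ q : ℚ, (0:ℝ) < q → Y q ω = Y' q ω := fun q hq => by
    obtain ⟨n, h1, h2⟩ := ((k3.eventually_gt_atTop (q:ℝ)).and (k4.eventually_gt_atTop (q:ℝ))).exists
    have h1' : (q:ℝ) < τ n (r ω) := by rw [k2]; exact h1
    have h2' : (q:ℝ) < σ n (r ω) := by rw [k2]; exact h2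
    obtain ⟨K0, hK0⟩ := loc_gt (M := fun t ω => M t (r ω)) (N := fun t ω => N t (r ω)) (Y := fun t ω => Y t (r ω))
      (Y' := fun t ω => Y' t (r ω)) (τ := fun ω => τ n (r ω)) (σ := fun ω => σ n (r ω)) (ω := ω)
      (fun ω => (P ω).1) (fun ω => (P ω).2.1) (fun ω => (P ω).2.2.1) (fun ω => (P ω).2.2.2.1) hq h1' h2'
    obtain ⟨K1, hK1⟩ := exists_nat_ge |y|
    have hK : |y| ≤ (max K0 K1 : ℕ) := hK1.trans (by exact_mod_cast le_max_right _ _)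
    have := k1 q n (max K0 K1) hq hK
    rw [k2] at this
    by_contra hne
    exact this ⟨hK0 _ (le_max_left _ _), hne⟩
  by_contra hne
  have c1 := (P ω).2.2.1
  have c2 := (P ω).2.2.2.1
  rw [k2] at c1 c2
  have op : IsOpen {t | Y t ω ≠ Y' t ω} := isOpen_ne_fun c1 c2
  obtain ⟨ε, hε, hb⟩ := Metric.isOpen_iff.1 op t hne
  obtain ⟨q, hq1, hq2⟩ := exists_rat_btwn (show t < t + ε by linarith)
  refine hb (a := (q:ℝ)) ?_ (Q q (ht.trans_lt hq1))
  rw [Metric.mem_ball, Real.dist_eq, abs_of_pos (by linarith)]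
  linarith

end final

/-- Prokaj. Pathwise uniqueness holds for the perturbed Tanaka
equation `Υ(t) = y + ∫₀ᵗ sgn(Υ(s)) dM(s) + N(t)`: if `M, N` are continuous local
martingales vanishing at `0`, with `⟨M,N⟩ ≡ 0` and `⟨M⟩(t) = ∫₀ᵗ q(s) d⟨N⟩(s)` for a
progressively measurable `q` with values in `[0,c]`, then any two solutions with the
same initial value `y` and the same drivers `M, N` are indistinguishable. -/
theorem perturbed_tanaka_pathwise_uniqueness
    {Ω : Type*} [m : MeasurableSpace Ω] (μ : Measure Ω) [IsProbabilityMeasure μ]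
    (F : Filtration ℝ m) (M N : ℝ → Ω → ℝ) (c : ℝ) (hc : 0 ≤ c)
    (hM : IsContLocMart μ F M) (hN : IsContLocMart μ F N)
    (hM0 : ∀ᵐ ω ∂μ, M 0 ω = 0) (hN0 : ∀ᵐ ω ∂μ, N 0 ω = 0)
    (horth : Orthogonal μ M N) (hdom : Dominated μ F M N c)
    (y : ℝ) (Y Y' : ℝ → Ω → ℝ)
    (hY : SolvesPerturbedTanaka μ (fun t => F t) M N y Y)
    (hY' : SolvesPerturbedTanaka μ (fun t => F t) M N y Y') :
    ∀ᵐ ω ∂μ, ∀ t : ℝ, 0 ≤ t → Y t ω = Y' t ω := by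
  exact uniq_aux μ F M N c hc hM hN hM0 hN0 horth hdom y Y Y' hY hY'

end SDEPaper
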